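/- Let K be a number field, K̄ an algebraic closure of K, and O_K̄ the integral closure of O_K in K̄. A Witt vector ξ ∈ W_{O_K}(O_K̄) is integral over O_K if and only if its coefficients are periodic with respect to some modulus: there exists a nonzero ideal f of O_K such that ξ_a = ξ_b for all a, b ∈ I_K with a ∼_f b, where a ∼_f b means that there exists a totally positive element t ∈ K (positive under every real embedding of K) such that the fractional ideal a·b^{−1} equals the principal fractional ideal generated by t and t − 1 lies in the fractional ideal f·b^{−1}. -/

import Mathlib

open NumberField

noncomputable section

/-- The multiplicative monoid `I_K` of nonzero ideals of the ring of integers of `K`. -/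
def IdealMonoid (K : Type) [Field K] [NumberField K] : Submonoid (Ideal (𝓞 K)) where
  carrier := {I | I ≠ ⊥}
  mul_mem' := by
    intro a b ha hb h
    rcases Ideal.mul_eq_bot.mp h with h' | h'
    · exact ha h'
    · exact hb h'
  one_mem' := by
    simp only [Set.mem_setOf_eq, Ideal.one_eq_top]
    exact top_ne_bot

/-- `I_K`, the monoid of nonzero ideals, as a type. -/
abbrev IK (K : Type) [Field K] [NumberField K] := ↥(IdealMonoid K)

/-- `P_K`, the set of nonzero prime ideals of `𝓞 K`, as a type. -/
def PrimeIdeal (K : Type) [Field K] [NumberField K] :=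
  {p : Ideal (𝓞 K) // p.IsPrime ∧ p ≠ ⊥}

/-- A nonzero prime ideal, regarded as an element of `I_K`. -/
def PrimeIdeal.toIK {K : Type} [Field K] [NumberField K] (p : PrimeIdeal K) : IK K :=
  ⟨p.1, p.2.2⟩

/-- `#k_p`: the cardinality of the residue ring `R ⧸ p`. -/
def residueCard {R : Type} [CommRing R] (p : Ideal R) : ℕ :=
  Nat.card (R ⧸ p)

/-- The shift operator `ψ_a` on `A^{I_K}`: `(ψ_a ξ)_b = ξ_{a·b}`. -/
def shift {K : Type} [Field K] [NumberField K] {A : Type} (a : IK K)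
    (ξ : IK K → A) : IK K → A :=
  fun b => ξ (a * b)

/-- For an ideal `p` of `𝓞 K` and a subset `S ⊆ A^{I_K}`, the set `p·S` of all finite
sums of products of elements of `p` with elements of (the module generated by) `S`. -/
def idealMulSet {K : Type} [Field K] [NumberField K] {A : Type} [CommRing A]
    [Algebra (𝓞 K) A] (p : Ideal (𝓞 K)) (S : Set (IK K → A)) : Set (IK K → A) :=
  ↑(p • Submodule.span (𝓞 K) S)

/-- The descending chain `U_n(A)` of subsets of `A^{I_K}`. -/
def UnSet (K : Type) [Field K] [NumberField K] (A : Type) [CommRing A]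
    [Algebra (𝓞 K) A] : ℕ → Set (IK K → A)
  | 0 => Set.univ
  | n + 1 => {ξ | ξ ∈ UnSet K A n ∧ ∀ p : PrimeIdeal K,
      shift p.toIK ξ - ξ ^ residueCard p.1 ∈ idealMulSet p.1 (UnSet K A n)}

/-- The ring of Witt vectors `W_{O_K}(A) = ⋂ₙ U_n(A)`, as a subset of `A^{I_K}`. -/
def WittSet (K : Type) [Field K] [NumberField K] (A : Type) [CommRing A]
    [Algebra (𝓞 K) A] : Set (IK K → A) :=
  ⋂ n, UnSet K A n

/-- A deterministic finite automaton with output, over input alphabet `Δ` and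
output alphabet `O`. -/
structure DFAO (Δ O : Type) : Type 1 where
  State : Type
  [finState : Finite State]
  trans : State → Δ → State
  start : State
  out : State → O

/-- The output of a DFAO on an input word, processing letters from left to right. -/
def DFAO.output {Δ O : Type} (M : DFAO Δ O) (l : List Δ) : O :=
  M.out (l.foldl M.trans M.start)

/-- `ξ ∈ A^{I_K}` is automatic if some DFAO with input alphabet `P_K` and output
alphabet `A` produces `ξ_a` from every word of primes whose product is `a`. -/
def IsAutomatic {K : Type} [Field K] [NumberField K] {A : Type}
    (ξ : IK K → A) : Prop :=
  ∃ M : DFAO (PrimeIdeal K) A, ∀ (l : List (PrimeIdeal K)) (a : IK K),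
    (a : Ideal (𝓞 K)) = (l.map Subtype.val).prod → ξ a = M.output l

/-- `v_p(a)`: the largest `e` such that `p^e` divides `a`. -/
def vIdeal {R : Type} [CommRing R] (p a : Ideal R) : ℕ :=
  sSup {e : ℕ | p ^ e ∣ a}

/-- The Deligne–Ribet congruence `a ∼_f b` on `I_K` for a modulus `f`: there is a
totally positive `t ∈ K` with `a·b⁻¹ = (t)` and `t − 1 ∈ f·b⁻¹`. -/
def DRcongruent (K : Type) [Field K] [NumberField K] (f a b : IK K) : Prop :=
  ∃ t : K, (∀ φ : K →+* ℝ, 0 < φ t) ∧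
    ((a : Ideal (𝓞 K)) : FractionalIdeal (nonZeroDivisors (𝓞 K)) K) *
        (((b : Ideal (𝓞 K)) : FractionalIdeal (nonZeroDivisors (𝓞 K)) K))⁻¹ =
      FractionalIdeal.spanSingleton (nonZeroDivisors (𝓞 K)) t ∧
    t - 1 ∈ ((f : Ideal (𝓞 K)) : FractionalIdeal (nonZeroDivisors (𝓞 K)) K) *
        (((b : Ideal (𝓞 K)) : FractionalIdeal (nonZeroDivisors (𝓞 K)) K))⁻¹

section
set_option linter.unusedSectionVars false
set_option linter.unusedSimpArgs false
set_option linter.style.haveILetI false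

/-! ### Part A: finiteness of the Deligne–Ribet classes -/

theorem finite_DR (K : Type) [Field K] [NumberField K] (f : IK K) :
    ∃ (T : Type) (_ : Finite T) (g : IK K → T), ∀ a b, g a = g b → DRcongruent K f a b := by
  classical
  have hex : ∀ c : ClassGroup (𝓞 K), ∃ b : nonZeroDivisors (Ideal (𝓞 K)), ClassGroup.mk0 b = c⁻¹ :=
    fun c => ClassGroup.mk0_surjective _
  choose B hB using hex
  let nz : IK K → nonZeroDivisors (Ideal (𝓞 K)) := fun a => ⟨a.1, mem_nonZeroDivisors_of_ne_zero a.2⟩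
  let cl : IK K → ClassGroup (𝓞 K) := fun a => ClassGroup.mk0 (nz a)
  have hal : ∀ a : IK K, ∃ α : 𝓞 K, α ≠ 0 ∧ (a : Ideal (𝓞 K)) * (B (cl a)).1 = Ideal.span {α} := by
    intro a
    have h1 : ClassGroup.mk0 (nz a * B (cl a)) = 1 := by
      rw [map_mul, hB]; simp [cl]
    rw [ClassGroup.mk0_eq_one_iff] at h1
    obtain ⟨α, hα⟩ := h1.principal
    refine ⟨α, ?_, hα⟩
    rintro rfl
    have h2 : (nz a * B (cl a)).1 ≠ 0 := nonZeroDivisors.coe_ne_zero _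
    apply h2
    rw [hα]; simp
  choose α hα0 hα using hal
  have hfin : ∀ c, Finite (𝓞 K ⧸ ((f : Ideal (𝓞 K)) * (B c).1)) := by
    intro c
    apply Ideal.finiteQuotientOfFreeOfNeBot
    exact mul_ne_zero f.2 (nonZeroDivisors.coe_ne_zero (B c))
  have : Finite (K →+* ℝ) := Finite.of_injective (fun φ : K →+* ℝ => (algebraMap ℝ ℂ).comp φ)
    (fun φ ψ h => by
      ext x
      have := congrArg (fun g : K →+* ℂ => g x) h
      simpa using this)
  refine ⟨(Σ c : ClassGroup (𝓞 K), (𝓞 K ⧸ ((f : Ideal (𝓞 K)) * (B c).1))) × ((K →+* ℝ) → Prop),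
    inferInstance, fun a => (⟨cl a, Ideal.Quotient.mk _ (α a)⟩, fun φ => 0 < φ (α a)), ?_⟩
  intro a b hab
  rw [Prod.mk.injEq] at hab
  obtain ⟨h1, h2⟩ := hab
  have hcl : cl a = cl b := congrArg Sigma.fst h1
  have hmem : α a - α b ∈ (f : Ideal (𝓞 K)) * (B (cl b)).1 := by
    have h3 := hα a
    generalize cl a = c at *
    subst hcl
    rw [Sigma.mk.injEq] at h1
    exact Ideal.Quotient.eq.mp (eq_of_heq h1.2)
  have ha := hα a
  have hb := hα b
  rw [hcl] at ha
  have ha0 : (α a : K) ≠ 0 := by simpa using hα0 a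
  have hb0 : (α b : K) ≠ 0 := by simpa using hα0 b
  have hB0 : (((B (cl b)).1 : Ideal (𝓞 K)) : FractionalIdeal (nonZeroDivisors (𝓞 K)) K) ≠ 0 := by
    rw [Ne, FractionalIdeal.coeIdeal_eq_zero]; exact nonZeroDivisors.coe_ne_zero _
  have hbb0 : (((b : Ideal (𝓞 K))) : FractionalIdeal (nonZeroDivisors (𝓞 K)) K) ≠ 0 := by
    rw [Ne, FractionalIdeal.coeIdeal_eq_zero]; exact b.2
  have ha' := congrArg (fun I : Ideal (𝓞 K) => (I : FractionalIdeal (nonZeroDivisors (𝓞 K)) K)) ha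
  have hb' := congrArg (fun I : Ideal (𝓞 K) => (I : FractionalIdeal (nonZeroDivisors (𝓞 K)) K)) hb
  simp only [FractionalIdeal.coeIdeal_mul, FractionalIdeal.coeIdeal_span_singleton] at ha' hb'
  refine ⟨(α a : K) / (α b : K), ?_, ?_, ?_⟩
  · intro φ
    have h3 : (0 < φ (α a)) ↔ (0 < φ (α b)) := iff_of_eq (congrFun h2 φ)
    have h4 : φ (α b) ≠ 0 := by simpa using hb0
    have h5 : φ (α a) ≠ 0 := by simpa using ha0
    rw [map_div₀]
    rcases lt_or_gt_of_ne h4 with h | h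
    · apply div_pos_of_neg_of_neg _ h
      rcases lt_or_gt_of_ne h5 with h' | h'
      · exact h'
      · exact absurd (h3.mp h') (not_lt.mpr h.le)
    · exact div_pos (h3.mpr h) h
  · rw [← div_eq_mul_inv, div_eq_iff hbb0]
    apply mul_right_cancel₀ hB0
    rw [mul_assoc, ha', hb', FractionalIdeal.spanSingleton_mul_spanSingleton]
    congr 1; field_simp
  · have h6 : ((b : Ideal (𝓞 K)) : FractionalIdeal (nonZeroDivisors (𝓞 K)) K)⁻¹ =
      ((B (cl b)).1 : FractionalIdeal (nonZeroDivisors (𝓞 K)) K) *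
        FractionalIdeal.spanSingleton _ ((α b : K)⁻¹) := by
      rw [inv_eq_iff_eq_inv, eq_comm, ← FractionalIdeal.spanSingleton_inv, ← hb']
      field_simp
    rw [h6, ← mul_assoc, ← FractionalIdeal.coeIdeal_mul]
    have h7 : (α a : K) / (α b : K) - 1 = (((α a - α b : 𝓞 K) : K)) * (α b : K)⁻¹ := by
      push_cast; field_simp
    rw [h7]
    exact FractionalIdeal.mul_mem_mul (FractionalIdeal.mem_coeIdeal_of_mem _ hmem)
      (FractionalIdeal.mem_spanSingleton_self _ _)

theorem integral_of_periodic (K : Type) [Field K] [NumberField K]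
    (ξ : IK K → ↥(integralClosure (𝓞 K) (AlgebraicClosure K)))
    (h : ∃ f : IK K, ∀ a b : IK K, DRcongruent K f a b → ξ a = ξ b) : IsIntegral (𝓞 K) ξ := by
  classical
  obtain ⟨f, hf⟩ := h
  obtain ⟨T, hT, g, hg⟩ := finite_DR K f
  have hfin : (Set.range ξ).Finite := by
    have h1 : ∃ r : Set.range g → integralClosure (𝓞 K) (AlgebraicClosure K), ∀ a, r ⟨g a, a, rfl⟩ = ξ a := by
      refine ⟨fun t => ξ t.2.choose, fun a => ?_⟩
      exact hf _ _ (hg _ _ (Set.mem_range_self (f := g) a).choose_spec)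
    obtain ⟨r, hr⟩ := h1
    apply (Set.finite_range r).subset
    rintro _ ⟨a, rfl⟩
    exact ⟨_, hr a⟩
  have hint : ∀ x : integralClosure (𝓞 K) (AlgebraicClosure K), IsIntegral (𝓞 K) x := fun x =>
    integralClosure.isIntegral x
  choose p hp hpe using hint
  refine ⟨∏ x ∈ hfin.toFinset, p x, Polynomial.monic_prod_of_monic _ _ (fun x _ => hp x), ?_⟩
  rw [← Polynomial.aeval_def]
  funext a
  have h2 : ∀ q : Polynomial (𝓞 K), (Polynomial.aeval ξ q) a = Polynomial.aeval (ξ a) q := by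
    intro q
    exact (Polynomial.aeval_algHom_apply (Pi.evalAlgHom (𝓞 K) _ a) ξ q).symm
  rw [h2, map_prod]
  apply Finset.prod_eq_zero (i := ξ a) (by simp)
  exact hpe _
open IsDedekindDomain

/-! ### Divisors, rays -/

abbrev Pl (K : Type) [Field K] [NumberField K] := HeightOneSpectrum (𝓞 K)
abbrev Dv (K : Type) [Field K] [NumberField K] := Pl K →₀ ℤ
abbrev FI (K : Type) [Field K] [NumberField K] := FractionalIdeal (nonZeroDivisors (𝓞 K)) K

section
variable {K : Type} [Field K] [NumberField K]

def dvI (I : FI K) : Dv K :=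
  Finsupp.ofSupportFinite (fun v => FractionalIdeal.count K v I)
    (by
      have := FractionalIdeal.finite_factors I
      rwa [Filter.eventually_cofinite] at this)

@[simp] lemma dvI_apply (I : FI K) (v : Pl K) : dvI I v = FractionalIdeal.count K v I := rfl

lemma dvI_mul {I J : FI K} (hI : I ≠ 0) (hJ : J ≠ 0) : dvI (I * J) = dvI I + dvI J := by
  ext v; simp [FractionalIdeal.count_mul K v hI hJ]

lemma dvI_one : dvI (1 : FI K) = 0 := by
  ext v; simp [FractionalIdeal.count_one]

lemma dvI_inv (I : FI K) : dvI I⁻¹ = - dvI I := by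
  ext v; simp [FractionalIdeal.count_inv]

lemma dvI_inj {I J : FI K} (hI : I ≠ 0) (hJ : J ≠ 0) (h : dvI I = dvI J) : I = J := by
  rw [← FractionalIdeal.finprod_heightOneSpectrum_factorization' K hI,
    ← FractionalIdeal.finprod_heightOneSpectrum_factorization' K hJ]
  apply finprod_congr
  intro v
  have := DFunLike.congr_fun h v
  simp only [dvI_apply] at this
  rw [this]

lemma dvI_pl (v : Pl K) : dvI (v.asIdeal : FI K) = Finsupp.single v 1 := by
  classical
  ext w
  rw [dvI_apply, FractionalIdeal.count_maximal, Finsupp.single_apply]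

lemma dvI_surj (D : Dv K) : ∃ I : FI K, I ≠ 0 ∧ dvI I = D := by
  induction D using Finsupp.induction_linear with
  | zero => exact ⟨1, one_ne_zero, dvI_one⟩
  | add f g hf hg =>
    obtain ⟨I, hI, rfl⟩ := hf
    obtain ⟨J, hJ, rfl⟩ := hg
    exact ⟨I * J, mul_ne_zero hI hJ, dvI_mul hI hJ⟩
  | single v n =>
    have h0 : (v.asIdeal : FI K) ≠ 0 := by
      rw [Ne, FractionalIdeal.coeIdeal_eq_zero]; exact v.ne_bot
    refine ⟨(v.asIdeal : FI K) ^ n, zpow_ne_zero _ h0, ?_⟩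
    classical
    ext w
    rw [dvI_apply, FractionalIdeal.count_zpow, FractionalIdeal.count_maximal, Finsupp.single_apply]
    simp

lemma dvI_nonneg_iff {I : FI K} (hI : I ≠ 0) : 0 ≤ dvI I ↔ ∃ J : Ideal (𝓞 K), J ≠ ⊥ ∧ I = J := by
  constructor
  · intro h
    have h1 : I = ∏ᶠ v : Pl K, ((v.asIdeal ^ (FractionalIdeal.count K v I).toNat : Ideal (𝓞 K)) : FI K) := by
      conv_lhs => rw [← FractionalIdeal.finprod_heightOneSpectrum_factorization' K hI]
      apply finprod_congr
      intro v
      have := h v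
      simp only [dvI_apply, Finsupp.coe_zero, Pi.zero_apply] at this
      rw [FractionalIdeal.coeIdeal_pow, ← zpow_natCast, Int.toNat_of_nonneg this]
    have hfin : Function.HasFiniteMulSupport
      (fun v : Pl K => (v.asIdeal ^ (FractionalIdeal.count K v I).toNat : Ideal (𝓞 K))) := by
      have h2 := FractionalIdeal.finite_factors I
      rw [Filter.eventually_cofinite] at h2
      apply h2.subset
      intro v hv
      simp only [Function.mem_mulSupport] at hv
      intro hc
      apply hv
      rw [hc]; simp
    have h3 : I = ((∏ᶠ v : Pl K, (v.asIdeal ^ (FractionalIdeal.count K v I).toNat : Ideal (𝓞 K)) : Ideal (𝓞 K)) : FI K) := by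
      have := (FractionalIdeal.coeIdealHom (nonZeroDivisors (𝓞 K)) K).toMonoidHom.map_finprod hfin
      exact h1.trans this.symm
    refine ⟨_, ?_, h3⟩
    rintro h4
    rw [h4] at h3
    exact hI (by simpa using h3)
  · rintro ⟨J, hJ, rfl⟩ v
    exact FractionalIdeal.count_coe_nonneg K v J

/-- divisor of an element -/
def dv (x : K) : Dv K := dvI (FractionalIdeal.spanSingleton _ x)

lemma span_ne_zero {x : K} (hx : x ≠ 0) :
    FractionalIdeal.spanSingleton (nonZeroDivisors (𝓞 K)) x ≠ 0 := by
  rwa [Ne, FractionalIdeal.spanSingleton_eq_zero_iff]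

lemma dv_mul {x y : K} (hx : x ≠ 0) (hy : y ≠ 0) : dv (x * y) = dv x + dv y := by
  rw [dv, ← FractionalIdeal.spanSingleton_mul_spanSingleton,
    dvI_mul (span_ne_zero hx) (span_ne_zero hy)]; rfl

@[simp] lemma dv_one : dv (1 : K) = 0 := by
  rw [dv, FractionalIdeal.spanSingleton_one, dvI_one]

lemma dv_inv (x : K) : dv x⁻¹ = - dv x := by
  rw [dv, ← FractionalIdeal.spanSingleton_inv, dvI_inv]; rfl

/-- `dv` as a homomorphism. -/
def dvH (K : Type) [Field K] [NumberField K] : Kˣ →* Multiplicative (Dv K) where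
  toFun x := Multiplicative.ofAdd (dv (x : K))
  map_one' := by simp
  map_mul' x y := by
    rw [Units.val_mul, dv_mul x.ne_zero y.ne_zero]; rfl

lemma dv_algebraMap_apply (v : Pl K) {x : 𝓞 K} (hx : x ≠ 0) :
    v.intValuation x = WithZero.exp (-(dv (x : K) v)) := by
  classical
  rw [HeightOneSpectrum.intValuation_if_neg v hx, dv, dvI_apply,
    ← FractionalIdeal.coeIdeal_span_singleton, FractionalIdeal.count_coe]
  simpa using hx

lemma valuation_eq (v : Pl K) {x : K} (hx : x ≠ 0) :
    v.valuation K x = WithZero.exp (-(dv x v)) := by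
  obtain ⟨a, b, hb, rfl⟩ := IsFractionRing.div_surjective (A := 𝓞 K) x
  have hb0 : b ≠ 0 := nonZeroDivisors.ne_zero hb
  have ha0 : a ≠ 0 := by rintro rfl; simp at hx
  have hb1 : algebraMap (𝓞 K) K b ≠ 0 := by simpa using hb0
  have ha1 : algebraMap (𝓞 K) K a ≠ 0 := by simpa using ha0
  rw [map_div₀, HeightOneSpectrum.valuation_of_algebraMap, HeightOneSpectrum.valuation_of_algebraMap,
    dv_algebraMap_apply v ha0, dv_algebraMap_apply v hb0, div_eq_mul_inv _ (algebraMap (𝓞 K) K b),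
    dv_mul ha1 (inv_ne_zero hb1), dv_inv, ← WithZero.exp_sub]
  congr 1
  simp; ring

lemma dv_apply_eq_zero_iff (v : Pl K) {x : K} (hx : x ≠ 0) : dv x v = 0 ↔ v.valuation K x = 1 := by
  rw [valuation_eq v hx, WithZero.exp_eq_one]; simp

lemma val_one_of_near (v : Pl K) {x : K} (h : v.valuation K (x - 1) < 1) : v.valuation K x = 1 := by
  have h1 : v.valuation K ((x - 1) + 1) = 1 := by
    rw [Valuation.map_add_eq_of_lt_right]
    · simp
    · simpa using h
  simpa using h1

lemma exp_lt_one' {n : ℤ} : WithZero.exp n < 1 ↔ n < 0 := by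
  rw [← WithZero.exp_zero, WithZero.exp_lt_exp]

/-- The ray: `t ≡ 1` modulo `v^(k+1)` for `v ∈ S`, totally positive. -/
def Ray (S : Finset (Pl K)) (k : ℕ) : Subgroup Kˣ where
  carrier := {t | (∀ v ∈ S, v.valuation K ((t : K) - 1) ≤ WithZero.exp (-((k : ℤ) + 1))) ∧
    ∀ φ : K →+* ℝ, 0 < φ t}
  one_mem' := by simp
  mul_mem' := by
    rintro a b ⟨ha, ha'⟩ ⟨hb, hb'⟩
    refine ⟨fun v hv => ?_, fun φ => by rw [Units.val_mul, map_mul]; exact mul_pos (ha' φ) (hb' φ)⟩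
    have h1 : ((a * b : Kˣ) : K) - 1 = (a : K) * ((b : K) - 1) + ((a : K) - 1) := by push_cast; ring
    have h2 : v.valuation K (a : K) = 1 := val_one_of_near v (lt_of_le_of_lt (ha v hv)
      (by rw [exp_lt_one']; omega))
    rw [h1]
    refine (Valuation.map_add _ _ _).trans (max_le ?_ (ha v hv))
    rw [map_mul, h2, one_mul]; exact hb v hv
  inv_mem' := by
    rintro a ⟨ha, ha'⟩
    refine ⟨fun v hv => ?_, fun φ => by rw [Units.val_inv_eq_inv_val, map_inv₀]; exact inv_pos.mpr (ha' φ)⟩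
    have h1 : ((a⁻¹ : Kˣ) : K) - 1 = -((a : K)⁻¹ * ((a : K) - 1)) := by
      rw [Units.val_inv_eq_inv_val]; have := a.ne_zero; field_simp; ring
    have h2 : v.valuation K (a : K) = 1 := val_one_of_near v (lt_of_le_of_lt (ha v hv)
      (by rw [exp_lt_one']; omega))
    rw [h1, Valuation.map_neg, map_mul, map_inv₀, h2, inv_one, one_mul]; exact ha v hv

lemma Ray_anti {S : Finset (Pl K)} {k l : ℕ} (h : k ≤ l) : Ray S l ≤ Ray S k := by
  rintro t ⟨h1, h2⟩
  refine ⟨fun v hv => (h1 v hv).trans ?_, h2⟩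
  rw [WithZero.exp_le_exp]; omega

/-- divisors of ray elements -/
def PR (S : Finset (Pl K)) (k : ℕ) : AddSubgroup (Dv K) :=
  (Subgroup.map (dvH K) (Ray S k)).toAddSubgroup'

lemma mem_PR {S : Finset (Pl K)} {k : ℕ} {D : Dv K} :
    D ∈ PR S k ↔ ∃ t : Kˣ, t ∈ Ray S k ∧ dv (t : K) = D := by
  rfl

lemma PR_anti {S : Finset (Pl K)} {k l : ℕ} (h : k ≤ l) : PR S l ≤ PR S k := by
  intro D hD
  rw [mem_PR] at *
  obtain ⟨t, ht, h'⟩ := hD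
  exact ⟨t, Ray_anti h ht, h'⟩

/-- divisors prime to `S` -/
def DivS (S : Finset (Pl K)) : AddSubgroup (Dv K) where
  carrier := {D | ∀ v ∈ S, D v = 0}
  zero_mem' := by simp
  add_mem' := by
    intro a b ha hb v hv
    simp [ha v hv, hb v hv]
  neg_mem' := by
    intro a ha v hv
    simp [ha v hv]

lemma mem_DivS {S : Finset (Pl K)} {D : Dv K} : D ∈ DivS S ↔ ∀ v ∈ S, D v = 0 := Iff.rfl

lemma PR_le_DivS (S : Finset (Pl K)) (k : ℕ) : PR S k ≤ DivS S := by
  intro D hD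
  obtain ⟨t, ht, rfl⟩ := mem_PR.mp hD
  intro v hv
  rw [dv_apply_eq_zero_iff v t.ne_zero]
  exact val_one_of_near v (lt_of_le_of_lt (ht.1 v hv) (by rw [exp_lt_one']; omega))

lemma mem_coeIdeal_pow_iff (x : K) (v : Pl K) (I : FI K) (h : x ∈ I) :
    v.valuation K x ≤ WithZero.exp (-(dvI I v)) := by
  by_cases hx : x = 0
  · subst hx; simp
  rw [valuation_eq v hx, WithZero.exp_le_exp, neg_le_neg_iff, dv, dvI_apply, dvI_apply]
  apply FractionalIdeal.count_mono K v (span_ne_zero hx)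
  rwa [FractionalIdeal.spanSingleton_le_iff_mem]

lemma mem_of_valuation (x : K) (I : FI K) (hI : I ≠ 0)
    (h : ∀ v : Pl K, v.valuation K x ≤ WithZero.exp (-(dvI I v))) : x ∈ I := by
  by_cases hx : x = 0
  · subst hx; exact FractionalIdeal.zero_mem I
  have h1 : 0 ≤ dvI (FractionalIdeal.spanSingleton (nonZeroDivisors (𝓞 K)) x * I⁻¹) := by
    rw [dvI_mul (span_ne_zero hx) (inv_ne_zero hI), dvI_inv]
    intro v
    have := h v
    rw [valuation_eq v hx, WithZero.exp_le_exp] at this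
    change 0 ≤ (dv x) v + -(dvI I v)
    omega
  rw [dvI_nonneg_iff (mul_ne_zero (span_ne_zero hx) (inv_ne_zero hI))] at h1
  obtain ⟨J, hJ, hJ'⟩ := h1
  have h2 : FractionalIdeal.spanSingleton (nonZeroDivisors (𝓞 K)) x = I * J := by
    rw [← hJ']; field_simp
  rw [← FractionalIdeal.spanSingleton_le_iff_mem, h2]
  calc I * (J : FI K) ≤ I * 1 := by gcongr; exact FractionalIdeal.coeIdeal_le_one
    _ = I := mul_one _

/-- effective part of finite index statement -/
theorem finiteIndex_PR (S : Finset (Pl K)) (k : ℕ) :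
    (PR S k).relIndex (DivS S) ≠ 0 := by
  classical
  -- modulus
  let F : Ideal (𝓞 K) := ∏ v ∈ S, v.asIdeal ^ (k + 1)
  have hF0 : F ≠ ⊥ := by
    rw [Ne, ← Ideal.zero_eq_bot, Finset.prod_eq_zero_iff]
    push Not
    intro v _
    exact pow_ne_zero _ v.ne_bot
  obtain ⟨T, hT, g, hg⟩ := finite_DR K ⟨F, hF0⟩
  have key : ∀ a b : IK K, dvI (a.1 : FI K) ∈ DivS S → dvI (b.1 : FI K) ∈ DivS S → g a = g b →
      dvI (a.1 : FI K) - dvI (b.1 : FI K) ∈ PR S k := by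
    intro a b ha hb hab
    obtain ⟨t, ht1, ht2, ht3⟩ := hg a b hab
    have ha0 : (a.1 : FI K) ≠ 0 := by rw [Ne, FractionalIdeal.coeIdeal_eq_zero]; exact a.2
    have hb0 : (b.1 : FI K) ≠ 0 := by rw [Ne, FractionalIdeal.coeIdeal_eq_zero]; exact b.2
    have hFF : (F : FI K) ≠ 0 := by rw [Ne, FractionalIdeal.coeIdeal_eq_zero]; exact hF0
    have ht0 : t ≠ 0 := by
      rintro rfl
      simp at ht2
      exact ht2.elim a.2 b.2
    rw [mem_PR]
    refine ⟨Units.mk0 t ht0, ⟨fun v hv => ?_, ht1⟩, ?_⟩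
    · have h1 := mem_coeIdeal_pow_iff _ v _ ht3
      refine h1.trans ?_
      rw [dvI_mul hFF (inv_ne_zero hb0), dvI_inv, WithZero.exp_le_exp]
      have h2 : dvI (b.1 : FI K) v = 0 := hb v hv
      have h3 : dvI (F : FI K) v = k + 1 := by
        rw [dvI_apply]
        have : (F : FI K) = ∏ v ∈ S, ((v.asIdeal : FI K) ^ (k + 1)) := by
          rw [show (F : FI K) = FractionalIdeal.coeIdealHom _ K F from rfl, map_prod]
          apply Finset.prod_congr rfl
          intro v _
          exact map_pow (FractionalIdeal.coeIdealHom (nonZeroDivisors (𝓞 K)) K) _ _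
        rw [this, FractionalIdeal.count_prod K v _ _ (fun i _ => pow_ne_zero _ (by
          rw [Ne, FractionalIdeal.coeIdeal_eq_zero]; exact i.ne_bot))]
        simp only [FractionalIdeal.count_pow, FractionalIdeal.count_maximal]
        simp [hv]
      change -(dvI (F : FI K) v + -(dvI (b.1 : FI K) v)) ≤ _
      rw [h2, h3]; simp
    · change dvI _ = _
      simp only [Units.val_mk0]
      rw [← ht2, dvI_mul ha0 (inv_ne_zero hb0), dvI_inv, sub_eq_add_neg]
  let Q := DivS S ⧸ (PR S k).addSubgroupOf (DivS S)
  -- classes of effective divisors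
  let Eff := {a : IK K // dvI (a.1 : FI K) ∈ DivS S}
  let q : Eff → Q := fun a => QuotientAddGroup.mk (⟨_, a.2⟩ : DivS S)
  have hq : ∀ a b : Eff, g a.1 = g b.1 → q a = q b := by
    intro a b hab
    rw [QuotientAddGroup.eq]
    rw [AddSubgroup.mem_addSubgroupOf]
    have := key b.1 a.1 b.2 a.2 hab.symm
    simpa [sub_eq_add_neg, add_comm] using this
  have hfin : (Set.range q).Finite := by
    let r : Set.range (fun a : Eff => g a.1) → Q := fun t => q t.2.choose
    apply (Set.finite_range r).subset
    rintro _ ⟨a, rfl⟩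
    refine ⟨⟨g a.1, a, rfl⟩, ?_⟩
    exact hq _ _ (Set.mem_range_self (f := fun a : Eff => g a.1) a).choose_spec
  have hadd : ∀ x ∈ Set.range q, ∀ y ∈ Set.range q, x + y ∈ Set.range q := by
    rintro _ ⟨a, rfl⟩ _ ⟨b, rfl⟩
    have ha0 : (a.1.1 : FI K) ≠ 0 := by rw [Ne, FractionalIdeal.coeIdeal_eq_zero]; exact a.1.2
    have hb0 : (b.1.1 : FI K) ≠ 0 := by rw [Ne, FractionalIdeal.coeIdeal_eq_zero]; exact b.1.2
    have h1 : dvI ((a.1 * b.1 : IK K).1 : FI K) = dvI (a.1.1 : FI K) + dvI (b.1.1 : FI K) := by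
      rw [← dvI_mul ha0 hb0, ← FractionalIdeal.coeIdeal_mul]; rfl
    refine ⟨⟨a.1 * b.1, by rw [h1]; exact add_mem a.2 b.2⟩, ?_⟩
    change QuotientAddGroup.mk _ = QuotientAddGroup.mk _ + QuotientAddGroup.mk _
    rw [← QuotientAddGroup.mk_add]
    apply congrArg
    exact Subtype.ext h1
  have hzero : (0 : Q) ∈ Set.range q := by
    refine ⟨⟨1, ?_⟩, ?_⟩
    · change dvI (((1 : Ideal (𝓞 K))) : FI K) ∈ _
      simp [dvI_one, zero_mem]
    · change QuotientAddGroup.mk _ = _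
      rw [QuotientAddGroup.eq_zero_iff, AddSubgroup.mem_addSubgroupOf]
      change dvI (((1 : Ideal (𝓞 K))) : FI K) ∈ _
      simp [dvI_one, zero_mem]
  have hneg : ∀ x ∈ Set.range q, -x ∈ Set.range q := by
    intro x hx
    have hmul : ∀ n : ℕ, n • x ∈ Set.range q := by
      intro n
      induction n with
      | zero => simpa using hzero
      | succ n ih => rw [succ_nsmul]; exact hadd _ ih _ hx
    obtain ⟨i, j, hij, h⟩ := Set.Finite.exists_lt_map_eq_of_forall_mem (t := Set.range q) hmul hfin
    have h2 : -x = (j - i - 1) • x := by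
      have h3 : (j - i - 1) • x + (i • x + x) = i • x := by
        have : (j - i - 1) + (i + 1) = j := by omega
        rw [← succ_nsmul, ← add_nsmul, this, h]
      rw [neg_eq_iff_add_eq_zero]
      have h4 := h3
      rw [add_comm (i • x) x, ← add_assoc] at h4
      have h5 := left_eq_add.mp (by rw [add_comm] at h4; exact h4.symm)
      rw [add_comm]; exact h5
    rw [h2]; exact hmul _
  have hsurj : Set.range q = Set.univ := by
    rw [Set.eq_univ_iff_forall]
    intro x
    obtain ⟨⟨D, hD⟩, rfl⟩ := QuotientAddGroup.mk_surjective x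
    have heff : ∀ D : Dv K, 0 ≤ D → ∀ hD : D ∈ DivS S, (QuotientAddGroup.mk (⟨D, hD⟩ : DivS S) : Q) ∈ Set.range q := by
      intro D h0 hD
      obtain ⟨I, hI, rfl⟩ := dvI_surj D
      obtain ⟨J, hJ, rfl⟩ := (dvI_nonneg_iff hI).mp h0
      exact ⟨⟨⟨J, hJ⟩, hD⟩, rfl⟩
    have hp : D ⊔ 0 ∈ DivS S := fun v hv => by
      have h1 : D v = 0 := hD v hv
      change max (D v) 0 = 0
      simp [h1]
    have hm : (-D) ⊔ 0 ∈ DivS S := fun v hv => by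
      have h1 : D v = 0 := hD v hv
      change max (-D v) 0 = 0
      simp [h1]
    have hsum : (⟨D, hD⟩ : DivS S) = ⟨_, hp⟩ + -⟨_, hm⟩ := by
      apply Subtype.ext
      ext v
      change D v = max (D v) 0 + -(max (-D v) 0)
      rcases le_total (D v) 0 with h | h
      · rw [max_eq_right h, max_eq_left (by omega)]; omega
      · rw [max_eq_left h, max_eq_right (by omega)]; omega
    rw [hsum, QuotientAddGroup.mk_add, QuotientAddGroup.mk_neg]
    exact hadd _ (heff _ le_sup_right _) _ (hneg _ (heff _ le_sup_right _))
  have hQ : Finite Q := by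
    rw [← Set.finite_univ_iff, ← hsurj]; exact hfin
  rw [AddSubgroup.relIndex, AddSubgroup.index]
  exact Nat.card_pos.ne'

end
open scoped Pointwise

/-! ### Frobenius characters -/

section
variable {K : Type} [Field K] [NumberField K]

def Nm (v : Pl K) : ℕ := Nat.card (𝓞 K ⧸ v.asIdeal)

lemma Nm_eq (v : Pl K) : Nm v = Ideal.absNorm v.asIdeal := by
  rw [Nm, Ideal.absNorm_apply]; rfl

lemma Nm_gt_one (v : Pl K) : 1 < Nm v := by
  rw [Nm_eq]
  have h0 : Ideal.absNorm v.asIdeal ≠ 0 := by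
    rw [Ne, Ideal.absNorm_eq_zero_iff]; exact v.ne_bot
  have h1 : Ideal.absNorm v.asIdeal ≠ 1 := by
    rw [Ne, Ideal.absNorm_eq_one_iff]; exact v.isPrime.ne_top
  omega

instance pl_finite (v : Pl K) : Finite (𝓞 K ⧸ v.asIdeal) :=
  Ideal.finiteQuotientOfFreeOfNeBot _ v.ne_bot

variable {Ω : Type} [Field Ω] [NumberField Ω] [Algebra K Ω]

/-- restriction of primes -/
abbrev dn (K : Type) [Field K] [NumberField K] {Ω : Type} [Field Ω] [NumberField Ω]
  [Algebra K Ω] (P : Pl Ω) : Pl K := P.under (𝓞 K)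

lemma dn_surj (v : Pl K) : ∃ P : Pl Ω, dn K P = v := by
  obtain ⟨Q, hQ, hQ2⟩ := Ideal.exists_ideal_over_prime_of_isIntegral (S := 𝓞 Ω) v.asIdeal ⊥ (by
    intro x hx
    have : algebraMap (𝓞 K) (𝓞 Ω) x = 0 := by simpa using hx
    have : x = 0 := by
      apply FaithfulSMul.algebraMap_injective (𝓞 K) (𝓞 Ω); simpa using this
    simp [this])
  refine ⟨⟨Q, hQ2.1, ?_⟩, ?_⟩
  · rintro rfl
    apply v.ne_bot
    rw [← hQ2.2]
    exact Ideal.comap_bot_of_injective _ (FaithfulSMul.algebraMap_injective (𝓞 K) (𝓞 Ω))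
  · ext1; exact hQ2.2

instance smulComm_gal : SMulCommClass Gal(Ω/K) (𝓞 K) (𝓞 Ω) where
  smul_comm σ a x := by
    rw [Algebra.smul_def, Algebra.smul_def, smul_mul']
    congr 1
    apply RingOfIntegers.coe_injective
    exact σ.commutes (a : K)

/-- Frobenius relation -/
def IsFr (K : Type) [Field K] [NumberField K] {Ω : Type} [Field Ω] [NumberField Ω]
  [Algebra K Ω] (P : Pl Ω) (σ : Gal(Ω/K)) : Prop :=
  ∀ x : 𝓞 Ω, σ • x - x ^ Nm (dn K P) ∈ P.asIdeal

/-- inertia relation -/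
def IsIn {K : Type} [Field K] [NumberField K] {Ω : Type} [Field Ω] [NumberField Ω]
  [Algebra K Ω] (P : Pl Ω) (σ : Gal(Ω/K)) : Prop :=
  ∀ x : 𝓞 Ω, σ • x - x ∈ P.asIdeal

lemma isFr_iff (P : Pl Ω) (σ : Gal(Ω/K)) : IsFr K P σ ↔ IsArithFrobAt (𝓞 K) σ P.asIdeal := Iff.rfl

lemma exists_isFr [IsGalois K Ω] (P : Pl Ω) : ∃ σ : Gal(Ω/K), IsFr K P σ :=
  IsArithFrobAt.exists_of_isInvariant (𝓞 K) Gal(Ω/K) P.asIdeal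

lemma isIn_of_isFr {P : Pl Ω} {σ τ : Gal(Ω/K)} (h : IsFr K P σ) (h' : IsFr K P τ) :
    IsIn P (σ * τ⁻¹) :=
  fun x => IsArithFrobAt.mul_inv_mem_inertia (R := 𝓞 K) h h' x

/-- action on places -/
lemma IsFr.conj {P : Pl Ω} {σ : Gal(Ω/K)} (h : IsFr K P σ) (τ : Gal(Ω/K)) (Q : Pl Ω)
    (hQ : Q.asIdeal = τ • P.asIdeal) : IsFr K Q (τ * σ * τ⁻¹) := by
  rw [isFr_iff, hQ]
  exact IsArithFrobAt.conj (R := 𝓞 K) h τ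

lemma exists_conj [IsGalois K Ω] (P Q : Pl Ω) (h : dn K P = dn K Q) :
    ∃ τ : Gal(Ω/K), Q.asIdeal = τ • P.asIdeal := by
  obtain ⟨g, hg⟩ := Algebra.IsInvariant.exists_smul_of_under_eq (𝓞 K) (𝓞 Ω) Gal(Ω/K) P.asIdeal Q.asIdeal
    (congrArg HeightOneSpectrum.asIdeal h)
  exact ⟨g, hg⟩

variable (χ : Gal(Ω/K) →* ℂˣ)

def Unr (v : Pl K) : Prop := ∀ P : Pl Ω, dn K P = v → ∀ σ : Gal(Ω/K), IsIn P σ → χ σ = 1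

open Classical in
def fr [IsGalois K Ω] (v : Pl K) : ℂˣ :=
  χ (exists_isFr (K := K) (dn_surj (Ω := Ω) v).choose).choose

lemma fr_eq [IsGalois K Ω] {v : Pl K} (hv : Unr χ v) {P : Pl Ω} (hP : dn K P = v) {σ : Gal(Ω/K)}
    (hσ : IsFr K P σ) : χ σ = fr χ v := by
  set P' := (dn_surj (Ω := Ω) v).choose
  have hP' : dn K P' = v := (dn_surj (Ω := Ω) v).choose_spec
  have h1 : IsFr K P' (exists_isFr (K := K) P').choose := (exists_isFr (K := K) P').choose_spec
  obtain ⟨τ, hτ⟩ := exists_conj (K := K) P P' (hP.trans hP'.symm)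
  have h2 := hσ.conj τ P' hτ
  have h3 := hv P' hP' _ (isIn_of_isFr h2 h1)
  have h4 : χ (τ * σ * τ⁻¹) = χ σ := by simp [mul_comm]
  rw [map_mul, h4, map_inv, mul_inv_eq_one] at h3
  exact h3

lemma Unr.one (v : Pl K) : Unr (1 : Gal(Ω/K) →* ℂˣ) v := fun _ _ _ _ => rfl
lemma Unr.mul {χ ψ : Gal(Ω/K) →* ℂˣ} {v : Pl K} (h : Unr χ v) (h' : Unr ψ v) : Unr (χ * ψ) v :=
  fun P hP σ hσ => by simp [h P hP σ hσ, h' P hP σ hσ]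
lemma Unr.inv {χ : Gal(Ω/K) →* ℂˣ} {v : Pl K} (h : Unr χ v) : Unr χ⁻¹ v :=
  fun P hP σ hσ => by simp [h P hP σ hσ]
lemma Unr.pow {χ : Gal(Ω/K) →* ℂˣ} {v : Pl K} (h : Unr χ v) (n : ℕ) : Unr (χ ^ n) v :=
  fun P hP σ hσ => by simp [h P hP σ hσ]

lemma fr_mul [IsGalois K Ω] (χ ψ : Gal(Ω/K) →* ℂˣ) (v : Pl K) : fr (χ * ψ) v = fr χ v * fr ψ v := rfl
lemma fr_inv [IsGalois K Ω] (χ : Gal(Ω/K) →* ℂˣ) (v : Pl K) : fr (χ⁻¹) v = (fr χ v)⁻¹ := rfl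
lemma fr_pow [IsGalois K Ω] (χ : Gal(Ω/K) →* ℂˣ) (n : ℕ) (v : Pl K) : fr (χ ^ n) v = fr χ v ^ n := rfl

/-- Artin map on divisors -/
def art [IsGalois K Ω] : Dv K →+ Additive ℂˣ :=
  Finsupp.liftAddHom (fun v => (zmultiplesHom (Additive ℂˣ)) (Additive.ofMul (fr χ v)))

lemma art_single [IsGalois K Ω] (v : Pl K) (m : ℤ) :
    art χ (Finsupp.single v m) = m • Additive.ofMul (fr χ v) := by
  simp [art]

lemma art_mul [IsGalois K Ω] (χ ψ : Gal(Ω/K) →* ℂˣ) (D : Dv K) :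
    art (χ * ψ) D = art χ D + art ψ D := by
  induction D using Finsupp.induction_linear with
  | zero => simp
  | add f g hf hg => rw [map_add, hf, hg, map_add, map_add]; abel
  | single v m => simp only [art_single, fr_mul]; rw [ofMul_mul]; exact zsmul_add _ _ _

def Nchi [IsGalois K Ω] : AddSubgroup (Dv K) where
  carrier := {D | ∀ v, (orderOf (fr χ v) : ℤ) ∣ D v}
  zero_mem' := by simp
  add_mem' := by intro a b ha hb v; exact dvd_add (ha v) (hb v)
  neg_mem' := by intro a ha v; simpa using ha v

lemma mem_Nchi [IsGalois K Ω] {D : Dv K} : D ∈ Nchi χ ↔ ∀ v, (orderOf (fr χ v) : ℤ) ∣ D v := Iff.rfl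

lemma single_mem_Nchi [IsGalois K Ω] {v : Pl K} {m : ℤ} (h : (orderOf (fr χ v) : ℤ) ∣ m) :
    Finsupp.single v m ∈ Nchi χ := by
  intro w
  classical
  rw [Finsupp.single_apply]; split_ifs with h'
  · subst h'; exact h
  · simp

lemma art_Nchi [IsGalois K Ω] {D : Dv K} (h : D ∈ Nchi χ) : art χ D = 0 := by
  rw [art, Finsupp.liftAddHom_apply]
  apply Finset.sum_eq_zero
  intro v _
  obtain ⟨c, hc⟩ := h v
  simp only [zmultiplesHom_apply]
  rw [hc]
  rw [← ofMul_zpow, zpow_mul, zpow_natCast, pow_orderOf_eq_one]; simp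

end

/-! towers -/
section
variable {K : Type} [Field K] [NumberField K]
variable {F : Type} [Field F] [NumberField F] [Algebra K F]
variable {Ω : Type} [Field Ω] [NumberField Ω] [Algebra K Ω] [Algebra F Ω] [IsScalarTower K F Ω]

lemma dn_dn (P : Pl Ω) : dn K (dn F P) = dn K P := by
  ext1
  exact Ideal.under_under (A := 𝓞 K) (B := 𝓞 F) P.asIdeal

/-- residue degree -/
def fd (K : Type) [Field K] [NumberField K] {F : Type} [Field F] [NumberField F] [Algebra K F]
  (w : Pl F) : ℕ := w.asIdeal.inertiaDeg (𝓞 K)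

lemma Nm_pow (w : Pl F) : Nm w = Nm (dn K w) ^ fd K w := by
  rw [Nm_eq, Nm_eq]
  haveI : w.asIdeal.LiesOver (dn K w).asIdeal := ⟨rfl⟩
  have h := Ideal.relNorm_eq_pow_of_isMaximal (R := 𝓞 K) w.asIdeal (dn K w).asIdeal
  rw [← Ideal.absNorm_relNorm (R := 𝓞 K), h, map_pow]
  rfl

lemma fd_pos (w : Pl F) : 0 < fd K w := by
  rcases Nat.eq_zero_or_pos (fd K w) with h | h
  · have := Nm_pow (K := K) w
    rw [h, pow_zero] at this
    have h2 := Nm_gt_one w; omega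
  · exact h

lemma fd_mul (P : Pl Ω) : fd K P = fd K (dn F P) * fd F P := by
  have h1 := Nm_pow (K := K) P
  have h2 := Nm_pow (K := F) P
  have h3 := Nm_pow (K := K) (dn F P)
  rw [h2, h3, ← pow_mul, dn_dn] at h1
  exact (Nat.pow_right_injective (Nm_gt_one (dn K P)) h1).symm

def resH (K : Type) [Field K] {F : Type} [Field F] [Algebra K F]
  {Ω : Type} [Field Ω] [Algebra K Ω] [Algebra F Ω] [IsScalarTower K F Ω] :
  Gal(Ω/F) →* Gal(Ω/K) := AlgEquiv.restrictScalarsHom K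

lemma resH_apply (τ : Gal(Ω/F)) (x : Ω) : resH K τ x = τ x := rfl
lemma resH_smul (τ : Gal(Ω/F)) (x : 𝓞 Ω) : resH K τ • x = τ • x := rfl

lemma Unr.tower {χ : Gal(Ω/K) →* ℂˣ} {w : Pl F} (h : Unr χ (dn K w)) : Unr (χ.comp (resH K)) w := by
  intro P hP σ hσ
  exact h P (by rw [← hP, dn_dn]) (resH K σ) hσ

lemma IsFr.pow_sub {P : Pl Ω} {σ : Gal(Ω/K)} (h : IsFr K P σ) (m : ℕ) (x : 𝓞 Ω) :
    (σ ^ m) • x - x ^ (Nm (dn K P) ^ m) ∈ P.asIdeal := by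
  induction m generalizing x with
  | zero => simp
  | succ m ih =>
    have h1 := ih (σ • x)
    have h2 : (σ • x) ^ (Nm (dn K P) ^ m) - (x ^ Nm (dn K P)) ^ (Nm (dn K P) ^ m) ∈ P.asIdeal :=
      Ideal.mem_of_dvd _ (sub_dvd_pow_sub_pow _ _ _) (h x)
    have := add_mem h1 h2
    rw [sub_add_sub_cancel, ← mul_smul, ← pow_succ, ← pow_mul, ← pow_succ'] at this
    exact this

lemma IsFr.tower {P : Pl Ω} {σ : Gal(Ω/K)} (h : IsFr K P σ) {τ : Gal(Ω/F)} (h' : IsFr F P τ) :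
    IsIn P (resH K τ * (σ ^ fd K (dn F P))⁻¹) := by
  intro x
  have h1 := h' ((σ ^ fd K (dn F P))⁻¹ • x)
  have h2 := h.pow_sub (fd K (dn F P)) ((σ ^ fd K (dn F P))⁻¹ • x)
  rw [smul_inv_smul] at h2
  rw [Nm_pow (K := K) (dn F P), dn_dn] at h1
  have := sub_mem h1 h2
  rw [sub_sub_sub_cancel_right] at this
  rw [mul_smul, resH_smul]; exact this

lemma fr_tower [IsGalois K Ω] [IsGalois F Ω] {χ : Gal(Ω/K) →* ℂˣ} {w : Pl F} (h : Unr χ (dn K w)) :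
    fr (χ.comp (resH K)) w = fr χ (dn K w) ^ fd K w := by
  obtain ⟨P, hP⟩ := dn_surj (Ω := Ω) w
  obtain ⟨σ, hσ⟩ := exists_isFr (K := K) P
  obtain ⟨τ, hτ⟩ := exists_isFr (K := F) P
  rw [← fr_eq _ h.tower hP hτ, ← fr_eq χ h (by rw [← hP, dn_dn]) hσ]
  have h3 := h P (by rw [← hP, dn_dn]) _ (hσ.tower hτ)
  rw [map_mul, map_inv, mul_inv_eq_one, hP, map_pow] at h3
  exact h3

/-- norm of divisors -/
def nD (K : Type) [Field K] [NumberField K] {F : Type} [Field F] [NumberField F] [Algebra K F] :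
  Dv F →+ Dv K :=
  Finsupp.liftAddHom (fun w => (zmultiplesHom (Dv K)) (Finsupp.single (dn K w) (fd K w : ℤ)))

lemma nD_single (w : Pl F) (m : ℤ) :
    nD K (Finsupp.single w m) = Finsupp.single (dn K w) (m * fd K w) := by
  simp [nD]

lemma nD_DivS {S : Finset (Pl K)} {T : Finset (Pl F)} (hT : ∀ w, dn K w ∈ S → w ∈ T)
    {D : Dv F} (hD : D ∈ DivS T) : nD K D ∈ DivS S := by
  intro v hv
  rw [nD, Finsupp.liftAddHom_apply, Finsupp.sum, Finsupp.finsetSum_apply]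
  apply Finset.sum_eq_zero
  intro w _
  by_cases h : dn K w = v
  · have := hD w (hT w (h ▸ hv)); simp [this]
  · simp [Finsupp.single_apply, h]

lemma art_nD [IsGalois K Ω] [IsGalois F Ω] {χ : Gal(Ω/K) →* ℂˣ} {S : Finset (Pl K)}
    {T : Finset (Pl F)}
    (hχ : ∀ v ∉ S, Unr χ v) (hT : ∀ w, dn K w ∈ S → w ∈ T) {D : Dv F} (hD : D ∈ DivS T) :
    art χ (nD K D) = art (χ.comp (resH K)) D := by
  rw [nD, Finsupp.liftAddHom_apply, Finsupp.sum, map_sum, art, art]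
  conv_rhs => rw [Finsupp.liftAddHom_apply]
  apply Finset.sum_congr rfl
  intro w hw
  have hw : D w ≠ 0 := by simpa using hw
  have : dn K w ∉ S := fun h => hw (hD w (hT w h))
  simp only [zmultiplesHom_apply, fr_tower (hχ _ this)]
  rw [Finsupp.smul_single, Finsupp.liftAddHom_apply_single, zmultiplesHom_apply]
  simp [mul_smul]

lemma nD_Nchi [IsGalois K Ω] [IsGalois F Ω] {χ : Gal(Ω/K) →* ℂˣ} {S : Finset (Pl K)}
    {T : Finset (Pl F)}
    (hχ : ∀ v ∉ S, Unr χ v) (hT : ∀ w, dn K w ∈ S → w ∈ T) {D : Dv F} (hD : D ∈ DivS T)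
    (hD' : D ∈ Nchi (χ.comp (resH K) : Gal(Ω/F) →* ℂˣ)) : nD K D ∈ Nchi χ := by
  rw [nD, Finsupp.liftAddHom_apply, Finsupp.sum]
  apply sum_mem
  intro w hw
  have hw : D w ≠ 0 := by simpa using hw
  have : dn K w ∉ S := fun h => hw (hD w (hT w h))
  simp only [zmultiplesHom_apply]
  rw [Finsupp.smul_single]
  apply single_mem_Nchi
  have h1 := hD' w
  rw [fr_tower (hχ _ this)] at h1
  rw [orderOf_dvd_iff_zpow_eq_one] at h1 ⊢
  rw [smul_eq_mul, mul_comm, zpow_mul, zpow_natCast, h1]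

end

/-! norms of elements -/
section
variable {K : Type} [Field K] [NumberField K]
variable {F : Type} [Field F] [NumberField F] [Algebra K F]

lemma dvI_relNorm (J : Ideal (𝓞 F)) (hJ : J ≠ ⊥) :
    dvI ((Ideal.relNorm (𝓞 K) J : Ideal (𝓞 K)) : FI K) = nD K (dvI (J : FI F)) := by
  revert hJ
  have ne : ∀ I : Ideal (𝓞 F), I ≠ ⊥ → Ideal.relNorm (𝓞 K) I ≠ ⊥ := by
    intro I hI h; exact hI (Ideal.relNorm_eq_bot_iff.mp h)
  refine UniqueFactorizationMonoid.induction_on_prime J (fun h => absurd rfl h) ?_ ?_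
  · intro I hI _
    rw [Ideal.isUnit_iff] at hI
    subst hI
    rw [Ideal.relNorm_top]
    have h1 : ((⊤ : Ideal (𝓞 K)) : FI K) = 1 := FractionalIdeal.coeIdeal_top _
    have h2 : ((⊤ : Ideal (𝓞 F)) : FI F) = 1 := FractionalIdeal.coeIdeal_top _
    rw [h1, h2, dvI_one, dvI_one, map_zero]
  · intro I p hI hp ih _
    have hI' : I ≠ ⊥ := hI
    have hp' : p ≠ ⊥ := hp.ne_zero
    rw [map_mul, FractionalIdeal.coeIdeal_mul, FractionalIdeal.coeIdeal_mul,
      dvI_mul, dvI_mul, ih hI', map_add]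
    · congr 1
      let w : Pl F := ⟨p, Ideal.isPrime_of_prime hp, hp'⟩
      haveI := w.isMaximal
      haveI : w.asIdeal.LiesOver (dn K w).asIdeal := ⟨rfl⟩
      have h := Ideal.relNorm_eq_pow_of_isMaximal (R := 𝓞 K) w.asIdeal (dn K w).asIdeal
      have h3 : dvI (p : FI F) = Finsupp.single w 1 := dvI_pl w
      rw [h3, nD_single, one_mul]
      change dvI (((Ideal.relNorm (𝓞 K) w.asIdeal) : Ideal (𝓞 K)) : FI K) = _
      rw [h]
      have : ∀ m : ℕ, dvI (((dn K w).asIdeal ^ m : Ideal (𝓞 K)) : FI K) = Finsupp.single (dn K w) (m : ℤ) := by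
        intro m
        induction m with
        | zero => rw [pow_zero, Ideal.one_eq_top, FractionalIdeal.coeIdeal_top, dvI_one]; simp
        | succ m ih =>
          rw [pow_succ, FractionalIdeal.coeIdeal_mul, dvI_mul, ih, dvI_pl, ← Finsupp.single_add]
          · simp
          · exact FractionalIdeal.coeIdeal_ne_zero.mpr (pow_ne_zero _ (dn K w).ne_bot)
          · exact FractionalIdeal.coeIdeal_ne_zero.mpr (dn K w).ne_bot
      exact this _
    · exact FractionalIdeal.coeIdeal_ne_zero.mpr hp'
    · exact FractionalIdeal.coeIdeal_ne_zero.mpr hI'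
    · exact FractionalIdeal.coeIdeal_ne_zero.mpr (ne _ hp')
    · exact FractionalIdeal.coeIdeal_ne_zero.mpr (ne _ hI')

lemma dv_norm {β : F} (hβ : β ≠ 0) : dv (Algebra.norm K β) = nD K (dv β) := by
  have int : ∀ x : 𝓞 F, x ≠ 0 → dv (Algebra.norm K (x : F)) = nD K (dv (x : F)) := by
    intro x hx
    have h1 := dvI_relNorm (K := K) (Ideal.span {x}) (by simpa using hx)
    rw [Ideal.relNorm_singleton, FractionalIdeal.coeIdeal_span_singleton,
      FractionalIdeal.coeIdeal_span_singleton] at h1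
    have h2 := Algebra.algebraMap_intNorm (A := 𝓞 K) (K := K) (L := F) (B := 𝓞 F) x
    rw [h2] at h1
    exact h1
  obtain ⟨a, b, hb, rfl⟩ := IsFractionRing.div_surjective (A := 𝓞 F) β
  have hb0 : b ≠ 0 := nonZeroDivisors.ne_zero hb
  have hb1 : (algebraMap (𝓞 F) F b) ≠ 0 := by
    intro h; exact hb0 (FaithfulSMul.algebraMap_injective (𝓞 F) F (by simpa using h))
  have ha1 : (algebraMap (𝓞 F) F a) ≠ 0 := by intro h; simp [h] at hβ
  have ha0 : a ≠ 0 := by rintro rfl; simp at ha1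
  have hninv : ∀ x : F, x ≠ 0 → Algebra.norm K x⁻¹ = (Algebra.norm K x)⁻¹ := by
    intro x hx
    apply eq_inv_of_mul_eq_one_left; rw [← map_mul, inv_mul_cancel₀ hx, map_one]
  rw [div_eq_mul_inv, map_mul, hninv _ hb1, dv_mul, dv_mul, dv_inv, dv_inv, map_add, map_neg]
  · rw [← int a ha0, ← int b hb0]
  · exact ha1
  · exact inv_ne_zero hb1
  · exact (Algebra.norm_ne_zero_iff).mpr ha1
  · exact inv_ne_zero ((Algebra.norm_ne_zero_iff).mpr hb1)

/-- S-integral elements have denominators prime to S. -/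
lemma exists_den (T : Finset (Pl K)) (y : K) (hy : ∀ w ∈ T, w.valuation K y ≤ 1) :
    ∃ t : 𝓞 K, t ≠ 0 ∧ (∀ w ∈ T, t ∉ w.asIdeal) ∧ ∃ a : 𝓞 K, (t : K) * y = a := by
  classical
  rcases T.eq_empty_or_nonempty with rfl | ⟨w0, hw0⟩
  · obtain ⟨a, b, hb, rfl⟩ := IsFractionRing.div_surjective (A := 𝓞 K) y
    refine ⟨b, nonZeroDivisors.ne_zero hb, by simp, a, ?_⟩
    have : algebraMap (𝓞 K) K b ≠ 0 := by
      simpa using nonZeroDivisors.ne_zero hb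
    exact mul_div_cancel₀ _ this
  let J : Ideal (𝓞 K) :=
    { carrier := {t | ∃ a : 𝓞 K, (t : K) * y = a}
      zero_mem' := ⟨0, by simp⟩
      add_mem' := by rintro s t ⟨a, ha⟩ ⟨b, hb⟩; exact ⟨a + b, by push_cast; rw [add_mul, ha, hb]⟩
      smul_mem' := by rintro c t ⟨a, ha⟩; exact ⟨c * a, by rw [smul_eq_mul]; push_cast; rw [mul_assoc, ha]⟩ }
  by_contra hcon
  push Not at hcon
  have h1 : (J : Set (𝓞 K)) ⊆ ⋃ w ∈ (↑T : Set (Pl K)), (w.asIdeal : Set (𝓞 K)) := by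
    rintro t ⟨a, ha⟩
    by_contra h2
    have hh : ∀ w ∈ T, t ∉ w.asIdeal := fun w hw h3 => h2 (Set.mem_biUnion (x := w) hw h3)
    refine hcon t ?_ hh a ha
    rintro rfl; exact hh w0 hw0 (zero_mem _)
  rw [Ideal.subset_union_prime w0 w0 (fun i _ _ _ => i.isPrime)] at h1
  obtain ⟨w, hw, hle⟩ := h1
  by_cases hy0 : y = 0
  · have : (1 : 𝓞 K) ∈ J := ⟨0, by simp [hy0]⟩
    exact w.isPrime.ne_top ((Ideal.eq_top_iff_one _).mpr (hle this))
  -- write the ideal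
  set I : FI K := FractionalIdeal.spanSingleton _ y
  have hI : I ≠ 0 := span_ne_zero hy0
  -- D = negative part of dv y
  let D : Dv K := Finsupp.mapRange (fun z : ℤ => max (-z) 0) (by simp) (dv y)
  obtain ⟨B, hB, hBD⟩ := dvI_surj D
  have hD0 : 0 ≤ D := by intro u; simp [D]
  obtain ⟨B', hB', rfl⟩ := (dvI_nonneg_iff hB).mp (hBD ▸ hD0)
  have hBJ : B' ≤ J := by
    intro t ht
    by_cases ht0 : t = 0
    · exact ht0 ▸ J.zero_mem
    have ht0' : (t : K) ≠ 0 := by simpa using ht0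
    have : (t : K) * y ∈ (1 : FI K) := by
      apply mem_of_valuation _ _ (by rw [← FractionalIdeal.coeIdeal_top]; exact FractionalIdeal.coeIdeal_ne_zero.mpr top_ne_bot)
      intro u
      rw [valuation_eq u (mul_ne_zero ht0' hy0), dv_mul ht0' hy0, dvI_one]
      have h5 := mem_coeIdeal_pow_iff (t : K) u B' (FractionalIdeal.mem_coeIdeal_of_mem _ ht)
      rw [valuation_eq u ht0', hBD, WithZero.exp_le_exp] at h5
      rw [WithZero.exp_le_exp]
      have : D u = max (-(dv y u)) 0 := rfl
      have := le_max_left (-(dv y u)) 0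
      simp only [Finsupp.add_apply, Finsupp.coe_zero, Pi.zero_apply]
      omega
    obtain ⟨a, ha⟩ := (FractionalIdeal.mem_one_iff _).mp this
    exact ⟨a, ha.symm⟩
  have h6 : B' ≤ w.asIdeal := hBJ.trans hle
  have h7 : D w = 0 := by
    have h8 := hy w hw
    rw [valuation_eq w hy0, ← WithZero.exp_zero, WithZero.exp_le_exp] at h8
    change max (-(dv y w)) 0 = 0
    exact max_eq_right h8
  obtain ⟨C, hC⟩ := Ideal.dvd_iff_le.mpr h6
  have hC0 : C ≠ ⊥ := by rintro rfl; apply hB'; rw [hC]; simp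
  rw [← hBD, hC, FractionalIdeal.coeIdeal_mul, dvI_mul, dvI_pl] at h7
  · have h9 : 0 ≤ dvI (C : FI K) := (dvI_nonneg_iff (FractionalIdeal.coeIdeal_ne_zero.mpr hC0)).mpr ⟨C, hC0, rfl⟩
    have := h9 w
    simp only [Finsupp.add_apply, Finsupp.single_eq_same, Finsupp.coe_zero, Pi.zero_apply] at h7 this
    omega
  · exact FractionalIdeal.coeIdeal_ne_zero.mpr w.ne_bot
  · exact FractionalIdeal.coeIdeal_ne_zero.mpr hC0

lemma finite_fiber (S : Finset (Pl K)) : {w : Pl F | dn K w ∈ S}.Finite := by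
  have h1 : ∀ v : Pl K, {w : Pl F | dn K w = v}.Finite := by
    intro v
    have h2 : v.asIdeal.map (algebraMap (𝓞 K) (𝓞 F)) ≠ ⊥ := by
      rw [Ne, Ideal.map_eq_bot_iff_of_injective (FaithfulSMul.algebraMap_injective (𝓞 K) (𝓞 F))]
      exact v.ne_bot
    have h3 := Ideal.finite_factors h2
    refine h3.subset ?_
    intro w hw
    change w.asIdeal ∣ _
    rw [Ideal.dvd_iff_le, Ideal.map_le_iff_le_comap]
    rw [← (show dn K w = v from hw)]
    exact le_rfl
  have : {w : Pl F | dn K w ∈ S} = ⋃ v ∈ S, {w : Pl F | dn K w = v} := by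
    ext w; simp
  rw [this]
  exact Set.Finite.biUnion S.finite_toSet (fun v _ => h1 v)

/-- primes above S -/
def up (F : Type) [Field F] [NumberField F] [Algebra K F] (S : Finset (Pl K)) : Finset (Pl F) :=
  (finite_fiber (F := F) S).toFinset

lemma mem_up {S : Finset (Pl K)} {w : Pl F} : w ∈ up F S ↔ dn K w ∈ S := by
  simp [up]

lemma exists_den_up (S : Finset (Pl K)) (y : F) (hy : ∀ w ∈ up F S, w.valuation F y ≤ 1) :
    ∃ s : 𝓞 K, (∀ v ∈ S, s ∉ v.asIdeal) ∧ ∃ a : 𝓞 F, algebraMap K F s * y = a := by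
  obtain ⟨t, ht0, ht, a, ha⟩ := exists_den (up F S) y hy
  have ht0' : (t : F) ≠ 0 := by simpa using ht0
  have hN : algebraMap K F (Algebra.intNorm (𝓞 K) (𝓞 F) t : 𝓞 K) = algebraMap K F (Algebra.norm K (t : F)) := by
    congr 1
    exact Algebra.algebraMap_intNorm (A := 𝓞 K) (K := K) (L := F) (B := 𝓞 F) t
  have hn0 : Algebra.norm K (t : F) ≠ 0 := Algebra.norm_ne_zero_iff.mpr ht0'
  refine ⟨Algebra.intNorm (𝓞 K) (𝓞 F) t, ?_, ?_⟩
  · intro v hv hmem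
    have h1 : v.valuation K (Algebra.norm K (t : F)) = 1 := by
      rw [← dv_apply_eq_zero_iff v hn0, dv_norm ht0']
      have : dv (t : F) ∈ DivS (up F S) := by
        intro w hw
        rw [dv_apply_eq_zero_iff w ht0']
        have := ht w hw
        rw [← HeightOneSpectrum.valuation_lt_one_iff_mem (K := F)] at this
        exact le_antisymm (w.valuation_le_one t) (not_lt.mp this)
      exact nD_DivS (fun w hw => mem_up.mpr hw) this v hv
    have h2 := (HeightOneSpectrum.valuation_lt_one_iff_mem (K := K) v _).mpr hmem
    have h3 := Algebra.algebraMap_intNorm (A := 𝓞 K) (K := K) (L := F) (B := 𝓞 F) t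
    exact (lt_irrefl _ ((h1.symm.trans (congrArg (v.valuation K) h3.symm)).trans_lt h2))
  · have hdvd : t ∣ algebraMap (𝓞 K) (𝓞 F) (Algebra.intNorm (𝓞 K) (𝓞 F) t) := by
      exact Algebra.dvd_algebraMap_intNorm_self (𝓞 K) (𝓞 F) t
    obtain ⟨c, hc⟩ := hdvd
    refine ⟨c * a, ?_⟩
    have : algebraMap K F (Algebra.intNorm (𝓞 K) (𝓞 F) t : 𝓞 K) = (t : F) * c := by
      have := congrArg (algebraMap (𝓞 F) F) hc
      rw [map_mul] at this
      rw [← this]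
      rfl
    rw [this]
    rw [show ((c * a : 𝓞 F) : F) = (c : F) * a from map_mul (algebraMap (𝓞 F) F) c a, mul_right_comm, ha, mul_comm]

lemma not_mem_iff_val (v : Pl K) (s : 𝓞 K) : s ∉ v.asIdeal ↔ v.valuation K (s : K) = 1 := by
  rw [← HeightOneSpectrum.valuation_lt_one_iff_mem (K := K), not_lt]
  exact ⟨fun h => le_antisymm (v.valuation_le_one s) h, fun h => h.ge⟩

/-- norm of `1 + c y` -/
lemma norm_one_add (S : Finset (Pl K)) (c : 𝓞 K) (hc : c ≠ 0) (y : F)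
    (hy : ∀ w ∈ up F S, w.valuation F y ≤ 1) :
    ∀ v ∈ S, v.valuation K (Algebra.norm K (1 + algebraMap K F c * y) - 1) ≤ v.valuation K (c : K) := by
  obtain ⟨s, hs, a, ha⟩ := exists_den_up S y hy
  intro v hv
  have hs1 := (not_mem_iff_val v s).mp (hs v hv)
  have hs0 : (s : K) ≠ 0 := by intro h; rw [h] at hs1; simp at hs1
  let n := Module.finrank K F
  -- N (s + c a) - s^n = c z
  have key : ∃ z : 𝓞 K, Algebra.norm K (algebraMap K F s + algebraMap K F c * a) - (s : K) ^ n = c * z := by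
    let E := AlgebraicClosure K
    let B := integralClosure (𝓞 K) E
    have hint : ∀ σ : F →ₐ[K] E, IsIntegral (𝓞 K) (σ a) := by
      intro σ
      have : IsIntegral (𝓞 K) (a : F) := by
        have := a.isIntegral_coe
        exact this.tower_top
      exact this.map (σ.restrictScalars (𝓞 K))
    let bs : B := algebraMap (𝓞 K) B s
    let bc : B := algebraMap (𝓞 K) B c
    let ba : (F →ₐ[K] E) → B := fun σ => ⟨σ a, hint σ⟩
    have h1 : Ideal.Quotient.mk (Ideal.span {bc}) (∏ σ : F →ₐ[K] E, (bs + bc * ba σ)) =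
        Ideal.Quotient.mk (Ideal.span {bc}) (bs ^ n) := by
      rw [map_prod, map_pow]
      have : ∀ σ : F →ₐ[K] E, Ideal.Quotient.mk (Ideal.span {bc}) (bs + bc * ba σ) =
          Ideal.Quotient.mk (Ideal.span {bc}) bs := by
        intro σ
        rw [Ideal.Quotient.eq, add_sub_cancel_left]
        exact Ideal.mul_mem_right _ _ (Ideal.mem_span_singleton_self bc)
      simp only [this]
      rw [Finset.prod_const, Finset.card_univ, ← Nat.card_eq_fintype_card, AlgHom.natCard_of_splits]
      intro x
      exact IsAlgClosed.splits _
    rw [Ideal.Quotient.eq, Ideal.mem_span_singleton] at h1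
    obtain ⟨z, hz⟩ := h1
    have h2 := congrArg (algebraMap B E) hz
    have h3 : algebraMap B E (∏ σ : F →ₐ[K] E, (bs + bc * ba σ)) =
        algebraMap K E (Algebra.norm K (algebraMap K F s + algebraMap K F c * a)) := by
      rw [Algebra.norm_eq_prod_embeddings K E, map_prod]
      apply Finset.prod_congr rfl
      intro σ _
      rw [map_add, map_mul, map_add, map_mul, σ.commutes, σ.commutes]
      rfl
    rw [map_sub, h3, map_pow, map_mul] at h2
    have h4 : algebraMap B E bs = algebraMap K E s := rfl
    have h5 : algebraMap B E bc = algebraMap K E c := rfl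
    rw [h4, h5, ← map_pow, ← map_sub] at h2
    have hc' : (c : K) ≠ 0 := by simpa using hc
    have hc'' : algebraMap K E c ≠ 0 := by simpa using hc'
    have h6 : algebraMap B E z = algebraMap K E ((Algebra.norm K (algebraMap K F s + algebraMap K F c * a) - (s : K) ^ n) / c) := by
      rw [map_div₀, h2, mul_div_cancel_left₀ _ hc'']
    have h7 : IsIntegral (𝓞 K) ((Algebra.norm K (algebraMap K F s + algebraMap K F c * a) - (s : K) ^ n) / c) := by
      have : IsIntegral (𝓞 K) (algebraMap B E z) := z.2
      rw [h6] at this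
      exact (isIntegral_algebraMap_iff (algebraMap K E).injective).mp this
    obtain ⟨z', hz'⟩ := (IsIntegrallyClosed.isIntegral_iff).mp h7
    refine ⟨z', ?_⟩
    change _ = (c : K) * algebraMap (𝓞 K) K z'
    rw [hz', mul_div_cancel₀ _ hc']
  obtain ⟨z, hz⟩ := key
  have h1 : algebraMap K F s * (1 + algebraMap K F c * y) = algebraMap K F s + algebraMap K F c * a := by
    rw [← ha]; ring
  have h2 : (s : K) ^ n * (Algebra.norm K (1 + algebraMap K F c * y) - 1) = c * z := by
    rw [← hz, ← h1, map_mul, Algebra.norm_algebraMap]; ring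
  have h3 := congrArg (v.valuation K) h2
  rw [map_mul, map_pow, hs1, one_pow, one_mul, map_mul] at h3
  rw [h3]
  exact mul_le_of_le_one_right' (v.valuation_le_one z)

lemma norm_pos_of {φ : K →+* ℝ} {β : F} (hβ : β ≠ 0)
    (h : ∀ ψ : F →+* ℝ, ψ.comp (algebraMap K F) = φ → 0 < ψ β) : 0 < φ (Algebra.norm K β) := by
  letI : Algebra K ℂ := (Complex.ofRealHom.comp φ).toAlgebra
  have hal : ∀ x : K, algebraMap K ℂ x = (φ x : ℂ) := fun x => rfl
  have h1 := Algebra.norm_eq_prod_embeddings K ℂ β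
  let cj : (F →ₐ[K] ℂ) → (F →ₐ[K] ℂ) := fun σ =>
    { (starRingEnd ℂ).comp σ.toRingHom with
      commutes' := by
        intro r
        change (starRingEnd ℂ) (σ (algebraMap K F r)) = _
        rw [σ.commutes, hal]; simp }
  have hcj : ∀ σ x, cj σ x = (starRingEnd ℂ) (σ x) := fun _ _ => rfl
  have hne : ∀ σ : F →ₐ[K] ℂ, σ β ≠ 0 := fun σ => by simpa using hβ
  have h2 : ∏ σ : F →ₐ[K] ℂ, (σ β / (‖σ β‖ : ℂ)) = 1 := by
    refine Finset.prod_ninvolution cj ?_ ?_ (fun _ => Finset.mem_univ _) ?_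
    · intro σ
      rw [hcj, Complex.norm_conj, div_mul_div_comm, Complex.mul_conj, Complex.normSq_eq_norm_sq]
      have : (‖σ β‖ : ℂ) ≠ 0 := by simpa using hβ
      field_simp
      push_cast; ring
    · intro σ hσ heq
      apply hσ
      -- σ real
      have hreal : ∀ x, ((σ x).re : ℂ) = σ x := by
        intro x
        rw [← Complex.conj_eq_iff_re, ← hcj, heq]
      let ψ : F →+* ℝ :=
        { toFun := fun x => (σ x).re
          map_one' := by simp
          map_zero' := by simp
          map_add' := by intro x y; simp
          map_mul' := by
            intro x y
            have : (((σ (x*y)).re : ℝ) : ℂ) = (((σ x).re * (σ y).re : ℝ) : ℂ) := by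
              rw [hreal]; push_cast; rw [hreal, hreal, map_mul]
            exact_mod_cast this }
      have hψ : 0 < ψ β := by
        apply h
        ext x
        change (σ (algebraMap K F x)).re = φ x
        rw [σ.commutes, hal]; simp
      have h3 : σ β = (ψ β : ℂ) := (hreal β).symm
      rw [h3, Complex.norm_real, Real.norm_of_nonneg hψ.le, div_self]
      exact_mod_cast hψ.ne'
    · intro σ
      ext x
      rw [hcj, hcj]; simp
  rw [Finset.prod_div_distrib, ← h1, hal] at h2
  have h3 : (0:ℝ) < ∏ σ : F →ₐ[K] ℂ, ‖σ β‖ := Finset.prod_pos (fun σ _ => by simpa using hβ)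
  have h4 : (φ (Algebra.norm K β) : ℂ) = ((∏ σ : F →ₐ[K] ℂ, ‖σ β‖ : ℝ) : ℂ) := by
    rw [div_eq_one_iff_eq] at h2
    · rw [h2]; push_cast; rfl
    · exact_mod_cast h3.ne'
  have h5 : φ (Algebra.norm K β) = (∏ σ : F →ₐ[K] ℂ, ‖σ β‖ : ℝ) := by exact_mod_cast h4
  rw [h5]; exact h3

lemma exists_small (S : Finset (Pl K)) (k : ℕ) :
    ∃ c : 𝓞 K, c ≠ 0 ∧ ∀ v ∈ S, v.valuation K (c : K) ≤ WithZero.exp (-((k : ℤ) + 1)) := by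
  have h0 : (∏ v ∈ S, v.asIdeal ^ (k + 1)) ≠ ⊥ := by
    rw [← Ideal.zero_eq_bot, Finset.prod_ne_zero_iff]
    intro v _; exact pow_ne_zero _ v.ne_bot
  obtain ⟨c, hc, hc0⟩ := Submodule.exists_mem_ne_zero_of_ne_bot h0
  refine ⟨c, hc0, fun v hv => ?_⟩
  have h1 : c ∈ v.asIdeal ^ (k + 1) := by
    have := Finset.dvd_prod_of_mem (fun v : Pl K => v.asIdeal ^ (k + 1)) hv
    exact Ideal.dvd_iff_le.mp this hc
  have h2 := (HeightOneSpectrum.intValuation_le_pow_iff_mem v c (k+1)).mpr h1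
  rw [← HeightOneSpectrum.valuation_of_algebraMap (K := K)] at h2
  exact_mod_cast h2

lemma exists_ray_norm (S : Finset (Pl K)) (k : ℕ) :
    ∃ k', ∀ β : Fˣ, β ∈ Ray (up F S) k' → ∃ t : Kˣ, t ∈ Ray S k ∧ (t : K) = Algebra.norm K (β : F) := by
  obtain ⟨c, hc0, hc⟩ := exists_small S k
  have hcF : algebraMap K F c ≠ 0 := by simpa using hc0
  refine ⟨∑ w ∈ up F S, (dv (algebraMap K F c) w).natAbs, fun β hβ => ?_⟩
  refine ⟨Units.map (Algebra.norm K) β, ⟨?_, ?_⟩, rfl⟩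
  · intro v hv
    have h1 := norm_one_add S c hc0 (((β : F) - 1) / algebraMap K F c) ?_ v hv
    · rw [mul_div_cancel₀ _ hcF, add_sub_cancel] at h1
      exact h1.trans (hc v hv)
    · intro w hw
      rw [map_div₀]
      have h2 := hβ.1 w hw
      have h3 : WithZero.exp (-(((∑ w ∈ up F S, (dv (algebraMap K F c) w).natAbs : ℕ) : ℤ) + 1)) ≤ w.valuation F (algebraMap K F c) := by
        rw [valuation_eq w hcF, WithZero.exp_le_exp]
        have := Finset.single_le_sum (f := fun w => (dv (algebraMap K F c) w).natAbs) (fun _ _ => Nat.zero_le _) hw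
        omega
      exact div_le_one_of_le₀ (h2.trans h3) zero_le
  · intro φ
    apply norm_pos_of β.ne_zero
    intro ψ _
    exact hβ.2 ψ

lemma exists_PR_norm (S : Finset (Pl K)) (k : ℕ) :
    ∃ k', ∀ D ∈ PR (up F S) k', nD K D ∈ PR S k := by
  obtain ⟨k', h⟩ := exists_ray_norm (F := F) S k
  refine ⟨k', fun D hD => ?_⟩
  obtain ⟨β, hβ, rfl⟩ := mem_PR.mp hD
  obtain ⟨t, ht, hteq⟩ := h β hβ
  exact mem_PR.mpr ⟨t, ht, by rw [hteq, dv_norm β.ne_zero]⟩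

end

section
variable {K : Type} [Field K] [NumberField K]
variable {Ω : Type} [Field Ω] [NumberField Ω] [Algebra K Ω]

attribute [local instance] Ideal.Quotient.field

lemma stab_pow (P : Pl Ω) (σ : Gal(Ω/K)) (hσ : ∀ x ∈ P.asIdeal, σ • x ∈ P.asIdeal) :
    ∃ i : ℕ, ∀ x : 𝓞 Ω, σ • x - x ^ (Nm (dn K P) ^ i) ∈ P.asIdeal := by
  haveI := P.isMaximal
  haveI := (dn K P).isMaximal
  haveI : P.asIdeal.LiesOver (dn K P).asIdeal := ⟨rfl⟩
  letI : Fintype (𝓞 K ⧸ (dn K P).asIdeal) := Fintype.ofFinite _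
  let f : (𝓞 Ω ⧸ P.asIdeal) →ₐ[𝓞 K ⧸ (dn K P).asIdeal] (𝓞 Ω ⧸ P.asIdeal) :=
    { Ideal.Quotient.lift P.asIdeal ((Ideal.Quotient.mk P.asIdeal).comp (MulSemiringAction.toRingHom Gal(Ω/K) (𝓞 Ω) σ))
        (by intro a ha; exact Ideal.Quotient.eq_zero_iff_mem.mpr (hσ a ha)) with
      commutes' := by
        intro r
        obtain ⟨r, rfl⟩ := Ideal.Quotient.mk_surjective r
        change Ideal.Quotient.mk P.asIdeal (σ • (algebraMap (𝓞 K) (𝓞 Ω) r)) = Ideal.Quotient.mk P.asIdeal (algebraMap (𝓞 K) (𝓞 Ω) r)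
        congr 1
        apply RingOfIntegers.coe_injective
        exact σ.commutes (r : K) }
  obtain ⟨i, hi⟩ := (FiniteField.bijective_frobeniusAlgHom_pow (𝓞 K ⧸ (dn K P).asIdeal) (𝓞 Ω ⧸ P.asIdeal)).2 f
  refine ⟨i, fun x => ?_⟩
  have h1 := DFunLike.congr_fun hi (Ideal.Quotient.mk _ x)
  simp only [AlgHom.coe_pow, FiniteField.coe_frobeniusAlgHom, pow_iterate] at h1
  rw [← Ideal.Quotient.eq, map_pow, Nm, Nat.card_eq_fintype_card]
  exact h1.symm

lemma fd_dvd (P : Pl Ω) (i : ℕ) (h : ∀ x : 𝓞 Ω, x - x ^ (Nm (dn K P) ^ i) ∈ P.asIdeal) : fd K P ∣ i := by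
  haveI := P.isMaximal
  haveI := (dn K P).isMaximal
  haveI : P.asIdeal.LiesOver (dn K P).asIdeal := ⟨rfl⟩
  letI : Fintype (𝓞 K ⧸ (dn K P).asIdeal) := Fintype.ofFinite _
  have h1 : (FiniteField.frobeniusAlgHom (𝓞 K ⧸ (dn K P).asIdeal) (𝓞 Ω ⧸ P.asIdeal)) ^ i = 1 := by
    ext x
    obtain ⟨x, rfl⟩ := Ideal.Quotient.mk_surjective x
    simp only [AlgHom.coe_pow, FiniteField.coe_frobeniusAlgHom, pow_iterate, AlgHom.one_apply]
    have := h x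
    rw [← Ideal.Quotient.eq, map_pow, Nm, Nat.card_eq_fintype_card] at this
    exact this.symm
  have h2 := orderOf_dvd_of_pow_eq_one h1
  rw [FiniteField.orderOf_frobeniusAlgHom] at h2
  have h3 : Module.finrank (𝓞 K ⧸ (dn K P).asIdeal) (𝓞 Ω ⧸ P.asIdeal) = fd K P := by
    apply Nat.pow_right_injective (Nm_gt_one (dn K P))
    change (Nm (dn K P)) ^ _ = (Nm (dn K P)) ^ _
    rw [← Nm_pow (K := K) P, Nm, Nm]
    exact (Module.natCard_eq_pow_finrank).symm
  rwa [h3] at h2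

end

section
variable {K : Type} [Field K] [NumberField K]
variable {L : Type} [Field L] [NumberField L] [Algebra K L]
variable {Ω : Type} [Field Ω] [NumberField Ω] [Algebra K Ω] [Algebra L Ω] [IsScalarTower K L Ω]
variable [IsGalois K Ω] [IsGalois K L] [IsGalois L Ω]

/-- restriction to normal subextension -/
def rs : Gal(Ω/K) →* Gal(L/K) := AlgEquiv.restrictNormalHom L

lemma rs_smul (σ : Gal(Ω/K)) (x : 𝓞 L) :
    algebraMap (𝓞 L) (𝓞 Ω) (rs (L := L) σ • x) = σ • algebraMap (𝓞 L) (𝓞 Ω) x := by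
  apply RingOfIntegers.coe_injective
  exact AlgEquiv.restrictNormal_commutes σ L x

lemma rs_surj : Function.Surjective (rs : Gal(Ω/K) →* Gal(L/K)) :=
  AlgEquiv.restrictNormalHom_surjective Ω

lemma rs_resH (τ : Gal(Ω/L)) : rs (L := L) (resH K τ) = 1 := by
  ext x
  apply (algebraMap L Ω).injective
  have := AlgEquiv.restrictNormal_commutes (resH K τ) L x
  rw [show rs (L := L) (resH K τ) x = AlgEquiv.restrictNormal (resH K τ) L x from rfl, this, resH_apply]
  simp

lemma mem_dn {P : Pl Ω} {x : 𝓞 L} : x ∈ (dn L P).asIdeal ↔ algebraMap (𝓞 L) (𝓞 Ω) x ∈ P.asIdeal := Iff.rfl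

lemma IsFr.rs {P : Pl Ω} {σ : Gal(Ω/K)} (h : IsFr K P σ) : IsFr K (dn L P) (rs σ) := by
  intro x
  rw [mem_dn, map_sub, rs_smul, map_pow, dn_dn]
  exact h _

lemma IsIn.lift {P : Pl Ω} {σ' : Gal(L/K)} (h : IsIn (dn L P) σ') :
    ∃ σ : Gal(Ω/K), IsIn P σ ∧ rs σ = σ' := by
  obtain ⟨σ, rfl⟩ := rs_surj (Ω := Ω) σ'
  -- σ • P lies over dn L P
  let Q : Pl Ω := ⟨σ • P.asIdeal, inferInstance, by
    intro hb
    apply P.ne_bot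
    have : σ⁻¹ • (σ • P.asIdeal) = σ⁻¹ • (⊥ : Ideal (𝓞 Ω)) := by rw [hb]
    rw [inv_smul_smul] at this
    rw [this]; exact Ideal.map_bot⟩
  have memQ : ∀ x, x ∈ Q.asIdeal ↔ σ⁻¹ • x ∈ P.asIdeal := fun x => Ideal.mem_pointwise_smul_iff_inv_smul_mem
  have hmapinv : ∀ x : 𝓞 L, x ∈ (dn L P).asIdeal → rs (L := L) σ • x ∈ (dn L P).asIdeal := by
    intro x hx
    have := add_mem (h x) hx
    simpa using this
  have hmapinv' : ∀ x : 𝓞 L, x ∈ (dn L P).asIdeal → rs (L := L) σ⁻¹ • x ∈ (dn L P).asIdeal := by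
    intro x hx
    have e1 := h (rs (L := L) σ⁻¹ • x)
    rw [← mul_smul, ← map_mul, mul_inv_cancel, map_one, one_smul] at e1
    have := sub_mem hx e1
    simpa using this
  have hQ : dn L P = dn L Q := by
    have hle : (dn L P).asIdeal ≤ (dn L Q).asIdeal := by
      intro x hx
      have e1 := hmapinv' x hx
      rw [mem_dn, rs_smul] at e1
      rw [mem_dn, memQ]; exact e1
    ext1
    exact ((dn L P).isMaximal.eq_of_le (dn L Q).isPrime.ne_top hle)
  obtain ⟨τ, hτ⟩ := exists_conj (K := L) P Q hQ
  let σ1 := (resH K τ)⁻¹ * σ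
  have h1 : rs (L := L) σ1 = rs σ := by
    simp only [σ1, map_mul, map_inv, rs_resH]; simp
  have h2 : ∀ x ∈ P.asIdeal, σ1 • x ∈ P.asIdeal := by
    intro x hx
    have : σ • x ∈ Q.asIdeal := by rw [memQ, inv_smul_smul]; exact hx
    rw [hτ, Ideal.mem_pointwise_smul_iff_inv_smul_mem] at this
    rw [mul_smul]; exact this
  obtain ⟨i, hi⟩ := stab_pow P σ1 h2
  have h3 : fd K (dn L P) ∣ i := by
    apply fd_dvd
    intro x
    have e1 := hi (algebraMap _ _ x)
    rw [← rs_smul, h1, ← map_pow, ← map_sub, ← mem_dn] at e1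
    have := sub_mem e1 (h x)
    rw [dn_dn]
    simpa using this
  obtain ⟨j, rfl⟩ := h3
  obtain ⟨ψ, hψ⟩ := exists_isFr (K := L) P
  refine ⟨σ1 * (resH K (ψ ^ j))⁻¹, ?_, ?_⟩
  · intro x
    set y := (ψ ^ j)⁻¹ • x with hy
    have hx : x = ψ ^ j • y := by rw [hy, smul_inv_smul]
    have e1 := hi y
    have e2 := hψ.pow_sub j y
    rw [Nm_pow (K := K) (dn L P), dn_dn, ← pow_mul, ← hx] at e2
    have := sub_mem e1 e2
    rw [sub_sub_sub_cancel_right] at this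
    rw [mul_smul, ← map_inv, resH_smul]
    exact this
  · rw [map_mul, map_inv, rs_resH, h1]; simp

lemma Unr.descend {χ : Gal(L/K) →* ℂˣ} {v : Pl K} (h : Unr (χ.comp (rs : Gal(Ω/K) →* Gal(L/K))) v) : Unr χ v := by
  intro w hw σ' hσ'
  obtain ⟨P, hP⟩ := dn_surj (Ω := Ω) w
  subst hP
  obtain ⟨σ, h1, h2⟩ := IsIn.lift hσ'
  rw [← h2]
  exact h P (by rw [← hw, dn_dn]) σ h1

lemma fr_descend {χ : Gal(L/K) →* ℂˣ} {v : Pl K} (h : Unr (χ.comp (rs : Gal(Ω/K) →* Gal(L/K))) v) :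
    fr χ v = fr (χ.comp (rs : Gal(Ω/K) →* Gal(L/K))) v := by
  obtain ⟨P, hP⟩ := dn_surj (Ω := Ω) v
  obtain ⟨σ, hσ⟩ := exists_isFr (K := K) P
  rw [← fr_eq _ h hP hσ, ← fr_eq _ h.descend (by rw [dn_dn]; exact hP) hσ.rs]
  rfl

lemma IsIn.rs {P : Pl Ω} {σ : Gal(Ω/K)} (h : IsIn P σ) : IsIn (dn L P) (rs σ) := by
  intro x
  rw [mem_dn, map_sub, rs_smul]
  exact h _

lemma Unr.ascend {χ : Gal(L/K) →* ℂˣ} {v : Pl K} (h : Unr χ v) :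
    Unr (χ.comp (rs : Gal(Ω/K) →* Gal(L/K))) v := by
  intro P hP σ hσ
  exact h (dn L P) (by rw [dn_dn]; exact hP) _ hσ.rs

end

section absindex
open AddSubgroup

lemma relIndex_map' {A B : Type} [AddCommGroup A] [AddCommGroup B] (φ : A →+ B) (X Y : AddSubgroup A) :
    (X.map φ).relIndex (Y.map φ) = (X ⊔ φ.ker).relIndex Y := by
  rw [← relIndex_comap, comap_map_eq]

lemma map_comap' {A B : Type} [AddCommGroup A] [AddCommGroup B] (φ : A →+ B) (X : AddSubgroup B) :
    (X.comap φ).map φ = φ.range ⊓ X := by rw [map_comap_eq]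

/-- index comparison -/
lemma abs_index {U J : Type} [AddCommGroup U] [AddCommGroup J] (f g : U →+ U) (f' g' : J →+ J)
    (d : U →+ J) (hf : ∀ x, d (f x) = f' (d x)) (hg : ∀ x, d (g x) = g' (d x))
    (hfg' : ∀ x, f' (g' x) = 0) (hgf' : ∀ x, g' (f' x) = 0)
    (K' : AddSubgroup U) (hK' : K' ≤ f.ker) (hgK : g.range ≤ K') (hfg : ∀ x, g (f x) = 0)
    (h90 : g.ker ≤ f.range)
    (hfin : d.range.index ≠ 0) (hE0 : (d.ker.map g).relIndex (f.ker ⊓ d.ker) ≠ 0) :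
    ((d.ker.map f).relIndex (g.ker ⊓ d.ker)) * K'.relIndex f.ker ≤
      (K'.map d ⊔ g'.range).relIndex f'.ker * (d.ker.map g).relIndex (f.ker ⊓ d.ker) := by
  set E := d.ker with hE
  set P := d.range with hP
  set T := f'.ker with hT
  have hgker : g.ker = f.range := le_antisymm h90 (by rintro _ ⟨x, rfl⟩; exact hfg x)
  have hK'T : K'.map d ≤ T := by
    rintro _ ⟨x, hx, rfl⟩
    change f' (d x) = 0
    rw [← hf, show f x = 0 from hK' hx, map_zero]
  have hg'T : g'.range ≤ T := by rintro _ ⟨x, rfl⟩; exact hfg' x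
  -- step 1
  set x := (K'.map d ⊔ g'.range).relIndex T with hx
  have h1 : (K'.map d).relIndex (K'.map d ⊔ g'.range) * x = (K'.map d).relIndex T :=
    relIndex_mul_relIndex _ _ _ le_sup_left (sup_le hK'T hg'T)
  have hz0 : (P ⊔ f'.range).index ≠ 0 := fun h => hfin (by
    have := index_dvd_of_le (H := P) (K := P ⊔ f'.range) le_sup_left
    rw [h] at this; exact Nat.eq_zero_of_zero_dvd this)
  have h2 : (K'.map d).relIndex (K'.map d ⊔ g'.range) ≤ (P ⊔ f'.range).index := by
    rw [relIndex_sup_left, AddMonoidHom.range_eq_map, ← relIndex_comap, relIndex_top_right]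
    refine Nat.le_of_dvd (Nat.pos_of_ne_zero hz0) (index_dvd_of_le (sup_le ?_ ?_))
    · rintro _ ⟨y, rfl⟩
      exact ⟨g y, hgK ⟨y, rfl⟩, hg y⟩
    · rintro _ ⟨y, rfl⟩
      change g' (f' y) ∈ K'.map d
      rw [hgf']; exact zero_mem _
  -- step 2
  have h3 : (P ⊔ f'.range).index = P.relIndex (P.comap f') := by
    have e1 : P.relIndex (P ⊔ f'.range) * (P ⊔ f'.range).index = P.index :=
      relIndex_mul_index le_sup_left
    have hPc : P ≤ P.comap f' := by
      rintro _ ⟨y, rfl⟩; exact ⟨f y, hf y⟩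
    have e2 : P.relIndex (P.comap f') * (P.comap f').index = P.index := relIndex_mul_index hPc
    have e3 : P.relIndex (P ⊔ f'.range) = (P.comap f').index := by
      rw [relIndex_sup_left, AddMonoidHom.range_eq_map, ← relIndex_comap, relIndex_top_right]
    rw [e3] at e1
    have h0 : (P.comap f').index ≠ 0 := fun h => hfin (by rw [← e2, h, mul_zero])
    exact Nat.eq_of_mul_eq_mul_left (Nat.pos_of_ne_zero h0) (by rw [e1, ← e2, mul_comm])
  -- step 3
  have hTc : T ≤ P.comap f' := fun y hy => by
    change f' y ∈ P; rw [show f' y = 0 from hy]; exact zero_mem _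
  have hPc : P ≤ P.comap f' := by rintro _ ⟨y, rfl⟩; exact ⟨f y, hf y⟩
  have h4 : P.relIndex (P.comap f') = P.relIndex T * (P ⊔ T).relIndex (P.comap f') := by
    rw [← relIndex_mul_relIndex P (P ⊔ T) (P.comap f') le_sup_left (sup_le hPc hTc), relIndex_sup_left]
  -- b
  have hfP : P.map f' = (f.range).map d := by
    ext y; constructor
    · rintro ⟨_, ⟨z, rfl⟩, rfl⟩; exact ⟨f z, ⟨z, rfl⟩, hf z⟩
    · rintro ⟨_, ⟨z, rfl⟩, rfl⟩; exact ⟨d z, ⟨z, rfl⟩, (hf z).symm⟩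
  have hPg : P ⊓ g'.ker = (E.comap g).map d := by
    ext y; constructor
    · rintro ⟨⟨z, rfl⟩, hz⟩; exact ⟨z, (show d (g z) = 0 by rw [hg]; exact hz), rfl⟩
    · rintro ⟨z, hz, rfl⟩; exact ⟨⟨z, rfl⟩, (hg z).symm.trans hz⟩
  have hb1 : (P.map f').relIndex (P ⊓ g'.ker) = (E.map g).relIndex (g.range ⊓ E) := by
    rw [hfP, hPg, relIndex_map', ← hgker, sup_comm, ← relIndex_map', map_comap']
  have hEK : (E.map g).relIndex (K' ⊓ E) ≠ 0 := fun h =>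
    hE0 (relIndex_eq_zero_of_le_right (inf_le_inf_right _ hK') h)
  have hb2 : (E.map g).relIndex (g.range ⊓ E) ≤ (E.map g).relIndex (K' ⊓ E) :=
    relIndex_le_of_le_right (inf_le_inf_right _ hgK) hEK
  have hb0 : (P.map f').relIndex (P ⊓ g'.ker) ≠ 0 := by
    rw [hb1]; exact fun h => hEK (relIndex_eq_zero_of_le_right (inf_le_inf_right _ hgK) h)
  have h5 : (P ⊔ T).relIndex (P.comap f') ≤ (E.map g).relIndex (K' ⊓ E) := by
    rw [← relIndex_map', map_comap']
    refine le_trans (relIndex_le_of_le_right ?_ hb0) (hb1.le.trans hb2)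
    rintro _ ⟨⟨y, rfl⟩, h⟩
    exact ⟨h, hgf' y⟩
  -- step 4
  have hKm : (f.ker).map d ≤ P ⊓ T := by
    rintro _ ⟨y, hy, rfl⟩
    exact ⟨⟨y, rfl⟩, (hf y).symm.trans (by rw [show f y = 0 from hy, map_zero])⟩
  have h6 : (K'.map d).relIndex T = (K'.map d).relIndex ((f.ker).map d) *
      (((f.ker).map d).relIndex (P ⊓ T) * P.relIndex T) := by
    rw [← inf_relIndex_right P T, relIndex_mul_relIndex _ _ _ hKm inf_le_right,
      relIndex_mul_relIndex _ _ _ (map_mono hK') (hKm.trans inf_le_right)]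
  have hPT : P ⊓ T = (E.comap f).map d := by
    ext y; constructor
    · rintro ⟨⟨z, rfl⟩, hz⟩; exact ⟨z, (show d (f z) = 0 by rw [hf]; exact hz), rfl⟩
    · rintro ⟨z, hz, rfl⟩; exact ⟨⟨z, rfl⟩, (hf z).symm.trans hz⟩
  have h7 : ((f.ker).map d).relIndex (P ⊓ T) = (E.map f).relIndex (g.ker ⊓ E) := by
    rw [hPT, relIndex_map', sup_comm, ← relIndex_map', map_comap', hgker]
  have h8 : (K'.map d).relIndex ((f.ker).map d) * (K').relIndex (f.ker ⊓ E) = K'.relIndex f.ker := by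
    rw [relIndex_map', ← inf_relIndex_right (K' ⊔ E) f.ker, mul_comm]
    have e : (K' ⊔ E) ⊓ f.ker = K' ⊔ (f.ker ⊓ E) := by
      rw [sup_inf_assoc_of_le _ hK', inf_comm]
    rw [e, ← relIndex_mul_relIndex K' (K' ⊔ (f.ker ⊓ E)) f.ker le_sup_left (sup_le hK' inf_le_left),
      relIndex_sup_left]
  have h9 : (E.map g).relIndex (K' ⊓ E) * K'.relIndex (f.ker ⊓ E) = (E.map g).relIndex (f.ker ⊓ E) := by
    have hEg : E.map g ≤ K' ⊓ E := by
      rintro _ ⟨y, hy, rfl⟩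
      exact ⟨hgK ⟨y, rfl⟩, show d (g y) = 0 by rw [hg, show d y = 0 from hy, map_zero]⟩
    rw [← inf_relIndex_right K' (f.ker ⊓ E)]
    have : K' ⊓ (f.ker ⊓ E) = K' ⊓ E := by rw [← inf_assoc, inf_of_le_left hK']
    rw [this, relIndex_mul_relIndex _ _ _ hEg (inf_le_inf_right _ hK')]
  have ha0 : P.relIndex T ≠ 0 := fun h => hfin (index_eq_zero_of_relIndex_eq_zero h)
  -- combine
  rw [← h8, ← h9, ← h7]
  set a := P.relIndex T
  set b := (P ⊔ T).relIndex (P.comap f')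
  set c := (K'.map d).relIndex ((f.ker).map d)
  set h := ((f.ker).map d).relIndex (P ⊓ T)
  set e := (E.map g).relIndex (K' ⊓ E)
  set u := K'.relIndex (f.ker ⊓ E)
  have key : c * (h * a) ≤ (a * b) * x := by
    rw [← h6, ← h1, ← h4, ← h3]; exact Nat.mul_le_mul_right _ h2
  have key2 : h * c ≤ b * x := by
    have : a * (h * c) ≤ a * (b * x) := by
      calc a * (h * c) = c * (h * a) := by ring
        _ ≤ _ := key
        _ = _ := by ring
    exact Nat.le_of_mul_le_mul_left this (Nat.pos_of_ne_zero ha0)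
  calc h * (c * u) = (h * c) * u := by ring
    _ ≤ (b * x) * u := Nat.mul_le_mul_right _ key2
    _ ≤ (e * x) * u := Nat.mul_le_mul_right _ (Nat.mul_le_mul_right _ h5)
    _ = _ := by ring

/-- Herbrand invariance -/
lemma herbrand {A : Type} [AddCommGroup A] (f g : A →+ A) (hfg : ∀ x, f (g x) = 0)
    (hgf : ∀ x, g (f x) = 0) (B : AddSubgroup A) (hBf : ∀ x ∈ B, f x ∈ B) (hBg : ∀ x ∈ B, g x ∈ B)
    (hfin : B.index ≠ 0) :
    g.range.relIndex f.ker * (B.map f).relIndex (B ⊓ g.ker) =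
    f.range.relIndex g.ker * (B.map g).relIndex (B ⊓ f.ker) := by
  have key : ∀ φ : A →+ A, B.index = (B.map φ).relIndex φ.range * B.relIndex φ.ker := by
    intro φ
    rw [AddMonoidHom.range_eq_map, relIndex_map', relIndex_top_right,
      ← relIndex_mul_index (le_sup_left : B ≤ B ⊔ φ.ker), relIndex_sup_left, mul_comm]
  have kf := key f
  have kg := key g
  have e1 : (B.map g).relIndex g.range * g.range.relIndex f.ker =
      (B.map g).relIndex (B ⊓ f.ker) * B.relIndex f.ker := by
    have h1 : B.map g ≤ g.range := by rintro _ ⟨y, _, rfl⟩; exact ⟨y, rfl⟩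
    have h2 : g.range ≤ f.ker := by rintro _ ⟨y, rfl⟩; exact hfg y
    have h3 : B.map g ≤ B ⊓ f.ker := by rintro _ ⟨y, hy, rfl⟩; exact ⟨hBg y hy, hfg y⟩
    rw [relIndex_mul_relIndex _ _ _ h1 h2, ← inf_relIndex_right B, relIndex_mul_relIndex _ _ _ h3 inf_le_right]
  have e2 : (B.map f).relIndex f.range * f.range.relIndex g.ker =
      (B.map f).relIndex (B ⊓ g.ker) * B.relIndex g.ker := by
    have h1 : B.map f ≤ f.range := by rintro _ ⟨y, _, rfl⟩; exact ⟨y, rfl⟩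
    have h2 : f.range ≤ g.ker := by rintro _ ⟨y, rfl⟩; exact hgf y
    have h3 : B.map f ≤ B ⊓ g.ker := by rintro _ ⟨y, hy, rfl⟩; exact ⟨hBf y hy, hgf y⟩
    rw [relIndex_mul_relIndex _ _ _ h1 h2, ← inf_relIndex_right B, relIndex_mul_relIndex _ _ _ h3 inf_le_right]
  rw [kf] at kg
  rw [kf] at hfin
  set p := (B.map f).relIndex f.range
  set q := B.relIndex f.ker
  set p' := (B.map g).relIndex g.range
  set q' := B.relIndex g.ker
  set X := g.range.relIndex f.ker
  set Y := f.range.relIndex g.ker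
  set Z := (B.map f).relIndex (B ⊓ g.ker)
  set W := (B.map g).relIndex (B ⊓ f.ker)
  have : (p * q) * (X * Z) = (p * q) * (Y * W) := by
    calc (p * q) * (X * Z) = (p' * q') * (X * Z) := by rw [kg]
      _ = (p' * X) * (Z * q') := by ring
      _ = (W * q) * (p * Y) := by rw [e1, e2]
      _ = _ := by ring
  exact Nat.eq_of_mul_eq_mul_left (Nat.pos_of_ne_zero hfin) this
end absindex

section
variable {K : Type} [Field K] [NumberField K]
variable {L : Type} [Field L] [NumberField L] [Algebra K L] [IsGalois K L]

/-- coordinates in the normal basis -/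
def co (x : L) (g : Gal(L/K)) : K := (IsGalois.normalBasis K L).repr x g

lemma co_add (x y : L) (g : Gal(L/K)) : co (x + y) g = co x g + co y g := by simp [co]
lemma co_sub (x y : L) (g : Gal(L/K)) : co (x - y) g = co x g - co y g := by simp [co]
lemma co_neg (x : L) (g : Gal(L/K)) : co (-x) g = - co x g := by simp [co]
lemma co_zero (g : Gal(L/K)) : co (0 : L) g = 0 := by simp [co]
lemma co_smul (a : K) (x : L) (g : Gal(L/K)) : co (a • x) g = a * co x g := by simp [co]
lemma co_mulL (a : K) (x : L) (g : Gal(L/K)) : co (algebraMap K L a * x) g = a * co x g := by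
  rw [← Algebra.smul_def, co_smul]
lemma co_sum {ι : Type} (s : Finset ι) (f : ι → L) (g : Gal(L/K)) :
    co (∑ i ∈ s, f i) g = ∑ i ∈ s, co (f i) g := by
  simp [co]

lemma eq_sum_co (x : L) : x = ∑ g : Gal(L/K), co x g • g (IsGalois.normalBasis K L 1) := by
  conv_lhs => rw [← (IsGalois.normalBasis K L).sum_repr x]
  refine Finset.sum_congr rfl fun g _ => ?_
  rw [IsGalois.normalBasis_apply]; rfl

lemma co_ext {x y : L} (h : ∀ g : Gal(L/K), co x g = co y g) : x = y := by
  apply (IsGalois.normalBasis K L).repr.injective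
  ext g; exact h g

open Classical in
lemma co_basis (h g : Gal(L/K)) : co (h (IsGalois.normalBasis K L 1)) g = if h = g then 1 else 0 := by
  rw [← IsGalois.normalBasis_apply, co, Module.Basis.repr_self, Finsupp.single_apply]

lemma co_gal (σ g : Gal(L/K)) (x : L) : co (σ x) g = co x (σ⁻¹ * g) := by
  classical
  have e : σ x = ∑ h : Gal(L/K), co x h • σ (h (IsGalois.normalBasis K L 1)) := by
    conv_lhs => rw [eq_sum_co (K := K) x]
    rw [map_sum]
    exact Finset.sum_congr rfl fun h _ => by simp [Algebra.smul_def]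
  rw [e, co_sum]
  simp only [co_smul]
  rw [Finset.sum_eq_single (σ⁻¹ * g)]
  · rw [show σ ((σ⁻¹ * g) (IsGalois.normalBasis K L 1)) = g (IsGalois.normalBasis K L 1) by
      rw [← AlgEquiv.mul_apply, mul_inv_cancel_left], co_basis]; simp
  · intro h _ hne
    rw [← AlgEquiv.mul_apply, co_basis, if_neg, mul_zero]
    rintro rfl; apply hne; group
  · simp

/-- the lattice of elements with coordinates bounded by `c` at `S` -/
def NL (S : Finset (Pl K)) (c : K) : AddSubgroup L where
  carrier := {x | ∀ v ∈ S, ∀ g : Gal(L/K), v.valuation K (co x g) ≤ v.valuation K c}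
  zero_mem' := fun v _ g => by rw [co_zero, map_zero]; exact zero_le
  add_mem' := fun {x y} hx hy v hv g => by
    rw [co_add]; exact Valuation.map_add_le _ (hx v hv g) (hy v hv g)
  neg_mem' := fun {x} hx v hv g => by rw [co_neg, Valuation.map_neg]; exact hx v hv g

lemma mem_NL {S : Finset (Pl K)} {c : K} {x : L} :
    x ∈ NL S c ↔ ∀ v ∈ S, ∀ g : Gal(L/K), v.valuation K (co x g) ≤ v.valuation K c := Iff.rfl

lemma NL_mono {S : Finset (Pl K)} {c c' : K} (h : ∀ v ∈ S, v.valuation K c ≤ v.valuation K c') :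
    (NL S c : AddSubgroup L) ≤ NL S c' := fun _ hx v hv g => (hx v hv g).trans (h v hv)

lemma NL_gal {S : Finset (Pl K)} {c : K} {x : L} (hx : x ∈ NL S c) (σ : Gal(L/K)) : σ x ∈ NL S c :=
  fun v hv g => by rw [co_gal]; exact hx v hv _

lemma NL_smul {S : Finset (Pl K)} {c : K} {x : L} (hx : x ∈ NL S c) (a : K) :
    algebraMap K L a * x ∈ NL S (a * c) := fun v hv g => by
  rw [co_mulL, map_mul, map_mul]; exact mul_le_mul_right (hx v hv g) _

variable (L) in
/-- data making multiplication contracting -/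
structure Gd (S : Finset (Pl K)) (π B c : K) : Prop where
  π0 : π ≠ 0
  π1 : ∀ v ∈ S, v.valuation K π < 1
  c0 : c ≠ 0
  mul : ∀ (a b : K) (x y : L), x ∈ NL S a → y ∈ NL S b → x * y ∈ NL S (B * a * b)
  Bc : ∀ v ∈ S, v.valuation K (B * c) ≤ v.valuation K π
  cT : ∀ v ∈ S, v.valuation K (c * Algebra.trace K L (IsGalois.normalBasis K L 1)) < 1

variable {S : Finset (Pl K)} {π B c : K}

lemma Gd.mul' (H : Gd L S π B c) {c' : K} {x y : L} (hx : x ∈ NL S c') (hy : y ∈ NL S c) :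
    x * y ∈ NL S (π * c') := by
  refine NL_mono (fun v hv => ?_) (H.mul _ _ _ _ hx hy)
  rw [show B * c' * c = (B * c) * c' by ring, map_mul, map_mul _ π c']
  exact mul_le_mul_left (H.Bc v hv) _

lemma Gd.le (H : Gd L S π B c) (c' : K) : (NL S (π * c') : AddSubgroup L) ≤ NL S c' := by
  refine NL_mono (fun v hv => ?_)
  rw [map_mul]; exact mul_le_of_le_one_left' (H.π1 v hv).le

lemma Gd.mul1 (H : Gd L S π B c) {c' : K} {x y : L} (hx : x ∈ NL S c') (hy : y - 1 ∈ NL S c) :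
    x * y ∈ NL S c' := by
  have := add_mem (H.le _ (H.mul' hx hy)) hx
  convert this using 1; ring

lemma Gd.prod (H : Gd L S π B c) {c' : K} (hc' : ∀ v ∈ S, v.valuation K c' ≤ v.valuation K c)
    {ι : Type} (s : Finset ι) (x : ι → L) (hx : ∀ i ∈ s, x i ∈ NL S c') :
    ∏ i ∈ s, (1 + x i) - 1 - ∑ i ∈ s, x i ∈ NL S (π * c') := by
  classical
  induction s using Finset.induction_on with
  | empty => simp
  | insert a s ha ih =>
    rw [Finset.prod_insert ha, Finset.sum_insert ha]
    have h1 := ih fun i hi => hx i (Finset.mem_insert_of_mem hi)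
    have h2 : ∑ i ∈ s, x i ∈ NL S c' := sum_mem fun i hi => hx i (Finset.mem_insert_of_mem hi)
    have hxa := hx a (Finset.mem_insert_self _ _)
    have h3 : ∏ i ∈ s, (1 + x i) - 1 ∈ NL S c' := by
      have := add_mem (H.le _ h1) h2; convert this using 1; ring
    have h4 := H.mul' hxa (NL_mono hc' h3)
    have := add_mem h1 h4
    convert this using 1; ring

lemma Gd.prod1 (H : Gd L S π B c) {c' : K} (hc' : ∀ v ∈ S, v.valuation K c' ≤ v.valuation K c)
    {ι : Type} (s : Finset ι) (x : ι → L) (hx : ∀ i ∈ s, x i ∈ NL S c') :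
    ∏ i ∈ s, (1 + x i) - 1 ∈ NL S c' := by
  have := add_mem (H.le _ (H.prod hc' s x hx)) (sum_mem hx)
  convert this using 1; ring

/-- coordinates of an element of `K` -/
lemma co_base (r : K) (g : Gal(L/K)) : co (algebraMap K L r) g = co (algebraMap K L r) 1 := by
  have := co_gal (K := K) g g (algebraMap K L r)
  rw [AlgEquiv.commutes] at this
  rw [this]; simp

lemma base_eq (r : K) : r = co (algebraMap K L r) (1 : Gal(L/K)) *
    Algebra.trace K L (IsGalois.normalBasis K L 1) := by
  apply (algebraMap K L).injective
  rw [map_mul, trace_eq_sum_automorphisms, Finset.mul_sum]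
  conv_lhs => rw [eq_sum_co (K := K) (algebraMap K L r)]
  refine Finset.sum_congr rfl fun g _ => ?_
  rw [co_base, Algebra.smul_def]

lemma Gd.base_lt (H : Gd L S π B c) {r : K} (hr : algebraMap K L r ∈ NL S c) :
    ∀ v ∈ S, v.valuation K r < 1 := by
  intro v hv
  rw [base_eq (L := L) r, map_mul]
  refine lt_of_le_of_lt (mul_le_mul_left (hr v hv 1) _) ?_
  rw [← map_mul]; exact H.cT v hv

lemma Gd.inv (H : Gd L S π B c) (hS : S.Nonempty) {x : L} (hx : x ∈ NL S c) :
    1 + x ≠ 0 ∧ (1 + x)⁻¹ - 1 ∈ NL S c := by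
  classical
  let r : K := Algebra.norm K (1 + x) - 1
  have hN : algebraMap K L (Algebra.norm K (1 + x)) = ∏ g : Gal(L/K), (1 + g x) := by
    rw [Algebra.norm_eq_prod_automorphisms]; simp
  have hr : algebraMap K L r ∈ NL S c := by
    simp only [r, map_sub, map_one, hN]
    exact H.prod1 (fun _ _ => le_rfl) _ _ fun g _ => NL_gal hx g
  have hr1 := H.base_lt hr
  have hv : ∀ v ∈ S, v.valuation K (1 + r) = 1 := fun v hv => by
    apply val_one_of_near; simpa using hr1 v hv
  have hy := H.prod1 (fun _ _ => le_rfl) (Finset.univ.erase (1 : Gal(L/K))) (fun g => g x)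
    fun g _ => NL_gal hx g
  set y := ∏ g ∈ Finset.univ.erase (1 : Gal(L/K)), (1 + g x) - 1 with hyd
  have hmul : (1 + x) * (1 + y) = algebraMap K L (1 + r) := by
    simp only [r, hyd, add_sub_cancel, hN]
    rw [← Finset.mul_prod_erase Finset.univ _ (Finset.mem_univ (1 : Gal(L/K)))]; simp
  obtain ⟨v0, hv0⟩ := hS
  have h0 : 1 + r ≠ 0 := fun h => by have := hv v0 hv0; rw [h, map_zero] at this; exact zero_ne_one this
  have h0L : algebraMap K L (1 + r) ≠ 0 := (map_ne_zero_iff _ (algebraMap K L).injective).2 h0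
  have hx0 : 1 + x ≠ 0 := fun h => h0L (by rw [← hmul, h, zero_mul])
  refine ⟨hx0, ?_⟩
  have : (1 + x)⁻¹ - 1 = algebraMap K L (1 + r)⁻¹ * (y - algebraMap K L r) := by
    rw [map_inv₀]
    field_simp
    have e : algebraMap K L (1 + r) = 1 + algebraMap K L r := by simp
    rw [e] at hmul ⊢
    linear_combination (-1 : L) * hmul
  rw [this]
  have h5 := NL_smul (sub_mem hy hr) (1 + r)⁻¹
  refine NL_mono (fun v hv' => ?_) h5
  rw [map_mul, map_inv₀, hv v hv', inv_one, one_mul]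
end

section
variable {K : Type} [Field K] [NumberField K]
variable {L : Type} [Field L] [NumberField L] [Algebra K L] [IsGalois K L]
variable {S : Finset (Pl K)} {π B c : K}

lemma theta_mem (g : Gal(L/K)) : g (IsGalois.normalBasis K L 1) ∈ NL S (1 : K) := by
  classical
  intro v hv h
  rw [co_basis]
  split_ifs <;> simp

lemma NL_smul' {x : L} {a b c' : K} (hx : x ∈ NL S b) (h : ∀ v ∈ S, v.valuation K (a * b) ≤ v.valuation K c') :
    algebraMap K L a * x ∈ NL S c' := NL_mono h (NL_smul hx a)

lemma tr_split (hπ : π ≠ 0) {σ : Gal(L/K)} (hσ : ∀ g : Gal(L/K), ∃ i : ℕ, σ ^ i = g) {c' : K} {x : L}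
    (hx : x ∈ NL S c')
    (ht : ∀ v ∈ S, v.valuation K (∑ g : Gal(L/K), co x g) ≤ v.valuation K (π * c')) :
    ∃ y z : L, y ∈ NL S c' ∧ z ∈ NL S c' ∧ x = σ y - y + algebraMap K L π * z := by
  choose i hi using hσ
  set θ := IsGalois.normalBasis K L 1 with hθ
  let Y : Gal(L/K) → L := fun g => ∑ l ∈ Finset.range (i g), (σ ^ l) θ
  have hY : ∀ g, σ (Y g) - Y g = g θ - θ := by
    intro g
    simp only [Y, map_sum, ← Finset.sum_sub_distrib]
    have : ∀ l, σ ((σ ^ l) θ) = (σ ^ (l + 1)) θ := fun l => by rw [pow_succ', AlgEquiv.mul_apply]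
    simp only [this]
    rw [Finset.sum_range_sub (fun l => (σ ^ l) θ), hi]; simp
  have hYm : ∀ g, Y g ∈ NL S (1 : K) := fun g => sum_mem fun l _ => theta_mem _
  refine ⟨∑ g, algebraMap K L (co x g) * Y g, algebraMap K L ((∑ g : Gal(L/K), co x g) / π) * θ,
    sum_mem fun g _ => NL_smul' (hYm g) fun v hv => ?_, NL_smul' (b := 1) ?_ fun v hv => ?_, ?_⟩
  · rw [mul_one]; exact hx v hv g
  · simpa using theta_mem (K := K) (L := L) (S := S) 1
  · rw [mul_one, map_div₀, div_le_iff₀, mul_comm, ← map_mul]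
    · exact ht v hv
    · rw [zero_lt_iff]; simpa using hπ
  · have hπ' : algebraMap K L π ≠ 0 := by simpa using hπ
    rw [map_sum, map_div₀, ← mul_assoc, mul_div_cancel₀ _ hπ', map_sum, Finset.sum_mul,
      ← Finset.sum_sub_distrib, ← Finset.sum_add_distrib]
    conv_lhs => rw [eq_sum_co (K := K) x]
    refine Finset.sum_congr rfl fun g _ => ?_
    rw [map_mul, AlgEquiv.commutes, ← mul_sub, hY, Algebra.smul_def]; ring

lemma sum_co (x : L) : ∑ g : Gal(L/K), co x g = co (algebraMap K L (Algebra.trace K L x)) (1 : Gal(L/K)) := by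
  rw [trace_eq_sum_automorphisms, co_sum]
  simp only [co_gal, mul_one]
  exact (Fintype.sum_equiv (Equiv.inv _) _ _ fun g => by simp).symm

lemma Gd.step (H : Gd L S π B c) (hS : S.Nonempty) {σ : Gal(L/K)}
    (hσ : ∀ g : Gal(L/K), ∃ i : ℕ, σ ^ i = g) {c' : K}
    (hc' : ∀ v ∈ S, v.valuation K c' ≤ v.valuation K c) {α : L} (hα : α - 1 ∈ NL S c')
    (hN : Algebra.norm K α = 1) :
    ∃ β : L, β ≠ 0 ∧ β - 1 ∈ NL S c' ∧ α * β / σ β - 1 ∈ NL S (π * c') := by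
  obtain ⟨x, rfl⟩ : ∃ x, α = 1 + x := ⟨α - 1, by ring⟩
  rw [add_sub_cancel_left] at hα
  have hpr := H.prod hc' (Finset.univ : Finset Gal(L/K)) (fun g => g x) fun g _ => NL_gal hα g
  have e1 : ∏ g : Gal(L/K), (1 + g x) = 1 := by
    have := Algebra.norm_eq_prod_automorphisms K (1 + x)
    rw [hN, map_one] at this
    simpa using this.symm
  have e2 : algebraMap K L (Algebra.trace K L x) ∈ NL S (π * c') := by
    rw [trace_eq_sum_automorphisms]
    rw [e1, sub_self, zero_sub] at hpr
    simpa using neg_mem hpr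
  obtain ⟨y, z, hy, hz, hxyz⟩ := tr_split H.π0 hσ hα (fun v hv => by
    rw [sum_co]; exact e2 v hv 1)
  have hyc := NL_mono hc' hy
  obtain ⟨h0, _⟩ := H.inv hS hyc
  obtain ⟨h0', hinv⟩ := H.inv hS (NL_gal hyc σ)
  refine ⟨1 + y, h0, by simpa using hy, ?_⟩
  have h1 : x * y + algebraMap K L π * z ∈ NL S (π * c') :=
    add_mem (H.mul' hα hyc) (NL_smul hz π)
  have h2 := H.mul1 h1 hinv
  convert h2 using 1
  rw [map_add, map_one]
  field_simp
  linear_combination hxyz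

lemma Gd.steps (H : Gd L S π B c) (hS : S.Nonempty) {σ : Gal(L/K)}
    (hσ : ∀ g : Gal(L/K), ∃ i : ℕ, σ ^ i = g) {α : L} (hα : α - 1 ∈ NL S c)
    (hN : Algebra.norm K α = 1) (j : ℕ) :
    ∃ β : L, β ≠ 0 ∧ β - 1 ∈ NL S c ∧ α * β / σ β - 1 ∈ NL S (π ^ j * c) := by
  induction j with
  | zero => exact ⟨1, one_ne_zero, by simp, by simpa using hα⟩
  | succ j ih =>
    obtain ⟨β, h0, hβ, h⟩ := ih
    have hc' : ∀ v ∈ S, v.valuation K (π ^ j * c) ≤ v.valuation K c := fun v hv => by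
      rw [map_mul, map_pow]; exact mul_le_of_le_one_left' (pow_le_one₀ zero_le (H.π1 v hv).le)
    have hσ0 : σ β ≠ 0 := by simpa using h0
    have hNσ : Algebra.norm K (σ β) = Algebra.norm K β := Algebra.norm_eq_of_algEquiv σ β
    have hN0 : Algebra.norm K β ≠ 0 := by simpa [Algebra.norm_ne_zero_iff] using h0
    have hN' : Algebra.norm K (α * β / σ β) = 1 := by
      have h3 : Algebra.norm K (α * β / σ β) * Algebra.norm K (σ β) = Algebra.norm K (α * β) := by
        rw [← map_mul, div_mul_cancel₀ _ hσ0]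
      rw [map_mul, hN, hNσ, one_mul] at h3
      exact mul_right_cancel₀ hN0 (h3.trans (one_mul _).symm)
    obtain ⟨γ, h0', hγ, h'⟩ := H.step hS hσ hc' h hN'
    refine ⟨β * γ, mul_ne_zero h0 h0', ?_, ?_⟩
    · have := add_mem (H.mul1 (NL_mono hc' hγ) hβ) hβ
      convert this using 1; ring
    · have hσ0' : σ γ ≠ 0 := by simpa using h0'
      have e : π ^ (j + 1) * c = π * (π ^ j * c) := by ring
      rw [e]; convert h' using 2
      rw [map_mul]; field_simp

lemma exists_pow_le (hπ1 : ∀ v ∈ S, v.valuation K π < 1) {a : K} (ha : a ≠ 0) :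
    ∃ j0 : ℕ, ∀ j ≥ j0, ∀ v ∈ S, v.valuation K (π ^ j) ≤ v.valuation K a := by
  classical
  have : ∀ v ∈ S, ∃ j0 : ℕ, ∀ j ≥ j0, v.valuation K (π ^ j) ≤ v.valuation K a := by
    intro v hv
    by_cases h0 : π = 0
    · exact ⟨1, fun j hj => by rw [h0, zero_pow (by omega), map_zero]; exact zero_le⟩
    · have h1 := hπ1 v hv
      rw [valuation_eq v h0, exp_lt_one'] at h1
      refine ⟨(dv a v).toNat, fun j hj => ?_⟩
      rw [map_pow, valuation_eq v h0, valuation_eq v ha, ← WithZero.exp_nsmul, WithZero.exp_le_exp]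
      have h2 : dv a v ≤ j := by omega
      rw [nsmul_eq_mul]
      nlinarith
  choose! f hf using this
  exact ⟨S.sup f, fun j hj v hv => hf v hv j ((Finset.le_sup hv).trans hj)⟩

lemma exists_ub (hπ1 : ∀ v ∈ S, v.valuation K π < 1) (A : Finset K) :
    ∃ j0 : ℕ, ∀ j ≥ j0, ∀ a ∈ A, ∀ v ∈ S, v.valuation K (a * π ^ j) ≤ 1 := by
  classical
  have : ∀ a ∈ A, ∃ j0 : ℕ, ∀ j ≥ j0, ∀ v ∈ S, v.valuation K (a * π ^ j) ≤ 1 := by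
    intro a _
    by_cases h0 : a = 0
    · exact ⟨0, fun j _ v _ => by simp [h0]⟩
    · obtain ⟨j0, h⟩ := exists_pow_le hπ1 (inv_ne_zero h0)
      refine ⟨j0, fun j hj v hv => ?_⟩
      rw [map_mul]
      refine (mul_le_mul_right (h j hj v hv) _).trans ?_
      rw [← map_mul, mul_inv_cancel₀ h0, map_one]
  choose! f hf using this
  exact ⟨A.sup f, fun j hj a ha v hv => hf a ha j ((Finset.le_sup ha).trans hj) v hv⟩

lemma gen_image {G : Type} [Group G] [Fintype G] [DecidableEq G] {σ : G}
    (hσ : ∀ g : G, ∃ i : ℕ, σ ^ i = g) :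
    (Finset.range (orderOf σ)).image (σ ^ ·) = Finset.univ := by
  ext g
  simp only [Finset.mem_image, Finset.mem_range, Finset.mem_univ, iff_true]
  obtain ⟨i, rfl⟩ := hσ g
  exact ⟨i % orderOf σ, Nat.mod_lt _ (orderOf_pos σ), pow_mod_orderOf σ i⟩

lemma gen_prod {G M : Type} [Group G] [Fintype G] [CommMonoid M] {σ : G}
    (hσ : ∀ g : G, ∃ i : ℕ, σ ^ i = g) (F : G → M) :
    ∏ g, F g = ∏ l ∈ Finset.range (orderOf σ), F (σ ^ l) := by
  classical
  rw [← gen_image hσ, Finset.prod_image]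
  intro a ha b hb h
  exact pow_injOn_Iio_orderOf (by simpa using ha) (by simpa using hb) h

lemma gen_sum {G M : Type} [Group G] [Fintype G] [AddCommMonoid M] {σ : G}
    (hσ : ∀ g : G, ∃ i : ℕ, σ ^ i = g) (F : G → M) :
    ∑ g, F g = ∑ l ∈ Finset.range (orderOf σ), F (σ ^ l) := by
  classical
  rw [← gen_image hσ, Finset.sum_image]
  intro a ha b hb h
  exact pow_injOn_Iio_orderOf (by simpa using ha) (by simpa using hb) h

/-- Hilbert 90 in the congruence subgroup -/
lemma Gd.h90 (H : Gd L S π B c) {σ : Gal(L/K)}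
    (hσ : ∀ g : Gal(L/K), ∃ i : ℕ, σ ^ i = g) {α : L} (hα : α - 1 ∈ NL S c)
    (hN : Algebra.norm K α = 1) : ∃ u : L, u ≠ 0 ∧ u - 1 ∈ NL S c ∧ α = u / σ u := by
  classical
  rcases S.eq_empty_or_nonempty with rfl | hS
  · have hz : ∀ x : Gal(L/K), x ∈ Subgroup.zpowers σ := fun x => by
      obtain ⟨i, rfl⟩ := hσ x; exact pow_mem (Subgroup.mem_zpowers σ) i
    haveI : IsCyclic Gal(L/K) := ⟨⟨σ, hz⟩⟩
    obtain ⟨y, hy⟩ := groupCohomology.exists_div_of_norm_eq_one (K := K) (g := σ)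
      hz hN
    exact ⟨y, y.ne_zero, fun v hv => by simp at hv, hy.symm⟩
  -- trace one element
  set T := Algebra.trace K L (IsGalois.normalBasis K L 1) with hT
  have hT0 : T ≠ 0 := fun h => by
    have := base_eq (K := K) (L := L) 1
    rw [← hT, h, mul_zero] at this; exact one_ne_zero this
  let τ : L := T⁻¹ • IsGalois.normalBasis K L 1
  have hτ : ∑ g : Gal(L/K), g τ = 1 := by
    rw [← trace_eq_sum_automorphisms, map_smul, ← hT, smul_eq_mul, inv_mul_cancel₀ hT0, map_one]
  have hτm : τ ∈ NL S (T⁻¹ * 1) := by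
    simp only [τ]; rw [Algebra.smul_def]
    have := theta_mem (K := K) (L := L) (S := S) 1
    exact NL_smul (by simpa using this) _
  obtain ⟨j, hj⟩ := exists_ub (S := S) H.π1 {B * T⁻¹}
  obtain ⟨β, hβ0, hβ, hαβ⟩ := H.steps hS hσ hα hN j
  set α' := α * β / σ β with hα'
  have hσβ : σ β ≠ 0 := by simpa using hβ0
  have hNσ : Algebra.norm K (σ β) = Algebra.norm K β := Algebra.norm_eq_of_algEquiv σ β
  have hN0 : Algebra.norm K β ≠ 0 := by simpa [Algebra.norm_ne_zero_iff] using hβ0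
  have hN' : Algebra.norm K α' = 1 := by
    have h3 : Algebra.norm K (α * β / σ β) * Algebra.norm K (σ β) = Algebra.norm K (α * β) := by
      rw [← map_mul, div_mul_cancel₀ _ hσβ]
    rw [map_mul, hN, hNσ, one_mul] at h3
    exact mul_right_cancel₀ hN0 (h3.trans (one_mul _).symm)
  have hc' : ∀ v ∈ S, v.valuation K (π ^ j * c) ≤ v.valuation K c := fun v hv => by
    rw [map_mul, map_pow]; exact mul_le_of_le_one_left' (pow_le_one₀ zero_le (H.π1 v hv).le)
  let a : ℕ → L := fun i => ∏ l ∈ Finset.range i, (σ ^ l) α'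
  have ha : ∀ i, a i - 1 ∈ NL S (π ^ j * c) := by
    intro i
    have := H.prod1 hc' (Finset.range i) (fun l => (σ ^ l) (α' - 1)) fun l _ => NL_gal hαβ _
    simpa only [map_sub, map_one, add_sub_cancel] using this
  have ha1 : ∀ i, σ (a i) * α' = a (i + 1) := by
    intro i
    simp only [a, Finset.prod_range_succ', map_prod, pow_zero, AlgEquiv.one_apply]
    congr 1
    exact Finset.prod_congr rfl fun l _ => by rw [pow_succ', AlgEquiv.mul_apply]
  have han : a (orderOf σ) = 1 := by
    have := Algebra.norm_eq_prod_automorphisms K α'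
    rw [hN', map_one, gen_prod hσ (fun g => g α')] at this
    exact this.symm
  let F : ℕ → L := fun i => (σ ^ i) τ * a i
  let u : L := ∑ i ∈ Finset.range (orderOf σ), F i
  have hu : σ u * α' = u := by
    have h1 : σ u * α' = ∑ i ∈ Finset.range (orderOf σ), F (i + 1) := by
      simp only [u, F, map_sum, Finset.sum_mul, map_mul, mul_assoc, ha1]
      refine Finset.sum_congr rfl fun i _ => ?_
      rw [pow_succ', AlgEquiv.mul_apply]
    have h2 := Finset.sum_range_succ F (orderOf σ)
    rw [Finset.sum_range_succ'] at h2
    have h3 : F (orderOf σ) = F 0 := by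
      have : a 0 = 1 := by simp [a]
      simp only [F, han, pow_orderOf_eq_one, pow_zero, this]
    rw [h1]; rw [h3] at h2; exact add_right_cancel h2
  have hum : u - 1 ∈ NL S c := by
    have e : u - 1 = ∑ i ∈ Finset.range (orderOf σ), (σ ^ i) τ * (a i - 1) := by
      have h5 : (1 : L) = ∑ i ∈ Finset.range (orderOf σ), (σ ^ i) τ := by
        rw [← hτ, gen_sum hσ (fun g => g τ)]
      simp only [mul_sub, mul_one, Finset.sum_sub_distrib]
      rw [← h5]
    rw [e]
    refine sum_mem fun i _ => NL_mono (fun v hv => ?_) (H.mul _ _ _ _ (NL_gal hτm _) (ha i))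
    rw [show B * (T⁻¹ * 1) * (π ^ j * c) = (B * T⁻¹ * π ^ j) * c by ring, map_mul]
    exact mul_le_of_le_one_left' (hj j le_rfl _ (by simp) v hv)
  have hu0 : u ≠ 0 := by
    have := (H.inv hS hum).1; simpa using this
  have hσu : σ u ≠ 0 := by simpa using hu0
  refine ⟨u / β, div_ne_zero hu0 hβ0, ?_, ?_⟩
  · have h1 := (H.inv hS hβ).2
    rw [add_sub_cancel] at h1
    have := add_mem (H.mul1 hum h1) h1
    convert this using 1; field_simp; ring
  · rw [map_div₀]
    rw [hα'] at hu
    field_simp at hu ⊢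
    linear_combination hu
end

section
variable {K : Type} [Field K] [NumberField K]
variable {L : Type} [Field L] [NumberField L] [Algebra K L] [IsGalois K L]

lemma ev_pow_le {S : Finset (Pl K)} {π : K} (hπ1 : ∀ v ∈ S, v.valuation K π < 1) {a : K} (ha : a ≠ 0) :
    ∀ᶠ j : ℕ in Filter.atTop, ∀ v ∈ S, v.valuation K (π ^ j) ≤ v.valuation K a := by
  rw [Filter.eventually_atTop]; exact exists_pow_le hπ1 ha

instance dn_liesOver (w : Pl L) : w.asIdeal.LiesOver (dn K w).asIdeal := ⟨rfl⟩

lemma val_up (w : Pl L) (x : K) : ∃ e : ℕ, e ≠ 0 ∧ w.valuation L (algebraMap K L x) = (dn K w).valuation K x ^ e := by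
  refine ⟨_, ?_, (HeightOneSpectrum.valuation_liesOver L (dn K w) w x).symm⟩
  exact Ideal.IsDedekindDomain.ramificationIdx'_ne_zero_of_liesOver w.asIdeal (dn K w).ne_bot

lemma val_up_le_one (w : Pl L) {x : K} (h : (dn K w).valuation K x ≤ 1) :
    w.valuation L (algebraMap K L x) ≤ 1 := by
  obtain ⟨e, _, he⟩ := val_up w x
  rw [he]; exact pow_le_one₀ zero_le h

lemma val_up_lt_one (w : Pl L) {x : K} (h : (dn K w).valuation K x < 1) :
    w.valuation L (algebraMap K L x) < 1 := by
  obtain ⟨e, h0, he⟩ := val_up w x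
  rw [he]; exact pow_lt_one₀ zero_le h h0

variable (L) in
lemma exists_Gd (S : Finset (Pl K)) : ∃ π B c : K, Gd L S π B c ∧
    (∀ x ∈ NL S c, ∀ w ∈ up L S, w.valuation L x < 1) ∧
    ∃ k : ℕ, ∀ y : L, (∀ w ∈ up L S, w.valuation L y ≤ WithZero.exp (-((k : ℤ) + 1))) → y ∈ NL S c := by
  classical
  obtain ⟨p, hp0, hp⟩ := exists_small S 0
  set π : K := (p : K) with hπ
  have hπ0 : π ≠ 0 := by simpa [hπ] using hp0
  have hπ1 : ∀ v ∈ S, v.valuation K π < 1 := fun v hv =>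
    lt_of_le_of_lt (hp v hv) (by rw [exp_lt_one']; norm_num)
  set θ := IsGalois.normalBasis K L 1 with hθ
  set T := Algebra.trace K L θ with hT
  have hT0 : T ≠ 0 := fun h => by
    have := base_eq (K := K) (L := L) 1
    rw [← hθ, ← hT, h, mul_zero] at this; exact one_ne_zero this
  have hθ0 : θ ≠ 0 := (IsGalois.normalBasis K L).ne_zero 1
  obtain ⟨j, hj⟩ := exists_ub hπ1 (Finset.univ.image fun q : Gal(L/K) × Gal(L/K) × Gal(L/K) =>
    co (q.1 θ * q.2.1 θ) q.2.2)
  set B : K := (π ^ j)⁻¹ with hB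
  have hB0 : π ^ j ≠ 0 := pow_ne_zero _ hπ0
  have hbb : ∀ g h : Gal(L/K), g θ * h θ ∈ NL S B := by
    intro g h v hv k
    have := hj j le_rfl _ (Finset.mem_image_of_mem _ (Finset.mem_univ (g, h, k))) v hv
    have hp : (0 : WithZero (Multiplicative ℤ)) < v.valuation K (π ^ j) := by
      rw [zero_lt_iff]; simpa using hB0
    rw [hB, map_inv₀, ← one_div, le_div_iff₀ hp, ← map_mul]; exact this
  have hmul : ∀ (a b : K) (x y : L), x ∈ NL S a → y ∈ NL S b → x * y ∈ NL S (B * a * b) := by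
    intro a b x y hx hy
    have e : x * y = ∑ g : Gal(L/K), ∑ h : Gal(L/K),
        algebraMap K L (co x g * co y h) * (g θ * h θ) := by
      conv_lhs => rw [eq_sum_co (K := K) x, eq_sum_co (K := K) y]
      rw [Finset.sum_mul_sum]
      refine Finset.sum_congr rfl fun g _ => Finset.sum_congr rfl fun h _ => ?_
      simp only [Algebra.smul_def, map_mul]; ring
    rw [e]
    refine sum_mem fun g _ => sum_mem fun h _ => NL_smul' (hbb g h) fun v hv => ?_
    simp only [map_mul]
    calc _ ≤ v.valuation K a * v.valuation K b * v.valuation K B := by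
          gcongr
          · exact hx v hv g
          · exact hy v hv h
      _ = _ := by rw [mul_comm, ← mul_assoc]
  have hup : ∀ w ∈ up L S, w.valuation L (algebraMap K L π) < 1 := fun w hw =>
    val_up_lt_one w (hπ1 _ (mem_up.1 hw))
  have hup0 : algebraMap K L π ≠ 0 := by simpa using hπ0
  have ev : ∀ᶠ m : ℕ in Filter.atTop, (∀ v ∈ S, v.valuation K (π ^ m) ≤ v.valuation K (π * π ^ j)) ∧
      (∀ v ∈ S, v.valuation K (π ^ m) ≤ v.valuation K (π / T)) ∧
      ∀ g : Gal(L/K), ∀ w ∈ up L S, w.valuation L (algebraMap K L π ^ m) ≤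
        w.valuation L (algebraMap K L π / g θ) := by
    refine (ev_pow_le hπ1 (mul_ne_zero hπ0 hB0)).and ((ev_pow_le hπ1 (div_ne_zero hπ0 hT0)).and ?_)
    rw [Filter.eventually_all]
    exact fun g => ev_pow_le hup (div_ne_zero hup0 (by simpa using hθ0))
  obtain ⟨m, hm1, hm2, hm3⟩ := ev.exists
  have hc0 : π ^ m ≠ 0 := pow_ne_zero _ hπ0
  refine ⟨π, B, π ^ m, ⟨hπ0, hπ1, hc0, hmul, fun v hv => ?_, fun v hv => ?_⟩, ?_, ?_⟩
  · rw [map_mul]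
    refine (mul_le_mul_right (hm1 v hv) _).trans ?_
    rw [← map_mul, hB]
    rw [show (π ^ j)⁻¹ * (π * π ^ j) = π by field_simp]
  · rw [map_mul]
    refine lt_of_le_of_lt (mul_le_mul_left (hm2 v hv) _) ?_
    rw [← map_mul, div_mul_cancel₀ _ hT0]; exact hπ1 v hv
  · intro x hx w hw
    rw [eq_sum_co (K := K) x]
    refine Valuation.map_sum_lt _ one_ne_zero fun g _ => ?_
    have h1 : w.valuation L (algebraMap K L (co x g / π ^ m)) ≤ 1 := by
      apply val_up_le_one
      rw [map_div₀]
      exact div_le_one_of_le₀ (hx _ (mem_up.1 hw) g) zero_le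
    have h2 := hm3 g w hw
    have hg0 : g θ ≠ 0 := by simpa using hθ0
    have e : co x g • g θ = algebraMap K L (co x g / π ^ m) * (algebraMap K L π ^ m * g θ) := by
      rw [Algebra.smul_def, map_div₀, map_pow, div_mul_eq_mul_div, eq_div_iff (pow_ne_zero _ hup0)]; ring
    rw [← hθ, e, map_mul]
    refine lt_of_le_of_lt (mul_le_of_le_one_left' h1) ?_
    rw [map_mul]
    refine lt_of_le_of_lt (mul_le_mul_left h2 _) ?_
    rw [← map_mul, div_mul_cancel₀ _ hg0]
    exact hup w hw
  · -- integral basis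
    let ib := integralBasis L
    obtain ⟨a, ha⟩ := exists_ub hπ1 (Finset.univ.image fun q : Module.Free.ChooseBasisIndex ℤ (𝓞 L) × Gal(L/K) =>
      co (ib q.1) q.2)
    have hib : ∀ i, ib i ∈ NL S ((π ^ a)⁻¹) := by
      intro i v hv g
      have := ha a le_rfl _ (Finset.mem_image_of_mem _ (Finset.mem_univ (i, g))) v hv
      have hp : (0 : WithZero (Multiplicative ℤ)) < v.valuation K (π ^ a) := by
        rw [zero_lt_iff]; simpa using pow_ne_zero a hπ0
      rw [map_inv₀, ← one_div, le_div_iff₀ hp, ← map_mul]; exact this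
    have hint : ∀ y : 𝓞 L, (y : L) ∈ NL S ((π ^ a)⁻¹) := by
      intro y
      have h1 : (y : L) = ∑ i, ((RingOfIntegers.basis L).repr y i) • ib i := by
        have := (RingOfIntegers.basis L).sum_repr y
        have h2 := congrArg (algebraMap (𝓞 L) L) this
        rw [map_sum] at h2
        refine h2.symm.trans (Finset.sum_congr rfl fun i _ => ?_)
        rw [map_zsmul, integralBasis_apply]
      rw [h1]
      exact sum_mem fun i _ => zsmul_mem (hib i) _
    set M := m + a with hM
    -- valuations of π^M at primes above
    obtain ⟨k, hk⟩ : ∃ k : ℕ, ∀ w ∈ up L S, WithZero.exp (-((k : ℤ) + 1)) ≤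
        w.valuation L (algebraMap K L π ^ M) := by
      refine ⟨(up L S).sup fun w => (dv (algebraMap K L π ^ M) w).toNat, fun w hw => ?_⟩
      rw [valuation_eq w (pow_ne_zero _ hup0), WithZero.exp_le_exp]
      have := Finset.le_sup (f := fun w => (dv (algebraMap K L π ^ M) w).toNat) hw
      omega
    refine ⟨k, fun y hy => ?_⟩
    have hMz : algebraMap K L π ^ M ≠ 0 := pow_ne_zero _ hup0
    obtain ⟨s, hs, b, hb⟩ := exists_den_up S (y / algebraMap K L π ^ M) fun w hw => by
      rw [map_div₀]
      exact div_le_one_of_le₀ ((hy w hw).trans (hk w hw)) zero_le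
    intro v hv g
    have hs1 := (not_mem_iff_val v s).1 (hs v hv)
    have hs0 : (s : K) ≠ 0 := fun h => by rw [h, map_zero] at hs1; exact zero_ne_one hs1
    have hs0' : algebraMap K L s ≠ 0 := by simpa using hs0
    have ey : y = algebraMap K L (π ^ M / s) * b := by
      rw [← hb, map_div₀, map_pow]; field_simp
    rw [ey, co_mulL, map_mul, map_div₀, hs1, div_one]
    refine (mul_le_mul_right (hint b v hv g) _).trans ?_
    rw [← map_mul, hM, pow_add, mul_assoc, mul_inv_cancel₀ (pow_ne_zero _ hπ0), mul_one]
end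

section gen
variable {G : Type} [Group G] [Finite G]

/-- `1 - σ` on a module -/
def dO (A : Type) [AddCommGroup A] [DistribMulAction G A] (σ : G) : A →+ A :=
  AddMonoidHom.id A - DistribSMul.toAddMonoidHom A σ

variable (G) in
/-- norm on a module -/
def tO (A : Type) [AddCommGroup A] [DistribMulAction G A] : A →+ A :=
  letI := Fintype.ofFinite G
  ∑ g : G, DistribSMul.toAddMonoidHom A g

variable {A : Type} [AddCommGroup A] [DistribMulAction G A]
lemma dO_apply (σ : G) (x : A) : dO A σ x = x - σ • x := rfl

lemma tO_apply [Fintype G] (x : A) : tO G A x = ∑ g : G, g • x := by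
  rw [tO, AddMonoidHom.finsetSum_apply]
  exact Finset.sum_congr (by ext; simp) (fun _ _ => rfl)

lemma tO_smul (σ : G) (x : A) : tO G A (σ • x) = tO G A x := by
  letI := Fintype.ofFinite G
  simp only [tO_apply, smul_smul]
  exact Fintype.sum_equiv (Equiv.mulRight σ) _ _ (fun _ => rfl)

lemma smul_tO (σ : G) (x : A) : σ • tO G A x = tO G A x := by
  letI := Fintype.ofFinite G
  simp only [tO_apply, Finset.smul_sum, smul_smul]
  exact Fintype.sum_equiv (Equiv.mulLeft σ) _ _ (fun _ => rfl)

lemma tO_dO (σ : G) (x : A) : tO G A (dO A σ x) = 0 := by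
  rw [dO_apply, map_sub, tO_smul, sub_self]
lemma dO_tO (σ : G) (x : A) : dO A σ (tO G A x) = 0 := by
  rw [dO_apply, smul_tO, sub_self]

lemma fix_all {σ : G} (hσ : ∀ g : G, ∃ i : ℕ, σ ^ i = g) {X : Type} [MulAction G X] {x : X} (h : σ • x = x) (g : G) : g • x = x := by
  obtain ⟨i, rfl⟩ := hσ g
  induction i with
  | zero => simp
  | succ i ih => rw [pow_succ, mul_smul, h, ih]

lemma tO_fix {σ : G} (hσ : ∀ g : G, ∃ i : ℕ, σ ^ i = g) {x : A} (h : σ • x = x) : tO G A x = Nat.card G • x := by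
  letI := Fintype.ofFinite G
  rw [tO_apply, Finset.sum_congr rfl (fun g _ => fix_all hσ h g)]
  simp

lemma card_smul_of_tO {σ : G} (hσ : ∀ g : G, ∃ i : ℕ, σ ^ i = g) (B : AddSubgroup A) (hB : ∀ x ∈ B, σ • x ∈ B) {x : A} (hx : x ∈ B) (h : tO G A x = 0) :
    Nat.card G • x ∈ B.map (dO A σ) := by
  letI := Fintype.ofFinite G
  have hB' : ∀ i : ℕ, ∀ x ∈ B, σ ^ i • x ∈ B := by
    intro i
    induction i with
    | zero => intro x hx; simpa using hx
    | succ i ih => intro x hx; rw [pow_succ, mul_smul]; exact ih _ (hB x hx)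
  have key : ∀ i : ℕ, x - σ ^ i • x ∈ B.map (dO A σ) := by
    intro i
    induction i with
    | zero => simp
    | succ i ih =>
      have : x - σ ^ (i+1) • x = (x - σ ^ i • x) + dO A σ (σ ^ i • x) := by
        rw [dO_apply, pow_succ', mul_smul]; abel
      rw [this]
      exact add_mem ih ⟨_, hB' i x hx, rfl⟩
  have : Nat.card G • x = ∑ g : G, (x - g • x) := by
    rw [Finset.sum_sub_distrib, ← tO_apply, h]; simp
  rw [this]
  refine sum_mem fun g _ => ?_
  obtain ⟨i, rfl⟩ := hσ g
  exact key i
end gen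

lemma relIndex_ne_zero_of_fg {A : Type} [AddCommGroup A] [Module.Finite ℤ A] (X Y : AddSubgroup A) (n : ℕ) (hn : n ≠ 0)
    (h : ∀ x ∈ X, n • x ∈ Y) : Y.relIndex X ≠ 0 := by
  have : Module.Finite ℤ X := by
    have := Module.Finite.of_fg (IsNoetherian.noetherian (AddSubgroup.toIntSubmodule X))
    exact this
  have : Module.Finite ℤ (X ⧸ Y.addSubgroupOf X) :=
    Module.Finite.of_surjective (QuotientAddGroup.mk' (Y.addSubgroupOf X)).toIntLinearMap (QuotientAddGroup.mk'_surjective _)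
  have : Finite (X ⧸ Y.addSubgroupOf X) := by
    apply Module.finite_of_fg_torsion
    intro x
    induction x using QuotientAddGroup.induction_on with
    | H x =>
    refine ⟨⟨(n : ℤ), by simpa using hn⟩, ?_⟩
    change ((n : ℤ) • (x : X ⧸ Y.addSubgroupOf X)) = 0
    rw [natCast_zsmul, ← QuotientAddGroup.mk_nsmul, QuotientAddGroup.eq_zero_iff, AddSubgroup.mem_addSubgroupOf]
    exact h x x.2
  rw [AddSubgroup.relIndex]
  exact AddSubgroup.index_ne_zero_of_finite

lemma index_ne_zero_of_finrank {M A : Type} [AddCommGroup M] [AddCommGroup A] [Module.Finite ℤ A] (Φ : M →+ A)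
    (hinj : Function.Injective Φ) (h : Module.finrank ℤ M = Module.finrank ℤ A) : Φ.range.index ≠ 0 := by
  set N : Submodule ℤ A := LinearMap.range Φ.toIntLinearMap with hN
  have h1 := N.finrank_quotient_add_finrank
  have h2 : Module.finrank ℤ N = Module.finrank ℤ M :=
    (LinearMap.finrank_range_of_inj (f := Φ.toIntLinearMap) hinj)
  have h3 : Module.finrank ℤ (A ⧸ N) = 0 := by omega
  rw [Module.finrank_eq_zero_iff_isTorsion] at h3
  have : Finite (A ⧸ N) := Module.finite_of_fg_torsion _ h3
  have h4 : N.toAddSubgroup = Φ.range := by ext; simp [hN]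
  rw [← h4]
  exact AddSubgroup.index_ne_zero_of_finite (hH := this)

lemma tate_transfer {A B : Type} [AddCommGroup A] [AddCommGroup B] (i : A →+ B) (hi : Function.Injective i)
    (f g : A →+ A) (f' g' : B →+ B) (hf : ∀ x, i (f x) = f' (i x)) (hg : ∀ x, i (g x) = g' (i x)) (X : AddSubgroup A) :
    ((X.map i).map f').relIndex (X.map i ⊓ g'.ker) = (X.map f).relIndex (X ⊓ g.ker) := by
  have h1 : (X.map i).map f' = (X.map f).map i := by
    rw [AddSubgroup.map_map, AddSubgroup.map_map]
    congr 1; ext x; simp [hf]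
  have h2 : X.map i ⊓ g'.ker = (X ⊓ g.ker).map i := by
    ext y
    constructor
    · rintro ⟨⟨x, hx, rfl⟩, h⟩
      refine ⟨x, ⟨hx, ?_⟩, rfl⟩
      change g' (i x) = 0 at h
      rw [← hg] at h
      exact hi (h.trans (map_zero i).symm)
    · rintro ⟨x, ⟨hx, h⟩, rfl⟩
      refine ⟨⟨x, hx, rfl⟩, ?_⟩
      change g x = 0 at h
      change g' (i x) = 0
      rw [← hg, h, map_zero]
  rw [h1, h2, relIndex_map', (AddMonoidHom.ker_eq_bot_iff i).2 hi, sup_bot_eq]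

lemma dom_inj {W : Type} [Fintype W] [DecidableEq W] (m : W → ℝ) (hm : ∀ w, 0 < m w) (a : W → W → ℝ)
    (ha : ∀ w' w, w' ≠ w → a w' w < 0) (hs : ∀ w, ∑ w', m w' * a w' w = 0) (x : W → ℝ)
    (hx : ∀ w', ∑ w, x w * a w' w = 0) (hx0 : ∑ w, x w = 0) : x = 0 := by
  classical
  by_contra hne
  obtain ⟨w1, h1⟩ : ∃ w, 0 < x w := by
    obtain ⟨w, hw⟩ := Function.ne_iff.1 hne
    obtain ⟨w, _, hw⟩ := Finset.exists_pos_of_sum_zero_of_exists_nonzero x hx0 ⟨w, Finset.mem_univ _, hw⟩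
    exact ⟨w, hw⟩
  obtain ⟨w0, h0⟩ : ∃ w, x w ≤ 0 := by
    by_contra! h
    exact (Finset.sum_pos (fun w _ => h w) ⟨w1, Finset.mem_univ _⟩).ne' hx0
  set P := Finset.univ.filter fun w => 0 < x w with hP
  set c : W → ℝ := fun w => ∑ w' ∈ P, m w' * a w' w with hc
  have e1 : ∑ w, x w * c w = 0 := by
    have : ∑ w' ∈ P, m w' * ∑ w, x w * a w' w = 0 := Finset.sum_eq_zero fun w' _ => by rw [hx, mul_zero]
    rw [← this]
    simp only [hc, Finset.mul_sum]
    rw [Finset.sum_comm]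
    refine Finset.sum_congr rfl fun _ _ => Finset.sum_congr rfl fun _ _ => by ring
  have e2 : ∀ w, c w = - ∑ w' ∈ Pᶜ, m w' * a w' w := by
    intro w
    have := hs w
    rw [← Finset.sum_add_sum_compl P] at this
    simp only [hc]; linarith
  have hpos : ∀ w, 0 < x w → 0 < c w := by
    intro w hw
    rw [e2, neg_pos]
    refine Finset.sum_neg (fun w' hw' => ?_) ⟨w0, by simp [hP, h0]⟩
    refine mul_neg_of_pos_of_neg (hm w') (ha w' w ?_)
    rintro rfl
    simp [hP, hw] at hw'
    linarith
  have hneg : ∀ w, x w ≤ 0 → c w ≤ 0 := by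
    intro w hw
    refine Finset.sum_nonpos fun w' hw' => ?_
    refine (mul_neg_of_pos_of_neg (hm w') (ha w' w ?_)).le
    rintro rfl
    simp [hP] at hw'
    linarith
  have : 0 < ∑ w, x w * c w := by
    refine Finset.sum_pos' (fun w _ => ?_) ⟨w1, Finset.mem_univ _, mul_pos h1 (hpos _ h1)⟩
    rcases lt_or_ge 0 (x w) with h | h
    · exact (mul_pos h (hpos w h)).le
    · exact mul_nonneg_of_nonpos_of_nonpos h (hneg w h)
  linarith

instance addUnitsAct {G R : Type} [Group G] [CommRing R] [MulSemiringAction G R] : DistribMulAction G (Additive Rˣ) where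
  smul g u := Additive.ofMul (Units.map (MulSemiringAction.toRingHom G R g : R →* R) u.toMul)
  one_smul u := by
    apply Additive.toMul.injective; ext
    exact one_smul G (u.toMul : R)
  mul_smul g h u := by
    apply Additive.toMul.injective; ext
    exact mul_smul g h (u.toMul : R)
  smul_zero g := by
    apply Additive.toMul.injective; ext
    exact smul_one g
  smul_add g u v := by
    apply Additive.toMul.injective; ext
    exact smul_mul' g (u.toMul : R) (v.toMul : R)

lemma au_smul {G R : Type} [Group G] [CommRing R] [MulSemiringAction G R] (g : G) (u : Additive Rˣ) :
    (((g • u).toMul : Rˣ) : R) = g • (u.toMul : R) := rfl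

lemma finrank_prod_int (A : Type) [AddCommGroup A] [Module.Finite ℤ A] :
    Module.finrank ℤ (A × ℤ) = Module.finrank ℤ A + 1 := by
  have h := (LinearMap.ker (LinearMap.snd ℤ A ℤ)).finrank_quotient_add_finrank
  rw [(LinearMap.snd ℤ A ℤ).quotKerEquivRange.finrank_eq] at h
  rw [LinearMap.ker_snd, LinearMap.finrank_range_of_inj LinearMap.inl_injective, LinearMap.range_eq_top.2 Prod.snd_surjective, finrank_top,
    Module.finrank_self] at h
  omega

lemma relIndex_prod' {A B : Type} [AddCommGroup A] [AddCommGroup B] (H K : AddSubgroup A) (H' K' : AddSubgroup B) :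
    (H.prod H').relIndex (K.prod K') = H.relIndex K * H'.relIndex K' := by
  have e : (K.subtype.prodMap K'.subtype).range = K.prod K' := by
    ext ⟨x, y⟩
    simp [AddSubgroup.mem_prod]
  rw [← e, ← AddSubgroup.index_comap, AddSubgroup.relIndex, AddSubgroup.relIndex, ← AddSubgroup.index_prod]
  rfl

section
variable {K : Type} [Field K] [NumberField K]
variable {L : Type} [Field L] [NumberField L] [Algebra K L] [IsGalois K L]

variable (K L) in
/-- ramified infinite places -/
abbrev RInf := {v : InfinitePlace K // ¬ v.IsUnramifiedIn L}

variable (K L) in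
lemma exists_eps : ∃ ε : InfinitePlace L → Additive (𝓞 L)ˣ, (∀ (g : Gal(L/K)) w, g • ε w = ε (g • w)) ∧
    ∀ w w' : InfinitePlace L, w' ≠ w → Real.log (w' ((ε w).toMul : 𝓞 L)) < 0 := by
  classical
  choose u hu using NumberField.Units.dirichletUnitTheorem.exists_unit L
  refine ⟨fun w => ∑ g : Gal(L/K), g • Additive.ofMul (u (g⁻¹ • w)), fun g w => ?_, fun w w' hw => ?_⟩
  · simp only [Finset.smul_sum, smul_smul]
    refine Fintype.sum_equiv (Equiv.mulLeft g) _ _ (fun h => ?_)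
    simp [mul_smul]
  · have e : (((∑ g : Gal(L/K), g • Additive.ofMul (u (g⁻¹ • w))).toMul : (𝓞 L)ˣ) : L) =
        ∏ g : Gal(L/K), g (u (g⁻¹ • w) : 𝓞 L) := by
      rw [toMul_sum, Units.coe_prod]
      simp only [map_prod]
      rfl
    refine lt_of_eq_of_lt (congrArg (fun z => Real.log (w' z)) e) ?_
    rw [map_prod, Real.log_prod]
    · refine Finset.sum_neg (fun g _ => ?_) ⟨1, Finset.mem_univ _⟩
      have : w' (g (u (g⁻¹ • w) : 𝓞 L)) = (g⁻¹ • w') (u (g⁻¹ • w) : 𝓞 L) := by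
        rw [InfinitePlace.smul_apply]; rfl
      rw [this]
      exact hu _ _ (fun h => hw (smul_left_cancel _ h))
    · intro g _
      simp

/-- the permutation module -/
abbrev PM (L : Type) [Field L] := InfinitePlace L → ℤ

/-- translation -/
def pmT (g : Gal(L/K)) : PM L →+ PM L where
  toFun x w := x (g⁻¹ • w)
  map_zero' := rfl
  map_add' _ _ := rfl

instance : DistribMulAction Gal(L/K) (PM L) where
  smul g x := pmT g x
  one_smul x := by funext w; change x _ = x w; simp
  mul_smul g h x := by funext w; change x _ = x _; simp [mul_smul]
  smul_zero g := map_zero _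
  smul_add g := map_add _

lemma pm_smul (g : Gal(L/K)) (x : PM L) (w) : (g • x) w = x (g⁻¹ • w) := rfl

lemma pm_H0 {σ : Gal(L/K)} (hσ : ∀ g, ∃ i : ℕ, σ ^ i = g) :
    (tO Gal(L/K) (PM L)).range.relIndex (dO (PM L) σ).ker ≤ 2 ^ Nat.card (RInf K L) := by
  classical
  have hsurj := InfinitePlace.comap_surjective (k := K) (K := L)
  choose r hr using hsurj
  simp only at hr
  let θ : PM L →+ (RInf K L → ZMod 2) :=
    { toFun := fun x v => (x (r v.1) : ZMod 2)
      map_zero' := by ext; simp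
      map_add' := by intros; ext; simp }
  have h1 : θ.ker ⊓ (dO (PM L) σ).ker ≤ (tO Gal(L/K) (PM L)).range := by
    rintro x ⟨hx1, hx2⟩
    change θ x = 0 at hx1
    change x - σ • x = 0 at hx2
    have hfix : ∀ (g : Gal(L/K)) w, x (g • w) = x w := by
      intro g w
      have := fix_all hσ (sub_eq_zero.1 hx2).symm g⁻¹
      conv_rhs => rw [← this]
      rw [pm_smul, inv_inv]
    let s : InfinitePlace L → ℕ := fun w => Nat.card (MulAction.stabilizer Gal(L/K) w)
    have hdiv : ∀ v, (s (r v) : ℤ) * (x (r v) / s (r v)) = x (r v) := by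
      intro v
      by_cases hv : v.IsUnramifiedIn L
      · have : s (r v) = 1 := by
          refine InfinitePlace.isUnramified_iff_card_stabilizer_eq_one.1 ?_
          rw [← InfinitePlace.isUnramifiedIn_comap, hr]; exact hv
        rw [this]; simp
      · have : s (r v) = 2 := by
          refine InfinitePlace.not_isUnramified_iff_card_stabilizer_eq_two.1 ?_
          rw [← InfinitePlace.isUnramifiedIn_comap, hr]; exact hv
        rw [this]
        apply Int.mul_ediv_cancel'
        have := congrFun hx1 ⟨v, hv⟩
        exact (ZMod.intCast_zmod_eq_zero_iff_dvd _ 2).1 this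
    let y : PM L := fun w => if w = r (w.comap (algebraMap K L)) then x w / s w else 0
    refine ⟨y, ?_⟩
    funext w
    rw [tO_apply, Finset.sum_apply]
    simp only [pm_smul]
    set v := w.comap (algebraMap K L) with hv
    have hco : ∀ g : Gal(L/K), (g • w).comap (algebraMap K L) = v := by
      intro g
      exact (InfinitePlace.mem_orbit_iff.1 (MulAction.mem_orbit w g)).symm
    obtain ⟨h, hh⟩ : ∃ h : Gal(L/K), h • r v = w := by
      have : w ∈ MulAction.orbit Gal(L/K) (r v) := by
        rw [InfinitePlace.mem_orbit_iff, hr]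
      exact this
    have e : ∀ g : Gal(L/K), y (g⁻¹ • w) = if g⁻¹ * h ∈ MulAction.stabilizer Gal(L/K) (r v) then x (r v) / s (r v) else 0 := by
      intro g
      simp only [y, hco, MulAction.mem_stabilizer_iff, mul_smul, hh]
      split_ifs with h1
      · rw [h1]
      · rfl
    rw [Finset.sum_congr rfl fun g _ => e g]
    refine (Fintype.sum_equiv ((Equiv.inv _).trans (Equiv.mulRight h)) _ (fun k => if k ∈ MulAction.stabilizer Gal(L/K) (r v) then x (r v) / s (r v) else 0) (fun g => rfl)).trans ?_
    rw [← Finset.sum_filter, Finset.sum_const, nsmul_eq_mul]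
    have : (Finset.univ.filter fun k => k ∈ MulAction.stabilizer Gal(L/K) (r v)).card = s (r v) := by
      rw [← Fintype.card_subtype, ← Nat.card_eq_fintype_card]
    rw [this, hdiv, ← hh, hfix]
  have h2 := AddSubgroup.relIndex_dvd_of_le_left (dO (PM L) σ).ker h1
  rw [AddSubgroup.inf_relIndex_right] at h2
  rw [AddSubgroup.relIndex_ker] at h2
  have h3 : Nat.card ((dO (PM L) σ).ker.map θ) ≤ 2 ^ Nat.card (RInf K L) := by
    refine (Nat.card_le_card_of_injective _ Subtype.val_injective).trans ?_
    rw [Nat.card_fun, Nat.card_zmod]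
  exact (Nat.le_of_dvd Nat.card_pos h2).trans h3

/-- the map from the permutation module to units times ℤ -/
def pmMap (ε : InfinitePlace L → Additive (𝓞 L)ˣ) : PM L →+ Additive (𝓞 L)ˣ × ℤ where
  toFun x := (∑ w, x w • ε w, ∑ w, x w)
  map_zero' := by simp
  map_add' x y := by
    ext1
    · simp only [Pi.add_apply, add_zsmul, Finset.sum_add_distrib, Prod.fst_add]
    · simp [Finset.sum_add_distrib]

lemma log_sum (y : PM L) (ε : InfinitePlace L → Additive (𝓞 L)ˣ) (w' : InfinitePlace L) :
    Real.log (w' (((∑ w, y w • ε w).toMul : (𝓞 L)ˣ) : 𝓞 L)) = ∑ w, y w * Real.log (w' ((ε w).toMul : 𝓞 L)) := by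
  let φ : Additive (𝓞 L)ˣ →+ ℝ :=
    { toFun := fun u => Real.log (w' (u.toMul : 𝓞 L))
      map_zero' := by simp
      map_add' := fun u v => by
        simp only [toMul_add, Units.val_mul, map_mul]
        rw [Real.log_mul] <;> simp }
  change φ _ = ∑ w, y w * φ (ε w)
  rw [map_sum]
  simp

lemma pmMap_inj (ε : InfinitePlace L → Additive (𝓞 L)ˣ)
    (h : ∀ w w' : InfinitePlace L, w' ≠ w → Real.log (w' ((ε w).toMul : 𝓞 L)) < 0) : Function.Injective (pmMap ε) := by
  classical
  rw [injective_iff_map_eq_zero]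
  intro x hx
  have h1 : ∑ w, x w • ε w = 0 := congrArg Prod.fst hx
  have h2 : ∑ w, x w = 0 := congrArg Prod.snd hx
  have := dom_inj (fun w : InfinitePlace L => (w.mult : ℝ)) (fun w => by exact_mod_cast InfinitePlace.mult_pos)
    (fun w' w => Real.log (w' ((ε w).toMul : 𝓞 L))) (fun w' w hw => h w w' hw)
    (fun w => NumberField.Units.sum_mult_mul_log _) (fun w => (x w : ℝ))
    (fun w' => by rw [← log_sum, h1]; simp) (by exact_mod_cast h2)
  funext w
  have := congrFun this w
  simpa using this

lemma unit_herb {σ : Gal(L/K)} (hσ : ∀ g, ∃ i : ℕ, σ ^ i = g) :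
    Nat.card Gal(L/K) * (tO Gal(L/K) (Additive (𝓞 L)ˣ)).range.relIndex (dO (Additive (𝓞 L)ˣ) σ).ker ≤
    2 ^ Nat.card (RInf K L) * (dO (Additive (𝓞 L)ˣ) σ).range.relIndex (tO Gal(L/K) (Additive (𝓞 L)ˣ)).ker := by
  classical
  set A := Additive (𝓞 L)ˣ with hA
  set n := Nat.card Gal(L/K) with hn
  have hn0 : n ≠ 0 := Nat.card_pos.ne'
  obtain ⟨ε, hε1, hε2⟩ := exists_eps K L
  have hinj := pmMap_inj ε hε2
  let f : A × ℤ →+ A × ℤ := (dO A σ).prodMap 0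
  let g : A × ℤ →+ A × ℤ := (tO Gal(L/K) A).prodMap (DistribSMul.toAddMonoidHom ℤ n)
  have hs : ∀ (g : Gal(L/K)) (x : PM L), ∑ w, (g • x) w • ε w = g • ∑ w, x w • ε w := by
    intro g x
    rw [Finset.smul_sum]
    simp only [pm_smul]
    refine Fintype.sum_equiv (MulAction.toPerm g⁻¹) _ _ (fun w => ?_)
    have : g • x (g⁻¹ • w) • ε (g⁻¹ • w) = x (g⁻¹ • w) • g • ε (g⁻¹ • w) :=
      map_zsmul (DistribSMul.toAddMonoidHom A g) _ _
    rw [MulAction.toPerm_apply, this, hε1, smul_inv_smul]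
  have hs2 : ∀ (g : Gal(L/K)) (x : PM L), ∑ w, (g • x) w = ∑ w, x w := by
    intro g x
    simp only [pm_smul]
    exact Fintype.sum_equiv (MulAction.toPerm g⁻¹) _ _ (fun w => rfl)
  have hf : ∀ x, pmMap ε (dO (PM L) σ x) = f (pmMap ε x) := by
    intro x
    rw [dO_apply, map_sub]
    ext1
    · exact congrArg (fun z => (pmMap ε x).1 - z) (hs σ x)
    · exact (congrArg (fun z => (pmMap ε x).2 - z) (hs2 σ x)).trans (sub_self _)
  have hg : ∀ x, pmMap ε (tO Gal(L/K) (PM L) x) = g (pmMap ε x) := by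
    intro x
    rw [tO_apply, map_sum]
    ext1
    · rw [Prod.fst_sum]
      change _ = tO Gal(L/K) A _
      rw [tO_apply]
      exact Finset.sum_congr rfl fun g _ => hs g x
    · rw [Prod.snd_sum]
      change _ = n • (pmMap ε x).2
      have h2 : ∀ g : Gal(L/K), (pmMap ε (g • x)).2 = (pmMap ε x).2 := fun g => hs2 g x
      simp only [h2]
      simp [hn]
  have hfin : Module.Finite ℤ (A × ℤ) := inferInstance
  have hidx : (pmMap ε).range.index ≠ 0 := by
    apply index_ne_zero_of_finrank _ hinj
    rw [finrank_prod_int, NumberField.Units.finrank_eq, Module.finrank_fintype_fun_eq_card,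
      NumberField.Units.rank]
    have : 0 < Fintype.card (InfinitePlace L) := Fintype.card_pos
    omega
  have key := herbrand f g (by rintro ⟨x, y⟩; simp [f, g, dO_tO]) (by rintro ⟨x, y⟩; simp [f, g, tO_dO])
    (pmMap ε).range (by rintro _ ⟨x, rfl⟩; exact ⟨_, hf x⟩) (by rintro _ ⟨x, rfl⟩; exact ⟨_, hg x⟩) hidx
  rw [AddMonoidHom.range_eq_map (pmMap ε), tate_transfer (pmMap ε) hinj _ _ f g hf hg,
    tate_transfer (pmMap ε) hinj _ _ g f hg hf, top_inf_eq, top_inf_eq, ← AddMonoidHom.range_eq_map,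
    ← AddMonoidHom.range_eq_map] at key
  have hH1 : (dO (PM L) σ).range.relIndex (tO Gal(L/K) (PM L)).ker ≠ 0 := by
    apply relIndex_ne_zero_of_fg _ _ n hn0
    intro x hx
    rw [AddMonoidHom.range_eq_map]
    exact card_smul_of_tO hσ ⊤ (fun _ _ => trivial) trivial hx
  have hk1 : g.range.relIndex f.ker = n * (tO Gal(L/K) A).range.relIndex (dO A σ).ker := by
    have e1 : f.ker = (dO A σ).ker.prod ⊤ := by
      ext ⟨x, y⟩; simp [f, AddSubgroup.mem_prod]
    have e2 : g.range = (tO Gal(L/K) A).range.prod (AddSubgroup.zmultiples (n : ℤ)) := by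
      ext ⟨x, y⟩
      simp [g, AddSubgroup.mem_prod, AddSubgroup.mem_zmultiples_iff, mul_comm]
    rw [e1, e2, relIndex_prod', AddSubgroup.relIndex_top_right, Int.index_zmultiples, Int.natAbs_natCast, mul_comm]
  have hk2 : f.range.relIndex g.ker = (dO A σ).range.relIndex (tO Gal(L/K) A).ker := by
    have e1 : g.ker = (tO Gal(L/K) A).ker.prod ⊥ := by
      ext ⟨x, y⟩; simp [g, AddSubgroup.mem_prod, hn0]
    have e2 : f.range = (dO A σ).range.prod ⊥ := by
      ext ⟨x, y⟩
      simp [f, AddSubgroup.mem_prod, eq_comm]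
    rw [e1, e2, relIndex_prod', AddSubgroup.relIndex_self, mul_one]
  rw [hk1, hk2] at key
  have h0 := pm_H0 (L := L) hσ
  calc _ ≤ _ := Nat.le_mul_of_pos_right _ (Nat.pos_of_ne_zero hH1)
    _ = _ := key
    _ ≤ _ := by rw [mul_comm]; gcongr
end

/-! ### Galois action on places and divisors -/
section
variable {K : Type} [Field K] [NumberField K]
variable {L : Type} [Field L] [NumberField L] [Algebra K L]

instance plAct : MulAction Gal(L/K) (Pl L) where
  smul g w := ⟨g • w.asIdeal, by
    have := w.isPrime
    infer_instance, by
    intro h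
    apply w.ne_bot
    have h2 : g⁻¹ • (g • w.asIdeal) = g⁻¹ • (⊥ : Ideal (𝓞 L)) := by rw [h]
    rw [inv_smul_smul] at h2
    rw [h2]
    exact Ideal.map_bot⟩
  one_smul w := by ext1; exact one_smul _ _
  mul_smul g h w := by ext1; exact mul_smul g h w.asIdeal

lemma pl_smul_asIdeal (g : Gal(L/K)) (w : Pl L) : (g • w).asIdeal = g • w.asIdeal := rfl

lemma dn_smul (g : Gal(L/K)) (w : Pl L) : dn K (g • w) = dn K w := by
  ext x
  change algebraMap (𝓞 K) (𝓞 L) x ∈ g • w.asIdeal ↔ algebraMap (𝓞 K) (𝓞 L) x ∈ w.asIdeal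
  have : algebraMap (𝓞 K) (𝓞 L) x = g • algebraMap (𝓞 K) (𝓞 L) x := by
    apply RingOfIntegers.coe_injective
    exact (g.commutes (x : K)).symm
  conv_lhs => rw [this]
  rw [Ideal.smul_mem_pointwise_smul_iff]

lemma exists_smul [IsGalois K L] (P Q : Pl L) (h : dn K P = dn K Q) : ∃ g : Gal(L/K), Q = g • P := by
  obtain ⟨τ, h⟩ := exists_conj P Q h
  exact ⟨τ, by ext1; exact h⟩

lemma intVal_smul (g : Gal(L/K)) (w : Pl L) (x : 𝓞 L) : (g • w).intValuation (g • x) = w.intValuation x := by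
  have key : ∀ n : ℕ, (g • w).intValuation (g • x) ≤ WithZero.exp (-(n:ℤ)) ↔ w.intValuation x ≤ WithZero.exp (-(n:ℤ)) := by
    intro n
    rw [HeightOneSpectrum.intValuation_le_pow_iff_mem, HeightOneSpectrum.intValuation_le_pow_iff_mem, pl_smul_asIdeal,
      ← smul_pow', Ideal.smul_mem_pointwise_smul_iff]
  by_cases hx : x = 0
  · simp [hx]
  have hx' : g • x ≠ 0 := fun h => hx (by simpa using congrArg (fun y => g⁻¹ • y) h)
  obtain ⟨n, hn⟩ : ∃ n : ℕ, w.intValuation x = WithZero.exp (-(n:ℤ)) := ⟨_, w.intValuation_if_neg hx⟩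
  obtain ⟨m, hm⟩ : ∃ m : ℕ, (g • w).intValuation (g • x) = WithZero.exp (-(m:ℤ)) := ⟨_, (g • w).intValuation_if_neg hx'⟩
  have h1 := (key n).2 hn.le
  have h2 := (key m).1 hm.le
  rw [← hn] at h1
  rw [← hm] at h2
  exact le_antisymm h1 h2

lemma val_smul (g : Gal(L/K)) (w : Pl L) (x : L) : (g • w).valuation L (g x) = w.valuation L x := by
  obtain ⟨a, b, hb, rfl⟩ := IsFractionRing.div_surjective (A := 𝓞 L) x
  rw [map_div₀, map_div₀, map_div₀]
  have h : ∀ a : 𝓞 L, g (algebraMap (𝓞 L) L a) = algebraMap (𝓞 L) L (g • a) := fun a => rfl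
  rw [h, h]
  simp only [HeightOneSpectrum.valuation_of_algebraMap, intVal_smul]

def dvT (g : Gal(L/K)) : Dv L →+ Dv L := Finsupp.mapDomain.addMonoidHom (fun w => g • w)

lemma dvT_apply (g : Gal(L/K)) (D : Dv L) (w) : dvT g D w = D (g⁻¹ • w) := by
  have := Finsupp.mapDomain_apply (f := fun w : Pl L => g • w) (MulAction.injective g) D (g⁻¹ • w)
  rw [smul_inv_smul] at this
  exact this

instance dvAct : DistribMulAction Gal(L/K) (Dv L) where
  smul g D := dvT g D
  one_smul D := by ext w; change dvT 1 D w = D w; rw [dvT_apply]; simp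
  mul_smul g h D := by
    ext w; change dvT (g * h) D w = dvT g (dvT h D) w
    simp only [dvT_apply, mul_inv_rev, mul_smul]
  smul_zero g := (dvT g).map_zero
  smul_add g := (dvT g).map_add

lemma dvA_apply (g : Gal(L/K)) (D : Dv L) (w) : (g • D) w = D (g⁻¹ • w) := dvT_apply g D w

lemma dv_gal (g : Gal(L/K)) {x : L} (hx : x ≠ 0) : dv (g x) = g • dv x := by
  ext w
  rw [dvA_apply]
  have hgx : g x ≠ 0 := by simpa using hx
  have h1 := valuation_eq w hgx
  have h2 := valuation_eq (g⁻¹ • w) hx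
  have h3 := val_smul g (g⁻¹ • w) x
  rw [smul_inv_smul, h1, h2] at h3
  have := WithZero.exp_injective h3
  omega

lemma DivS_gal (g : Gal(L/K)) (S : Finset (Pl K)) {D : Dv L} (h : D ∈ DivS (up L S)) : g • D ∈ DivS (up L S) := by
  intro w hw
  rw [dvA_apply]
  apply h
  rw [mem_up] at hw ⊢
  rwa [dn_smul]

/-- conorm -/
def con (L : Type) [Field L] [NumberField L] [Algebra K L] : Dv K →+ Dv L where
  toFun D := Finsupp.onFinset (up L D.support) (fun w => D (dn K w)) (by
    intro w hw; rw [mem_up]; simpa using hw)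
  map_zero' := by ext; simp
  map_add' := by intro D E; ext; simp

lemma con_apply (D : Dv K) (w : Pl L) : con L D w = D (dn K w) := rfl

lemma con_inj : Function.Injective (con (K := K) L) := by
  intro D E h
  ext v
  obtain ⟨w, rfl⟩ := dn_surj (Ω := L) v
  rw [← con_apply, h, con_apply]

lemma con_DivS (S : Finset (Pl K)) (D : Dv K) : con L D ∈ DivS (up L S) ↔ D ∈ DivS S := by
  constructor
  · intro h v hv
    obtain ⟨w, rfl⟩ := dn_surj (Ω := L) v
    exact h w (mem_up.2 hv)
  · intro h w hw
    exact h _ (mem_up.1 hw)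

lemma con_surj [IsGalois K L] {D : Dv L} (h : ∀ g : Gal(L/K), g • D = D) : ∃ E : Dv K, con L E = D := by
  choose s hs using fun v : Pl K => dn_surj (Ω := L) v
  have hinj : Function.Injective s := fun a b h => by rw [← hs a, h, hs]
  refine ⟨Finsupp.comapDomain s D hinj.injOn, ?_⟩
  ext w
  rw [con_apply, Finsupp.comapDomain_apply]
  obtain ⟨g, hg⟩ := exists_smul w (s (dn K w)) (hs _).symm
  have := dvA_apply g⁻¹ D w
  rw [h, inv_inv, ← hg] at this
  exact this.symm

lemma con_fix (g : Gal(L/K)) (E : Dv K) : g • con L E = con L E := by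
  ext w
  rw [dvA_apply, con_apply, con_apply, dn_smul]
end

section
variable {K : Type} [Field K] [NumberField K]
variable {L : Type} [Field L] [NumberField L] [Algebra K L] [IsGalois K L]

lemma e_one (w : Pl L) (h : ∀ g : Gal(L/K), IsIn w g → g = 1) (x : K) :
    w.valuation L (algebraMap K L x) = (dn K w).valuation K x := by
  have h1 := HeightOneSpectrum.valuation_liesOver L (dn K w) w x
  have : Finite ((dn K w).asIdeal.ResidueField) := by
    have hm : (dn K w).asIdeal.IsMaximal := (dn K w).isMaximal
    exact Finite.of_surjective _ (Ideal.bijective_algebraMap_quotient_residueField (dn K w).asIdeal).surjective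
  have hw := w.isPrime
  have hp := (dn K w).isPrime
  have h2 := Ideal.card_inertia_eq_ramificationIdxIn (G := Gal(L/K)) (dn K w).asIdeal w.asIdeal
  have h3 := Ideal.ramificationIdxIn_eq_ramificationIdx (dn K w).asIdeal w.asIdeal Gal(L/K)
  have h4 := Ideal.ramificationIdx'_eq_ramificationIdx (dn K w).asIdeal w.asIdeal (dn K w).ne_bot
  have h5 : Ideal.inertia Gal(L/K) w.asIdeal = ⊥ := by
    rw [eq_bot_iff]
    intro g hg
    exact h g (fun x => hg x)
  rw [h5, Subgroup.card_bot] at h2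
  rw [h4, ← h3, ← h2, pow_one] at h1
  exact h1.symm

lemma dv_base (w : Pl L) (h : ∀ g : Gal(L/K), IsIn w g → g = 1) {x : K} (hx : x ≠ 0) :
    dv (algebraMap K L x) w = dv x (dn K w) := by
  have h1 := e_one w h x
  rw [valuation_eq _ hx, valuation_eq _ (by simpa using hx)] at h1
  have := WithZero.exp_injective h1
  omega

lemma isIn_trivial {χ : Gal(L/K) →* ℂˣ} (hχ : Function.Injective χ) {w : Pl L} (h : Unr χ (dn K w))
    (g : Gal(L/K)) (hg : IsIn w g) : g = 1 := by
  apply hχ; rw [h w rfl g hg, map_one]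

lemma card_stab_dvd {χ : Gal(L/K) →* ℂˣ} (hχ : Function.Injective χ) {w : Pl L} (h : Unr χ (dn K w)) :
    Nat.card (MulAction.stabilizer Gal(L/K) w) ∣ orderOf (fr χ (dn K w)) := by
  obtain ⟨φ, hφ⟩ := exists_isFr (K := K) w
  rw [← fr_eq χ h rfl hφ, orderOf_injective χ hχ, ← Nat.card_zpowers]
  apply Subgroup.card_dvd_of_le
  intro g hg
  have hg' : g • w = w := hg
  obtain ⟨i, hi⟩ := stab_pow w g (by
    intro x hx
    have : g • x ∈ (g • w).asIdeal := Ideal.smul_mem_pointwise_smul_iff.2 hx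
    rwa [hg'] at this)
  refine ⟨i, ?_⟩
  have h2 : IsIn w (g * (φ ^ i)⁻¹) := by
    intro x
    have e1 := hi ((φ ^ i)⁻¹ • x)
    have e2 := hφ.pow_sub i ((φ ^ i)⁻¹ • x)
    rw [smul_inv_smul] at e2
    have := sub_mem e1 e2
    rw [mul_smul]
    convert this using 1
    ring
  have := isIn_trivial hχ h _ h2
  rw [mul_inv_eq_one] at this
  exact this.symm

open Classical in
lemma tO_single (w w' : Pl L) (a : ℤ) : tO Gal(L/K) (Dv L) (Finsupp.single w a) w' =
    if dn K w' = dn K w then (Nat.card (MulAction.stabilizer Gal(L/K) w) : ℤ) * a else 0 := by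
  classical
  rw [tO_apply, Finsupp.finsetSum_apply]
  have hs : ∀ g : Gal(L/K), (g • (Finsupp.single w a : Dv L)) w' = if g • w = w' then a else 0 := by
    intro g
    rw [dvA_apply, Finsupp.single_apply]
    congr 1
    exact propext (eq_inv_smul_iff)
  simp only [hs]
  split_ifs with h
  · obtain ⟨g₀, rfl⟩ := exists_smul w w' h.symm
    rw [← Finset.sum_filter, Finset.sum_const, nsmul_eq_mul]
    congr 2
    rw [Nat.card_eq_fintype_card, Fintype.card_subtype]
    apply Finset.card_bij (fun g _ => g₀⁻¹ * g)
    · intro g hg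
      simp only [Finset.mem_filter, Finset.mem_univ, true_and, MulAction.mem_stabilizer_iff, mul_smul] at hg ⊢
      rw [hg, inv_smul_smul]
    · intro a _ b _ h; exact mul_left_cancel h
    · intro b hb
      simp only [Finset.mem_filter, Finset.mem_univ, true_and, MulAction.mem_stabilizer_iff] at hb
      exact ⟨g₀ * b, by simp [mul_smul, hb], by simp⟩
  · apply Finset.sum_eq_zero
    intro g _
    rw [if_neg]
    rintro rfl
    exact h (dn_smul g w)

lemma con_Nchi {χ : Gal(L/K) →* ℂˣ} (hχ : Function.Injective χ) {S : Finset (Pl K)} (hS : ∀ v ∉ S, Unr χ v)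
    {D : Dv K} (h : D ∈ Nchi χ) (hD : D ∈ DivS S) :
    ∃ E ∈ DivS (up L S), tO Gal(L/K) (Dv L) E = con L D := by
  classical
  -- choose
  choose s hs using fun v : Pl K => dn_surj (Ω := L) v
  have key : ∀ v : Pl K, ∃ a : ℤ, (v ∈ S → a = 0) ∧ (Nat.card (MulAction.stabilizer Gal(L/K) (s v)) : ℤ) * a = D v := by
    intro v
    by_cases hv : v ∈ S
    · exact ⟨0, fun _ => rfl, by rw [mul_zero, hD v hv]⟩
    · have h1 := card_stab_dvd hχ (w := s v) (by rw [hs]; exact hS v hv)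
      rw [hs] at h1
      obtain ⟨a, ha⟩ := (Int.natCast_dvd_natCast.2 h1).trans (h v)
      exact ⟨a, fun h => absurd h hv, ha.symm⟩
  choose a ha0 ha using key
  refine ⟨∑ v ∈ D.support, Finsupp.single (s v) (a v), ?_, ?_⟩
  · apply sum_mem
    intro v _ w hw
    rw [Finsupp.single_apply]
    split_ifs with hvw
    · apply ha0
      rw [mem_up, ← hvw, hs] at hw
      exact hw
    · rfl
  · ext w
    rw [map_sum, Finsupp.finsetSum_apply, con_apply]
    simp only [tO_single, hs, ha]
    rw [Finset.sum_ite_eq]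
    split_ifs with h
    · rfl
    · exact (Finsupp.notMem_support_iff.1 h).symm
end

section
variable {K : Type} [Field K] [NumberField K]
variable {L : Type} [Field L] [NumberField L] [Algebra K L] [IsGalois K L]

def sg : ℝˣ →* ℤˣ where
  toFun x := if 0 < (x : ℝ) then 1 else -1
  map_one' := by simp
  map_mul' x y := by
    rcases lt_or_gt_of_ne x.ne_zero with hx | hx <;> rcases lt_or_gt_of_ne y.ne_zero with hy | hy
    · simp [hx.not_gt, hy.not_gt, mul_pos_of_neg_of_neg hx hy]
    · simp [hx.not_gt, hy, (mul_neg_of_neg_of_pos hx hy).not_gt]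
    · simp [hx, hy.not_gt, (mul_neg_of_pos_of_neg hx hy).not_gt]
    · simp [hx, hy, mul_pos hx hy]

lemma sg_eq_one (x : ℝˣ) : sg x = 1 ↔ 0 < (x : ℝ) := by
  change (if 0 < (x : ℝ) then (1 : ℤˣ) else -1) = 1 ↔ _
  split_ifs with h <;> simp [h]

lemma rinf_real (v : RInf K L) : v.1.IsReal := by
  by_contra h
  apply v.2
  intro w hw
  by_contra hr
  obtain ⟨_, h2⟩ := InfinitePlace.isRamified_iff.1 hr
  rw [hw] at h2
  exact h h2

def rphi (v : RInf K L) : K →+* ℝ := InfinitePlace.embedding_of_isReal (rinf_real v)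

lemma rphi_abs (v : RInf K L) (x : K) : v.1 x = |rphi v x| := by
  rw [← InfinitePlace.norm_embedding_of_isReal (rinf_real v) x]; rfl

lemma rphi_no_lift (v : RInf K L) (ψ : L →+* ℝ) : ψ.comp (algebraMap K L) ≠ rphi v := by
  intro h
  apply v.2
  intro w hw
  have hreal : ∀ w : InfinitePlace L, w = InfinitePlace.mk (Complex.ofRealHom.comp ψ) → w.IsReal := by
    rintro _ rfl
    exact ⟨_, by
      rw [ComplexEmbedding.isReal_iff]
      ext x; simp [ComplexEmbedding.conjugate], rfl⟩
  have hc : (InfinitePlace.mk (Complex.ofRealHom.comp ψ)).comap (algebraMap K L) = v.1 := by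
    rw [InfinitePlace.comap_mk, RingHom.comp_assoc, h]
    ext x
    rw [rphi_abs]; simp
  have h1 := (InfinitePlace.isUnramifiedIn_comap (K := L) (k := K) (w := InfinitePlace.mk (Complex.ofRealHom.comp ψ))).2 (by
    by_contra hr
    obtain ⟨h3, _⟩ := InfinitePlace.isRamified_iff.1 hr
    exact (InfinitePlace.not_isComplex_iff_isReal.2 (hreal _ rfl)) h3)
  rw [hc] at h1
  exact h1 w hw

variable (K L) in
def sgn : Additive Kˣ →+ Additive (RInf K L → ℤˣ) :=
  MonoidHom.toAdditive (MonoidHom.mk' (fun x v => sg (Units.map (rphi v).toMonoidHom x))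
    (fun x y => by ext v; simp))

lemma sgn_eq_zero (x : Additive Kˣ) : sgn K L x = 0 ↔ ∀ v : RInf K L, 0 < rphi v (x.toMul : K) := by
  constructor
  · intro h v
    have : sg (Units.map (rphi v).toMonoidHom x.toMul) = 1 := congrFun (congrArg Additive.toMul h) v
    exact (sg_eq_one _).1 this
  · intro h
    apply Additive.toMul.injective
    funext v
    exact (sg_eq_one _).2 (h v)

lemma exists_sign (s : RInf K L → ℤˣ) : ∃ y : 𝓞 K, ∀ v : RInf K L, 0 < ((s v : ℤ) : ℝ) * rphi v (y : K) := by
  classical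
  let s' : InfinitePlace K → K := fun v => if h : ¬ v.IsUnramifiedIn L then ((s ⟨v, h⟩ : ℤ) : K) else 1
  have hd := InfinitePlace.denseRange_algebraMap_pi K
  obtain ⟨y, hy⟩ := hd.exists_dist_lt (fun v => WithAbs.toAbs v.1 (s' v)) zero_lt_one
  have hy2 : ∀ v : RInf K L, |((s v : ℤ) : ℝ) - rphi v y| < 1 := by
    intro v
    have := (dist_pi_lt_iff zero_lt_one).1 hy v.1
    rw [dist_eq_norm] at this
    have h2 : ‖WithAbs.toAbs v.1.1 (s' v.1) - (algebraMap K ((v : InfinitePlace K) → WithAbs v.1)) y v.1‖ = v.1 (s' v.1 - y) := rfl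
    rw [h2, rphi_abs, map_sub] at this
    have h3 : s' v.1 = ((s v : ℤ) : K) := dif_pos v.2
    rw [h3, map_intCast] at this
    exact this
  have hy3 : ∀ v : RInf K L, 0 < ((s v : ℤ) : ℝ) * rphi v y := by
    intro v
    have := abs_lt.1 (hy2 v)
    rcases Int.units_eq_one_or (s v) with h | h <;> rw [h] at this ⊢ <;> push_cast at this ⊢ <;>
      simp at this ⊢ <;> linarith
  obtain ⟨b, d, hd0, hbd⟩ := IsFractionRing.div_surjective (A := 𝓞 K) y
  refine ⟨b * d, fun v => ?_⟩
  have hd : (d : K) ≠ 0 := by simpa using nonZeroDivisors.ne_zero hd0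
  have : ((b * d : 𝓞 K) : K) = y * (d : K) ^ 2 := by
    rw [← hbd]; push_cast; field_simp
  rw [this, map_mul, map_pow, ← mul_assoc]
  have : rphi v (d : K) ≠ 0 := by simpa using hd
  have := hy3 v
  positivity

variable (L) in
lemma exists_sgn (S : Finset (Pl K)) (k : ℕ) (s : Additive (RInf K L → ℤˣ)) : ∃ a : Additive Kˣ, sgn K L a = s ∧
    ∀ w ∈ up L S, w.valuation L (algebraMap K L (a.toMul : K) - 1) ≤ WithZero.exp (-((k : ℤ) + 1)) := by
  classical
  obtain ⟨y, hy⟩ := exists_sign s.toMul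
  obtain ⟨c, hc0, hc⟩ := exists_small (up L S) k
  set N := Ideal.absNorm (Ideal.span {c}) with hN
  have hN0 : N ≠ 0 := by rw [hN, Ne, Ideal.absNorm_eq_zero_iff]; simpa using hc0
  have hNc : c ∣ (N : 𝓞 L) := by
    rw [← Ideal.mem_span_singleton]; exact Ideal.absNorm_mem _
  obtain ⟨j, hj⟩ : ∃ j : ℕ, ∀ v : RInf K L, 1 < (j : ℝ) * |rphi v (y : K)| := by
    obtain ⟨j, hj⟩ := exists_nat_gt (∑ v : RInf K L, 1 / |rphi v (y : K)|)
    refine ⟨j, fun v => ?_⟩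
    have hpos : 0 < |rphi v (y : K)| := abs_pos.2 (fun h => by have := hy v; rw [h, mul_zero] at this; exact lt_irrefl _ this)
    rw [← div_lt_iff₀ hpos]
    refine lt_of_le_of_lt ?_ hj
    exact Finset.single_le_sum (f := fun v : RInf K L => 1 / |rphi v (y : K)|) (fun i _ => by positivity) (Finset.mem_univ v)
  set a : K := 1 + (N : K) * (j : K) * y with ha
  have hs : ∀ v : RInf K L, 0 < (((s.toMul) v : ℤ) : ℝ) * rphi v a := by
    intro v
    have h1 := hj v
    have h2 := hy v
    have hN1 : (1 : ℝ) ≤ N := by exact_mod_cast Nat.pos_of_ne_zero hN0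
    rw [ha]
    simp only [map_add, map_mul, map_one, map_natCast]
    rcases Int.units_eq_one_or (s.toMul v) with h | h <;> rw [h] at h2 ⊢ <;> push_cast at h2 ⊢
    · rw [one_mul] at h2 ⊢
      positivity
    · have h2' : rphi v (y : K) < 0 := by linarith
      rw [abs_of_neg h2'] at h1
      nlinarith
  have hne : ∀ w ∈ up L S, w.valuation L (algebraMap K L a - 1) ≤ WithZero.exp (-((k : ℤ) + 1)) := by
    intro w hw
    obtain ⟨e, he⟩ := hNc
    have : algebraMap K L a - 1 = algebraMap (𝓞 L) L (c * (e * (j : 𝓞 L) * algebraMap (𝓞 K) (𝓞 L) y)) := by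
      have e1 : ((N : ℕ) : L) = algebraMap (𝓞 L) L (c * e) := by rw [← he]; simp
      rw [ha]
      simp only [map_add, map_mul, map_one, map_natCast] at e1 ⊢
      rw [e1]
      have : algebraMap K L (y : K) = algebraMap (𝓞 L) L (algebraMap (𝓞 K) (𝓞 L) y) := rfl
      rw [this]; ring
    rw [this, HeightOneSpectrum.valuation_of_algebraMap, map_mul]
    refine le_trans (mul_le_of_le_one_right' (HeightOneSpectrum.intValuation_le_one _ _)) ?_
    have := hc w hw
    rwa [← HeightOneSpectrum.valuation_of_algebraMap (K := L)]
  have ha0 : a ≠ 0 ∨ IsEmpty (RInf K L) := by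
    by_cases h : IsEmpty (RInf K L)
    · exact Or.inr h
    · left
      rw [not_isEmpty_iff] at h
      obtain ⟨v⟩ := h
      intro h0
      have := hs v
      rw [h0, map_zero, mul_zero] at this
      exact lt_irrefl _ this
  rcases ha0 with ha0 | he
  · refine ⟨Additive.ofMul (Units.mk0 a ha0), ?_, hne⟩
    apply Additive.toMul.injective
    funext v
    change sg _ = _
    have h := hs v
    rcases Int.units_eq_one_or (s.toMul v) with h1 | h1 <;> rw [h1] at h ⊢ <;> push_cast at h
    · rw [sg_eq_one]; simpa using h
    · change (if _ then (1 : ℤˣ) else -1) = _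
      rw [if_neg]
      change ¬ (0 < rphi v a)
      linarith
  · refine ⟨0, ?_, ?_⟩
    · apply Additive.toMul.injective
      funext v
      exact he.elim v
    · intro w hw; simp
end

/-! ### The first inequality -/
section
variable {K : Type} [Field K] [NumberField K]
variable {L : Type} [Field L] [NumberField L] [Algebra K L] [IsGalois K L]
variable {S : Finset (Pl K)} {π B c : K}

lemma map_tO {G A A' : Type} [Group G] [Finite G] [AddCommGroup A] [DistribMulAction G A] [AddCommGroup A'] [DistribMulAction G A']
    (d : A →+ A') (h : ∀ (g : G) x, d (g • x) = g • d x) (x : A) : d (tO G A x) = tO G A' (d x) := by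
  have := Fintype.ofFinite G
  simp only [tO_apply, map_sum, h]

lemma map_dO {G A A' : Type} [Group G] [Finite G] [AddCommGroup A] [DistribMulAction G A] [AddCommGroup A'] [DistribMulAction G A']
    (d : A →+ A') (h : ∀ (g : G) x, d (g • x) = g • d x) (σ : G) (x : A) : d (dO A σ x) = dO A' σ (d x) := by
  simp only [dO_apply, map_sub, h]

def VL (H : Gd L S π B c) : AddSubgroup (Additive Lˣ) where
  carrier := {x | (x.toMul : L) - 1 ∈ NL S c}
  zero_mem' := by
    change ((1 : Lˣ) : L) - 1 ∈ NL (L := L) S c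
    simp [zero_mem]
  add_mem' := by
    intro x y hx hy
    have hx' : (x.toMul : L) - 1 ∈ NL S c := hx
    have hy' : (y.toMul : L) - 1 ∈ NL S c := hy
    have := add_mem (H.mul1 hx' hy') hy'
    change (x.toMul : L) * (y.toMul : L) - 1 ∈ NL (L := L) S c
    convert this using 1; ring
  neg_mem' := by
    intro x hx
    have hx' : (x.toMul : L) - 1 ∈ NL S c := hx
    change ((x.toMul⁻¹ : Lˣ) : L) - 1 ∈ NL (L := L) S c
    rcases S.eq_empty_or_nonempty with rfl | hS
    · intro v hv; simp at hv
    · have := (H.inv hS hx').2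
      rw [add_sub_cancel] at this
      simpa using this

lemma mem_VL {H : Gd L S π B c} {x : Additive Lˣ} : x ∈ VL H ↔ (x.toMul : L) - 1 ∈ NL S c := Iff.rfl

lemma VL_gal (H : Gd L S π B c) {x : Additive Lˣ} (hx : x ∈ VL H) (g : Gal(L/K)) : g • x ∈ VL H := by
  rw [mem_VL] at hx ⊢
  have := NL_gal hx g
  rw [map_sub, map_one] at this
  exact this

instance VLact (H : Gd L S π B c) : DistribMulAction Gal(L/K) (VL H) where
  smul g x := ⟨g • x.1, VL_gal H x.2 g⟩
  one_smul x := Subtype.ext (one_smul _ x.1)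
  mul_smul g h x := Subtype.ext (mul_smul g h x.1)
  smul_zero g := Subtype.ext (smul_zero g)
  smul_add g x y := Subtype.ext (smul_add g x.1 y.1)

variable (L) in
/-- divisors of `L` away from `S` -/
abbrev DL (S : Finset (Pl K)) := DivS (up L S)

instance DLact (S : Finset (Pl K)) : DistribMulAction Gal(L/K) (DL L S) where
  smul g x := ⟨g • x.1, DivS_gal g S x.2⟩
  one_smul x := Subtype.ext (one_smul _ x.1)
  mul_smul g h x := Subtype.ext (mul_smul g h x.1)
  smul_zero g := Subtype.ext (smul_zero g)
  smul_add g x y := Subtype.ext (smul_add g x.1 y.1)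

def dA (L : Type) [Field L] [NumberField L] : Additive Lˣ →+ Dv L where
  toFun x := dv (x.toMul : L)
  map_zero' := dv_one
  map_add' x y := dv_mul x.toMul.ne_zero y.toMul.ne_zero

lemma dA_gal (g : Gal(L/K)) (x : Additive Lˣ) : dA L (g • x) = g • dA L x := dv_gal g x.toMul.ne_zero

lemma dA_VL {H : Gd L S π B c} (hw : ∀ x ∈ NL S c, ∀ w ∈ up L S, w.valuation L x < 1) {x : Additive Lˣ}
    (hx : x ∈ VL H) : dA L x ∈ DivS (up L S) := by
  intro w hwS
  exact (dv_apply_eq_zero_iff w x.toMul.ne_zero).2 (val_one_of_near w (hw _ hx w hwS))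

def iO (L : Type) [Field L] [NumberField L] : Additive (𝓞 L)ˣ →+ Additive Lˣ :=
  MonoidHom.toAdditive (Units.map (algebraMap (𝓞 L) L).toMonoidHom)

lemma iO_inj : Function.Injective (iO L) := by
  intro x y h
  apply Additive.toMul.injective
  apply Units.ext
  have : ((iO L x).toMul : L) = (iO L y).toMul := by rw [h]
  exact RingOfIntegers.coe_injective this

lemma iO_gal (g : Gal(L/K)) (x : Additive (𝓞 L)ˣ) : iO L (g • x) = g • iO L x := by
  apply Additive.toMul.injective
  apply Units.ext
  rfl

lemma dA_ker (x : Additive Lˣ) : dA L x = 0 ↔ ∃ u, iO L u = x := by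
  constructor
  · intro h
    have h1 : ∀ w : Pl L, w.valuation L (x.toMul : L) = 1 := fun w =>
      (dv_apply_eq_zero_iff w x.toMul.ne_zero).1 (DFunLike.congr_fun h w)
    have h2 : ∀ y : Lˣ, (∀ w : Pl L, w.valuation L (y : L) = 1) → ∃ a : 𝓞 L, (a : L) = y := by
      intro y hy
      obtain ⟨a, ha⟩ := HeightOneSpectrum.mem_integers_of_valuation_le_one (R := 𝓞 L) L (y : L) (fun w => (hy w).le)
      exact ⟨a, ha⟩
    obtain ⟨a, ha⟩ := h2 x.toMul h1
    obtain ⟨b, hb⟩ := h2 x.toMul⁻¹ (fun w => by simp [h1 w])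
    refine ⟨Additive.ofMul ⟨a, b, ?_, ?_⟩, ?_⟩
    · apply RingOfIntegers.coe_injective; rw [map_mul, map_one]; change (a : L) * (b : L) = 1; rw [ha, hb]; simp
    · apply RingOfIntegers.coe_injective; rw [map_mul, map_one]; change (b : L) * (a : L) = 1; rw [ha, hb]; simp
    · apply Additive.toMul.injective
      apply Units.ext
      exact ha
  · rintro ⟨u, rfl⟩
    ext w
    apply (dv_apply_eq_zero_iff w (iO L u).toMul.ne_zero).2
    change w.valuation L (algebraMap (𝓞 L) L (u.toMul : 𝓞 L)) = 1
    rw [HeightOneSpectrum.valuation_of_algebraMap]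
    have h1 := w.intValuation_le_one (u.toMul : 𝓞 L)
    have h2 := w.intValuation_le_one ((u.toMul⁻¹ : (𝓞 L)ˣ) : 𝓞 L)
    have h3 : w.intValuation (u.toMul : 𝓞 L) * w.intValuation ((u.toMul⁻¹ : (𝓞 L)ˣ) : 𝓞 L) = 1 := by
      rw [← map_mul]; simp
    refine le_antisymm h1 ?_
    rw [← h3]
    exact mul_le_of_le_one_right' h2

variable (L) in
def iK : Additive Kˣ →+ Additive Lˣ :=
  MonoidHom.toAdditive (Units.map (algebraMap K L).toMonoidHom)

lemma iK_inj : Function.Injective (iK (K := K) L) := by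
  intro x y h
  apply Additive.toMul.injective
  apply Units.ext
  have : ((iK L x).toMul : L) = (iK L y).toMul := by rw [h]
  exact (algebraMap K L).injective this

lemma iK_fix {σ : Gal(L/K)} (hσ : ∀ g, ∃ i : ℕ, σ ^ i = g) (x : Additive Lˣ) (h : σ • x = x) : ∃ a : Additive Kˣ, iK L a = x := by
  have h1 : ∀ g : Gal(L/K), g (x.toMul : L) = (x.toMul : L) := by
    intro g
    have := fix_all hσ h g
    exact congrArg (fun z : Additive Lˣ => (z.toMul : L)) this
  have h2 : (x.toMul : L) ∈ (⊥ : IntermediateField K L) :=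
    IsGalois.mem_bot_iff_fixed (F := K) (E := L) _ |>.2 h1
  obtain ⟨a, ha⟩ := IntermediateField.mem_bot.1 h2
  have ha0 : a ≠ 0 := by rintro rfl; rw [map_zero] at ha; exact x.toMul.ne_zero ha.symm
  exact ⟨Additive.ofMul (Units.mk0 a ha0), Additive.toMul.injective (Units.ext ha)⟩

lemma tO_iK (x : Additive Lˣ) : tO Gal(L/K) (Additive Lˣ) x =
    iK L (Additive.ofMul (Units.mk0 (Algebra.norm K (x.toMul : L)) (by
      rw [Algebra.norm_ne_zero_iff]; exact x.toMul.ne_zero))) := by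
  apply Additive.toMul.injective
  apply Units.ext
  rw [tO_apply, toMul_sum, Units.coe_prod]
  exact (Algebra.norm_eq_prod_automorphisms K (x.toMul : L)).symm

lemma units_index (H : Gd L S π B c) {k : ℕ}
    (hk : ∀ y : L, (∀ w ∈ up L S, w.valuation L y ≤ WithZero.exp (-((k : ℤ) + 1))) → y ∈ NL S c) :
    ((VL H).comap (iO L)).index ≠ 0 := by
  obtain ⟨a, ha0, ha⟩ := exists_small (up L S) k
  set I := Ideal.span {a}
  have : Finite (𝓞 L ⧸ I) := Ideal.finiteQuotientOfFreeOfNeBot _ (by simpa [I] using ha0)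
  let q : Additive (𝓞 L)ˣ →+ Additive (𝓞 L ⧸ I)ˣ := MonoidHom.toAdditive (Units.map (Ideal.Quotient.mk I).toMonoidHom)
  have h1 : q.ker.index ≠ 0 := by
    rw [AddSubgroup.index_ker]
    exact Nat.card_ne_zero.2 ⟨⟨0⟩, inferInstance⟩
  have h2 : q.ker ≤ (VL H).comap (iO L) := by
    intro u hu
    have h3 : Ideal.Quotient.mk I (u.toMul : 𝓞 L) = 1 := congrArg (fun z : Additive (𝓞 L ⧸ I)ˣ => (z.toMul : 𝓞 L ⧸ I)) hu
    rw [← map_one (Ideal.Quotient.mk I), Ideal.Quotient.eq, Ideal.mem_span_singleton] at h3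
    obtain ⟨b, hb⟩ := h3
    apply hk
    intro w hw
    have : ((iO L u).toMul : L) - 1 = algebraMap (𝓞 L) L (a * b) := by rw [← hb]; simp; rfl
    rw [this, map_mul, map_mul]
    refine le_trans (mul_le_of_le_one_right' (HeightOneSpectrum.valuation_le_one _ _)) (ha w hw)
  intro h
  have := AddSubgroup.index_dvd_of_le h2
  rw [h] at this
  exact h1 (Nat.eq_zero_of_zero_dvd this)
end

section
variable {K : Type} [Field K] [NumberField K]
variable {L : Type} [Field L] [NumberField L] [Algebra K L] [IsGalois K L]

theorem first_ineq {σ : Gal(L/K)} (hσ : ∀ g, ∃ i : ℕ, σ ^ i = g) {χ : Gal(L/K) →* ℂˣ} (hχ : Function.Injective χ)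
    (S : Finset (Pl K)) (hS : ∀ v ∉ S, Unr χ v) :
    ∃ k, Nat.card Gal(L/K) ≤ (PR S k ⊔ (Nchi χ ⊓ DivS S)).relIndex (DivS S) := by
  classical
  obtain ⟨π, B, c, H, hw, k, hk⟩ := exists_Gd L S
  refine ⟨k, ?_⟩
  set n := Nat.card Gal(L/K) with hn
  have hn0 : n ≠ 0 := Nat.card_pos.ne'
  set A := PR S k ⊔ (Nchi χ ⊓ DivS S) with hA
  set r := Nat.card (RInf K L)
  have hAD : A.relIndex (DivS S) ≠ 0 := by
    intro h
    have := AddSubgroup.relIndex_dvd_of_le_left (DivS S) (show PR S k ≤ A from le_sup_left)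
    rw [h] at this
    exact finiteIndex_PR S k (Nat.eq_zero_of_zero_dvd this)
  -- the data
  let U := VL H
  let J := DL L S
  let f := dO U σ
  let g := tO Gal(L/K) U
  let f' := dO J σ
  let g' := tO Gal(L/K) J
  let d : U →+ J := ((dA L).comp U.subtype).codRestrict J (fun x => dA_VL hw x.2)
  have hd : ∀ (τ : Gal(L/K)) x, d (τ • x) = τ • d x := fun τ x => Subtype.ext (dA_gal τ x.1)
  -- elements from K
  have hbase : ∀ a : Additive Kˣ, (∀ w ∈ up L S, w.valuation L (algebraMap K L (a.toMul : K) - 1) ≤ WithZero.exp (-((k : ℤ) + 1))) →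
      iK L a ∈ U := fun a ha => hk _ ha
  let VK : AddSubgroup (Additive Kˣ) := U.comap (iK L)
  let iU : VK →+ U := ((iK L).comp VK.subtype).codRestrict U (fun x => x.2)
  have hiU : Function.Injective iU := fun x y h => Subtype.ext (iK_inj (congrArg Subtype.val h))
  have hiUfix : ∀ (τ : Gal(L/K)) x, τ • iU x = iU x := fun τ x => Subtype.ext
    (Additive.toMul.injective (Units.ext (τ.commutes (x.1.toMul : K))))
  have hfker : f.ker = (⊤ : AddSubgroup VK).map iU := by
    ext x
    constructor
    · intro hx
      have hx' : x - σ • x = 0 := hx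
      have hx2 : σ • x.1 = x.1 := congrArg Subtype.val (sub_eq_zero.1 hx').symm
      obtain ⟨a, ha⟩ := iK_fix hσ x.1 hx2
      exact ⟨⟨a, by change iK L a ∈ U; rw [ha]; exact x.2⟩, trivial, Subtype.ext ha⟩
    · rintro ⟨y, _, rfl⟩
      change iU y - σ • iU y = 0
      rw [hiUfix, sub_self]
  let sV : VK →+ Additive (RInf K L → ℤˣ) := (sgn K L).comp VK.subtype
  let K' : AddSubgroup U := sV.ker.map iU
  have hK' : K' ≤ f.ker := by rw [hfker]; exact AddSubgroup.map_mono le_top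
  have hK'idx : K'.relIndex f.ker = 2 ^ r := by
    rw [hfker, relIndex_map', (AddMonoidHom.ker_eq_bot_iff iU).2 hiU, sup_bot_eq, AddSubgroup.relIndex_ker]
    have : (⊤ : AddSubgroup VK).map sV = ⊤ := by
      rw [eq_top_iff]
      intro s _
      obtain ⟨a, ha, ha2⟩ := exists_sgn L S k s
      exact ⟨⟨a, hbase a ha2⟩, trivial, ha⟩
    rw [this, AddSubgroup.card_top]
    change Nat.card (RInf K L → ℤˣ) = _
    rw [Nat.card_fun]
    simp [r]
  have hgK : g.range ≤ K' := by
    rintro _ ⟨x, rfl⟩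
    have h1 : (g x).1 = iK L _ := (map_tO U.subtype (fun _ _ => rfl) x).trans (tO_iK x.1)
    refine ⟨⟨_, by have h2 := (g x).2; rw [h1] at h2; exact h2⟩, ?_, Subtype.ext h1.symm⟩
    change sgn K L _ = 0
    rw [sgn_eq_zero]
    intro v
    exact norm_pos_of x.1.toMul.ne_zero (fun ψ h => absurd h (rphi_no_lift v ψ))
  have h90 : g.ker ≤ f.range := by
    intro x hx
    have h1 : (g x).1 = _ := (map_tO U.subtype (fun _ _ => rfl) x).trans (tO_iK x.1)
    have hx' : g x = 0 := hx
    rw [hx'] at h1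
    have h2 : Algebra.norm K (x.1.toMul : L) = 1 := by
      have h3 : iK L (0 : Additive Kˣ) = iK L _ := (map_zero _).trans h1
      have h4 := iK_inj h3
      have := congrArg (fun z : Additive Kˣ => (z.toMul : K)) h4
      exact this.symm
    obtain ⟨u, hu0, hu1, hu⟩ := H.h90 hσ x.2 h2
    refine ⟨⟨Additive.ofMul (Units.mk0 u hu0), hu1⟩, Subtype.ext (Additive.toMul.injective (Units.ext ?_))⟩
    rw [hu]
    change ((Units.mk0 u hu0 / (σ • (Additive.ofMul (Units.mk0 u hu0) : Additive Lˣ)).toMul : Lˣ) : L) = _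
    rw [Units.val_div_eq_div_val]
    rfl
  have hfin : d.range.index ≠ 0 := by
    have h1 := finiteIndex_PR (up L S) k
    have h2 : (PR (up L S) k).addSubgroupOf (DivS (up L S)) ≤ d.range := by
      intro D hD
      obtain ⟨t, ht, htD⟩ := mem_PR.1 (AddSubgroup.mem_addSubgroupOf.1 hD)
      exact ⟨⟨Additive.ofMul t, hk _ (fun w hw => ht.1 w hw)⟩, Subtype.ext htD⟩
    intro h
    have := AddSubgroup.index_dvd_of_le h2
    rw [h] at this
    exact h1 (Nat.eq_zero_of_zero_dvd this)
  -- units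
  let O := Additive (𝓞 L)ˣ
  let E : AddSubgroup O := U.comap (iO L)
  have hE : E.map (iO L) = d.ker.map U.subtype := by
    ext x
    constructor
    · rintro ⟨u, hu, rfl⟩
      exact ⟨⟨iO L u, hu⟩, Subtype.ext ((dA_ker _).2 ⟨u, rfl⟩), rfl⟩
    · rintro ⟨y, hy, rfl⟩
      obtain ⟨u, hu⟩ := (dA_ker y.1).1 (congrArg Subtype.val hy)
      exact ⟨u, by change iO L u ∈ U; rw [hu]; exact y.2, hu⟩
  have hUs : ∀ (τ : Gal(L/K)) (x : U), U.subtype (τ • x) = τ • U.subtype x := fun _ _ => rfl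
  have ha : (d.ker.map f).relIndex (d.ker ⊓ g.ker) = (E.map (dO O σ)).relIndex (E ⊓ (tO Gal(L/K) O).ker) := by
    rw [← tate_transfer U.subtype U.subtype_injective f g _ _ (map_dO _ hUs σ) (map_tO _ hUs),
      ← tate_transfer (iO L) iO_inj _ _ _ _ (map_dO _ iO_gal σ) (map_tO _ iO_gal), hE]
  have hb : (d.ker.map g).relIndex (d.ker ⊓ f.ker) = (E.map (tO Gal(L/K) O)).relIndex (E ⊓ (dO O σ).ker) := by
    rw [← tate_transfer U.subtype U.subtype_injective g f _ _ (map_tO _ hUs) (map_dO _ hUs σ),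
      ← tate_transfer (iO L) iO_inj _ _ _ _ (map_tO _ iO_gal) (map_dO _ iO_gal σ), hE]
  have hEg : ∀ (τ : Gal(L/K)), ∀ x ∈ E, τ • x ∈ E := by
    intro τ x hx
    change iO L (τ • x) ∈ U
    rw [iO_gal]; exact VL_gal H hx τ
  have hherb := herbrand (dO O σ) (tO Gal(L/K) O) (dO_tO σ) (tO_dO σ) E
    (fun x hx => sub_mem hx (hEg σ x hx)) (fun x hx => by
      rw [tO_apply]; exact sum_mem (fun τ _ => hEg τ x hx)) (units_index H hk)
  have hunit := unit_herb (L := L) hσ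
  have hOfin : Module.Finite ℤ O := inferInstance
  have hb0 : (E.map (tO Gal(L/K) O)).relIndex (E ⊓ (dO O σ).ker) ≠ 0 := by
    apply relIndex_ne_zero_of_fg _ _ n hn0
    rintro x ⟨hx, hx2⟩
    have hx3 : x - σ • x = 0 := hx2
    exact ⟨x, hx, tO_fix hσ (sub_eq_zero.1 hx3).symm⟩
  have h00 : (tO Gal(L/K) O).range.relIndex (dO O σ).ker ≠ 0 := by
    apply relIndex_ne_zero_of_fg _ _ n hn0
    rintro x hx2
    have hx3 : x - σ • x = 0 := hx2
    exact ⟨x, tO_fix hσ (sub_eq_zero.1 hx3).symm⟩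
  have habs := abs_index f g f' g' d (map_dO d hd σ) (map_tO d hd) (dO_tO σ) (tO_dO σ) K' hK' hgK (tO_dO σ) h90 hfin
    (by rw [inf_comm, hb]; exact hb0)
  rw [inf_comm g.ker, inf_comm f.ker, ha, hb, hK'idx] at habs
  -- index of X
  let conJ : DivS S →+ J := ((con L).comp (DivS S).subtype).codRestrict J (fun x => (con_DivS S x.1).2 x.2)
  have hcinj : Function.Injective conJ := fun x y h => Subtype.ext (con_inj (congrArg Subtype.val h))
  have hf'ker : f'.ker = (⊤ : AddSubgroup (DivS S)).map conJ := by
    ext x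
    constructor
    · intro hx
      have hx' : x - σ • x = 0 := hx
      have hx2 : σ • x.1 = x.1 := congrArg Subtype.val (sub_eq_zero.1 hx').symm
      obtain ⟨a, ha⟩ := con_surj (fix_all hσ hx2)
      exact ⟨⟨a, (con_DivS (L := L) S a).1 (by rw [ha]; exact x.2)⟩, trivial, Subtype.ext ha⟩
    · rintro ⟨y, _, rfl⟩
      change conJ y - σ • conJ y = 0
      rw [show σ • conJ y = conJ y from Subtype.ext (con_fix σ y.1), sub_self]
  have hX : (A.addSubgroupOf (DivS S)).map conJ ≤ K'.map d ⊔ g'.range := by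
    rintro _ ⟨⟨D, hDS⟩, hD, rfl⟩
    have hD' : D ∈ A := hD
    obtain ⟨P, hP, Q, hQ, hPQ⟩ := AddSubgroup.mem_sup.1 hD'
    have hPS := PR_le_DivS S k hP
    have : conJ ⟨D, hDS⟩ = conJ ⟨P, hPS⟩ + conJ ⟨Q, hQ.2⟩ := by
      rw [← map_add]; congr 1; exact Subtype.ext hPQ.symm
    rw [this]
    apply add_mem
    · apply AddSubgroup.mem_sup_left
      obtain ⟨t, ht, htP⟩ := mem_PR.1 hP
      have htV : iK L (Additive.ofMul t) ∈ U := by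
        apply hbase
        intro w hw
        have h1 := (ht.1 (dn K w) (mem_up.1 hw))
        obtain ⟨e, he0, he⟩ := val_up w ((t : K) - 1)
        rw [map_sub, map_one] at he
        change w.valuation L (algebraMap K L (t : K) - 1) ≤ _
        rw [he]
        refine le_trans ?_ h1
        apply pow_le_of_le_one zero_le _ he0
        refine h1.trans (exp_lt_one'.2 (by omega)).le
      refine ⟨iU ⟨Additive.ofMul t, htV⟩, ⟨⟨Additive.ofMul t, htV⟩, (sgn_eq_zero (Additive.ofMul t)).2 (fun v => ht.2 (rphi v)), rfl⟩, Subtype.ext ?_⟩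
      change dv (algebraMap K L (t : K)) = con L P
      ext w
      rw [con_apply]
      by_cases hwS : dn K w ∈ S
      · have h1 := dA_VL hw htV w (mem_up.2 hwS)
        rw [hPS _ hwS]
        exact h1
      · rw [dv_base w (isIn_trivial hχ (hS _ hwS)) t.ne_zero, htP]
    · apply AddSubgroup.mem_sup_right
      obtain ⟨E, hE, hE2⟩ := con_Nchi hχ hS hQ.1 hQ.2
      exact ⟨⟨E, hE⟩, Subtype.ext ((map_tO (DivS (up L S)).subtype (fun _ _ => rfl) (⟨E, hE⟩ : J)).trans hE2)⟩
  have hXle : (K'.map d ⊔ g'.range).relIndex f'.ker ≤ A.relIndex (DivS S) := by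
    have h1 := AddSubgroup.relIndex_dvd_of_le_left f'.ker hX
    have h2 : ((A.addSubgroupOf (DivS S)).map conJ).relIndex f'.ker = A.relIndex (DivS S) := by
      rw [hf'ker, relIndex_map', (AddMonoidHom.ker_eq_bot_iff conJ).2 hcinj, sup_bot_eq, AddSubgroup.relIndex_top_right]
      rfl
    rw [h2] at h1
    exact Nat.le_of_dvd (Nat.pos_of_ne_zero hAD) h1
  -- conclusion
  set a := (E.map (dO O σ)).relIndex (E ⊓ (tO Gal(L/K) O).ker)
  set b := (E.map (tO Gal(L/K) O)).relIndex (E ⊓ (dO O σ).ker)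
  set h0 := (tO Gal(L/K) O).range.relIndex (dO O σ).ker
  set h1 := (dO O σ).range.relIndex (tO Gal(L/K) O).ker
  set X := (K'.map d ⊔ g'.range).relIndex f'.ker
  have e1 : h0 * (n * b) ≤ h0 * (2 ^ r * a) := by
    calc h0 * (n * b) = (n * h0) * b := by ring
      _ ≤ (2 ^ r * h1) * b := Nat.mul_le_mul_right _ hunit
      _ = 2 ^ r * (h1 * b) := by ring
      _ = 2 ^ r * (h0 * a) := by rw [hherb]
      _ = _ := by ring
  have e2 : n * b ≤ 2 ^ r * a := Nat.le_of_mul_le_mul_left e1 (Nat.pos_of_ne_zero h00)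
  have e3 : n * b ≤ X * b := by rw [mul_comm (2 ^ r)] at e2; exact e2.trans habs
  exact (Nat.le_of_mul_le_mul_right e3 (Nat.pos_of_ne_zero hb0)).trans hXle
end

/-! ### Weak Chebotarev -/
section
variable {K : Type} [Field K] [NumberField K]
variable {Ω : Type} [Field Ω] [NumberField Ω] [Algebra K Ω] [IsGalois K Ω]

variable (K Ω) in
lemma finite_ram : ∃ S : Finset (Pl K), ∀ P : Pl Ω, dn K P ∉ S → ∀ g : Gal(Ω/K), IsIn P g → g = 1 := by
  classical
  have h1 : ∀ g : Gal(Ω/K), ∃ T : Finset (Pl Ω), g ≠ 1 → ∀ P ∉ T, ¬ IsIn P g := by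
    intro g
    by_cases hg : g = 1
    · exact ⟨∅, fun h => absurd hg h⟩
    have : ∃ x : 𝓞 Ω, g • x - x ≠ 0 := by
      by_contra hcon
      push Not at hcon
      apply hg
      ext y
      obtain ⟨a, b, hb, rfl⟩ := IsFractionRing.div_surjective (A := 𝓞 Ω) y
      have h : ∀ a : 𝓞 Ω, g (algebraMap (𝓞 Ω) Ω a) = algebraMap (𝓞 Ω) Ω a := fun a => by
        have := hcon a
        rw [sub_eq_zero] at this
        conv_rhs => rw [← this]
        rfl
      rw [map_div₀, h, h]; rfl
    obtain ⟨x, hx⟩ := this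
    have hfin : {P : Pl Ω | P.asIdeal ∣ Ideal.span {g • x - x}}.Finite :=
      Ideal.finite_factors (by simpa using hx)
    refine ⟨hfin.toFinset, fun _ P hP h => hP ?_⟩
    rw [Set.Finite.mem_toFinset]
    exact Ideal.dvd_span_singleton.2 (h x)
  choose T hT using h1
  refine ⟨(Finset.univ.biUnion T).image (dn K), fun P hP g hg => ?_⟩
  by_contra h
  apply hP
  rw [Finset.mem_image]
  refine ⟨P, ?_, rfl⟩
  by_contra hPT
  exact hT g h P (fun h2 => hPT (Finset.mem_biUnion.2 ⟨g, Finset.mem_univ _, h2⟩)) hg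

lemma exists_unr (χ : Gal(Ω/K) →* ℂˣ) : ∃ S : Finset (Pl K), ∀ v ∉ S, Unr χ v := by
  obtain ⟨S, hS⟩ := finite_ram K Ω
  refine ⟨S, fun v hv P hP g hg => ?_⟩
  rw [hS P (by rwa [hP]) g hg, map_one]

lemma exists_descend (χ : Gal(Ω/K) →* ℂˣ) : ∃ (M : IntermediateField K Ω) (_ : IsGalois K M) (χ' : Gal(M/K) →* ℂˣ),
    Function.Injective χ' ∧ χ'.comp (rs : Gal(Ω/K) →* Gal(M/K)) = χ ∧ M.fixingSubgroup = χ.ker := by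
  let M := IntermediateField.fixedField χ.ker
  have hG : IsGalois K M := IsGalois.of_fixedField_normal_subgroup χ.ker
  have hfix : M.fixingSubgroup = χ.ker := IntermediateField.fixingSubgroup_fixedField _
  have hker : (rs : Gal(Ω/K) →* Gal(M/K)).ker = χ.ker := by
    rw [← hfix]; exact IntermediateField.restrictNormalHom_ker M
  let χ' : Gal(M/K) →* ℂˣ := (rs : Gal(Ω/K) →* Gal(M/K)).liftOfSurjective rs_surj ⟨χ, hker.le⟩
  have hc : χ'.comp (rs : Gal(Ω/K) →* Gal(M/K)) = χ := by
    ext1 x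
    exact (rs : Gal(Ω/K) →* Gal(M/K)).liftOfRightInverse_comp_apply _ (Function.rightInverse_surjInv rs_surj) _ x
  refine ⟨M, hG, χ', ?_, hc, hfix⟩
  rw [injective_iff_map_eq_one]
  intro a ha
  obtain ⟨b, rfl⟩ := rs_surj (Ω := Ω) a
  have : b ∈ χ.ker := by
    rw [← hc]; exact ha
  rw [← hker] at this
  exact this

lemma exists_gen {G : Type} [Group G] [Finite G] {χ : G →* ℂˣ} (hχ : Function.Injective χ) : ∃ σ : G, ∀ g, ∃ i : ℕ, σ ^ i = g := by
  have : IsCyclic G := isCyclic_of_injective_ringHom ((Units.coeHom ℂ).comp χ) (Units.val_injective.comp hχ)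
  obtain ⟨σ, h⟩ := IsCyclic.exists_monoid_generator (α := G)
  exact ⟨σ, fun g => h g⟩

/-- first inequality for arbitrary characters -/
theorem first_ineq' (χ : Gal(Ω/K) →* ℂˣ) (S : Finset (Pl K)) (hS : ∀ v ∉ S, Unr χ v) :
    ∃ k, Nat.card χ.range ≤ (PR S k ⊔ (Nchi χ ⊓ DivS S)).relIndex (DivS S) := by
  obtain ⟨M, hM, χ', hinj, hc, hfix⟩ := exists_descend χ
  obtain ⟨σ, hσ⟩ := exists_gen hinj
  have hS' : ∀ v ∉ S, Unr χ' v := fun v hv => Unr.descend (Ω := Ω) (by rw [hc]; exact hS v hv)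
  obtain ⟨k, hk⟩ := first_ineq hσ hinj S hS'
  refine ⟨k, ?_⟩
  have h1 : Nchi χ' ⊓ DivS S = Nchi χ ⊓ DivS S := by
    ext D
    simp only [AddSubgroup.mem_inf, mem_Nchi]
    refine and_congr_left (fun hD => forall_congr' fun v => ?_)
    by_cases hv : v ∈ S
    · rw [hD v hv]; simp
    · have : fr χ v = fr χ' v := by
        have h := fr_descend (Ω := Ω) (χ := χ') (v := v) (by rw [hc]; exact hS v hv)
        rw [hc] at h; first | exact h | exact h.symm
      rw [this]
  rw [h1] at hk
  refine le_trans (le_of_eq ?_) hk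
  have h2 : χ.range = χ'.range := by
    rw [← hc, MonoidHom.range_comp, MonoidHom.range_eq_top.2 rs_surj, ← MonoidHom.range_eq_map]
  rw [h2]
  exact Nat.card_congr (MonoidHom.ofInjective hinj).symm.toEquiv

theorem weak_cheb (χ : Gal(Ω/K) →* ℂˣ) (T : Finset (Pl K)) (h : ∀ v ∉ T, fr χ v = 1) : χ = 1 := by
  classical
  obtain ⟨S, hS⟩ := exists_unr χ
  obtain ⟨k, hk⟩ := first_ineq' χ (S ∪ T) (fun v hv => hS v (fun h => hv (Finset.mem_union_left _ h)))
  have h1 : DivS (S ∪ T) ≤ Nchi χ := by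
    intro D hD v
    by_cases hv : v ∈ S ∪ T
    · rw [hD v hv]; simp
    · rw [h v (fun h => hv (Finset.mem_union_right _ h))]; simp
  have h2 : (PR (S ∪ T) k ⊔ (Nchi χ ⊓ DivS (S ∪ T))).relIndex (DivS (S ∪ T)) = 1 := by
    rw [AddSubgroup.relIndex_eq_one, inf_eq_right.2 h1]
    exact le_sup_right
  rw [h2] at hk
  have h3 : χ.range = ⊥ := Subgroup.card_le_one_iff_eq_bot _ |>.1 hk
  ext1 g
  have : χ g ∈ χ.range := ⟨g, rfl⟩
  rw [h3] at this
  exact this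
end

/-! ### Dedekind zeta as a sum over divisors -/
section
variable {K : Type} [Field K] [NumberField K]

/-- log of the norm of a divisor -/
def lg : Dv K →+ ℝ :=
  Finsupp.liftAddHom fun v => (AddMonoidHom.mulRight (Real.log (Nm v))).comp (Int.castAddHom ℝ)

lemma lg_single (v : Pl K) (n : ℤ) : lg (Finsupp.single v n) = n * Real.log (Nm v) := by
  simp [lg]

lemma logNm_pos (v : Pl K) : 0 < Real.log (Nm v) :=
  Real.log_pos (by exact_mod_cast Nm_gt_one v)

lemma lg_nonneg {D : Dv K} (hD : 0 ≤ D) : 0 ≤ lg D := by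
  rw [lg, Finsupp.liftAddHom_apply]
  apply Finset.sum_nonneg
  intro v _
  have := hD v
  have h2 : (0:ℝ) ≤ (D v : ℝ) := by exact_mod_cast this
  exact mul_nonneg h2 (logNm_pos v).le

lemma lg_dvI {I : Ideal (𝓞 K)} (hI : I ≠ ⊥) : lg (dvI (I : FI K)) = Real.log (Ideal.absNorm I) := by
  induction I using UniqueFactorizationMonoid.induction_on_prime with
  | h₁ => exact absurd rfl hI
  | h₂ I hu =>
    have h1 : I = 1 := by simpa using hu
    subst h1
    rw [Ideal.one_eq_top, FractionalIdeal.coeIdeal_top, dvI_one]; simp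
  | h₃ I p hI0 hp ih =>
    have hp0 : p ≠ ⊥ := hp.ne_zero
    have h1 : (I : FI K) ≠ 0 := by rwa [Ne, FractionalIdeal.coeIdeal_eq_zero]
    have h2 : (p : FI K) ≠ 0 := by rwa [Ne, FractionalIdeal.coeIdeal_eq_zero]
    have h3 := dvI_pl (⟨p, Ideal.isPrime_of_prime hp, hp0⟩ : Pl K)
    have h4 := Nm_eq (⟨p, Ideal.isPrime_of_prime hp, hp0⟩ : Pl K)
    simp only at h3 h4
    rw [FractionalIdeal.coeIdeal_mul, dvI_mul h2 h1, map_add, ih hI0, h3, lg_single, h4, map_mul,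
      Nat.cast_mul, Real.log_mul]
    · simp
    · exact_mod_cast fun h => hp0 (Ideal.absNorm_eq_zero_iff.mp h)
    · exact_mod_cast fun h => hI0 (Ideal.absNorm_eq_zero_iff.mp h)

lemma exp_lg_dvI {I : Ideal (𝓞 K)} (hI : I ≠ ⊥) (s : ℝ) :
    Real.exp (s * lg (dvI (I : FI K))) = (Ideal.absNorm I : ℝ) ^ s := by
  rw [lg_dvI hI, Real.rpow_def_of_pos, mul_comm]
  have : Ideal.absNorm I ≠ 0 := fun h => hI (Ideal.absNorm_eq_zero_iff.mp h)
  positivity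

open Classical in
/-- the positive divisor sum -/
def ztf (K : Type) [Field K] [NumberField K] (s : ℝ) (D : Dv K) : ℝ :=
  if 0 ≤ D then Real.exp (-s * lg D) else 0

lemma ztf_nonneg (s : ℝ) (D : Dv K) : 0 ≤ ztf K s D := by
  unfold ztf; split_ifs <;> positivity

lemma hasSum_ideal_iff (s : ℝ) (x : ℝ) : HasSum (ztf K s) x ↔
    HasSum (fun I : {I : Ideal (𝓞 K) // I ≠ ⊥} => (Ideal.absNorm I.1 : ℝ) ^ (-s)) x := by
  have hinj : Function.Injective (fun I : {I : Ideal (𝓞 K) // I ≠ ⊥} => dvI (I.1 : FI K)) := by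
    intro I J h
    have := dvI_inj (by rw [Ne, FractionalIdeal.coeIdeal_eq_zero]; exact I.2)
      (by rw [Ne, FractionalIdeal.coeIdeal_eq_zero]; exact J.2) h
    exact Subtype.ext (FractionalIdeal.coeIdeal_injective this)
  rw [← hinj.hasSum_iff]
  · apply iff_of_eq; congr 1
    funext I
    have h0 : 0 ≤ dvI (I.1 : FI K) := (dvI_nonneg_iff (by
      rw [Ne, FractionalIdeal.coeIdeal_eq_zero]; exact I.2)).mpr ⟨I.1, I.2, rfl⟩
    simp only [Function.comp, ztf, h0, if_true]
    exact exp_lg_dvI I.2 _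
  · intro D hD
    unfold ztf
    rw [if_neg]
    intro h
    obtain ⟨I, hI, rfl⟩ := dvI_surj D
    obtain ⟨J, hJ, rfl⟩ := (dvI_nonneg_iff hI).mp h
    exact hD ⟨⟨J, hJ⟩, rfl⟩

lemma lterm_eq (s : ℝ) (n : ℕ) :
    LSeries.term (fun n ↦ (Nat.card {I : Ideal (𝓞 K) // Ideal.absNorm I = n} : ℂ)) s n =
    ((∑' I : {I : {I : Ideal (𝓞 K) // I ≠ ⊥} // Ideal.absNorm I.1 = n},
        (Ideal.absNorm I.1.1 : ℝ) ^ (-s) : ℝ) : ℂ) := by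
  rcases eq_or_ne n 0 with rfl | hn
  · rw [LSeries.term_zero]
    have : IsEmpty {I : {I : Ideal (𝓞 K) // I ≠ ⊥} // Ideal.absNorm I.1 = 0} :=
      ⟨fun I => I.1.2 (Ideal.absNorm_eq_zero_iff.mp I.2)⟩
    simp
  · have hf : Finite {I : Ideal (𝓞 K) // Ideal.absNorm I = n} :=
      Ideal.finite_setOfPred_absNorm_eq n
    let e : {I : {I : Ideal (𝓞 K) // I ≠ ⊥} // Ideal.absNorm I.1 = n} ≃
        {I : Ideal (𝓞 K) // Ideal.absNorm I = n} :=
      { toFun := fun I => ⟨I.1.1, I.2⟩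
        invFun := fun I => ⟨⟨I.1, fun h => hn (by rw [← I.2, h]; simp)⟩, I.2⟩
        left_inv := fun _ => rfl
        right_inv := fun _ => rfl }
    have hf' := Finite.of_equiv _ e.symm
    have h1 : ∀ I : {I : {I : Ideal (𝓞 K) // I ≠ ⊥} // Ideal.absNorm I.1 = n},
      (Ideal.absNorm I.1.1 : ℝ) ^ (-s) = (n : ℝ) ^ (-s) := fun I => by rw [I.2]
    rw [tsum_congr h1, LSeries.term_of_ne_zero hn, tsum_const, Nat.card_congr e]
    simp only [nsmul_eq_mul, Complex.ofReal_mul, Complex.ofReal_natCast]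
    rw [Complex.ofReal_cpow (by positivity), Complex.ofReal_neg, Complex.cpow_neg, div_eq_mul_inv]
    simp

lemma ztf_hasSum {s : ℝ} (hs : LSeriesSummable (fun n ↦ (Nat.card {I : Ideal (𝓞 K) // Ideal.absNorm I = n} : ℂ)) s) :
    Summable (ztf K s) ∧ ((∑' D, ztf K s D : ℝ) : ℂ) = dedekindZeta K s := by
  have h1 : Summable (fun n : ℕ => ∑' I : {I : {I : Ideal (𝓞 K) // I ≠ ⊥} // Ideal.absNorm I.1 = n},
        (Ideal.absNorm I.1.1 : ℝ) ^ (-s)) := by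
    rw [← Complex.summable_ofReal]
    refine Summable.congr hs fun n => (lterm_eq s n)
  have h2 : Summable (fun I : {I : Ideal (𝓞 K) // I ≠ ⊥} => (Ideal.absNorm I.1 : ℝ) ^ (-s)) := by
    rw [← (Equiv.sigmaFiberEquiv (fun I : {I : Ideal (𝓞 K) // I ≠ ⊥} => Ideal.absNorm I.1)).summable_iff]
    rw [summable_sigma_of_nonneg (fun _ => by simp only [Function.comp]; positivity)]
    refine ⟨fun n => ?_, h1⟩
    have hf : Finite {I : Ideal (𝓞 K) // Ideal.absNorm I = n} :=
      if hn : n = 0 then by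
        subst hn
        refine Set.Finite.to_subtype (Set.Finite.subset (Set.finite_singleton ⊥) ?_)
        intro I hI
        exact Ideal.absNorm_eq_zero_iff.mp hI
      else Ideal.finite_setOfPred_absNorm_eq n
    have hf' : Finite {I : {I : Ideal (𝓞 K) // I ≠ ⊥} // Ideal.absNorm I.1 = n} :=
      Finite.of_injective (β := {I : Ideal (𝓞 K) // Ideal.absNorm I = n}) (fun I => ⟨I.1.1, I.2⟩)
        (by
          intro I J h
          simp only [Subtype.mk.injEq] at h
          exact Subtype.ext (Subtype.ext h))
    exact Summable.of_finite
  have h3 := (hasSum_ideal_iff (K := K) s _).mpr h2.hasSum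
  refine ⟨h3.summable, ?_⟩
  rw [h3.tsum_eq, ← (Equiv.sigmaFiberEquiv (fun I : {I : Ideal (𝓞 K) // I ≠ ⊥} => Ideal.absNorm I.1)).tsum_eq,
    Summable.tsum_sigma]
  · rw [dedekindZeta, LSeries, Complex.ofReal_tsum]
    exact tsum_congr fun n => (lterm_eq s n).symm
  · exact (Equiv.sigmaFiberEquiv (fun I : {I : Ideal (𝓞 K) // I ≠ ⊥} => Ideal.absNorm I.1)).summable_iff.mpr h2

lemma zt_near (K : Type) [Field K] [NumberField K] : ∃ ε > 0, ε ≤ 1 ∧ ∃ c > 0, ∃ C > 0, ∀ s : ℝ, 1 < s → s < 1 + ε →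
    Summable (ztf K s) ∧ c ≤ (s - 1) * ∑' D, ztf K s D ∧ (s - 1) * ∑' D, ztf K s D ≤ C := by
  have h := tendsto_sub_one_mul_dedekindZeta_nhdsGT K
  have hp := dedekindZeta_residue_pos K
  set ρ := dedekindZeta_residue K
  have h1 : ∀ᶠ s : ℝ in nhdsWithin 1 (Set.Ioi 1), ‖((s:ℂ) - 1) * dedekindZeta K s - ρ‖ < ρ / 2 := by
    have := (Metric.tendsto_nhds.mp h) (ρ / 2) (by positivity)
    simpa [dist_eq_norm] using this
  rw [eventually_nhdsWithin_iff, Metric.eventually_nhds_iff] at h1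
  obtain ⟨ε, hε, h1⟩ := h1
  refine ⟨min ε 1, by positivity, min_le_right _ _, ρ / 2, by positivity, 2 * ρ, by positivity, ?_⟩
  intro s hs1 hs2
  have h2 := h1 (y := s) (by rw [Real.dist_eq, abs_of_pos (by linarith)]; have := min_le_left ε 1; linarith) hs1
  have hsum : LSeriesSummable (fun n ↦ (Nat.card {I : Ideal (𝓞 K) // Ideal.absNorm I = n} : ℂ)) s := by
    by_contra hc
    have h3 : dedekindZeta K s = 0 := by
      rw [dedekindZeta, LSeries]; exact tsum_eq_zero_of_not_summable hc
    rw [h3] at h2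
    simp only [mul_zero, zero_sub, norm_neg, Complex.norm_real, Real.norm_eq_abs] at h2
    rw [abs_of_pos hp] at h2
    linarith
  obtain ⟨h3, h4⟩ := ztf_hasSum hsum
  rw [← h4] at h2
  have h5 : |(s - 1) * (∑' D, ztf K s D) - ρ| < ρ / 2 := by
    rw [← Real.norm_eq_abs, ← Complex.norm_real]
    simpa using h2
  rw [abs_lt] at h5
  exact ⟨h3, by linarith, by linarith⟩

lemma ztf_anti {s s' : ℝ} (h : s ≤ s') (D : Dv K) : ztf K s' D ≤ ztf K s D := by
  unfold ztf
  split_ifs with h0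
  · apply Real.exp_le_exp.mpr
    have := lg_nonneg h0
    nlinarith
  · exact le_rfl

lemma summable_ztf {s : ℝ} (hs : 1 < s) : Summable (ztf K s) := by
  obtain ⟨ε, hε, _, c, hc, C, hC, h⟩ := zt_near K
  have h1 := (h (1 + min (ε / 2) ((s-1)/2)) (by
    have : 0 < min (ε / 2) ((s-1)/2) := lt_min (by linarith) (by linarith)
    linarith) (by have := min_le_left (ε / 2) ((s-1)/2); linarith)).1
  refine Summable.of_nonneg_of_le (ztf_nonneg s) (ztf_anti ?_) h1
  have := min_le_right (ε / 2) ((s-1)/2); linarith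

end

/-! ### Euler products -/
section
variable {K : Type} [Field K] [NumberField K]

/-- completely multiplicative functions on effective divisors, bounded by one -/
structure CM (a : Dv K → ℂ) : Prop where
  zero : a 0 = 1
  add : ∀ D, 0 ≤ D → ∀ v, a (D + Finsupp.single v 1) = a D * a (Finsupp.single v 1)
  le : ∀ D, ‖a D‖ ≤ 1

/-- local term -/
def xv (s : ℝ) (v : Pl K) : ℝ := Real.exp (-s * Real.log (Nm v))

lemma xv_pos (s : ℝ) (v : Pl K) : 0 < xv s v := Real.exp_pos _

lemma single_nonneg (v : Pl K) : (0 : Dv K) ≤ Finsupp.single v 1 :=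
  Finsupp.single_nonneg.mpr zero_le_one

lemma ztf_single (s : ℝ) (v : Pl K) : ztf K s (Finsupp.single v 1) = xv s v := by
  rw [ztf, if_pos (single_nonneg v), lg_single, xv]; simp

lemma summable_xv {s : ℝ} (hs : 1 < s) : Summable (xv (K := K) s) := by
  have h := (summable_ztf (K := K) hs).comp_injective
    (i := fun v : Pl K => Finsupp.single v (1:ℤ)) (Finsupp.single_left_injective one_ne_zero)
  exact h.congr fun v => ztf_single s v

lemma xv_sq (s : ℝ) (v : Pl K) : xv s v ^ 2 = xv (2 * s) v := by
  rw [xv, xv, ← Real.exp_nat_mul]; congr 1; push_cast; ring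

lemma xv_anti {s s' : ℝ} (h : s ≤ s') (v : Pl K) : xv s' v ≤ xv s v := by
  apply Real.exp_le_exp.mpr
  have := logNm_pos v
  nlinarith

lemma xv_le_half {s : ℝ} (hs : 1 ≤ s) (v : Pl K) : xv s v ≤ 1 / 2 := by
  refine (xv_anti hs v).trans ?_
  have h : (2:ℝ) ≤ Nm v := by exact_mod_cast Nm_gt_one v
  rw [xv, neg_one_mul, Real.exp_neg, Real.exp_log (by linarith)]
  rw [one_div]; exact inv_anti₀ (by norm_num) h

lemma summable_xv_sq {s : ℝ} (hs : 1 < s) : Summable (fun v : Pl K => xv s v ^ 2) := by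
  simp_rw [xv_sq]; exact summable_xv (by linarith)

lemma tsum_xv_sq_le {s : ℝ} (hs : 1 < s) : ∑' v : Pl K, xv s v ^ 2 ≤ ∑' v : Pl K, xv 2 v := by
  refine Summable.tsum_le_tsum (fun v => ?_) (summable_xv_sq hs) (summable_xv (by norm_num))
  rw [xv_sq]; exact xv_anti (by linarith) v

variable {a : Dv K → ℂ}

/-- Dirichlet term -/
def lt (a : Dv K → ℂ) (s : ℝ) (D : Dv K) : ℂ := a D * ztf K s D

/-- Euler term -/
def zv (a : Dv K → ℂ) (s : ℝ) (v : Pl K) : ℂ := a (Finsupp.single v 1) * xv s v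

lemma CM.norm_lt (ha : CM a) (s : ℝ) (D : Dv K) : ‖lt a s D‖ ≤ ztf K s D := by
  rw [lt, norm_mul, Complex.norm_real, Real.norm_of_nonneg (ztf_nonneg s D)]
  exact mul_le_of_le_one_left (ztf_nonneg s D) (ha.le D)

lemma CM.norm_zv (ha : CM a) (s : ℝ) (v : Pl K) : ‖zv a s v‖ ≤ xv s v := by
  rw [zv, norm_mul, Complex.norm_real, Real.norm_of_nonneg (xv_pos s v).le]
  exact mul_le_of_le_one_left (xv_pos s v).le (ha.le _)

lemma CM.summable (ha : CM a) {s : ℝ} (hs : 1 < s) : Summable (lt a s) :=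
  (summable_ztf hs).of_norm_bounded (ha.norm_lt s)

lemma CM.lt_add (ha : CM a) (s : ℝ) {D : Dv K} (hD : 0 ≤ D) (v : Pl K) :
    lt a s (D + Finsupp.single v 1) = zv a s v * lt a s D := by
  have h1 : 0 ≤ D + Finsupp.single v 1 := add_nonneg hD (single_nonneg v)
  rw [lt, lt, zv, ha.add D hD, ztf, ztf, if_pos h1, if_pos hD, map_add, lg_single, mul_add,
    Real.exp_add, xv]
  push_cast
  ring_nf

lemma lt_eq_zero (s : ℝ) {D : Dv K} (hD : ¬ 0 ≤ D) : lt a s D = 0 := by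
  rw [lt, ztf, if_neg hD]; simp

open Classical in
lemma CM.euler_fin (ha : CM a) {s : ℝ} (hs : 1 < s) (T : Finset (Pl K)) :
    (∑' D : Dv K, if D.support ⊆ T then lt a s D else 0) * ∏ v ∈ T, (1 - zv a s v) = 1 := by
  induction T using Finset.induction_on with
  | empty =>
    rw [Finset.prod_empty, mul_one, tsum_eq_single 0]
    · simp [lt, ha.zero, ztf]
    · intro D hD
      rw [if_neg]
      simpa using hD
  | insert v T hv ih =>
    rw [Finset.prod_insert hv, ← mul_assoc]
    have hsm : ∀ (p : Dv K → Prop) [DecidablePred p], Summable fun D => if p D then lt a s D else 0 := by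
      intro p _
      refine (summable_ztf hs).of_norm_bounded fun D => ?_
      split_ifs
      · exact ha.norm_lt s D
      · simpa using ztf_nonneg s D
    have key : (∑' D : Dv K, if D.support ⊆ insert v T then lt a s D else 0) * zv a s v =
        ∑' D : Dv K, if D.support ⊆ insert v T ∧ 1 ≤ D v then lt a s D else 0 := by
      rw [← tsum_mul_right]
      conv_rhs => rw [← (Equiv.addRight (Finsupp.single v (1:ℤ) : Dv K)).tsum_eq]
      apply tsum_congr
      intro D
      change _ = if (D + Finsupp.single v 1).support ⊆ insert v T ∧ 1 ≤ (D + Finsupp.single v 1 : Dv K) v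
        then lt a s (D + Finsupp.single v 1) else 0
      by_cases hD : 0 ≤ D
      · have e : (D + Finsupp.single v 1).support ⊆ insert v T ↔ D.support ⊆ insert v T := by
          simp only [Finset.subset_iff, Finsupp.mem_support_iff, Finset.mem_insert, Finsupp.add_apply,
            Finsupp.single_apply]
          apply forall_congr'
          intro w
          by_cases hw : v = w
          · subst hw; simp
          · simp [hw]
        have e2 : 1 ≤ (D + Finsupp.single v 1 : Dv K) v := by
          have := hD v
          simpa using this
        rw [ha.lt_add s hD]
        simp only [e, e2, and_true]
        split_ifs <;> ring
      · rw [lt_eq_zero s hD]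
        simp only [ite_self, zero_mul]
        symm
        rw [ite_eq_right_iff]
        intro h
        · rw [lt_eq_zero]
          intro h0
          apply hD
          intro w
          have h1 := h0 w
          by_cases hw : v = w
          · subst hw
            have := h.2
            simp at this
            simpa using this
          · simpa [Finsupp.single_apply, hw] using h1
    rw [mul_sub, mul_one, key, ← (hsm _).tsum_sub (hsm _)]
    refine Eq.trans ?_ ih
    congr 1
    apply tsum_congr
    intro D
    by_cases hD : 0 ≤ D
    · by_cases h1 : 1 ≤ D v
      · have h2 : ¬ D.support ⊆ T := by
          intro h
          exact hv (h (by simp; omega))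
        simp [h1, h2]
      · have h3 : D v = 0 := by have := hD v; simp at this; omega
        have h2 : D.support ⊆ insert v T ↔ D.support ⊆ T := by
          rw [Finset.subset_insert_iff_of_notMem]
          simpa using h3
        simp [h1, h2]
    · simp [lt_eq_zero s hD]

lemma CM.euler (ha : CM a) {s : ℝ} (hs : 1 < s) :
    Filter.Tendsto (fun T : Finset (Pl K) => (∏ v ∈ T, (1 - zv a s v))⁻¹) Filter.atTop
      (nhds (∑' D, lt a s D)) := by
  classical
  have h : ∀ T : Finset (Pl K), (∏ v ∈ T, (1 - zv a s v))⁻¹ =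
      ∑' D : Dv K, if D.support ⊆ T then lt a s D else 0 := fun T =>
    (eq_inv_of_mul_eq_one_left (ha.euler_fin hs T)).symm
  simp_rw [h]
  refine tendsto_tsum_of_dominated_convergence (summable_ztf hs) (fun D => ?_) (.of_forall fun T D => ?_)
  · refine tendsto_const_nhds.congr' ?_
    filter_upwards [Filter.eventually_ge_atTop D.support] with T hT
    rw [if_pos hT]
  · split_ifs
    · exact ha.norm_lt s D
    · simpa using ztf_nonneg s D

lemma inv_norm_ge (z : ℂ) (hz : ‖z‖ < 1) : Real.exp (z.re - ‖z‖ ^ 2) ≤ ‖1 - z‖⁻¹ := by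
  have h0 : 0 < ‖1 - z‖ := by
    rw [norm_pos_iff]; intro h
    have : z = 1 := by linear_combination -h
    rw [this] at hz; simp at hz
  rw [le_inv_comm₀ (Real.exp_pos _) h0, ← Real.exp_neg]
  apply le_of_sq_le_sq (b := _) _ (Real.exp_pos _).le
  rw [← Real.exp_nat_mul, ← Complex.normSq_eq_norm_sq, ← Complex.normSq_eq_norm_sq]
  have := Real.add_one_le_exp (((2:ℕ):ℝ) * -(z.re - Complex.normSq z))
  refine le_trans ?_ this
  rw [Complex.normSq_apply, Complex.normSq_apply]
  simp
  nlinarith [mul_self_nonneg z.re, mul_self_nonneg z.im]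

lemma CM.lower (ha : CM a) {s : ℝ} (hs : 1 < s) :
    Real.exp (∑' v, (zv a s v).re - ∑' v : Pl K, xv s v ^ 2) ≤ ‖∑' D, lt a s D‖ := by
  have h1 := (ha.euler hs).norm
  have hz : Summable (fun v => (zv a s v).re) :=
    (summable_xv hs).of_norm_bounded fun v =>
      (Complex.abs_re_le_norm _).trans (ha.norm_zv s v)
  have h2 : Filter.Tendsto (fun T : Finset (Pl K) =>
      Real.exp (∑ v ∈ T, ((zv a s v).re - xv s v ^ 2))) Filter.atTop
      (nhds (Real.exp (∑' v, (zv a s v).re - ∑' v : Pl K, xv s v ^ 2))) := by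
    refine (Real.continuous_exp.tendsto _).comp ?_
    rw [← hz.tsum_sub (summable_xv_sq hs)]
    exact (hz.sub (summable_xv_sq hs)).hasSum
  refine le_of_tendsto_of_tendsto' h2 h1 fun T => ?_
  rw [norm_inv, norm_prod, ← Finset.prod_inv_distrib, Real.exp_sum]
  refine Finset.prod_le_prod (fun v _ => (Real.exp_pos _).le) fun v _ => ?_
  have h3 := ha.norm_zv s v
  refine le_trans (Real.exp_le_exp.mpr ?_) (inv_norm_ge (zv a s v) ?_)
  · have := norm_nonneg (zv a s v)
    nlinarith
  · have := xv_le_half hs.le v; linarith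

lemma CM.one : CM (fun _ : Dv K => (1:ℂ)) := ⟨rfl, by simp, by simp⟩

lemma zeta_upper {s : ℝ} (hs : 1 < s) :
    ∑' D, ztf K s D ≤ Real.exp (∑' v : Pl K, xv s v + 2 * ∑' v : Pl K, xv s v ^ 2) := by
  have h1 := ((CM.one (K := K)).euler hs).norm
  have e1 : ∑' D : Dv K, lt (fun _ => (1:ℂ)) s D = ((∑' D, ztf K s D : ℝ) : ℂ) := by
    rw [Complex.ofReal_tsum]; apply tsum_congr; intro D; simp [lt]
  rw [e1, Complex.norm_real, Real.norm_of_nonneg (tsum_nonneg (ztf_nonneg s))] at h1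
  refine le_of_tendsto h1 (.of_forall fun T => ?_)
  have h2 : ∑ v ∈ T, (xv s v + 2 * xv s v ^ 2) ≤ ∑' v : Pl K, xv s v + 2 * ∑' v : Pl K, xv s v ^ 2 := by
    rw [← tsum_mul_left, ← (summable_xv hs).tsum_add ((summable_xv_sq hs).mul_left 2)]
    exact Summable.sum_le_tsum T (fun v _ => by have := xv_pos s v; positivity)
      ((summable_xv hs).add ((summable_xv_sq hs).mul_left 2))
  refine le_trans ?_ (Real.exp_le_exp.mpr h2)
  rw [norm_inv, norm_prod, ← Finset.prod_inv_distrib, Real.exp_sum]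
  refine Finset.prod_le_prod (fun v _ => by positivity) fun v _ => ?_
  have h3 := xv_le_half hs.le v
  have h4 := xv_pos s v
  have e2 : ‖1 - zv (fun _ => (1:ℂ)) s v‖ = 1 - xv s v := by
    have : 1 - zv (fun _ => (1:ℂ)) s v = ((1 - xv s v : ℝ) : ℂ) := by simp [zv]
    rw [this, Complex.norm_real, Real.norm_of_nonneg]; linarith
  rw [e2]
  set x := xv s v
  have h5 : (1 - x)⁻¹ = x / (1 - x) + 1 := by
    have : (1 - x) ≠ 0 := by linarith
    field_simp; ring
  have h6 : x / (1 - x) ≤ x + 2 * x ^ 2 := by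
    rw [div_le_iff₀ (by linarith)]; nlinarith [mul_nonneg (sq_nonneg x) (by linarith : 0 ≤ 1 - 2 * x)]
  rw [h5]
  exact (Real.add_one_le_exp _).trans (Real.exp_le_exp.mpr h6)

end

/-! ### Tent functions and logarithmic coordinates -/
section
def tent (c : ℝ) : ℝ := max 0 (1 - |c|)

lemma tent_nonneg (c : ℝ) : 0 ≤ tent c := le_max_left _ _
lemma tent_le_one (c : ℝ) : tent c ≤ 1 := max_le zero_le_one (by have := abs_nonneg c; linarith)
lemma tent_lip (a b : ℝ) : |tent a - tent b| ≤ |a - b| := by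
  rw [tent, tent, max_comm 0, max_comm 0]
  refine (abs_max_sub_max_le_abs _ _ _).trans ?_
  · have h : (1 - |a|) - (1 - |b|) = |b| - |a| := by ring
    rw [h, abs_sub_comm a b]; exact abs_abs_sub_abs_le _ _
lemma abs_le_of_tent {c : ℝ} (h : tent c ≠ 0) : |c| ≤ 1 := by
  by_contra hc
  push Not at hc
  exact h (max_eq_left (by linarith))

lemma tent_eq_zero (c : ℝ) (n : ℤ) (hn : n ∉ ({-⌊c⌋, -⌊c⌋ - 1} : Finset ℤ)) : tent (c + n) = 0 := by
  by_contra h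
  have h1 := abs_le_of_tent h
  have h3 : |c + n| ≠ 1 := by
    intro h3; apply h; rw [tent, h3]; simp
  have h2 : |c + n| < 1 := lt_of_le_of_ne h1 h3
  rw [abs_lt] at h2
  have h4 := Int.floor_le c
  have h5 := Int.lt_floor_add_one c
  apply hn
  simp only [Finset.mem_insert, Finset.mem_singleton]
  have h6 : (-2:ℝ) < ((⌊c⌋ + n : ℤ) : ℝ) := by push_cast; linarith
  have h7 : ((⌊c⌋ + n : ℤ) : ℝ) < 1 := by push_cast; linarith
  have h8 : -2 < ⌊c⌋ + n := by exact_mod_cast h6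
  have h9 : ⌊c⌋ + n < 1 := by exact_mod_cast h7
  omega

lemma tent_sum (c : ℝ) : ∑ n ∈ ({-⌊c⌋, -⌊c⌋ - 1} : Finset ℤ), tent (c + n) = 1 := by
  rw [Finset.sum_pair (by omega)]
  have h4 := Int.floor_le c
  have h5 := Int.lt_floor_add_one c
  push_cast
  rw [tent, tent, abs_of_nonneg (by linarith), abs_of_nonpos (by linarith), max_eq_right (by linarith),
    max_eq_right (by linarith)]
  ring

lemma tent_hasSum {ι : Type*} [Fintype ι] (c : ι → ℝ) :
    HasSum (fun n : ι → ℤ => ∏ i, tent (c i + n i)) 1 := by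
  classical
  have h := Finset.prod_univ_sum (fun i => ({-⌊c i⌋, -⌊c i⌋ - 1} : Finset ℤ)) (fun i n => tent (c i + n))
  simp_rw [tent_sum] at h
  rw [Finset.prod_const_one] at h
  rw [h]
  apply hasSum_sum_of_ne_finset_zero
  intro n hn
  rw [Fintype.mem_piFinset] at hn
  push Not at hn
  obtain ⟨i, hi⟩ := hn
  exact Finset.prod_eq_zero (Finset.mem_univ i) (tent_eq_zero _ _ hi)

lemma prod_lip {ι : Type*} (s : Finset ι) (a b : ι → ℝ) :
    |∏ i ∈ s, tent (a i) - ∏ i ∈ s, tent (b i)| ≤ ∑ i ∈ s, |a i - b i| := by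
  classical
  induction s using Finset.induction_on with
  | empty => simp
  | insert i s hi ih =>
    rw [Finset.prod_insert hi, Finset.prod_insert hi, Finset.sum_insert hi]
    have h1 : tent (a i) * ∏ i ∈ s, tent (a i) - tent (b i) * ∏ i ∈ s, tent (b i) =
      (tent (a i) - tent (b i)) * ∏ i ∈ s, tent (a i) +
        tent (b i) * (∏ i ∈ s, tent (a i) - ∏ i ∈ s, tent (b i)) := by ring
    rw [h1]
    refine (abs_add_le _ _).trans (add_le_add ?_ ?_)
    · rw [abs_mul]
      refine (mul_le_of_le_one_right (abs_nonneg _) ?_).trans (tent_lip _ _)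
      rw [abs_of_nonneg (Finset.prod_nonneg fun _ _ => tent_nonneg _)]
      exact Finset.prod_le_one (fun _ _ => tent_nonneg _) (fun _ _ => tent_le_one _)
    · rw [abs_mul, abs_of_nonneg (tent_nonneg _)]
      exact (mul_le_of_le_one_left (abs_nonneg _) (tent_le_one _)).trans ih

end

section
variable (K : Type) [Field K] [NumberField K]
open NumberField.Units.dirichletUnitTheorem NumberField.mixedEmbedding.fundamentalCone
open scoped Classical

abbrev Ci := {w : InfinitePlace K // w ≠ w₀}

variable {K}

/-- log vector -/
def ll (x : K) (v : InfinitePlace K) : ℝ := Real.log (v x)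

lemma ll_mul {x y : K} (hx : x ≠ 0) (hy : y ≠ 0) : ll (x * y) = ll x + ll y := by
  funext v
  simp only [ll, map_mul, Pi.add_apply]
  exact Real.log_mul (by simpa using hx) (by simpa using hy)

/-- the `i`-th coordinate -/
def lc (i : InfinitePlace K) : (InfinitePlace K → ℝ) →ₗ[ℝ] ℝ :=
  ((completeBasis K).coord i).comp
    (LinearMap.pi fun v => (v.mult : ℝ) • LinearMap.proj v)

lemma lc_fund (i j : Ci K) :
    lc j.1 (ll ((NumberField.Units.fundSystem K (equivFinRank.symm i) : 𝓞 K) : K)) =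
      if i = j then 1 else 0 := by
  have h : (LinearMap.pi fun v : InfinitePlace K => (v.mult : ℝ) • LinearMap.proj (R := ℝ) (φ := fun _ => ℝ) v)
      (ll ((NumberField.Units.fundSystem K (equivFinRank.symm i) : 𝓞 K) : K)) = completeBasis K i := by
    rw [completeBasis_apply_of_ne]
    funext v
    rw [expMap_symm_apply, NumberField.mixedEmbedding.normAtAllPlaces_mixedEmbedding]
    simp [ll]
  rw [lc, LinearMap.comp_apply, h, Module.Basis.coord_apply, Module.Basis.repr_self, Finsupp.single_apply]
  simp only [Subtype.ext_iff]

lemma lc_bound (M : ℝ) : ∃ B : ℝ, 0 ≤ B ∧ ∀ l : InfinitePlace K → ℝ, (∀ i : Ci K, |lc i.1 l| ≤ M) →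
    ∀ v v', l v ≤ l v' + B := by
  have key : ∀ (l : InfinitePlace K → ℝ) v, l v = lc w₀ l +
      ∑ i : Ci K, lc i.1 l * ((v.mult : ℝ)⁻¹ * completeBasis K i v) := by
    intro l v
    have h := (completeBasis K).sum_repr ((LinearMap.pi fun v : InfinitePlace K => (v.mult : ℝ) • LinearMap.proj (R := ℝ) (φ := fun _ => ℝ) v) l)
    have h1 := congrFun h v
    have hm : (v.mult : ℝ) ≠ 0 := NumberField.InfinitePlace.mult_coe_ne_zero
    rw [Fintype.sum_eq_add_sum_subtype_ne _ w₀, completeBasis_apply_of_eq] at h1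
    simp only [Pi.add_apply, Finset.sum_apply, Pi.smul_apply, smul_eq_mul, LinearMap.pi_apply,
      LinearMap.smul_apply, LinearMap.proj_apply] at h1
    have h2 : l v = (v.mult : ℝ)⁻¹ * (v.mult * l v) := by field_simp
    rw [h2, ← h1, mul_add, Finset.mul_sum]
    congr 1
    · change _ = (completeBasis K).repr _ w₀
      field_simp
    · apply Finset.sum_congr rfl
      intro i _
      change _ = (completeBasis K).repr _ i.1 * _
      rw [mul_left_comm]
  let N : ℝ := ∑ v : InfinitePlace K, ∑ i : Ci K, |M| * |(v.mult : ℝ)⁻¹ * completeBasis K i v|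
  have hN : ∀ l : InfinitePlace K → ℝ, (∀ i : Ci K, |lc i.1 l| ≤ M) → ∀ v, |l v - lc w₀ l| ≤ N := by
    intro l hl v
    rw [key l v, add_sub_cancel_left]
    refine (Finset.abs_sum_le_sum_abs _ _).trans ?_
    refine le_trans ?_ (Finset.single_le_sum (f := fun v : InfinitePlace K => ∑ i : Ci K, |M| * |(v.mult : ℝ)⁻¹ * completeBasis K i v|)
      (fun v _ => Finset.sum_nonneg fun i _ => by positivity) (Finset.mem_univ v))
    apply Finset.sum_le_sum
    intro i _
    rw [abs_mul]
    exact mul_le_mul_of_nonneg_right ((hl i).trans (le_abs_self M)) (abs_nonneg _)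
  refine ⟨2 * N, by positivity, fun l hl v v' => ?_⟩
  have h1 := hN l hl v
  have h2 := hN l hl v'
  rw [abs_le] at h1 h2
  linarith

lemma lc_lip : ∃ A : ℝ, 0 ≤ A ∧ ∀ (l l' : InfinitePlace K → ℝ) (η : ℝ), (∀ v, |l v - l' v| ≤ η) →
    ∑ i : Ci K, |lc i.1 l - lc i.1 l'| ≤ A * η := by
  let A : ℝ := ∑ i : Ci K, ∑ v : InfinitePlace K, |lc i.1 (Pi.single v 1)|
  refine ⟨A, by positivity, fun l l' η h => ?_⟩
  rw [Finset.sum_mul]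
  apply Finset.sum_le_sum
  intro i _
  rw [← map_sub, LinearMap.pi_apply_eq_sum_univ (lc i.1) (l - l')]
  refine (Finset.abs_sum_le_sum_abs _ _).trans ?_
  rw [Finset.sum_mul]
  apply Finset.sum_le_sum
  intro v _
  rw [smul_eq_mul, abs_mul, mul_comm]
  have e : (fun j => if v = j then (1:ℝ) else 0) = Pi.single v 1 := by
    funext j; rw [Pi.single_apply]; simp [eq_comm]
  rw [e]
  exact mul_le_mul_of_nonneg_left (h v) (abs_nonneg _)

/-- total log -/
def tl (l : InfinitePlace K → ℝ) : ℝ := ∑ v, (v.mult : ℝ) * l v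

/-- weight function -/
def Gw (M s : ℝ) (l : InfinitePlace K → ℝ) : ℝ :=
  (∏ i : Ci K, tent (lc i.1 l / M)) * Real.exp (-s * tl l)

lemma Gw_lip (M : ℝ) (hM : 0 < M) : ∃ A : ℝ, 0 ≤ A ∧ ∀ (l l' : InfinitePlace K → ℝ) (η s : ℝ),
    (∀ v, |l v - l' v| ≤ η) → η ≤ 1 → 1 ≤ s → s ≤ 2 →
    |Gw M s l' - Gw M s l| ≤ A * η * Real.exp (-s * tl l) := by
  obtain ⟨A, hA, h⟩ := lc_lip (K := K)
  let m : ℝ := ∑ v : InfinitePlace K, (v.mult : ℝ)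
  have hm : 0 ≤ m := by positivity
  refine ⟨A / M + 2 * m * Real.exp (2 * m), by positivity, fun l l' η s hη hη1 hs1 hs2 => ?_⟩
  have hη0 : 0 ≤ η := (abs_nonneg _).trans (hη w₀)
  have e1 : |∏ i : Ci K, tent (lc i.1 l' / M) - ∏ i : Ci K, tent (lc i.1 l / M)| ≤ A / M * η := by
    refine (prod_lip _ _ _).trans ?_
    have := h l' l η (fun v => by rw [abs_sub_comm]; exact hη v)
    calc ∑ i : Ci K, |lc i.1 l' / M - lc i.1 l / M| = (∑ i : Ci K, |lc i.1 l' - lc i.1 l|) / M := by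
          rw [Finset.sum_div]
          apply Finset.sum_congr rfl
          intro i _
          rw [← sub_div, abs_div, abs_of_pos hM]
      _ ≤ A * η / M := by gcongr
      _ = _ := by ring
  have e2 : |tl l' - tl l| ≤ m * η := by
    rw [tl, tl, ← Finset.sum_sub_distrib, Finset.sum_mul]
    refine (Finset.abs_sum_le_sum_abs _ _).trans (Finset.sum_le_sum fun v _ => ?_)
    rw [← mul_sub, abs_mul, abs_of_nonneg (by positivity : (0:ℝ) ≤ v.mult), abs_sub_comm]
    exact mul_le_mul_of_nonneg_left (hη v) (by positivity)
  have e3 : |Real.exp (-s * tl l') - Real.exp (-s * tl l)| ≤ 2 * m * Real.exp (2 * m) * η * Real.exp (-s * tl l) := by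
    have h1 : Real.exp (-s * tl l') - Real.exp (-s * tl l) =
      (Real.exp (-s * (tl l' - tl l)) - 1) * Real.exp (-s * tl l) := by
      rw [sub_mul, ← Real.exp_add]; ring_nf
    rw [h1, abs_mul, abs_of_pos (Real.exp_pos _)]
    refine mul_le_mul_of_nonneg_right ?_ (Real.exp_pos _).le
    set y := -s * (tl l' - tl l) with hy
    have hy1 : |y| ≤ 2 * m * η := by
      rw [hy, abs_mul, abs_neg, abs_of_nonneg (by linarith)]
      calc s * |tl l' - tl l| ≤ 2 * (m * η) := mul_le_mul hs2 e2 (abs_nonneg _) (by norm_num)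
        _ = _ := by ring
    have hy2 : |y| ≤ 2 * m := hy1.trans (mul_le_of_le_one_right (by positivity) hη1)
    have h3 : |Real.exp y - 1| ≤ |y| * Real.exp |y| := by
      have := Real.add_one_le_exp y
      have h4 := Real.add_one_le_exp (-y)
      have h5 := Real.exp_pos y
      have h6 : Real.exp y * Real.exp (-y) = 1 := by rw [← Real.exp_add]; simp
      have h7 : 1 ≤ Real.exp |y| := Real.one_le_exp (abs_nonneg y)
      rw [abs_le]
      constructor
      · nlinarith [neg_abs_le y, abs_nonneg y, mul_le_mul_of_nonneg_left h7 (abs_nonneg y)]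
      · rcases le_total 0 y with hy0 | hy0
        · rw [abs_of_nonneg hy0]; nlinarith
        · have : Real.exp y ≤ 1 := Real.exp_le_one_iff.mpr hy0
          have : 0 ≤ |y| * Real.exp |y| := by positivity
          linarith
    refine h3.trans ?_
    calc |y| * Real.exp |y| ≤ (2 * m * η) * Real.exp (2 * m) := by gcongr
      _ = _ := by ring
  have e4 : |∏ i : Ci K, tent (lc i.1 l' / M)| ≤ 1 := by
    rw [abs_of_nonneg (Finset.prod_nonneg fun _ _ => tent_nonneg _)]
    exact Finset.prod_le_one (fun _ _ => tent_nonneg _) (fun _ _ => tent_le_one _)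
  have e5 : Gw M s l' - Gw M s l = (∏ i : Ci K, tent (lc i.1 l' / M)) * (Real.exp (-s * tl l') - Real.exp (-s * tl l))
    + (∏ i : Ci K, tent (lc i.1 l' / M) - ∏ i : Ci K, tent (lc i.1 l / M)) * Real.exp (-s * tl l) := by
    rw [Gw, Gw]; ring
  rw [e5]
  refine (abs_add_le _ _).trans ?_
  rw [abs_mul, abs_mul, abs_of_pos (Real.exp_pos (-s * tl l))]
  have e6 := mul_le_mul_of_nonneg_right e1 (Real.exp_pos (-s * tl l)).le
  have e7 := (mul_le_of_le_one_left (abs_nonneg _) e4).trans e3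
  nlinarith

end

/-! ### Lattice sums of the weight function -/
section
variable {K : Type} [Field K] [NumberField K]
open scoped Classical

/-- sup norm -/
def nv (α : 𝓞 K) : ℝ := ‖mixedEmbedding K (α : K)‖

lemma le_nv (v : InfinitePlace K) (α : 𝓞 K) : v (α : K) ≤ nv α := by
  rw [nv, mixedEmbedding.norm_eq_sup'_normAtPlace, ← mixedEmbedding.normAtPlace_apply v]
  exact Finset.le_sup' (fun w => mixedEmbedding.normAtPlace w (mixedEmbedding K (α : K))) (Finset.mem_univ v)

lemma exists_nv (α : 𝓞 K) : ∃ v : InfinitePlace K, nv α = v (α : K) := by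
  rw [nv, mixedEmbedding.norm_eq_sup'_normAtPlace]
  obtain ⟨v, _, hv⟩ := Finset.exists_mem_eq_sup' (s := (Finset.univ : Finset (InfinitePlace K))) Finset.univ_nonempty
    (fun w => mixedEmbedding.normAtPlace w (mixedEmbedding K (α : K)))
  exact ⟨v, by rw [hv, mixedEmbedding.normAtPlace_apply]⟩

lemma nv_add (α β : 𝓞 K) : nv (α + β) ≤ nv α + nv β := by
  have h : ((α + β : 𝓞 K) : K) = (α : K) + β := map_add (algebraMap (𝓞 K) K) α β
  rw [nv, nv, nv, h, map_add]
  exact norm_add_le _ _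

lemma nv_nonneg (α : 𝓞 K) : 0 ≤ nv α := norm_nonneg _

lemma nv_neg (α : 𝓞 K) : nv (-α) = nv α := by
  have h : ((-α : 𝓞 K) : K) = -(α : K) := map_neg (algebraMap (𝓞 K) K) α
  rw [nv, nv, h, map_neg, norm_neg]

lemma vsum_le (v : InfinitePlace K) (α δ : 𝓞 K) : v ((α + δ : 𝓞 K) : K) ≤ v (α : K) + v (δ : K) := by
  have h : ((α + δ : 𝓞 K) : K) = (α : K) + δ := map_add (algebraMap (𝓞 K) K) α δ
  rw [h]; exact v.1.add_le' _ _

lemma vsum_le' (v : InfinitePlace K) (α δ : 𝓞 K) : v (α : K) ≤ v ((α + δ : 𝓞 K) : K) + v (δ : K) := by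
  have h := vsum_le v (α + δ) (-δ)
  have h2 : ((-δ : 𝓞 K) : K) = -(δ : K) := map_neg (algebraMap (𝓞 K) K) δ
  rwa [add_neg_cancel_right, h2, show v (-(δ:K)) = v (δ:K) from map_neg_eq_map v.1 _] at h

lemma nv_pos {α : 𝓞 K} (h : α ≠ 0) : 0 < nv α := by
  rw [nv, norm_pos_iff]
  intro h0
  apply h
  have := (map_eq_zero_iff _ (mixedEmbedding_injective K)).mp h0
  exact_mod_cast this

set_option maxHeartbeats 1000000 in
lemma summable_nv {r : ℝ} (hr : r < -(Module.finrank ℚ K : ℝ)) :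
    Summable fun α : 𝓞 K => nv α ^ r := by
  have h1 : Module.finrank ℤ (mixedEmbedding.integerLattice K) = Module.finrank ℚ K := by
    rw [ZLattice.rank ℝ, mixedEmbedding.finrank]
  have h := ZLattice.summable_norm_rpow (mixedEmbedding.integerLattice K) r (by rw [h1]; exact hr)
  let i : 𝓞 K → mixedEmbedding.integerLattice K := fun α => ⟨mixedEmbedding K (α : K), ⟨α, rfl⟩⟩
  have hi : Function.Injective i := by
    intro α β hαβ
    have := congrArg Subtype.val hαβ
    exact RingOfIntegers.coe_injective (mixedEmbedding_injective K this)
  have h2 := h.comp_injective hi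
  refine h2.congr fun α => ?_
  rfl

lemma abs_real (φ : K →+* ℝ) : ∃ v : InfinitePlace K, ∀ x, |φ x| = v x := by
  refine ⟨InfinitePlace.mk (Complex.ofRealHom.comp φ), fun x => ?_⟩
  rw [InfinitePlace.apply]
  simp

/-- nonzero and totally positive -/
def TP (x : K) : Prop := x ≠ 0 ∧ ∀ φ : K →+* ℝ, 0 < φ x

lemma TP_near {α δ : 𝓞 K} (h : ∀ v : InfinitePlace K, nv δ < v (α : K)) :
    TP ((α + δ : 𝓞 K) : K) ↔ TP (α : K) := by
  have hα : (α : K) ≠ 0 := by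
    intro h0
    obtain ⟨v⟩ : Nonempty (InfinitePlace K) := inferInstance
    have := h v
    rw [h0, map_zero] at this
    exact absurd this (not_lt.mpr (nv_nonneg δ))
  have hαδ : ((α + δ : 𝓞 K) : K) ≠ 0 := by
    intro h0
    obtain ⟨v⟩ : Nonempty (InfinitePlace K) := inferInstance
    have h1 : (α : K) = -(δ : K) := by
      have : (α : K) + (δ : K) = 0 := by simpa using h0
      linear_combination this
    have h2 := h v
    rw [h1, show v (-(δ:K)) = v (δ:K) from map_neg_eq_map v.1 _] at h2
    exact absurd (le_nv v δ) (not_le.mpr h2)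
  have h3 : ∀ φ : K →+* ℝ, |φ (δ : K)| < |φ (α : K)| := by
    intro φ
    obtain ⟨v, hv⟩ := abs_real φ
    rw [hv, hv]
    exact (le_nv v δ).trans_lt (h v)
  unfold TP
  refine and_congr (iff_of_true hαδ hα) (forall_congr' fun φ => ?_)
  have h4 := h3 φ
  have h5 : φ ((α + δ : 𝓞 K) : K) = φ (α : K) + φ (δ : K) := by simp
  rw [h5]
  have := abs_lt.mp (lt_of_le_of_lt (le_refl _) h4)
  constructor
  · intro h6
    by_contra h7
    rw [abs_of_nonpos (not_lt.mp h7)] at h4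
    have := le_abs_self (φ (δ : K))
    linarith
  · intro h6
    rw [abs_of_pos h6] at h4
    have := neg_abs_le (φ (δ : K))
    linarith

/-- weight on integers -/
def Fw (M s : ℝ) (α : 𝓞 K) : ℝ := if TP (α : K) then Gw M s (ll (α : K)) else 0

lemma tl_eq {x : K} (hx : x ≠ 0) : tl (ll x) = Real.log |(Algebra.norm ℚ x : ℚ)| := by
  have h := InfinitePlace.prod_eq_abs_norm x
  have h2 := congrArg Real.log h
  rw [Real.log_prod (fun v _ => pow_ne_zero _ (by simpa using hx))] at h2
  simp only [Real.log_pow] at h2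
  rw [tl]
  unfold ll
  rw [h2, Rat.cast_abs]

lemma tl_nonneg {α : 𝓞 K} (h : α ≠ 0) : 0 ≤ tl (ll (α : K)) := by
  have h0 : (α : K) ≠ 0 := by exact_mod_cast h
  rw [tl_eq h0]
  apply Real.log_nonneg
  have h1 : (Algebra.norm ℚ (α : K) : ℚ) = ((Algebra.norm ℤ α : ℤ) : ℚ) := by
    rw [Algebra.coe_norm_int]
  rw [h1]
  have h2 : Algebra.norm ℤ α ≠ 0 := Algebra.norm_ne_zero_iff.mpr h
  have h3 : 1 ≤ |Algebra.norm ℤ α| := Int.one_le_abs h2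
  exact_mod_cast h3

lemma Gw_nonneg (M s : ℝ) (l : InfinitePlace K → ℝ) : 0 ≤ Gw M s l :=
  mul_nonneg (Finset.prod_nonneg fun _ _ => tent_nonneg _) (Real.exp_pos _).le

lemma Gw_le (M s : ℝ) (l : InfinitePlace K → ℝ) : Gw M s l ≤ Real.exp (-s * tl l) :=
  mul_le_of_le_one_left (Real.exp_pos _).le
    (Finset.prod_le_one (fun _ _ => tent_nonneg _) (fun _ _ => tent_le_one _))

lemma Fw_nonneg (M s : ℝ) (α : 𝓞 K) : 0 ≤ Fw M s α := by
  unfold Fw; split_ifs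
  · exact Gw_nonneg _ _ _
  · exact le_rfl

lemma Fw_le_one (M : ℝ) {s : ℝ} (hs : 0 ≤ s) (α : 𝓞 K) : Fw M s α ≤ 1 := by
  unfold Fw; split_ifs with h
  · refine (Gw_le _ _ _).trans ?_
    rw [Real.exp_le_one_iff]
    have := tl_nonneg (α := α) (by rintro rfl; exact h.1 (by simp))
    nlinarith
  · exact zero_le_one

/-- comparability on the support -/
lemma Fw_supp {M : ℝ} (hM : 0 < M) : ∃ c > 0, c ≤ 1 ∧ ∀ (s : ℝ) (α : 𝓞 K), Fw M s α ≠ 0 →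
    ∀ v : InfinitePlace K, c * nv α ≤ v (α : K) := by
  obtain ⟨B, hB0, hB⟩ := lc_bound (K := K) M
  refine ⟨Real.exp (-B), Real.exp_pos _, Real.exp_le_one_iff.mpr (by linarith), fun s α h v => ?_⟩
  unfold Fw at h
  rw [ite_ne_right_iff] at h
  obtain ⟨hT, hG⟩ := h
  have h1 : ∀ i : Ci K, |lc i.1 (ll (α : K))| ≤ M := by
    intro i
    have h2 : tent (lc i.1 (ll (α : K)) / M) ≠ 0 := fun h0 =>
      hG (by rw [Gw, Finset.prod_eq_zero (Finset.mem_univ i) h0, zero_mul])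
    have h3 := abs_le_of_tent h2
    rw [abs_div, abs_of_pos hM, div_le_one hM] at h3
    exact h3
  obtain ⟨w, hw⟩ := exists_nv α
  have h2 := hB _ h1 w v
  have hv : 0 < v (α : K) := InfinitePlace.pos_iff.mpr hT.1
  have hw' : 0 < w (α : K) := InfinitePlace.pos_iff.mpr hT.1
  unfold ll at h2
  rw [hw, ← Real.exp_log hw', ← Real.exp_log hv, ← Real.exp_add]
  apply Real.exp_le_exp.mpr
  linarith

lemma exp_tl_le {c : ℝ} {α : 𝓞 K} (hc : 0 < c) (h : ∀ v : InfinitePlace K, c ≤ v (α : K)) {s : ℝ} (hs : 0 ≤ s) :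
    Real.exp (-s * tl (ll (α : K))) ≤ c ^ (-s * (Module.finrank ℚ K : ℝ)) := by
  rw [Real.rpow_def_of_pos hc]
  apply Real.exp_le_exp.mpr
  have h1 : (Module.finrank ℚ K : ℝ) * Real.log c ≤ tl (ll (α : K)) := by
    rw [← InfinitePlace.sum_mult_eq, Nat.cast_sum, Finset.sum_mul]
    apply Finset.sum_le_sum
    intro v _
    exact mul_le_mul_of_nonneg_left (Real.log_le_log hc (h v)) (by positivity)
  nlinarith

lemma summable_Fw {M : ℝ} (hM : 0 < M) {s : ℝ} (hs : 1 < s) : Summable (Fw (K := K) M s) := by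
  obtain ⟨c, hc, _, h⟩ := Fw_supp (K := K) hM
  have hd : (0:ℝ) < Module.finrank ℚ K := by exact_mod_cast Module.finrank_pos
  have h1 := summable_nv (K := K) (r := -s * (Module.finrank ℚ K : ℝ)) (by nlinarith)
  refine Summable.of_nonneg_of_le (Fw_nonneg M s) (fun α => ?_)
    (h1.mul_left (c ^ (-s * (Module.finrank ℚ K : ℝ))))
  by_cases h0 : Fw M s α = 0
  · rw [h0]; have := nv_nonneg α; positivity
  · have h2 := h s α h0
    have hT : TP (α : K) := by
      by_contra hT; exact h0 (by rw [Fw, if_neg hT])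
    have hα : 0 < nv α := nv_pos (by rintro rfl; exact hT.1 (by simp))
    rw [Fw, if_pos hT, ← Real.mul_rpow hc.le hα.le]
    exact (Gw_le _ _ _).trans (exp_tl_le (by positivity) h2 (by linarith))

lemma log_diff {a b e : ℝ} (ha : 0 < a) (hb : 0 < b) (h : |a - b| ≤ e) (he : e ≤ a / 2) :
    |Real.log a - Real.log b| ≤ 2 * e / a := by
  rw [abs_le] at h
  have h1 : Real.log a - Real.log b ≤ a / b - 1 := by
    rw [← Real.log_div ha.ne' hb.ne']
    have := Real.log_le_sub_one_of_pos (div_pos ha hb); linarith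
  have h2 : Real.log b - Real.log a ≤ b / a - 1 := by
    rw [← Real.log_div hb.ne' ha.ne']
    have := Real.log_le_sub_one_of_pos (div_pos hb ha); linarith
  have h3 : a / b - 1 ≤ 2 * e / a := by
    rw [div_sub_one hb.ne', div_le_div_iff₀ hb ha]; nlinarith
  have h4 : b / a - 1 ≤ 2 * e / a := by
    rw [div_sub_one ha.ne', div_le_div_iff_of_pos_right ha]; linarith
  rw [abs_le]; constructor <;> linarith

set_option maxHeartbeats 1000000 in
lemma Fw_diff {M : ℝ} (hM : 0 < M) (δ : 𝓞 K) : ∃ C : ℝ, 0 ≤ C ∧ ∀ s : ℝ, 1 ≤ s → s ≤ 2 → ∀ α : 𝓞 K,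
    |Fw M s (α + δ) - Fw M s α| ≤ C * nv α ^ (-(Module.finrank ℚ K : ℝ) - 1) + if α = 0 then 1 else 0 := by
  obtain ⟨c, hc, hc1, hsupp⟩ := Fw_supp (K := K) hM
  obtain ⟨A, hA, hlip⟩ := Gw_lip (K := K) M hM
  set d : ℝ := (Module.finrank ℚ K : ℝ) with hd
  have hd0 : 0 < d := by rw [hd]; exact_mod_cast Module.finrank_pos
  set q := c / 4 with hq
  have hq0 : 0 < q := by positivity
  set R := 4 * (nv δ + 1) / q with hR
  have hδ := nv_nonneg δ
  have hR0 : 0 < R := by positivity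
  have hRq : q * R = 4 * (nv δ + 1) := by rw [hR]; field_simp
  refine ⟨A * (2 * nv δ / q) * q ^ (-d) + R ^ (d + 1), by positivity, fun s hs1 hs2 α => ?_⟩
  have hnn : 0 ≤ nv α ^ (-d - 1) := Real.rpow_nonneg (nv_nonneg α) _
  have hb : |Fw M s (α + δ) - Fw M s α| ≤ 1 := by
    have h1 := Fw_nonneg M s (α + δ)
    have h2 := Fw_nonneg M s α
    have h3 := Fw_le_one M (by linarith : 0 ≤ s) (α + δ)
    have h4 := Fw_le_one M (by linarith : 0 ≤ s) α
    rw [abs_le]; constructor <;> linarith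
  by_cases hα0 : α = 0
  · rw [if_pos hα0]
    have : 0 ≤ (A * (2 * nv δ / q) * q ^ (-d) + R ^ (d + 1)) * nv α ^ (-d - 1) := by positivity
    linarith
  rw [if_neg hα0, add_zero]
  have hα := nv_pos hα0
  by_cases hsm : nv α < R
  · have h1 : 1 ≤ R ^ (d + 1) * nv α ^ (-d - 1) := by
      rw [show -d - 1 = -(d + 1) by ring, Real.rpow_neg hα.le, ← div_eq_mul_inv,
        one_le_div (by positivity)]
      exact Real.rpow_le_rpow hα.le hsm.le (by positivity)
    have h2 : 0 ≤ A * (2 * nv δ / q) * q ^ (-d) * nv α ^ (-d - 1) := by positivity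
    rw [add_mul]; linarith
  push Not at hsm
  have hqα : 4 * (nv δ + 1) ≤ q * nv α := by rw [← hRq]; exact mul_le_mul_of_nonneg_left hsm hq0.le
  by_cases hz : Fw M s α = 0 ∧ Fw M s (α + δ) = 0
  · rw [hz.1, hz.2]; simp; positivity
  have hge : ∀ v : InfinitePlace K, q * nv α ≤ v (α : K) := by
    intro v
    by_cases h1 : Fw M s α = 0
    · have h2 : Fw M s (α + δ) ≠ 0 := fun h => hz ⟨h1, h⟩
      have h3 := hsupp s _ h2 v
      have h4 : nv α ≤ nv (α + δ) + nv δ := by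
        have := nv_add (α + δ) (-δ)
        rwa [add_neg_cancel_right, nv_neg] at this
      have h5 : v ((α + δ : 𝓞 K) : K) ≤ v (α : K) + v (δ : K) := by
        exact vsum_le v α δ
      have h6 := le_nv v δ
      have h7 : c * nv α ≤ c * nv (α + δ) + c * nv δ := by
        rw [← mul_add]; exact mul_le_mul_of_nonneg_left h4 hc.le
      have h8 : c * nv δ ≤ nv δ := mul_le_of_le_one_left hδ hc1
      have h9 : c * nv α = 4 * (q * nv α) := by rw [hq]; ring
      linarith
    · have := hsupp s α h1 v
      have h9 : c * nv α = 4 * (q * nv α) := by rw [hq]; ring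
      have : 0 < q * nv α := by positivity
      linarith
  have hT : TP ((α + δ : 𝓞 K) : K) ↔ TP (α : K) := TP_near fun v => by
    have := hge v; linarith
  by_cases hTα : TP (α : K)
  swap
  · rw [Fw, Fw, if_neg hTα, if_neg (by rwa [hT])]; simp; positivity
  rw [Fw, Fw, if_pos hTα, if_pos (hT.mpr hTα)]
  have hl : ∀ v : InfinitePlace K, |ll (α : K) v - ll ((α + δ : 𝓞 K) : K) v| ≤ 2 * nv δ / (q * nv α) := by
    intro v
    have h1 := hge v
    have hv : 0 < v (α : K) := by have : 0 < q * nv α := by positivity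
                                  linarith
    have hv' : 0 < v ((α + δ : 𝓞 K) : K) := InfinitePlace.pos_iff.mpr (hT.mpr hTα).1
    refine (log_diff hv hv' (e := nv δ) ?_ (by linarith)).trans ?_
    · have h5 : v ((α + δ : 𝓞 K) : K) ≤ v (α : K) + v (δ : K) := by
        exact vsum_le v α δ
      have h6 : v (α : K) ≤ v ((α + δ : 𝓞 K) : K) + v (δ : K) := vsum_le' v α δ
      have := le_nv v δ
      rw [abs_le]; constructor <;> linarith
    · exact div_le_div_of_nonneg_left (by positivity) (by positivity) h1
  have hη1 : 2 * nv δ / (q * nv α) ≤ 1 := by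
    rw [div_le_one (by positivity)]; linarith
  refine (hlip _ _ _ s hl hη1 hs1 hs2).trans ?_
  have h1 := exp_tl_le (α := α) (c := q * nv α) (by positivity) hge (s := s) (by linarith)
  have h2 : (q * nv α) ^ (-s * d) ≤ (q * nv α) ^ (-d) :=
    Real.rpow_le_rpow_of_exponent_le (by linarith) (by nlinarith)
  calc A * (2 * nv δ / (q * nv α)) * Real.exp (-s * tl (ll (α : K)))
      ≤ A * (2 * nv δ / (q * nv α)) * (q * nv α) ^ (-d) :=
        mul_le_mul_of_nonneg_left (h1.trans h2) (by positivity)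
    _ = A * (2 * nv δ / q) * q ^ (-d) * nv α ^ (-d - 1) := by
        rw [Real.mul_rpow hq0.le hα.le, Real.rpow_sub hα, Real.rpow_one]
        field_simp
    _ ≤ _ := by
        rw [add_mul]; have : 0 ≤ R ^ (d + 1) * nv α ^ (-d - 1) := by positivity
        linarith

/-- total variation bound -/
lemma Fw_var {M : ℝ} (hM : 0 < M) (δ : 𝓞 K) : ∃ C : ℝ, ∀ s : ℝ, 1 < s → s ≤ 2 →
    Summable (fun α : 𝓞 K => |Fw M s (α + δ) - Fw M s α|) ∧
    ∑' α : 𝓞 K, |Fw M s (α + δ) - Fw M s α| ≤ C := by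
  obtain ⟨C, hC, h⟩ := Fw_diff (K := K) hM δ
  have h1 := (summable_nv (K := K) (r := -(Module.finrank ℚ K : ℝ) - 1) (by linarith)).mul_left C
  have h2 : Summable (fun α : 𝓞 K => if α = 0 then (1:ℝ) else 0) :=
    (hasSum_ite_eq 0 1).summable
  have h3 := h1.add h2
  refine ⟨∑' α : 𝓞 K, (C * nv α ^ (-(Module.finrank ℚ K : ℝ) - 1) + if α = 0 then (1:ℝ) else 0), fun s hs1 hs2 => ?_⟩
  have h4 : Summable (fun α : 𝓞 K => |Fw M s (α + δ) - Fw M s α|) :=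
    h3.of_nonneg_of_le (fun _ => abs_nonneg _) (fun α => h s hs1.le hs2 α)
  exact ⟨h4, h4.tsum_le_tsum (fun α => h s hs1.le hs2 α) h3⟩

end

/-! ### Units in the ray -/
section
variable {K : Type} [Field K] [NumberField K]
open NumberField.Units.dirichletUnitTheorem NumberField.mixedEmbedding.fundamentalCone
open scoped Classical

/-- the modulus -/
def mS (S : Finset (Pl K)) (k : ℕ) : Ideal (𝓞 K) := ∏ v ∈ S, v.asIdeal ^ (k + 1)

lemma mS_ne (S : Finset (Pl K)) (k : ℕ) : mS S k ≠ ⊥ := by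
  rw [Ne, ← Ideal.zero_eq_bot, mS, Finset.prod_eq_zero_iff]
  push Not
  intro v _
  exact pow_ne_zero _ v.ne_bot

lemma coe_ne {I : Ideal (𝓞 K)} (h : I ≠ ⊥) : (I : FI K) ≠ 0 := by
  rw [Ne, FractionalIdeal.coeIdeal_eq_zero]; exact h

lemma dvI_mS (S : Finset (Pl K)) (k : ℕ) (v : Pl K) :
    dvI (mS S k : FI K) v = if v ∈ S then (k : ℤ) + 1 else 0 := by
  rw [dvI_apply]
  have : (mS S k : FI K) = ∏ v ∈ S, ((v.asIdeal : FI K) ^ (k + 1)) := by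
    rw [show (mS S k : FI K) = FractionalIdeal.coeIdealHom _ K (mS S k) from rfl, mS, map_prod]
    apply Finset.prod_congr rfl
    intro v _
    exact map_pow (FractionalIdeal.coeIdealHom (nonZeroDivisors (𝓞 K)) K) _ _
  rw [this, FractionalIdeal.count_prod K v _ _ (fun i _ => pow_ne_zero _ (by
    rw [Ne, FractionalIdeal.coeIdeal_eq_zero]; exact i.ne_bot))]
  simp only [FractionalIdeal.count_pow, FractionalIdeal.count_maximal]
  simp

lemma mem_coe {I : Ideal (𝓞 K)} (hI : I ≠ ⊥) (x : 𝓞 K) :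
    x ∈ I ↔ ∀ v : Pl K, v.valuation K (x : K) ≤ WithZero.exp (-(dvI (I : FI K) v)) := by
  constructor
  · intro h v
    exact mem_coeIdeal_pow_iff _ v _ ((FractionalIdeal.mem_coeIdeal _).mpr ⟨x, h, rfl⟩)
  · intro h
    obtain ⟨y, hy, hxy⟩ := (FractionalIdeal.mem_coeIdeal _).mp (mem_of_valuation (x : K) _ (coe_ne hI) h)
    rwa [← RingOfIntegers.coe_injective hxy]

lemma mem_mS {S : Finset (Pl K)} {k : ℕ} {x : 𝓞 K} :
    x ∈ mS S k ↔ ∀ v ∈ S, v.valuation K (x : K) ≤ WithZero.exp (-((k : ℤ) + 1)) := by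
  rw [mem_coe (mS_ne S k)]
  constructor
  · intro h v hv
    have := h v
    rwa [dvI_mS, if_pos hv] at this
  · intro h v
    rw [dvI_mS]
    split_ifs with hv
    · exact h v hv
    · simpa using v.valuation_le_one x

lemma oc_sub (x y : 𝓞 K) : ((x - y : 𝓞 K) : K) = (x : K) - y := map_sub (algebraMap (𝓞 K) K) x y
lemma oc_add (x y : 𝓞 K) : ((x + y : 𝓞 K) : K) = (x : K) + y := map_add (algebraMap (𝓞 K) K) x y
lemma oc_mul (x y : 𝓞 K) : ((x * y : 𝓞 K) : K) = (x : K) * y := map_mul (algebraMap (𝓞 K) K) x y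
lemma oc_one : ((1 : 𝓞 K) : K) = 1 := map_one (algebraMap (𝓞 K) K)
lemma oc_pow (x : 𝓞 K) (n : ℕ) : ((x ^ n : 𝓞 K) : K) = (x : K) ^ n := map_pow (algebraMap (𝓞 K) K) x n
lemma oc_ne {x : 𝓞 K} : (x : K) ≠ 0 ↔ x ≠ 0 := RingOfIntegers.coe_ne_zero_iff

/-- units in the ray -/
def EP (S : Finset (Pl K)) (k : ℕ) : AddSubgroup (Additive (𝓞 K)ˣ) :=
  (Subgroup.comap (Units.map (algebraMap (𝓞 K) K : 𝓞 K →* K)) (Ray S k)).toAddSubgroup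

lemma mem_EP {S : Finset (Pl K)} {k : ℕ} {x : Additive (𝓞 K)ˣ} : x ∈ EP S k ↔
    (∀ v ∈ S, v.valuation K (((x.toMul : 𝓞 K) : K) - 1) ≤ WithZero.exp (-((k : ℤ) + 1))) ∧
    ∀ φ : K →+* ℝ, 0 < φ ((x.toMul : 𝓞 K) : K) := Iff.rfl

lemma exists_M0 (S : Finset (Pl K)) (k : ℕ) : ∃ M : ℕ, 0 < M ∧ ∀ x : Additive (𝓞 K)ˣ, M • x ∈ EP S k := by
  have : Finite (𝓞 K ⧸ mS S k) := Ideal.finiteQuotientOfFreeOfNeBot _ (mS_ne S k)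
  let c := Nat.card (𝓞 K ⧸ mS S k)ˣ
  have hc : 0 < c := Nat.card_pos
  refine ⟨c * 2, by omega, fun x => ?_⟩
  rw [mem_EP]
  have e : (((c * 2) • x).toMul : 𝓞 K) = ((x.toMul : 𝓞 K) ^ c) ^ 2 := by
    rw [← pow_mul]; rfl
  constructor
  · have h1 : ((x.toMul : 𝓞 K) ^ c) ^ 2 - 1 ∈ mS S k := by
      rw [← Ideal.Quotient.eq, map_one, map_pow, map_pow]
      have h2 : (Units.map (Ideal.Quotient.mk (mS S k) : 𝓞 K →* _) x.toMul) ^ c = 1 := pow_card_eq_one'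
      have h3 := congrArg Units.val h2
      rw [Units.val_pow_eq_pow_val, Units.coe_map] at h3
      have h4 : (Ideal.Quotient.mk (mS S k)) (x.toMul : 𝓞 K) ^ c = 1 := h3
      rw [h4, one_pow]
    have h2 := mem_mS.mp h1
    intro v hv
    have h3 := h2 v hv
    rw [← e] at h3
    have h4 : ((((((c * 2) • x).toMul : 𝓞 K) - 1 : 𝓞 K)) : K) = ((((c * 2) • x).toMul : 𝓞 K) : K) - 1 := by
      rw [oc_sub, oc_one]
    rwa [h4] at h3
  · intro φ
    rw [e, oc_pow, map_pow]
    refine sq_pos_of_ne_zero ?_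
    rw [map_ne_zero, oc_ne]
    exact pow_ne_zero _ x.toMul.ne_zero

/-- log embedding of units -/
def uL : Additive (𝓞 K)ˣ →+ (InfinitePlace K → ℝ) where
  toFun x := ll ((x.toMul : 𝓞 K) : K)
  map_zero' := by funext v; simp [ll]
  map_add' x y := by
    rw [← ll_mul (oc_ne.mpr x.toMul.ne_zero) (oc_ne.mpr y.toMul.ne_zero), ← oc_mul]; rfl

lemma uL_apply (x : Additive (𝓞 K)ˣ) : uL x = ll ((x.toMul : 𝓞 K) : K) := rfl

lemma tl_add (l l' : InfinitePlace K → ℝ) : tl (l + l') = tl l + tl l' := by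
  simp [tl, mul_add, Finset.sum_add_distrib]

lemma tl_uL (x : Additive (𝓞 K)ˣ) : tl (uL x) = 0 := by
  rw [uL_apply, tl_eq (oc_ne.mpr x.toMul.ne_zero), ← Rat.cast_abs]
  have := NumberField.Units.norm K x.toMul
  rw [this]; simp

/-- the free part -/
def th (M : ℕ) : (Ci K → ℤ) →+ Additive (𝓞 K)ˣ where
  toFun n := M • ∑ i, n i • Additive.ofMul (NumberField.Units.fundSystem K (equivFinRank.symm i))
  map_zero' := by simp
  map_add' x y := by
    rw [← nsmul_add, ← Finset.sum_add_distrib]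
    congr 1
    exact Finset.sum_congr rfl fun i _ => add_zsmul _ _ _

lemma th_apply (M : ℕ) (n : Ci K → ℤ) : th M n =
  M • ∑ i, n i • Additive.ofMul (NumberField.Units.fundSystem K (equivFinRank.symm i)) := rfl

lemma lc_th (M : ℕ) (n : Ci K → ℤ) (j : Ci K) : lc j.1 (uL (th M n)) = M * n j := by
  rw [th_apply, map_nsmul, map_sum, map_nsmul, map_sum]
  have : ∀ i : Ci K, lc j.1 (uL (n i • Additive.ofMul (NumberField.Units.fundSystem K (equivFinRank.symm i)))) =
      n i * if i = j then 1 else 0 := by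
    intro i
    rw [map_zsmul, map_zsmul, uL_apply]
    have := lc_fund i j
    rw [zsmul_eq_mul]
    congr 1
  rw [Finset.sum_congr rfl fun i _ => this i]
  simp

lemma TP_mul {S : Finset (Pl K)} {k : ℕ} {x : Additive (𝓞 K)ˣ} (hx : x ∈ EP S k) {α : 𝓞 K} (hα : TP (α : K)) :
    TP (((x.toMul : 𝓞 K) * α : 𝓞 K) : K) := by
  rw [oc_mul]
  refine ⟨mul_ne_zero (oc_ne.mpr x.toMul.ne_zero) hα.1, fun φ => ?_⟩
  rw [map_mul]
  exact mul_pos (hx.2 φ) (hα.2 φ)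

lemma th_sum {S : Finset (Pl K)} {k : ℕ} {M : ℕ} (hM : 0 < M) (hM' : ∀ x : Additive (𝓞 K)ˣ, M • x ∈ EP S k)
    {α : 𝓞 K} (hα : TP (α : K)) (s : ℝ) :
    HasSum (fun n : Ci K → ℤ => Fw M s (((th M n).toMul : 𝓞 K) * α)) (Real.exp (-s * tl (ll (α : K)))) := by
  have h := (tent_hasSum (fun i : Ci K => lc i.1 (ll (α : K)) / M)).mul_right (Real.exp (-s * tl (ll (α : K))))
  rw [one_mul] at h
  refine HasSum.congr_fun h fun n => ?_
  have hn : th M n ∈ EP S k := hM' _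
  rw [Fw, if_pos (TP_mul hn hα), oc_mul, ll_mul (oc_ne.mpr (Units.ne_zero _)) hα.1, ← uL_apply, Gw, tl_add, tl_uL, zero_add]
  congr 1
  apply Finset.prod_congr rfl
  intro i _
  have hM0 : (M : ℝ) ≠ 0 := by positivity
  rw [map_add, lc_th]
  congr 1
  field_simp
  ring

lemma th_index (S : Finset (Pl K)) (k : ℕ) {M : ℕ} (hM : 0 < M) : (th (K := K) M).range.relIndex (EP S k) ≠ 0 := by
  apply relIndex_ne_zero_of_fg _ _ (NumberField.Units.torsionOrder K * M)
    (mul_ne_zero (NumberField.Units.torsionOrder_ne_zero K) hM.ne')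
  intro x _
  obtain ⟨⟨ζ, n⟩, h, _⟩ := NumberField.Units.exist_unique_eq_mul_prod K x.toMul
  refine ⟨fun i => (NumberField.Units.torsionOrder K : ℤ) * n (equivFinRank.symm i), ?_⟩
  have hζ : (ζ : (𝓞 K)ˣ) ^ NumberField.Units.torsionOrder K = 1 := by
    have : ζ ^ NumberField.Units.torsionOrder K = 1 := pow_card_eq_one'
    exact_mod_cast congrArg Subtype.val this
  have hx : NumberField.Units.torsionOrder K • x = NumberField.Units.torsionOrder K •
      ∑ i, n i • Additive.ofMul (NumberField.Units.fundSystem K i) := by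
    have : x = Additive.ofMul (ζ : (𝓞 K)ˣ) + ∑ i, n i • Additive.ofMul (NumberField.Units.fundSystem K i) := by
      apply Additive.toMul.injective
      rw [h, toMul_add, toMul_sum]
      rfl
    rw [this, nsmul_add, ← ofMul_pow, hζ, ofMul_one, zero_add]
  rw [th_apply, mul_nsmul, hx]
  congr 1
  rw [← Finset.sum_nsmul, ← Equiv.sum_comp equivFinRank.symm]
  apply Finset.sum_congr rfl
  intro i _
  rw [mul_zsmul, natCast_zsmul]

lemma unit_sum (S : Finset (Pl K)) (k : ℕ) : ∃ M : ℕ, 0 < M ∧ ∃ j : ℕ, 0 < j ∧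
    ∀ α : 𝓞 K, TP (α : K) → ∀ s : ℝ,
      HasSum (fun u : EP S k => Fw M s ((u.1.toMul : 𝓞 K) * α)) (j * Real.exp (-s * tl (ll (α : K)))) := by
  obtain ⟨M, hM, hM'⟩ := exists_M0 S k
  refine ⟨M, hM, (th (K := K) M).range.relIndex (EP S k), Nat.pos_of_ne_zero (th_index S k hM), fun α hα s => ?_⟩
  let Y := (th (K := K) M).range.addSubgroupOf (EP S k)
  have hfin : Finite (EP S k ⧸ Y) := by
    have : Y.FiniteIndex := ⟨th_index S k hM⟩
    infer_instance
  have : Fintype (EP S k ⧸ Y) := Fintype.ofFinite _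
  let e0 : (EP S k ⧸ Y) × (Ci K → ℤ) → EP S k := fun p => p.1.out + ⟨th M p.2, hM' _⟩
  have hinj : Function.Injective (th (K := K) M) := by
    intro n n' h
    funext j
    have := lc_th M n j
    rw [h, lc_th] at this
    have hM0 : (M : ℝ) ≠ 0 := by positivity
    exact_mod_cast (mul_left_cancel₀ hM0 this).symm
  have hmem : ∀ n, (⟨th M n, hM' _⟩ : EP S k) ∈ Y := fun n => ⟨n, rfl⟩
  have he : Function.Bijective e0 := by
    constructor
    · rintro ⟨q, n⟩ ⟨q', n'⟩ h
      have h' : q.out + ⟨th M n, hM' _⟩ = q'.out + (⟨th M n', hM' _⟩ : EP S k) := h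
      have hq : q = q' := by
        have := congrArg (QuotientAddGroup.mk (s := Y)) h'
        rw [QuotientAddGroup.mk_add_of_mem _ (hmem n), QuotientAddGroup.mk_add_of_mem _ (hmem n'),
          QuotientAddGroup.out_eq', QuotientAddGroup.out_eq'] at this
        exact this
      subst hq
      have := congrArg Subtype.val (add_left_cancel h')
      rw [hinj this]
    · intro x
      have : -(QuotientAddGroup.mk (s := Y) x).out + x ∈ Y := by
        rw [← QuotientAddGroup.eq, QuotientAddGroup.out_eq']
      obtain ⟨n, hn⟩ := this
      refine ⟨(QuotientAddGroup.mk x, n), ?_⟩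
      change _ + _ = _
      have h2 : (⟨th M n, hM' _⟩ : EP S k) = -(QuotientAddGroup.mk (s := Y) x).out + x := Subtype.ext hn
      rw [h2, add_neg_cancel_left]
  let e := Equiv.ofBijective e0 he
  rw [← e.hasSum_iff]
  have hfib : ∀ q : EP S k ⧸ Y, HasSum (fun n : Ci K → ℤ => Fw M s (((e0 (q, n)).1.toMul : 𝓞 K) * α))
      (Real.exp (-s * tl (ll (α : K)))) := by
    intro q
    have h1 := th_sum hM hM' (TP_mul q.out.2 hα) s
    rw [oc_mul, ll_mul (oc_ne.mpr (Units.ne_zero _)) hα.1, ← uL_apply, tl_add, tl_uL, zero_add] at h1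
    convert h1 using 1
    funext n
    congr 1
    change ((q.out.1 + th M n).toMul : 𝓞 K) * α = _
    rw [toMul_add, Units.val_mul]; ring
  have hsum : Summable (fun p : (EP S k ⧸ Y) × (Ci K → ℤ) => Fw M s (((e0 p).1.toMul : 𝓞 K) * α)) := by
    rw [summable_prod_of_nonneg (fun p => Fw_nonneg _ _ _)]
    exact ⟨fun q => (hfib q).summable, (hasSum_fintype _).summable⟩
  have h2 := hsum.hasSum.prod_fiberwise hfib
  have h3 := h2.unique (hasSum_fintype _)
  have h4 := hsum.hasSum
  rw [h3] at h4
  rw [Finset.sum_const, Finset.card_univ, nsmul_eq_mul, ← Nat.card_eq_fintype_card] at h4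
  exact h4

end

/-! ### Partial zeta sums of ray classes -/
section
variable {K : Type} [Field K] [NumberField K]
open scoped Classical

lemma tsum_shift {G : Type} [AddCommGroup G] {a : G → ℝ} (ha : Summable a) (d : G) :
    (Summable fun t => a (t + d)) ∧ ∑' t, a t = ∑' t, a (t + d) :=
  ⟨(Equiv.addRight d).summable_iff.mpr ha, ((Equiv.addRight d).tsum_eq a).symm⟩

set_option maxHeartbeats 400000 in
lemma coset_sum {M : ℝ} (hM : 0 < M) {I : Ideal (𝓞 K)} (hI : I ≠ ⊥) (y : 𝓞 K) :
    ∃ C : ℝ, ∀ s : ℝ, 1 < s → s ≤ 2 →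
      |(Ideal.absNorm I : ℝ) * (∑' t : 𝓞 K, if t - y ∈ I then Fw M s t else 0) - ∑' t : 𝓞 K, Fw M s t| ≤ C := by
  have hfin : Finite (𝓞 K ⧸ I) := Ideal.finiteQuotientOfFreeOfNeBot _ hI
  have : Fintype (𝓞 K ⧸ I) := Fintype.ofFinite _
  let π := Ideal.Quotient.mk I
  have hr : ∀ q, ∃ r : 𝓞 K, π r = q := Ideal.Quotient.mk_surjective
  choose r hr using hr
  choose C hC using fun q => Fw_var (K := K) hM (r q - y)
  refine ⟨∑ q, C q, fun s hs1 hs2 => ?_⟩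
  have hF := summable_Fw (K := K) hM hs1
  let a : 𝓞 K ⧸ I → 𝓞 K → ℝ := fun q t => if π t = q then Fw M s t else 0
  have ha : ∀ q, Summable (a q) := by
    intro q
    refine hF.of_nonneg_of_le (fun t => ?_) (fun t => ?_)
    · dsimp only [a]; split_ifs; exacts [Fw_nonneg _ _ _, le_rfl]
    · dsimp only [a]; split_ifs; exacts [le_rfl, Fw_nonneg _ _ _]
  have h1 : ∑' t : 𝓞 K, Fw M s t = ∑ q, ∑' t, a q t := by
    rw [← Summable.tsum_finsetSum fun q _ => ha q]
    apply tsum_congr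
    intro t
    simp [a]
  have h2 : (∑' t : 𝓞 K, if t - y ∈ I then Fw M s t else 0) = ∑' t, a (π y) t := by
    apply tsum_congr
    intro t
    dsimp only [a]
    simp only [π, Ideal.Quotient.eq]
  have h3 : ∀ q, |∑' t, a (π y) t - ∑' t, a q t| ≤ C q := by
    intro q
    obtain ⟨hs', e1⟩ := tsum_shift (ha q) (r q - y)
    rw [e1, ← (ha _).tsum_sub hs']
    obtain ⟨h4, h5⟩ := hC q s hs1 hs2
    have hle : ∀ t, ‖a (π y) t - a q (t + (r q - y))‖ ≤ |Fw M s (t + (r q - y)) - Fw M s t| := by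
      intro t
      dsimp only [a]
      have : π (t + (r q - y)) = q ↔ π t = π y := by
        rw [map_add, map_sub, hr]
        constructor
        · intro h; linear_combination h
        · intro h; linear_combination h
      rw [Real.norm_eq_abs, abs_sub_comm]
      simp only [this]
      split_ifs
      · exact le_rfl
      · simp
    have h6 := tsum_of_norm_bounded h4.hasSum hle
    rw [Real.norm_eq_abs] at h6
    exact h6.trans h5
  rw [h1, h2]
  have h4 : (Ideal.absNorm I : ℝ) * ∑' t, a (π y) t = ∑ q : 𝓞 K ⧸ I, ∑' t, a (π y) t := by
    rw [Finset.sum_const, Finset.card_univ, nsmul_eq_mul, ← Nat.card_eq_fintype_card]; rfl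
  rw [h4, ← Finset.sum_sub_distrib]
  exact (Finset.abs_sum_le_sum_abs _ _).trans (Finset.sum_le_sum fun q _ => h3 q)

lemma tl_lg {α : 𝓞 K} (h : α ≠ 0) : tl (ll (α : K)) = lg (dv (α : K)) := by
  have hb : Ideal.span {α} ≠ ⊥ := by simpa using h
  rw [tl_eq (oc_ne.mpr h), dv, ← FractionalIdeal.coeIdeal_span_singleton, lg_dvI hb,
    Ideal.absNorm_span_singleton]
  congr 1
  have h1 : (Algebra.norm ℚ (α : K) : ℚ) = ((Algebra.norm ℤ α : ℤ) : ℚ) := by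
    rw [Algebra.coe_norm_int]
  rw [h1, Nat.cast_natAbs]
  push_cast
  rfl

/-- if `v` divides `I` -/
lemma dvI_pos_of_le {I : Ideal (𝓞 K)} (hI : I ≠ ⊥) {v : Pl K} (h : I ≤ v.asIdeal) : 1 ≤ dvI (I : FI K) v := by
  obtain ⟨J, rfl⟩ := Ideal.dvd_iff_le.mpr h
  have hJ : J ≠ ⊥ := by rintro rfl; simp at hI
  rw [FractionalIdeal.coeIdeal_mul, dvI_mul (coe_ne v.ne_bot) (coe_ne hJ), dvI_pl]
  have := (dvI_nonneg_iff (coe_ne hJ)).mpr ⟨J, hJ, rfl⟩ v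
  simpa using this

lemma coprime_mS {S : Finset (Pl K)} {k : ℕ} {b : Ideal (𝓞 K)} (hb : b ≠ ⊥) (h : dvI (b : FI K) ∈ DivS S) :
    b ⊔ mS S k = ⊤ := by
  by_contra hne
  obtain ⟨P, hP, hle⟩ := Ideal.exists_le_maximal _ hne
  have hP0 : P ≠ ⊥ := by
    rintro rfl
    exact hb (le_bot_iff.mp (le_sup_left.trans hle))
  let v : Pl K := ⟨P, hP.isPrime, hP0⟩
  have h1 := dvI_pos_of_le (v := v) hb (le_sup_left.trans hle)
  have h2 := dvI_pos_of_le (v := v) (mS_ne S k) (le_sup_right.trans hle)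
  rw [dvI_mS] at h2
  split_ifs at h2 with hv
  · rw [h v hv] at h1; omega
  · omega

/-- partial zeta term -/
def fE (S : Finset (Pl K)) (k : ℕ) (E : Dv K) (s : ℝ) (D : Dv K) : ℝ :=
  if D + E ∈ PR S k then ztf K s D else 0

lemma fE_nonneg (S : Finset (Pl K)) (k : ℕ) (E : Dv K) (s : ℝ) (D : Dv K) : 0 ≤ fE S k E s D := by
  unfold fE; split_ifs; exacts [ztf_nonneg _ _, le_rfl]

lemma fE_le (S : Finset (Pl K)) (k : ℕ) (E : Dv K) (s : ℝ) (D : Dv K) : fE S k E s D ≤ ztf K s D := by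
  unfold fE; split_ifs; exacts [le_rfl, ztf_nonneg _ _]

lemma summable_fE (S : Finset (Pl K)) (k : ℕ) (E : Dv K) {s : ℝ} (hs : 1 < s) : Summable (fE S k E s) :=
  (summable_ztf hs).of_nonneg_of_le (fE_nonneg _ _ _ _) (fE_le _ _ _ _)

lemma exists_int {x : K} (hx : x ≠ 0) (h : 0 ≤ dv x) : ∃ α : 𝓞 K, (α : K) = x := by
  obtain ⟨J, hJ, h1⟩ := (dvI_nonneg_iff (span_ne_zero hx)).mp h
  have : x ∈ (J : FI K) := by rw [← h1]; exact FractionalIdeal.mem_spanSingleton_self _ _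
  obtain ⟨y, _, hy⟩ := (FractionalIdeal.mem_coeIdeal _).mp this
  exact ⟨y, hy⟩

lemma mem_iff_dv {b : Ideal (𝓞 K)} (hb : b ≠ ⊥) {t : 𝓞 K} (ht : t ≠ 0) :
    t ∈ b ↔ dvI (b : FI K) ≤ dv (t : K) := by
  rw [mem_coe hb, Finsupp.le_def]
  apply forall_congr'
  intro v
  rw [valuation_eq v (oc_ne.mpr ht), WithZero.exp_le_exp]
  omega

lemma dv_unit (u : (𝓞 K)ˣ) : dv ((u : 𝓞 K) : K) = 0 := by
  rw [dv, ← FractionalIdeal.coeIdeal_span_singleton]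
  have : Ideal.span {(u : 𝓞 K)} = 1 := by rw [Ideal.one_eq_top, Ideal.span_singleton_eq_top]; exact u.isUnit
  rw [this]; simp [dvI_one]

lemma oc_inj {x y : 𝓞 K} (h : (x : K) = y) : x = y := RingOfIntegers.coe_injective h

lemma class_sum {S : Finset (Pl K)} {k : ℕ} {M j : ℕ} (hM : 0 < M)
    (hu : ∀ α : 𝓞 K, TP (α : K) → ∀ s : ℝ,
      HasSum (fun u : EP S k => Fw M s ((u.1.toMul : 𝓞 K) * α)) (j * Real.exp (-s * tl (ll (α : K)))))
    {b : Ideal (𝓞 K)} (hb : b ≠ ⊥) {s : ℝ} (hs : 1 < s) :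
    j * ∑' D, fE S k (dvI (b : FI K)) s D = Real.exp (s * lg (dvI (b : FI K))) *
      ∑' t : 𝓞 K, if t ∈ b ∧ t - 1 ∈ mS S k then Fw M s t else 0 := by
  set E := dvI (b : FI K) with hE
  have hE0 : 0 ≤ E := (dvI_nonneg_iff (coe_ne hb)).mpr ⟨b, hb, rfl⟩
  let P := {D : Dv K // 0 ≤ D ∧ D + E ∈ PR S k}
  let X := {t : 𝓞 K // (t ∈ b ∧ t - 1 ∈ mS S k) ∧ TP (t : K)}
  have hray : ∀ t : 𝓞 K, (t - 1 ∈ mS S k ∧ TP (t : K)) ↔ ∃ h : (t : K) ≠ 0, Units.mk0 (t : K) h ∈ Ray S k := by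
    intro t
    rw [mem_mS]
    simp only [oc_sub, oc_one]
    constructor
    · rintro ⟨h1, h2⟩; exact ⟨h2.1, h1, h2.2⟩
    · rintro ⟨h0, h1, h2⟩; exact ⟨h1, h0, h2⟩
  have hex : ∀ D : P, ∃ α : 𝓞 K, (α - 1 ∈ mS S k ∧ TP (α : K)) ∧ dv (α : K) = D.1 + E := by
    rintro ⟨D, hD0, hD⟩
    obtain ⟨t, ht, htD⟩ := mem_PR.mp hD
    obtain ⟨α, hα⟩ := exists_int t.ne_zero (by rw [htD]; exact add_nonneg hD0 hE0)
    refine ⟨α, (hray α).mpr ⟨by rw [hα]; exact t.ne_zero, ?_⟩, by rw [hα, htD]⟩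
    have : Units.mk0 (α : K) (by rw [hα]; exact t.ne_zero) = t := Units.ext hα
    rwa [this]
  choose α hα hαD using hex
  have hα0 : ∀ D, α D ≠ 0 := fun D => oc_ne.mp (hα D).2.1
  have hdu : ∀ (u : (𝓞 K)ˣ) (D : P), dv (((u : 𝓞 K) * α D : 𝓞 K) : K) = D.1 + E := by
    intro u D
    rw [oc_mul, dv_mul (oc_ne.mpr u.ne_zero) (hα D).2.1, dv_unit, zero_add, hαD]
  let e0 : P × EP S k → X := fun p => ⟨(p.2.1.toMul : 𝓞 K) * α p.1, by
    have h1 : ((p.2.1.toMul : 𝓞 K) * α p.1 : 𝓞 K) ≠ 0 := mul_ne_zero (Units.ne_zero _) (hα0 _)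
    refine ⟨⟨?_, ?_⟩, TP_mul p.2.2 (hα _).2⟩
    · rw [mem_iff_dv hb h1, hdu, ← hE]
      exact le_add_of_nonneg_left p.1.2.1
    · refine ((hray _).mpr ⟨oc_ne.mpr h1, ?_⟩).1
      obtain ⟨h2, h3⟩ := (hray _).mp (hα p.1)
      have h4 := (Ray S k).mul_mem p.2.2 h3
      convert h4 using 1
      apply Units.ext
      rw [Units.val_mk0, oc_mul]
      rfl⟩
  have he : Function.Bijective e0 := by
    constructor
    · rintro ⟨D, u⟩ ⟨D', u'⟩ h
      have h1 : (u.1.toMul : 𝓞 K) * α D = (u'.1.toMul : 𝓞 K) * α D' := congrArg Subtype.val h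
      have h2 := hdu u.1.toMul D
      rw [h1, hdu] at h2
      have h3 : D = D' := Subtype.ext (add_right_cancel h2).symm
      subst h3
      have h4 := mul_right_cancel₀ (hα0 D) h1
      have h5 : u = u' := Subtype.ext (Additive.toMul.injective (Units.ext h4))
      rw [h5]
    · rintro ⟨t, ⟨htb, htm⟩, htT⟩
      have ht0 : t ≠ 0 := oc_ne.mp htT.1
      obtain ⟨h0, hR⟩ := (hray t).mp ⟨htm, htT⟩
      have hle := (mem_iff_dv hb ht0).mp htb
      let D : P := ⟨dv (t : K) - E, sub_nonneg.mpr hle, by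
        rw [sub_add_cancel]; exact mem_PR.mpr ⟨_, hR, rfl⟩⟩
      have hDt : dv (α D : K) = dv (t : K) := by rw [hαD]; exact sub_add_cancel _ _
      have hq : dv ((t : K) / α D) = 0 := by
        rw [div_eq_mul_inv, dv_mul htT.1 (inv_ne_zero (hα D).2.1), dv_inv, hDt, add_neg_cancel]
      have hq' : dv ((α D : K) / t) = 0 := by
        rw [div_eq_mul_inv, dv_mul (hα D).2.1 (inv_ne_zero htT.1), dv_inv, hDt, add_neg_cancel]
      obtain ⟨u, hu1⟩ := exists_int (div_ne_zero htT.1 (hα D).2.1) hq.ge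
      obtain ⟨u', hu2⟩ := exists_int (div_ne_zero (hα D).2.1 htT.1) hq'.ge
      have huu : u * u' = 1 := by
        apply oc_inj
        have := htT.1
        have := (hα D).2.1
        rw [oc_mul, hu1, hu2, oc_one]; field_simp
      let U : (𝓞 K)ˣ := Units.mkOfMulEqOne u u' huu
      obtain ⟨h2, h3⟩ := (hray _).mp (hα D)
      have hU : Additive.ofMul U ∈ EP S k := by
        have h4 := (Ray S k).div_mem hR h3
        have h5 : Units.mk0 (t : K) h0 / Units.mk0 (α D : K) h2 =
            Units.map (algebraMap (𝓞 K) K : 𝓞 K →* K) U := by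
          apply Units.ext
          rw [Units.val_div_eq_div_val]
          exact hu1.symm
        rw [h5] at h4
        exact h4
      refine ⟨(D, ⟨Additive.ofMul U, hU⟩), Subtype.ext ?_⟩
      change u * α D = t
      apply oc_inj
      have := (hα D).2.1
      rw [oc_mul, hu1]; field_simp
  let e := Equiv.ofBijective e0 he
  have hF := summable_Fw (K := K) (M := M) (by exact_mod_cast hM) hs
  have hX : (∑' t : 𝓞 K, if t ∈ b ∧ t - 1 ∈ mS S k then Fw M s t else 0) = ∑' t : X, Fw M s t.1 := by
    refine Eq.trans ?_ (tsum_subtype {t : 𝓞 K | (t ∈ b ∧ t - 1 ∈ mS S k) ∧ TP (t : K)} (Fw M s)).symm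
    apply tsum_congr
    intro t
    rw [Set.indicator_apply]
    by_cases h1 : t ∈ b ∧ t - 1 ∈ mS S k
    · by_cases h2 : TP (t : K)
      · rw [if_pos h1, if_pos ⟨h1, h2⟩]
      · rw [if_pos h1, if_neg (fun h => h2 h.2), Fw, if_neg h2]
    · rw [if_neg h1, if_neg (fun h => h1 h.1)]
  have hsX : Summable (fun t : X => Fw M s t.1) := hF.subtype _
  have h1 : HasSum (fun p : P × EP S k => Fw M s ((p.2.1.toMul : 𝓞 K) * α p.1)) (∑' t : X, Fw M s t.1) :=
    e.hasSum_iff.mpr hsX.hasSum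
  have h2 := h1.prod_fiberwise fun D => hu (α D) (hα D).2 s
  have h3 : ∑' D, fE S k E s D = ∑' D : P, Real.exp (-s * lg D.1) := by
    refine Eq.trans ?_ (tsum_subtype {D : Dv K | 0 ≤ D ∧ D + E ∈ PR S k} (fun D => Real.exp (-s * lg D))).symm
    apply tsum_congr
    intro D
    rw [Set.indicator_apply, fE, ztf]
    by_cases h1 : 0 ≤ D <;> by_cases h2 : D + E ∈ PR S k <;> simp [h1, h2]
  rw [h3, hX, ← h2.tsum_eq, ← tsum_mul_left, ← tsum_mul_left]
  apply tsum_congr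
  intro D
  rw [tl_lg (hα0 D), hαD, map_add, mul_left_comm, ← Real.exp_add]
  congr 2
  ring

lemma class_bound {S : Finset (Pl K)} {k : ℕ} {M j : ℕ} (hM : 0 < M)
    (hu : ∀ α : 𝓞 K, TP (α : K) → ∀ s : ℝ,
      HasSum (fun u : EP S k => Fw M s ((u.1.toMul : 𝓞 K) * α)) (j * Real.exp (-s * tl (ll (α : K)))))
    {b : Ideal (𝓞 K)} (hb : b ≠ ⊥) (hbS : dvI (b : FI K) ∈ DivS S) :
    ∃ C : ℝ, ∀ s : ℝ, 1 < s → s ≤ 2 →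
      |j * (Ideal.absNorm (mS S k) : ℝ) * ∑' D, fE S k (dvI (b : FI K)) s D -
        Real.exp ((s - 1) * lg (dvI (b : FI K))) * ∑' t : 𝓞 K, Fw M s t| ≤ C := by
  have hcop := coprime_mS (k := k) hb hbS
  obtain ⟨y, hy, z, hz, hyz⟩ := Submodule.mem_sup.mp (hcop ▸ Submodule.mem_top : (1 : 𝓞 K) ∈ b ⊔ mS S k)
  have hiff : ∀ t : 𝓞 K, (t ∈ b ∧ t - 1 ∈ mS S k) ↔ t - y ∈ b * mS S k := by
    intro t
    rw [Ideal.mul_eq_inf_of_isCoprime (Ideal.isCoprime_iff_sup_eq.mpr hcop), Ideal.mem_inf]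
    refine and_congr ?_ ?_
    · exact (Submodule.sub_mem_iff_left _ hy).symm
    · rw [← Submodule.add_mem_iff_left (mS S k) hz]
      have : t - 1 + z = t - y := by linear_combination hyz
      rw [this]
  obtain ⟨C, hC⟩ := coset_sum (K := K) (M := M) (by exact_mod_cast hM) (mul_ne_zero hb (mS_ne S k)) y
  refine ⟨Real.exp (lg (dvI (b : FI K))) * C, fun s hs1 hs2 => ?_⟩
  have h1 := class_sum hM hu hb hs1
  have h2 := hC s hs1 hs2
  simp only [hiff] at h1
  set A := ∑' t : 𝓞 K, if t - y ∈ b * mS S k then Fw M s t else 0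
  set T := ∑' t : 𝓞 K, Fw M s t
  set E := dvI (b : FI K)
  have hlE : 0 ≤ lg E := lg_nonneg ((dvI_nonneg_iff (coe_ne hb)).mpr ⟨b, hb, rfl⟩)
  have hN : (Ideal.absNorm b : ℝ) = Real.exp (lg E) := by
    have := exp_lg_dvI hb 1
    rw [one_mul, Real.rpow_one] at this
    exact this.symm
  have h3 : (Ideal.absNorm (b * mS S k) : ℝ) = Real.exp (lg E) * Ideal.absNorm (mS S k) := by
    rw [map_mul, Nat.cast_mul, hN]
  rw [h3] at h2
  have h4 : Real.exp (s * lg E) = Real.exp ((s - 1) * lg E) * Real.exp (lg E) := by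
    rw [← Real.exp_add]; congr 1; ring
  have h5 : j * (Ideal.absNorm (mS S k) : ℝ) * ∑' D, fE S k E s D - Real.exp ((s - 1) * lg E) * T =
      Real.exp ((s - 1) * lg E) * (Real.exp (lg E) * Ideal.absNorm (mS S k) * A - T) := by
    rw [mul_right_comm, h1, h4]; ring
  rw [h5, abs_mul, abs_of_pos (Real.exp_pos _)]
  have hC0 : 0 ≤ C := (abs_nonneg _).trans h2
  refine mul_le_mul (Real.exp_le_exp.mpr ?_) h2 (abs_nonneg _) (Real.exp_pos _).le
  nlinarith

/-- All ray class partial zeta functions have the same polar behaviour. -/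
theorem class_asymp (S : Finset (Pl K)) (k : ℕ) : ∃ ε > 0, ε ≤ 1 ∧ ∃ T : ℝ → ℝ,
    ∀ b : Ideal (𝓞 K), b ≠ ⊥ → dvI (b : FI K) ∈ DivS S → ∃ C : ℝ, ∀ s : ℝ, 1 < s → s < 1 + ε →
      |∑' D, fE S k (dvI (b : FI K)) s D - T s| ≤ C := by
  obtain ⟨M, hM, j, hj, hu⟩ := unit_sum S k
  obtain ⟨ε, hε, hε1, c, hc, C, hC, hz⟩ := zt_near K
  set W : ℝ := j * (Ideal.absNorm (mS S k) : ℝ) with hW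
  have hW0 : 0 < W := by
    have : 0 < Ideal.absNorm (mS S k) := Nat.pos_of_ne_zero (fun h => mS_ne S k (Ideal.absNorm_eq_zero_iff.mp h))
    positivity
  refine ⟨ε, hε, hε1, fun s => (∑' t : 𝓞 K, Fw M s t) / W, fun b hb hbS => ?_⟩
  have h1S : dvI ((1 : Ideal (𝓞 K)) : FI K) ∈ DivS S := by simp [dvI_one, zero_mem]
  obtain ⟨C0, hC0⟩ := class_bound hM hu one_ne_zero h1S
  obtain ⟨C1, hC1⟩ := class_bound hM hu hb hbS
  set E := dvI (b : FI K)
  have hlE : 0 ≤ lg E := lg_nonneg ((dvI_nonneg_iff (coe_ne hb)).mpr ⟨b, hb, rfl⟩)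
  refine ⟨(C1 + lg E * Real.exp (lg E) * (W * C + C0)) / W, fun s hs1 hs2 => ?_⟩
  have hs2' : s ≤ 2 := by linarith
  have h0 := hC0 s hs1 hs2'
  have h1 := hC1 s hs1 hs2'
  obtain ⟨hz1, hz2, hz3⟩ := hz s hs1 hs2
  have hlg1 : lg (dvI ((1 : Ideal (𝓞 K)) : FI K)) = 0 := by simp [dvI_one]
  rw [hlg1, mul_zero, Real.exp_zero, one_mul] at h0
  set T := ∑' t : 𝓞 K, Fw M s t
  have hT0 : 0 ≤ T := tsum_nonneg fun t => Fw_nonneg _ _ _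
  set f0 := ∑' D, fE S k (dvI ((1 : Ideal (𝓞 K)) : FI K)) s D
  have hf0 : f0 ≤ ∑' D, ztf K s D := (summable_fE _ _ _ hs1).tsum_le_tsum (fE_le _ _ _ _) hz1
  have hC00 : 0 ≤ C0 := (abs_nonneg _).trans h0
  have hT : (s - 1) * T ≤ W * C + C0 := by
    have h2 : T ≤ W * f0 + C0 := by have := (abs_le.mp h0).1; linarith
    have h3 : (s - 1) * f0 ≤ C := (mul_le_mul_of_nonneg_left hf0 (by linarith)).trans hz3
    have h4 : (s - 1) * T ≤ (s - 1) * (W * f0 + C0) := mul_le_mul_of_nonneg_left h2 (by linarith)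
    have h5 : W * ((s - 1) * f0) ≤ W * C := mul_le_mul_of_nonneg_left h3 hW0.le
    have h6 : (s - 1) * C0 ≤ C0 := mul_le_of_le_one_left hC00 (by linarith)
    linarith
  have hexp : |Real.exp ((s - 1) * lg E) - 1| ≤ (s - 1) * (lg E * Real.exp (lg E)) := by
    have hx : 0 ≤ (s - 1) * lg E := mul_nonneg (by linarith) hlE
    have h2 : 1 ≤ Real.exp ((s - 1) * lg E) := Real.one_le_exp hx
    rw [abs_of_nonneg (by linarith)]
    have h3 : 1 - (s - 1) * lg E ≤ Real.exp (-((s - 1) * lg E)) := by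
      have := Real.add_one_le_exp (-((s - 1) * lg E)); linarith
    have h4 : Real.exp ((s - 1) * lg E) * Real.exp (-((s - 1) * lg E)) = 1 := by
      rw [← Real.exp_add]; simp
    have h5 : Real.exp ((s - 1) * lg E) ≤ Real.exp (lg E) := Real.exp_le_exp.mpr (by nlinarith)
    have h6 := mul_le_mul_of_nonneg_left h3 (Real.exp_pos ((s - 1) * lg E)).le
    have h7 := mul_le_mul_of_nonneg_left h5 hx
    nlinarith
  have h2 : |W * ∑' D, fE S k E s D - T| ≤ C1 + lg E * Real.exp (lg E) * (W * C + C0) := by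
    have h3 : W * ∑' D, fE S k E s D - T = (W * ∑' D, fE S k E s D - Real.exp ((s - 1) * lg E) * T) +
      (Real.exp ((s - 1) * lg E) - 1) * T := by ring
    rw [h3]
    refine (abs_add_le _ _).trans (add_le_add h1 ?_)
    rw [abs_mul, abs_of_nonneg hT0]
    calc _ ≤ (s - 1) * (lg E * Real.exp (lg E)) * T := mul_le_mul_of_nonneg_right hexp hT0
      _ = lg E * Real.exp (lg E) * ((s - 1) * T) := by ring
      _ ≤ _ := mul_le_mul_of_nonneg_left hT (mul_nonneg hlE (Real.exp_pos _).le)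
  have h3 : ∑' D, fE S k E s D - T / W = (W * ∑' D, fE S k E s D - T) / W := by field_simp
  rw [h3, abs_div, abs_of_pos hW0]
  exact div_le_div_of_nonneg_right h2 hW0.le

end

/-! ### The second inequality -/
section
variable {K : Type} [Field K] [NumberField K]
open scoped Classical

lemma exists_eff (S : Finset (Pl K)) (k : ℕ) {D : Dv K} (hD : D ∈ DivS S) :
    ∃ b : Ideal (𝓞 K), b ≠ ⊥ ∧ dvI (b : FI K) ∈ DivS S ∧ D + dvI (b : FI K) ∈ PR S k := by
  set m := (PR S k).relIndex (DivS S) with hm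
  have hm0 : m ≠ 0 := finiteIndex_PR S k
  have hp : D ⊔ 0 ∈ DivS S := fun v hv => by
    have h1 : D v = 0 := hD v hv
    change max (D v) 0 = 0
    simp [h1]
  have h1 : m • (D ⊔ 0) ∈ PR S k := by
    have := AddSubgroup.nsmul_index_mem ((PR S k).addSubgroupOf (DivS S)) ⟨D ⊔ 0, hp⟩
    exact this
  have h0 : 0 ≤ -D + m • (D ⊔ 0) := by
    intro v
    have h2 : (m • (D ⊔ 0)) v = m * max (D v) 0 := by simp
    rw [Finsupp.add_apply, h2, Finsupp.neg_apply, Finsupp.zero_apply]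
    have h3 : (1:ℤ) ≤ m := by omega
    rcases le_total (D v) 0 with h | h
    · rw [max_eq_right h]; linarith
    · rw [max_eq_left h]; nlinarith
  obtain ⟨I, hI, hI'⟩ := dvI_surj (-D + m • (D ⊔ 0))
  rw [← hI'] at h0
  obtain ⟨J, hJ, rfl⟩ := (dvI_nonneg_iff hI).mp h0
  refine ⟨J, hJ, ?_, ?_⟩
  · rw [hI']; exact add_mem (neg_mem hD) (nsmul_mem hp _)
  · rw [hI']; simpa using h1

lemma L_bdd (S : Finset (Pl K)) (k : ℕ) (u : Dv K → ℂ) (h0 : ∀ D, D ∉ DivS S → u D = 0)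
    (hadd : ∀ D ∈ DivS S, ∀ E ∈ DivS S, u (D + E) = u D * u E) (hP : ∀ D ∈ PR S k, u D = 1)
    (h1 : ∃ D ∈ DivS S, u D ≠ 1) :
    ∃ ε > 0, ∃ C : ℝ, ∀ s, 1 < s → s < 1 + ε → ‖∑' D, lt u s D‖ ≤ C := by
  obtain ⟨ε, hε, -, T, hT⟩ := class_asymp S k
  let Q := DivS S ⧸ (PR S k).addSubgroupOf (DivS S)
  have : ((PR S k).addSubgroupOf (DivS S)).FiniteIndex := AddSubgroup.finiteIndex_iff.mpr (finiteIndex_PR S k)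
  have : Fintype Q := Fintype.ofFinite _
  let π : DivS S → Q := QuotientAddGroup.mk
  have hπ : ∀ x y : DivS S, π x = π y ↔ (-x + y : Dv K) ∈ PR S k := fun x y => by
    simp only [π]; rw [QuotientAddGroup.eq]; rfl
  have hr : ∀ q, ∃ r : DivS S, π r = q := QuotientAddGroup.mk_surjective
  choose r hr using hr
  have huc : ∀ x y : DivS S, π x = π y → u x = u y := by
    intro x y h
    have h2 := hP _ ((hπ x y).mp h)
    have h3 := hadd x x.2 (-x + y : Dv K) (add_mem (neg_mem x.2) y.2)
    rw [h2, mul_one, add_neg_cancel_left] at h3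
    exact h3.symm
  choose b hb hbD hbP using fun q => exists_eff S k (r q).2
  choose C hC using fun q => hT (b q) (hb q) (hbD q)
  obtain ⟨D0, hD0, hu0⟩ := h1
  have hsum : ∑ q, u (r q) = 0 := by
    have h2 : u D0 * ∑ q, u (r q) = ∑ q, u (r q) := by
      rw [Finset.mul_sum, ← Equiv.sum_comp (Equiv.addLeft (π ⟨D0, hD0⟩)) (fun q => u (r q))]
      refine Finset.sum_congr rfl fun q _ => ?_
      rw [← hadd _ hD0 _ (r q).2]
      refine huc (⟨D0, hD0⟩ + r q) _ ?_
      rw [hr]; change π _ + π _ = _; rw [hr]; rfl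
    have h3 : (u D0 - 1) * ∑ q, u (r q) = 0 := by rw [sub_mul, h2]; ring
    exact (mul_eq_zero.mp h3).resolve_left (sub_ne_zero.mpr hu0)
  refine ⟨ε, hε, ∑ q, ‖u (r q)‖ * C q, fun s hs1 hs2 => ?_⟩
  have hL : ∑' D, lt u s D = ∑ q, u (r q) * ((∑' D, fE S k (dvI (b q : FI K)) s D : ℝ) : ℂ) := by
    simp_rw [Complex.ofReal_tsum, ← tsum_mul_left]
    rw [← Summable.tsum_finsetSum fun q _ => ((Complex.summable_ofReal.mpr (summable_fE S k _ hs1)).mul_left _)]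
    apply tsum_congr
    intro D
    by_cases hD : D ∈ DivS S
    · have h2 : ∀ q, D + dvI (b q : FI K) ∈ PR S k ↔ π ⟨D, hD⟩ = q := by
        intro q
        rw [← hr q, hπ, hr]
        have e : (D + dvI (b q : FI K)) + ((-D : Dv K) + r q) = r q + dvI (b q : FI K) := by abel
        constructor
        · intro h
          rw [← AddSubgroup.add_mem_cancel_left _ h, e]; exact hbP q
        · intro h
          rw [← AddSubgroup.add_mem_cancel_right _ h, e]; exact hbP q
      rw [Finset.sum_eq_single (π ⟨D, hD⟩)]
      · rw [fE, if_pos ((h2 _).mpr rfl), lt]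
        congr 1
        exact huc ⟨D, hD⟩ _ (by rw [hr])
      · intro q _ hq
        rw [fE, if_neg (fun h => hq ((h2 q).mp h).symm)]; simp
      · simp
    · rw [lt, h0 D hD, zero_mul]
      symm
      apply Finset.sum_eq_zero
      intro q _
      rw [fE, if_neg]; · simp
      intro h
      exact hD ((AddSubgroup.add_mem_cancel_right _ (hbD q)).mp (PR_le_DivS _ _ h))
  have hL2 : ∑' D, lt u s D = ∑ q, u (r q) * (((∑' D, fE S k (dvI (b q : FI K)) s D - T s : ℝ)) : ℂ) := by
    rw [hL]
    simp_rw [Complex.ofReal_sub, mul_sub, Finset.sum_sub_distrib, ← Finset.sum_mul, hsum, zero_mul, sub_zero]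
  rw [hL2]
  refine (norm_sum_le _ _).trans (Finset.sum_le_sum fun q _ => ?_)
  rw [norm_mul, Complex.norm_real]
  exact mul_le_mul_of_nonneg_left (hC q s hs1 hs2) (norm_nonneg _)

/-- extension by zero of a character of a quotient of `DivS` -/
def cu {S : Finset (Pl K)} {B : AddSubgroup (DivS S)} (ω : AddChar (DivS S ⧸ B) ℂ) (D : Dv K) : ℂ :=
  if h : D ∈ DivS S then ω (QuotientAddGroup.mk ⟨D, h⟩) else 0

lemma cu_add {S : Finset (Pl K)} {B : AddSubgroup (DivS S)} (ω : AddChar (DivS S ⧸ B) ℂ) {D E : Dv K}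
    (hD : D ∈ DivS S) (hE : E ∈ DivS S) : cu ω (D + E) = cu ω D * cu ω E := by
  rw [cu, cu, cu, dif_pos hD, dif_pos hE, dif_pos (add_mem hD hE), ← AddChar.map_add_eq_mul]; rfl

lemma cu_CM {S : Finset (Pl K)} {B : AddSubgroup (DivS S)} [Finite (DivS S ⧸ B)] (ω : AddChar (DivS S ⧸ B) ℂ) :
    CM (cu ω) := by
  refine ⟨?_, fun D hD v => ?_, fun D => ?_⟩
  · rw [cu, dif_pos (zero_mem _)]; exact AddChar.map_zero_eq_one ω
  · by_cases h1 : D ∈ DivS S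
    · by_cases h2 : Finsupp.single v 1 ∈ DivS S
      · exact cu_add ω h1 h2
      · rw [cu, dif_neg, cu, cu, dif_neg h2, mul_zero]
        exact fun h => h2 ((AddSubgroup.add_mem_cancel_left _ h1).mp h)
    · rw [cu, dif_neg, cu, dif_neg h1, zero_mul]
      intro h; apply h1; intro w hw
      have h3 := h w hw
      rw [Finsupp.add_apply] at h3
      have := hD w; have := single_nonneg v w
      simp only [Finsupp.zero_apply] at *
      linarith
  · rw [cu]; split_ifs
    · rw [AddChar.norm_apply]
    · simp

open scoped Topology

lemma ev_of {ε : ℝ} (hε : 0 < ε) {P : ℝ → Prop} (h : ∀ s, 1 < s → s < 1 + ε → P s) : ∀ᶠ s in 𝓝[>] (1:ℝ), P s := by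
  filter_upwards [Ioo_mem_nhdsGT (show (1:ℝ) < 1 + ε by linarith)] with s hs
  exact h s hs.1 hs.2

lemma le_log_of {x y C : ℝ} (h : Real.exp x ≤ y) (hy : y ≤ C) : x ≤ Real.log C := by
  rw [← Real.log_exp x]
  exact Real.log_le_log (Real.exp_pos _) (h.trans hy)

lemma dens_upper (S : Finset (Pl K)) (k : ℕ) {A : AddSubgroup (Dv K)} (hPA : PR S k ≤ A) (hA : A ≤ DivS S) :
    ∃ C : ℝ, ∀ᶠ s in 𝓝[>] (1:ℝ), (A.relIndex (DivS S) : ℝ) *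
      ∑' v, (if Finsupp.single v 1 ∈ A then xv s v else 0) ≤ -Real.log (s - 1) + C := by
  let B := A.addSubgroupOf (DivS S)
  have hB : A.relIndex (DivS S) ≠ 0 := fun h => finiteIndex_PR S k
    (Nat.eq_zero_of_zero_dvd (h ▸ AddSubgroup.relIndex_dvd_of_le_left (DivS S) hPA))
  have : B.FiniteIndex := AddSubgroup.finiteIndex_iff.mpr hB
  let G := DivS S ⧸ B
  have : Fintype G := Fintype.ofFinite _
  set X2 := ∑' v : Pl K, xv 2 v with hX2
  have hone : ∃ C : ℝ, ∀ ω : AddChar G ℂ, ∀ᶠ s in 𝓝[>] (1:ℝ), ∑' v, (zv (cu ω) s v).re ≤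
      (if ω = 1 then - Real.log (s - 1) else 0) + C := by
    have : ∀ ω : AddChar G ℂ, ∃ C : ℝ, ∀ᶠ s in 𝓝[>] (1:ℝ), ∑' v, (zv (cu ω) s v).re ≤
      (if ω = 1 then - Real.log (s - 1) else 0) + C := by
      intro ω
      by_cases hω : ω = 1
      · obtain ⟨ε, hε, -, c, hc, C, hC, hz⟩ := zt_near K
        refine ⟨Real.log C + X2, ev_of hε fun s h1 h2 => ?_⟩
        rw [if_pos hω]
        obtain ⟨-, -, h3⟩ := hz s h1 h2
        have h4 : ‖∑' D, lt (cu ω) s D‖ ≤ ∑' D, ztf K s D :=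
          tsum_of_norm_bounded (summable_ztf h1).hasSum ((cu_CM ω).norm_lt s)
        have h5 : ∑' D, ztf K s D ≤ C / (s - 1) := by
          rw [le_div_iff₀ (by linarith)]; linarith
        have h6 := le_log_of ((cu_CM ω).lower h1) (h4.trans h5)
        rw [Real.log_div hC.ne' (by linarith)] at h6
        linarith [tsum_xv_sq_le (K := K) h1]
      · obtain ⟨g, hg⟩ : ∃ g, ω g ≠ 1 := by
          by_contra h; push Not at h; exact hω (by ext g; simp [h])
        obtain ⟨⟨D, hD⟩, rfl⟩ := QuotientAddGroup.mk_surjective g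
        obtain ⟨ε, hε, C, hC⟩ := L_bdd S k (cu ω) (fun D hD => by rw [cu, dif_neg hD])
          (fun D hD E hE => cu_add ω hD hE) (fun D hD => by
            rw [cu, dif_pos (hA (hPA hD))]
            rw [(QuotientAddGroup.eq_zero_iff (N := B) (⟨D, hA (hPA hD)⟩ : DivS S)).mpr (hPA hD)]
            exact AddChar.map_zero_eq_one ω) ⟨D, hD, by rw [cu, dif_pos hD]; exact hg⟩
        refine ⟨Real.log C + X2, ev_of hε fun s h1 h2 => ?_⟩
        rw [if_neg hω]
        have h6 := le_log_of ((cu_CM ω).lower h1) (hC s h1 h2)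
        linarith [tsum_xv_sq_le (K := K) h1]
    choose C hC using this
    obtain ⟨M, hM⟩ := (Set.finite_range C).bddAbove
    refine ⟨M, fun ω => (hC ω).mono fun s h => h.trans ?_⟩
    have := hM ⟨ω, rfl⟩; linarith
  obtain ⟨C, hC⟩ := hone
  refine ⟨Fintype.card (AddChar G ℂ) * C, ?_⟩
  filter_upwards [Filter.eventually_all.mpr hC, self_mem_nhdsWithin] with s h hs
  have h1 := Finset.sum_le_sum fun ω (_ : ω ∈ Finset.univ) => h ω
  rw [Finset.sum_add_distrib, Finset.sum_ite_eq' Finset.univ (1 : AddChar G ℂ)] at h1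
  simp only [Finset.mem_univ, if_true, Finset.sum_const, Finset.card_univ, nsmul_eq_mul] at h1
  refine le_trans (le_of_eq ?_) h1
  rw [← Summable.tsum_finsetSum fun ω _ => (summable_xv hs).of_norm_bounded fun v =>
      (Complex.abs_re_le_norm _).trans ((cu_CM ω).norm_zv s v), ← tsum_mul_left]
  apply tsum_congr
  intro v
  have h2 : ∑ ω : AddChar G ℂ, (zv (cu ω) s v).re =
      ((∑ ω : AddChar G ℂ, cu ω (Finsupp.single v 1)) * (xv s v : ℂ)).re := by
    rw [Finset.sum_mul, Complex.re_sum]; rfl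
  rw [h2]
  by_cases hv : Finsupp.single v 1 ∈ DivS S
  · have h3 : ∑ ω : AddChar G ℂ, cu ω (Finsupp.single v 1) =
        if (QuotientAddGroup.mk ⟨_, hv⟩ : G) = 0 then (Fintype.card G : ℂ) else 0 := by
      rw [← AddChar.sum_apply_eq_ite]
      exact Finset.sum_congr rfl fun ω _ => by rw [cu, dif_pos hv]
    have h4 : (QuotientAddGroup.mk ⟨_, hv⟩ : G) = 0 ↔ Finsupp.single v 1 ∈ A := QuotientAddGroup.eq_zero_iff _
    have h5 : A.relIndex (DivS S) = Fintype.card G := by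
      rw [← Nat.card_eq_fintype_card]; rfl
    rw [h3, h5]
    by_cases h6 : Finsupp.single v 1 ∈ A
    · rw [if_pos (h4.mpr h6), if_pos h6]; norm_cast
    · rw [if_neg (fun h => h6 (h4.mp h)), if_neg h6]; simp
  · rw [if_neg (fun h => hv (hA h))]
    simp [cu, dif_neg hv]

/-- at most `[M : K]` places above each place -/
lemma fiber_sum {M : Type} [Field M] [NumberField M] [Algebra K M] [IsGalois K M] {g : Pl K → ℝ}
    (hg : ∀ v, 0 ≤ g v) (hs : Summable g) :
    (Summable fun W : Pl M => g (dn K W)) ∧ ∑' W : Pl M, g (dn K W) ≤ Module.finrank K M * ∑' v, g v := by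
  choose P hP using dn_surj (K := K) (Ω := M)
  have hτ : ∀ W : Pl M, ∃ τ : Gal(M/K), W.asIdeal = τ • (P (dn K W)).asIdeal := fun W =>
    exists_conj _ _ (hP _)
  choose τ hτ using hτ
  obtain ⟨i, hi'⟩ : ∃ i : Pl M → Gal(M/K) × Pl K, ∀ W, i W = (τ W, dn K W) := ⟨_, fun _ => rfl⟩
  have hi : Function.Injective i := by
    intro W W' h
    rw [hi', hi'] at h
    have h1 : τ W = τ W' := congrArg Prod.fst h
    have h3 : dn K W = dn K W' := congrArg Prod.snd h
    apply HeightOneSpectrum.ext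
    rw [hτ W, hτ W', h1, h3]
  have hG : Summable (fun x : Gal(M/K) × Pl K => g x.2) := by
    rw [summable_prod_of_nonneg (fun x => hg x.2)]
    exact ⟨fun _ => hs, .of_finite⟩
  have h2 : Summable fun W : Pl M => g (dn K W) := (hG.comp_injective hi).congr fun W => by simp [hi']
  have h4 : ∑' W : Pl M, g (dn K W) ≤ ∑' c : Gal(M/K) × Pl K, g c.2 :=
    Summable.tsum_le_tsum_of_inj i hi (fun c _ => hg c.2) (fun W => by simp [hi']) h2 hG
  refine ⟨h2, h4.trans (le_of_eq ?_)⟩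
  have h5 : ∑' c : Gal(M/K) × Pl K, g c.2 = ∑' _ : Gal(M/K), ∑' v, g v := hG.tsum_prod
  rw [h5, tsum_const, nsmul_eq_mul, IsGalois.card_aut_eq_finrank]

lemma dens_lower {M : Type} [Field M] [NumberField M] [Algebra K M] [IsGalois K M] (S : Finset (Pl K))
    (P : Pl K → Prop) (hP : ∀ W : Pl M, fd K W = 1 → dn K W ∉ S → P (dn K W)) :
    ∃ C : ℝ, ∀ᶠ s in 𝓝[>] (1:ℝ), -Real.log (s - 1) ≤
      Module.finrank K M * (∑' v, if P v then xv s v else 0) + C := by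
  obtain ⟨ε, hε, -, c, hc, _, _, hz⟩ := zt_near M
  set n := Module.finrank K M
  refine ⟨n * (∑' v : Pl K, xv 2 v + ∑' v : Pl K, if v ∈ S then 1 else 0) + 2 * ∑' W : Pl M, xv 2 W - Real.log c,
    ev_of hε fun s h1 h2 => ?_⟩
  obtain ⟨-, h3, -⟩ := hz s h1 h2
  have h4 : c / (s - 1) ≤ ∑' D, ztf M s D := by rw [div_le_iff₀ (by linarith)]; linarith
  have h5 := Real.log_le_log (div_pos hc (by linarith)) (h4.trans (zeta_upper h1))
  rw [Real.log_exp, Real.log_div hc.ne' (by linarith)] at h5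
  let g1 : Pl K → ℝ := fun v => if P v then xv s v else 0
  let g3 : Pl K → ℝ := fun v => if v ∈ S then 1 else 0
  have s1 : Summable g1 := (summable_xv (K := K) h1).of_nonneg_of_le
    (fun v => by dsimp only [g1]; split_ifs; exacts [(xv_pos _ _).le, le_rfl])
    (fun v => by dsimp only [g1]; split_ifs; exacts [le_rfl, (xv_pos _ _).le])
  have s2 : Summable (xv (K := K) 2) := summable_xv (by norm_num)
  have s3 : Summable g3 := summable_of_ne_finset_zero (s := S) fun v hv => by simp [g3, hv]
  have p1 : ∀ v, 0 ≤ g1 v := fun v => by dsimp only [g1]; split_ifs; exacts [(xv_pos _ _).le, le_rfl]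
  have p3 : ∀ v, 0 ≤ g3 v := fun v => by dsimp only [g3]; split_ifs <;> norm_num
  obtain ⟨h6, h7⟩ := fiber_sum (M := M) (g := fun v => g1 v + (xv 2 v + g3 v))
    (fun v => add_nonneg (p1 v) (add_nonneg (xv_pos _ _).le (p3 v))) (s1.add (s2.add s3))
  have h8 : ∑' W : Pl M, xv s W ≤ ∑' W : Pl M, (g1 (dn K W) + (xv 2 (dn K W) + g3 (dn K W))) := by
    refine Summable.tsum_le_tsum (fun W => ?_) (summable_xv h1) h6
    have hp1 := p1 (dn K W); have hp2 := (xv_pos 2 (dn K W)).le; have hp3 := p3 (dn K W)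
    by_cases hS : dn K W ∈ S
    · have : g3 (dn K W) = 1 := by simp [g3, hS]
      have := xv_le_half h1.le W
      linarith
    · have h9 : Real.log (Nm W) = fd K W * Real.log (Nm (dn K W)) := by
        rw [Nm_pow (K := K) W]; push_cast; rw [Real.log_pow]
      have h10 := logNm_pos (dn K W)
      by_cases hf : fd K W = 1
      · have : g1 (dn K W) = xv s W := by
          dsimp only [g1]; rw [if_pos (hP W hf hS), xv, xv, h9, hf]; simp
        linarith
      · have h11 : (2:ℝ) ≤ fd K W := by
          have := fd_pos (K := K) W
          exact_mod_cast (show 2 ≤ fd K W by omega)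
        have : xv s W ≤ xv 2 (dn K W) := by
          rw [xv, xv, h9]; apply Real.exp_le_exp.mpr
          have : 2 * Real.log (Nm (dn K W)) ≤ fd K W * Real.log (Nm (dn K W)) := by gcongr
          nlinarith
        linarith
  rw [s1.tsum_add (s2.add s3), s2.tsum_add s3, mul_add] at h7
  have := tsum_xv_sq_le (K := M) h1
  linarith

theorem second_ineq {Ω : Type} [Field Ω] [NumberField Ω] [Algebra K Ω] [IsGalois K Ω] (χ : Gal(Ω/K) →* ℂˣ)
    (S : Finset (Pl K)) (hS : ∀ v ∉ S, Unr χ v) (k : ℕ) :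
    (PR S k ⊔ (Nchi χ ⊓ DivS S)).relIndex (DivS S) ≤ Nat.card χ.range := by
  obtain ⟨M, hM, χ', hinj, hcomp, hfix⟩ := exists_descend χ
  set A := PR S k ⊔ (Nchi χ ⊓ DivS S) with hA
  have hcard : Nat.card χ.range = Module.finrank K M := by
    rw [← IsGalois.card_aut_eq_finrank, ← hcomp, MonoidHom.range_comp, MonoidHom.range_eq_top.mpr rs_surj,
      ← MonoidHom.range_eq_map]
    exact Nat.card_congr (MonoidHom.ofInjective hinj).symm.toEquiv
  have htriv : χ.comp (resH K : Gal(Ω/M) →* Gal(Ω/K)) = 1 := by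
    ext τ
    have : resH K τ ∈ M.fixingSubgroup := by
      rw [IntermediateField.mem_fixingSubgroup_iff]
      intro x hx
      exact τ.commutes ⟨x, hx⟩
    rw [hfix] at this
    simp [MonoidHom.mem_ker.mp this]
  obtain ⟨C1, h1⟩ := dens_upper S k (A := A) le_sup_left (sup_le (PR_le_DivS S k) inf_le_right)
  obtain ⟨C2, h2⟩ := dens_lower (M := M) S (fun v => Finsupp.single v 1 ∈ A) (by
    intro W hf hW
    have h3 := fr_tower (Ω := Ω) (hS _ hW)
    rw [htriv, hf, pow_one] at h3
    have h4 : fr χ (dn K W) = 1 := by rw [← h3]; rfl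
    refine AddSubgroup.mem_sup_right ⟨single_mem_Nchi χ (by rw [h4]; simp), ?_⟩
    intro v hv
    rw [Finsupp.single_apply, if_neg]
    rintro rfl; exact hW hv)
  rw [hcard]
  by_contra hlt
  push Not at hlt
  set h := A.relIndex (DivS S)
  set n := Module.finrank K M
  have h3 : Filter.Tendsto (fun s : ℝ => -Real.log (s - 1)) (𝓝[>] 1) Filter.atTop := by
    refine Filter.tendsto_neg_atBot_atTop.comp (Real.tendsto_log_nhdsGT_zero.comp ?_)
    refine tendsto_nhdsWithin_iff.mpr ⟨?_, ?_⟩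
    · have : Filter.Tendsto (fun s : ℝ => s - 1) (𝓝 1) (𝓝 (1 - 1)) := Filter.tendsto_id.sub_const 1
      rw [sub_self] at this
      exact this.mono_left nhdsWithin_le_nhds
    · filter_upwards [self_mem_nhdsWithin] with s hs
      exact sub_pos.mpr (Set.mem_Ioi.mp hs)
  obtain ⟨s, h4, h5, h6⟩ := (h1.and (h2.and (h3.eventually_gt_atTop (max 0 (n * C1 + h * C2))))).exists
  set Y := ∑' v, (if Finsupp.single v 1 ∈ A then xv s v else 0)
  set l := -Real.log (s - 1)
  have hn : (n:ℝ) + 1 ≤ h := by exact_mod_cast hlt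
  have hn0 : (0:ℝ) ≤ n := by positivity
  have e1 : h * l ≤ n * (h * Y) + h * C2 := by nlinarith
  have e2 : n * (h * Y) ≤ n * (l + C1) := by gcongr
  have hl := (le_max_left _ _).trans_lt h6
  have hl2 := (le_max_right _ _).trans_lt h6
  nlinarith
end

/-! ### Cyclotomic characters -/
section
variable {K : Type} [Field K] [NumberField K]
open scoped Classical

def uN (N : ℕ) (v : Pl K) : (ZMod N)ˣ :=
  if h : (Nm v).Coprime N then ZMod.unitOfCoprime _ h else 1

lemma uN_coe {N : ℕ} {v : Pl K} (h : (Nm v).Coprime N) : (uN N v : ZMod N) = Nm v := by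
  rw [uN, dif_pos h, ZMod.coe_unitOfCoprime]

/-- the divisor norm modulo `N` -/
def gN (N : ℕ) : Dv K →+ Additive (ZMod N)ˣ :=
  Finsupp.liftAddHom fun v => zmultiplesHom _ (Additive.ofMul (uN N v))

lemma gN_single (N : ℕ) (v : Pl K) (m : ℤ) : gN N (Finsupp.single v m) = m • Additive.ofMul (uN N v) := by
  simp [gN]

lemma gN_dvI (N : ℕ) {I : Ideal (𝓞 K)} (hI : I ≠ ⊥) (h : (Ideal.absNorm I).Coprime N) :
    (((gN N (dvI (I : FI K))).toMul : (ZMod N)ˣ) : ZMod N) = Ideal.absNorm I := by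
  induction I using UniqueFactorizationMonoid.induction_on_prime with
  | h₁ => exact absurd rfl hI
  | h₂ I hu =>
    have h1 : I = 1 := by simpa using hu
    subst h1
    rw [Ideal.one_eq_top, FractionalIdeal.coeIdeal_top, dvI_one]; simp
  | h₃ I p hI0 hp ih =>
    have hp0 : p ≠ ⊥ := hp.ne_zero
    have h1 : (I : FI K) ≠ 0 := by rwa [Ne, FractionalIdeal.coeIdeal_eq_zero]
    have h2 : (p : FI K) ≠ 0 := by rwa [Ne, FractionalIdeal.coeIdeal_eq_zero]
    have h3 := dvI_pl (⟨p, Ideal.isPrime_of_prime hp, hp0⟩ : Pl K)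
    have h4 := Nm_eq (⟨p, Ideal.isPrime_of_prime hp, hp0⟩ : Pl K)
    simp only at h3 h4
    rw [map_mul] at h
    have h5 := uN_coe (v := (⟨p, Ideal.isPrime_of_prime hp, hp0⟩ : Pl K)) (h4 ▸ Nat.Coprime.coprime_mul_right h)
    rw [FractionalIdeal.coeIdeal_mul, dvI_mul h2 h1, map_add, h3, gN_single, map_mul, one_smul,
      toMul_add, Units.val_mul, ih hI0 (Nat.Coprime.coprime_mul_left h), toMul_ofMul, h5, h4, Nat.cast_mul]

lemma Nm_mem (v : Pl K) : ((Nm v : ℕ) : 𝓞 K) ∈ v.asIdeal := by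
  rw [Nm_eq]; exact Ideal.absNorm_mem _

lemma mem_of_dvd_Nm {v : Pl K} {q : ℕ} (hq : q.Prime) (h : q ∣ Nm v) : (q : 𝓞 K) ∈ v.asIdeal := by
  haveI := Fact.mk hq
  haveI : Finite (𝓞 K ⧸ v.asIdeal) := Nat.finite_of_card_ne_zero (by have := Nm_gt_one v; unfold Nm at this; omega)
  obtain ⟨x, hx⟩ := exists_prime_addOrderOf_dvd_card' (G := 𝓞 K ⧸ v.asIdeal) q h
  have h1 : q • x = 0 := hx ▸ addOrderOf_nsmul_eq_zero x
  have h0 : x ≠ 0 := fun h => by rw [h, addOrderOf_zero] at hx; exact hq.one_lt.ne hx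
  rw [nsmul_eq_mul, mul_eq_zero, or_iff_left h0] at h1
  rwa [← Ideal.Quotient.eq_zero_iff_mem, map_natCast]

lemma coprime_of {v : Pl K} {N : ℕ} (h : (N : 𝓞 K) ∉ v.asIdeal) : (Nm v).Coprime N := by
  by_contra h1
  obtain ⟨q, hq, h2, h3⟩ := Nat.Prime.not_coprime_iff_dvd.mp h1
  exact h (Ideal.mem_of_dvd _ (Nat.cast_dvd_cast h3) (mem_of_dvd_Nm hq h2))

lemma of_coprime {v : Pl K} {N : ℕ} (h : (Nm v).Coprime N) : (N : 𝓞 K) ∉ v.asIdeal := by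
  intro h1
  obtain ⟨a, b, hab⟩ : IsCoprime ((Nm v : ℤ)) (N : ℤ) := Nat.isCoprime_iff_coprime.mpr h
  apply v.isPrime.ne_top
  rw [Ideal.eq_top_iff_one]
  have h2 := congrArg (Int.cast : ℤ → 𝓞 K) hab
  push_cast at h2
  rw [← h2]
  exact add_mem (Ideal.mul_mem_left _ _ (Nm_mem v)) (Ideal.mul_mem_left _ _ h1)

lemma bad_finite {N : ℕ} (hN : N ≠ 0) : {v : Pl K | ¬ (Nm v).Coprime N}.Finite := by
  have h0 : Ideal.span {(N : 𝓞 K)} ≠ 0 := by simpa using hN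
  refine (Ideal.finite_factors h0).subset fun v hv => ?_
  have h : (N : 𝓞 K) ∈ v.asIdeal := by by_contra h; exact hv (coprime_of h)
  change v.asIdeal ∣ _
  rwa [Ideal.dvd_span_singleton]

lemma uN_tower {F : Type} [Field F] [NumberField F] [Algebra K F] (N : ℕ) (w : Pl F) :
    uN N w = uN N (dn K w) ^ fd K w := by
  have h : (Nm w).Coprime N ↔ (Nm (dn K w)).Coprime N := by
    rw [Nm_pow (K := K) w, Nat.coprime_pow_left_iff (fd_pos w)]
  by_cases h1 : (Nm w).Coprime N
  · apply Units.ext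
    rw [Units.val_pow_eq_pow_val, uN_coe h1, uN_coe (h.mp h1), Nm_pow (K := K) w, Nat.cast_pow]
  · rw [uN, dif_neg h1, uN, dif_neg (fun h2 => h1 (h.mpr h2)), one_pow]

lemma gN_nD {F : Type} [Field F] [NumberField F] [Algebra K F] (N : ℕ) (D : Dv F) :
    gN N (nD K D) = gN N D := by
  have : ((gN N : Dv K →+ _).comp (nD K : Dv F →+ Dv K)) = gN N := by
    apply Finsupp.addHom_ext
    intro w m
    rw [AddMonoidHom.comp_apply, nD_single, gN_single, gN_single, uN_tower (K := K) N w, ofMul_pow, mul_smul,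
      natCast_zsmul]
  exact DFunLike.congr_fun this D

variable {Ω : Type} [Field Ω] [NumberField Ω] [Algebra K Ω] [IsGalois K Ω]

/-- cyclotomic characters -/
def Cyc (N : ℕ) (ψ : Gal(Ω/K) →* ℂˣ) : Prop :=
  N ≠ 0 ∧ ∃ κ : (ZMod N)ˣ →* ℂˣ, ∀ v : Pl K, (Nm v).Coprime N → Unr ψ v ∧ fr ψ v = κ (uN N v)

lemma gN_nat {N n : ℕ} (hn : n ≠ 0) (h : n.Coprime N) : (((gN N (dv (n : ℚ))).toMul : (ZMod N)ˣ) : ZMod N) = n := by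
  have h0 : Ideal.span {(n : 𝓞 ℚ)} ≠ ⊥ := by simpa using hn
  have h1 : dv (n : ℚ) = dvI ((Ideal.span {(n : 𝓞 ℚ)} : Ideal (𝓞 ℚ)) : FI ℚ) := by
    rw [dv, FractionalIdeal.coeIdeal_span_singleton, map_natCast]
  have h2 : Ideal.absNorm (Ideal.span {(n : 𝓞 ℚ)}) = n := by
    rw [Ideal.absNorm_span_natCast, RingOfIntegers.rank, Module.finrank_self, pow_one]
  rw [h1, gN_dvI N h0 (by rwa [h2]), h2]

lemma exists_pl {q : ℕ} (hq : q.Prime) : ∃ v : Pl ℚ, (q : 𝓞 ℚ) ∈ v.asIdeal := by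
  have h2 : Ideal.absNorm (Ideal.span {(q : 𝓞 ℚ)}) = q := by
    rw [Ideal.absNorm_span_natCast, RingOfIntegers.rank, Module.finrank_self, pow_one]
  have h1 : Ideal.span {(q : 𝓞 ℚ)} ≠ ⊤ := fun h => by
    rw [h, Ideal.absNorm_top] at h2; exact hq.one_lt.ne h2
  obtain ⟨M, hM, hle⟩ := Ideal.exists_le_maximal _ h1
  have hm : (q : 𝓞 ℚ) ∈ M := hle (Ideal.mem_span_singleton_self _)
  refine ⟨⟨M, hM.isPrime, ?_⟩, hm⟩
  rintro rfl
  exact hq.ne_zero (by simpa using hm)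

lemma gN_rat {N : ℕ} (hN : N ≠ 0) : ∃ k, ∀ D ∈ PR (bad_finite (K := ℚ) hN).toFinset k, gN N D = 0 := by
  set S := (bad_finite (K := ℚ) hN).toFinset with hS
  have hNq : (N : ℚ) ≠ 0 := by exact_mod_cast hN
  obtain ⟨k, hk⟩ : ∃ k : ℕ, ∀ v ∈ S, dv (N : ℚ) v ≤ k := by
    refine ⟨∑ v ∈ S, (dv (N : ℚ) v).natAbs, fun v hv => Int.le_natAbs.trans ?_⟩
    exact_mod_cast Finset.single_le_sum (f := fun v => (dv (N : ℚ) v).natAbs) (fun _ _ => Nat.zero_le _) hv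
  have hval : ∀ (v : Pl ℚ) (n : ℕ), (n : 𝓞 ℚ) ∉ v.asIdeal ↔ v.valuation ℚ (n : ℚ) = 1 := fun v n => by
    rw [not_mem_iff_val]; simp
  refine ⟨k, fun D hD => ?_⟩
  obtain ⟨t, ht, rfl⟩ := mem_PR.mp hD
  have ht0 : (t : ℚ) ≠ 0 := t.ne_zero
  have hpos : (0 : ℚ) < t := by
    have := ht.2 (Rat.castHom ℝ); simpa using this
  obtain ⟨a, ha⟩ : ∃ a : ℕ, (a : ℤ) = (t : ℚ).num := ⟨_, Int.toNat_of_nonneg (Rat.num_nonneg.mpr hpos.le)⟩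
  set b := (t : ℚ).den with hb
  have hb0 : b ≠ 0 := (t : ℚ).den_ne_zero
  have hbq : (b : ℚ) ≠ 0 := by exact_mod_cast hb0
  have hab : (a : ℚ) = t * b := by
    have : (a : ℚ) = ((t : ℚ).num : ℚ) := by exact_mod_cast ha
    rw [this, Rat.mul_den_eq_num]
  have haq : (a : ℚ) ≠ 0 := by rw [hab]; exact mul_ne_zero ht0 hbq
  have ha0 : a ≠ 0 := by exact_mod_cast haq
  have hcop : a.Coprime b := by have := (t : ℚ).reduced; rwa [← ha, Int.natAbs_natCast] at this
  have hiff : ∀ v ∈ S, v.valuation ℚ (a : ℚ) = v.valuation ℚ (b : ℚ) := fun v hv => by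
    rw [hab, map_mul, val_one_of_near v ((ht.1 v hv).trans_lt (exp_lt_one'.mpr (by omega))), one_mul]
  have hbS : ∀ v ∈ S, (b : 𝓞 ℚ) ∉ v.asIdeal := fun v hv h => by
    have h2 : (a : 𝓞 ℚ) ∈ v.asIdeal := by
      by_contra h3
      rw [hval, hiff v hv, ← hval] at h3; exact h3 h
    obtain ⟨x, y, hxy⟩ : IsCoprime (a : ℤ) (b : ℤ) := Nat.isCoprime_iff_coprime.mpr hcop
    apply v.isPrime.ne_top
    rw [Ideal.eq_top_iff_one]
    have h4 := congrArg (Int.cast : ℤ → 𝓞 ℚ) hxy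
    push_cast at h4
    rw [← h4]
    exact add_mem (Ideal.mul_mem_left _ _ h2) (Ideal.mul_mem_left _ _ h)
  have haS : ∀ v ∈ S, (a : 𝓞 ℚ) ∉ v.asIdeal := fun v hv => by
    rw [hval, hiff v hv, ← hval]; exact hbS v hv
  have key : ∀ c : ℕ, (∀ v ∈ S, (c : 𝓞 ℚ) ∉ v.asIdeal) → c.Coprime N := fun c hc => by
    by_contra h1
    obtain ⟨q, hq, h2, h3⟩ := Nat.Prime.not_coprime_iff_dvd.mp h1
    obtain ⟨v, hv⟩ := exists_pl hq
    refine hc v ?_ (Ideal.mem_of_dvd _ (Nat.cast_dvd_cast h2) hv)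
    have : ¬ (Nm v).Coprime N := fun h => of_coprime h (Ideal.mem_of_dvd _ (Nat.cast_dvd_cast h3) hv)
    simpa [hS] using this
  have hmod : (a : ZMod N) = b := by
    by_cases hne : (a : ℚ) - b = 0
    · have : (a : ℚ) = b := by linarith
      have : a = b := by exact_mod_cast this
      rw [this]
    have hx0 : ((a : ℚ) - b) / N ≠ 0 := div_ne_zero hne hNq
    obtain ⟨α, hα⟩ := exists_int hx0 (fun v => by
      have e1 : dv (((a : ℚ) - b) / N) v = dv ((a : ℚ) - b) v - dv (N : ℚ) v := by
        rw [div_eq_mul_inv, dv_mul hne (inv_ne_zero hNq), dv_inv]; simp [sub_eq_add_neg]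
      rw [e1, Finsupp.zero_apply]
      by_cases hv : v ∈ S
      · have e2 : v.valuation ℚ ((a : ℚ) - b) ≤ WithZero.exp (-((k : ℤ) + 1)) := by
          have : (a : ℚ) - b = (t - 1) * b := by rw [hab]; ring
          rw [this, map_mul, (hval v b).mp (hbS v hv), mul_one]
          exact ht.1 v hv
        rw [valuation_eq v hne, WithZero.exp_le_exp] at e2
        have := hk v hv
        omega
      · have e2 : (Nm v).Coprime N := by by_contra h; exact hv (by simpa [hS] using h)
        rw [(dv_apply_eq_zero_iff v hNq).mpr ((hval v N).mp (of_coprime e2)), sub_zero]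
        by_contra hlt
        have e3 : v.valuation ℚ ((a : ℚ) - b) ≤ 1 := by
          have := v.valuation_le_one (K := ℚ) ((a : 𝓞 ℚ) - b); simpa using this
        rw [valuation_eq v hne, ← WithZero.exp_zero, WithZero.exp_le_exp] at e3
        omega)
    obtain ⟨y, hy⟩ := IsIntegrallyClosed.isIntegral_iff.mp (RingOfIntegers.isIntegral_coe α)
    have hy := hy.trans hα
    rw [eq_div_iff hNq] at hy
    have hy' : y * (N : ℤ) = (a : ℤ) - b := by
      have : ((y * (N : ℤ) : ℤ) : ℚ) = ((a - b : ℤ) : ℚ) := by push_cast; simpa using hy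
      exact_mod_cast this
    have := congrArg (Int.cast : ℤ → ZMod N) hy'
    push_cast at this
    rw [ZMod.natCast_self, mul_zero] at this
    exact (sub_eq_zero.mp this.symm)
  have e : dv (t : ℚ) + dv (b : ℚ) = dv (a : ℚ) := by rw [hab, dv_mul ht0 hbq]
  have e2 : gN N (dv (a : ℚ)) = gN N (dv (b : ℚ)) := by
    apply Additive.toMul.injective
    apply Units.ext
    rw [gN_nat ha0 (key a haS), gN_nat hb0 (key b hbS), hmod]
  rw [← e, map_add] at e2
  exact add_eq_right.mp e2

lemma PR_mono {S T : Finset (Pl K)} (h : S ⊆ T) (k : ℕ) : PR T k ≤ PR S k := by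
  intro D hD
  obtain ⟨t, ht, rfl⟩ := mem_PR.mp hD
  exact mem_PR.mpr ⟨t, ⟨fun v hv => ht.1 v (h hv), ht.2⟩, rfl⟩

lemma art_Cyc {N : ℕ} {ψ : Gal(Ω/K) →* ℂˣ} (hψ : Cyc N ψ) : ∃ κ : (ZMod N)ˣ →* ℂˣ,
    ∀ D ∈ DivS (bad_finite (K := K) hψ.1).toFinset, art ψ D = Additive.ofMul (κ (gN N D).toMul) := by
  obtain ⟨hN, κ, hκ⟩ := hψ
  refine ⟨κ, fun D hD => ?_⟩
  change _ = (MonoidHom.toAdditive κ) (gN N D)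
  rw [art, gN, Finsupp.liftAddHom_apply, Finsupp.liftAddHom_apply, Finsupp.sum, Finsupp.sum, map_sum]
  apply Finset.sum_congr rfl
  intro v hv
  have hv : D v ≠ 0 := by simpa using hv
  have : (Nm v).Coprime N := by
    by_contra h; exact hv (hD v (by simpa using h))
  rw [zmultiplesHom_apply, zmultiplesHom_apply, map_zsmul, (hκ v this).2]; rfl

lemma cyc_AR {N : ℕ} {ψ : Gal(Ω/K) →* ℂˣ} (hψ : Cyc N ψ) (S : Finset (Pl K))
    (hS : ∀ v, ¬ (Nm v).Coprime N → v ∈ S) : ∃ k, ∀ D ∈ PR S k, art ψ D = 0 := by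
  obtain ⟨κ, h⟩ := art_Cyc hψ
  obtain ⟨k0, h0⟩ := gN_rat hψ.1
  obtain ⟨k, hk⟩ := exists_PR_norm (F := K) (bad_finite (K := ℚ) hψ.1).toFinset k0
  refine ⟨k, fun D hD => ?_⟩
  have hb : (bad_finite (K := K) hψ.1).toFinset ⊆ S := fun v hv => hS v (by simpa using hv)
  have hu : up K (bad_finite (K := ℚ) hψ.1).toFinset ⊆ S := fun v hv => hS v (by
    rw [mem_up] at hv
    rw [Nm_pow (K := ℚ) v, Nat.coprime_pow_left_iff (fd_pos v)]; simpa using hv)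
  have h1 := h0 _ (hk D (PR_mono hu k hD))
  rw [h D (fun v hv => PR_le_DivS S k hD v (hb hv)), ← gN_nD (K := ℚ), h1]
  simp

lemma Cyc.mul {M N : ℕ} {ψ ψ' : Gal(Ω/K) →* ℂˣ} (h : Cyc M ψ) (h' : Cyc N ψ') : Cyc (M * N) (ψ * ψ') := by
  obtain ⟨hM, κ, hκ⟩ := h
  obtain ⟨hN, κ', hκ'⟩ := h'
  refine ⟨mul_ne_zero hM hN, κ.comp (ZMod.unitsMap (Dvd.intro _ rfl)) * κ'.comp (ZMod.unitsMap (Dvd.intro_left _ rfl)),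
    fun v hv => ?_⟩
  have h1 := Nat.Coprime.coprime_mul_right_right hv
  have h2 := Nat.Coprime.coprime_mul_left_right hv
  refine ⟨(hκ v h1).1.mul (hκ' v h2).1, ?_⟩
  rw [fr_mul, (hκ v h1).2, (hκ' v h2).2, MonoidHom.mul_apply, MonoidHom.comp_apply, MonoidHom.comp_apply]
  congr 2 <;> apply Units.ext <;> rw [ZMod.unitsMap_val, uN_coe hv, uN_coe, ZMod.cast_natCast] <;>
    first | assumption | exact Dvd.intro _ rfl | exact Dvd.intro_left _ rfl

lemma Cyc.rs {L : Type} [Field L] [NumberField L] [Algebra K L] [IsGalois K L] [Algebra L Ω] [IsScalarTower K L Ω]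
    {N : ℕ} {ψ : Gal(L/K) →* ℂˣ} (h : Cyc N ψ) : Cyc N (ψ.comp (rs : Gal(Ω/K) →* Gal(L/K))) := by
  haveI : IsGalois L Ω := IsGalois.tower_top_of_isGalois K L Ω
  obtain ⟨hN, κ, hκ⟩ := h
  refine ⟨hN, κ, fun v hv => ⟨(hκ v hv).1.ascend, ?_⟩⟩
  rw [← fr_descend (hκ v hv).1.ascend, (hκ v hv).2]

lemma Cyc.res {F : Type} [Field F] [NumberField F] [Algebra K F] [Algebra F Ω] [IsScalarTower K F Ω] [IsGalois F Ω]
    {N : ℕ} {ψ : Gal(Ω/K) →* ℂˣ} (h : Cyc N ψ) : Cyc N (ψ.comp (resH K : Gal(Ω/F) →* Gal(Ω/K))) := by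
  obtain ⟨hN, κ, hκ⟩ := h
  refine ⟨hN, κ, fun w hw => ?_⟩
  rw [Nm_pow (K := K) w, Nat.coprime_pow_left_iff (fd_pos w)] at hw
  refine ⟨(hκ _ hw).1.tower, ?_⟩
  rw [fr_tower (hκ _ hw).1, (hκ _ hw).2, uN_tower (K := K) N w, map_pow]

lemma root_eq {P : Pl Ω} {N : ℕ} (hN : (N : 𝓞 Ω) ∉ P.asIdeal) {x y : 𝓞 Ω} (hx : x ^ N = 1) (hy : y ^ N = 1)
    (h : x - y ∈ P.asIdeal) : x = y := by
  have hN0 : N ≠ 0 := by rintro rfl; simp at hN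
  have hyy : y ^ (N - 1) * y = 1 := by rw [← pow_succ, Nat.sub_add_cancel (by omega), hy]
  set z := y ^ (N - 1) * x with hz
  have hz1 : z ^ N = 1 := by rw [hz, mul_pow, hx, ← pow_mul, mul_comm (N - 1), pow_mul, hy]; simp
  have hzP : z - 1 ∈ P.asIdeal := by rw [hz, ← hyy, ← mul_sub]; exact Ideal.mul_mem_left _ _ h
  have h2 := geom_sum_mul z N
  rw [hz1, sub_self, mul_eq_zero, sub_eq_zero] at h2
  rcases h2 with h2 | h2
  · exfalso
    apply hN
    have h3 := congrArg (Ideal.Quotient.mk P.asIdeal) h2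
    have h4 : Ideal.Quotient.mk P.asIdeal z = 1 := by
      rw [← sub_eq_zero, ← map_one (Ideal.Quotient.mk P.asIdeal), ← map_sub, Ideal.Quotient.eq_zero_iff_mem]; exact hzP
    rw [map_sum] at h3
    simp only [map_pow, h4, one_pow, map_zero] at h3
    rw [← Ideal.Quotient.eq_zero_iff_mem, map_natCast]
    simpa using h3
  · calc x = y * z := by rw [hz, ← mul_assoc, mul_comm y, hyy, one_mul]
      _ = y := by rw [h2, mul_one]

lemma prim_eq {N : ℕ} [NeZero N] {ζ : Ω} (hζ : IsPrimitiveRoot ζ N) {i j : ℕ} (h : ζ ^ i = ζ ^ j) :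
    (i : ZMod N) = j := by
  obtain ⟨u, rfl⟩ := hζ.isUnit (NeZero.ne N)
  rw [IsPrimitiveRoot.coe_units_iff] at hζ
  have h : u ^ i = u ^ j := by exact_mod_cast h
  rwa [pow_eq_pow_iff_modEq, ← hζ.eq_orderOf, ← ZMod.natCast_eq_natCast_iff] at h

lemma Cyc.base {N : ℕ} [NeZero N] {ζ : Ω} (hζ : IsPrimitiveRoot ζ N) (κ : (ZMod N)ˣ →* ℂˣ) (v : Pl K)
    (hv : (Nm v).Coprime N) : Unr (κ.comp (hζ.autToPow K)) v ∧ fr (κ.comp (hζ.autToPow K)) v = κ (uN N v) := by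
  obtain ⟨z, hz⟩ : ∃ z : 𝓞 Ω, (z : Ω) = ζ := ⟨⟨ζ, hζ.isIntegral (NeZero.pos N)⟩, rfl⟩
  have hzN : z ^ N = 1 := by apply oc_inj; rw [oc_pow, hz, oc_one, hζ.pow_eq_one]
  have hsm : ∀ σ : Gal(Ω/K), (σ • z) ^ N = 1 := fun σ => by rw [← smul_pow', hzN, smul_one]
  have hPN : ∀ P : Pl Ω, dn K P = v → (N : 𝓞 Ω) ∉ P.asIdeal := fun P hP => by
    apply of_coprime
    rw [Nm_pow (K := K) P, hP]; exact hv.pow_left _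
  have key : ∀ (σ : Gal(Ω/K)) (m : ℕ) (u : (ZMod N)ˣ), (u : ZMod N) = m → σ • z = z ^ m → hζ.autToPow K σ = u := by
    intro σ m u hu h
    have h1 : σ ζ = ζ ^ m := by
      have := congrArg (fun x : 𝓞 Ω => (x : Ω)) h
      simp only [oc_pow, hz] at this
      rw [← this, ← hz]; rfl
    rw [← hζ.autToPow_spec K σ] at h1
    have h1 := prim_eq hζ h1
    rw [ZMod.natCast_zmod_val] at h1
    exact Units.ext (h1.trans hu.symm)
  have hU : Unr (κ.comp (hζ.autToPow K)) v := by
    intro P hP σ hσ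
    have := key σ 1 1 (by simp) (by
      rw [pow_one]; exact root_eq (hPN P hP) (hsm σ) hzN (hσ z))
    rw [MonoidHom.comp_apply, this, map_one]
  refine ⟨hU, ?_⟩
  obtain ⟨P, hP⟩ := dn_surj (Ω := Ω) v
  obtain ⟨σ, hσ⟩ := exists_isFr (K := K) P
  rw [← fr_eq _ hU hP hσ, MonoidHom.comp_apply]
  congr 1
  apply key σ (Nm v) _ (uN_coe hv)
  refine root_eq (hPN P hP) (hsm σ) ?_ ?_
  · rw [← pow_mul, mul_comm, pow_mul, hzN, one_pow]
  · rw [← hP]; exact hσ z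

end

/-! ### Auxiliary cyclotomic extensions -/
section
open Polynomial

lemma exists_r {a n : ℕ} (ha : 2 ≤ a) (hn : 0 < n) (B : ℕ) :
    ∃ r : ℕ, r.Prime ∧ B < r ∧ a.Coprime r ∧ n ∣ orderOf (a : ZMod r) := by
  obtain ⟨s, hs1, hs⟩ := Nat.exists_infinite_primes (a ^ n + n + B + 1)
  have hs2 := hs.two_le
  have hns : 1 < n * s := by nlinarith
  have h1 := sub_one_lt_natAbs_cyclotomic_eval hns (q := a) (by omega)
  obtain ⟨r, hr, hrd⟩ := Nat.exists_prime_and_dvd (n := ((cyclotomic (n * s) ℤ).eval (a : ℤ)).natAbs) (by omega)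
  haveI := Fact.mk hr
  have hroot : IsRoot (cyclotomic (n * s) (ZMod r)) (a : ZMod r) := by
    have h2 : (r : ℤ) ∣ (cyclotomic (n * s) ℤ).eval (a : ℤ) := Int.natCast_dvd.mpr hrd
    rw [← ZMod.intCast_zmod_eq_zero_iff_dvd] at h2
    rw [IsRoot.def, ← map_cyclotomic_int, eval_map, eval₂_at_natCast, ← h2]
    simp
  have hpow : (a : ZMod r) ^ (n * s) = 1 := by
    have := (hroot.dvd (cyclotomic.dvd_X_pow_sub_one (n * s) (ZMod r)))
    rw [IsRoot.def] at this
    simpa [sub_eq_zero] using this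
  have hgeom : ∑ i ∈ Finset.range s, ((a : ZMod r) ^ n) ^ i = 0 := by
    have h2 : cyclotomic (n * s) (ZMod r) ∣ ∑ i ∈ Finset.range s, (X ^ n) ^ i := by
      have h3 := X_pow_sub_one_mul_cyclotomic_dvd_X_pow_sub_one_of_dvd (ZMod r) (d := n) (n := n * s)
        (Nat.mem_properDivisors.mpr ⟨Dvd.intro _ rfl, by nlinarith⟩)
      have h4 : (∑ i ∈ Finset.range s, (X ^ n) ^ i : (ZMod r)[X]) * (X ^ n - 1) = X ^ (n * s) - 1 := by
        rw [geom_sum_mul, pow_mul]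
      rw [← h4, mul_comm (X ^ n - 1)] at h3
      have hx0 : (X ^ n - 1 : (ZMod r)[X]) ≠ 0 := by simpa using X_pow_sub_C_ne_zero hn (1 : ZMod r)
      exact (mul_dvd_mul_iff_right hx0).mp h3
    have := hroot.dvd h2
    rw [IsRoot.def, eval_finsetSum] at this
    simpa using this
  have hne : (a : ZMod r) ^ n ≠ 1 := fun h => by
    simp only [h, one_pow, Finset.sum_const, Finset.card_range, nsmul_eq_mul, mul_one] at hgeom
    rw [ZMod.natCast_eq_zero_iff, Nat.prime_dvd_prime_iff_eq hr hs] at hgeom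
    subst hgeom
    have h3 : ((a ^ n - 1 : ℕ) : ZMod r) = 0 := by
      rw [Nat.cast_sub (Nat.one_le_pow _ _ (by omega))]; push_cast; rw [h]; simp
    rw [ZMod.natCast_eq_zero_iff] at h3
    have h4 : 1 < a ^ n := Nat.one_lt_pow hn.ne' (by omega)
    have := Nat.le_of_dvd (by omega) h3
    omega
  have hso : s ∣ orderOf (a : ZMod r) := by
    by_contra h
    have h2 : (orderOf (a : ZMod r)).Coprime s := ((Nat.Prime.coprime_iff_not_dvd hs).mpr h).symm
    exact hne (orderOf_dvd_iff_pow_eq_one.mp (h2.dvd_of_dvd_mul_right (orderOf_dvd_iff_pow_eq_one.mpr hpow)))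
  have ha0 : (a : ZMod r) ≠ 0 := fun h => by
    rw [h, zero_pow (by omega)] at hpow; exact zero_ne_one hpow
  have hsr : s ∣ r - 1 := hso.trans (orderOf_dvd_of_pow_eq_one (ZMod.pow_card_sub_one_eq_one ha0))
  have hsr' := Nat.le_of_dvd (by have := hr.two_le; omega) hsr
  have hcop : a.Coprime r := by
    rw [Nat.coprime_comm, Nat.Prime.coprime_iff_not_dvd hr, ← ZMod.natCast_eq_zero_iff]; exact ha0
  refine ⟨r, hr, by omega, hcop, ?_⟩
  have hnr : ¬ r ∣ n * s := fun h => by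
    have han : n ≤ a ^ n + n := by omega
    rcases (Nat.Prime.dvd_mul hr).mp h with h | h
    · have := Nat.le_of_dvd hn h; omega
    · have := Nat.le_of_dvd hs.pos h; omega
  haveI : NeZero ((n * s : ℕ) : ZMod r) := ⟨fun h => hnr ((ZMod.natCast_eq_zero_iff _ _).mp h)⟩
  rw [isRoot_cyclotomic_iff] at hroot
  rw [← hroot.eq_orderOf]; exact Dvd.intro _ rfl

variable {L : Type} [Field L] [NumberField L]

variable (L) in
lemma exists_unram : ∃ B : ℕ, ∀ r : ℕ, r.Prime → B < r → ∀ Q : Pl L, (r : 𝓞 L) ∈ Q.asIdeal → (r : 𝓞 L) ∉ Q.asIdeal ^ 2 := by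
  refine ⟨Ideal.absNorm (differentIdeal ℤ (𝓞 L)), fun r hr hB Q hQ hQ2 => ?_⟩
  haveI : (Ideal.span {(r : ℤ)}).IsMaximal :=
    PrincipalIdealRing.isMaximal_of_irreducible (Nat.prime_iff_prime_int.mp hr).irreducible
  have h1 : Q.asIdeal ^ 2 ∣ (Ideal.span {(r : ℤ)}).map (algebraMap ℤ (𝓞 L)) := by
    rw [Ideal.map_span, Set.image_singleton, Ideal.dvd_span_singleton]; simpa using hQ2
  have h2 := pow_sub_one_dvd_differentIdeal ℤ Q.asIdeal 2 (by simpa using hr.ne_zero) h1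
  have h3 : Ideal.absNorm Q.asIdeal ∣ _ := map_dvd Ideal.absNorm (show Q.asIdeal ∣ differentIdeal ℤ (𝓞 L) by simpa using h2)
  have h4 : Nm Q ∣ r ^ Module.finrank ℤ (𝓞 L) := by
    rw [Nm_eq, ← Ideal.absNorm_span_natCast]
    exact map_dvd _ ((Ideal.dvd_span_singleton).mpr hQ)
  have h5 : r ∣ Nm Q := by
    obtain ⟨k, -, hk⟩ := (Nat.dvd_prime_pow hr).mp h4
    have := Nm_gt_one Q
    rw [hk] at this ⊢
    exact dvd_pow_self _ (by rintro rfl; simp at this)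
  rw [← Nm_eq] at h3
  have h6 : Ideal.absNorm (differentIdeal ℤ (𝓞 L)) ≠ 0 := by
    rw [Ne, Ideal.absNorm_eq_zero_iff]; exact differentIdeal_ne_bot
  exact absurd (Nat.le_of_dvd (Nat.pos_of_ne_zero h6) (h5.trans h3)) (by omega)

lemma cyclo_irr {r : ℕ} (hr : r.Prime) (h : ∀ Q : Pl L, (r : 𝓞 L) ∈ Q.asIdeal → (r : 𝓞 L) ∉ Q.asIdeal ^ 2) :
    Irreducible (cyclotomic r L) := by
  haveI := Fact.mk hr
  have h2 : (Ideal.span {(r : 𝓞 L)}) ≠ ⊤ := fun h2 => by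
    have h3 := Ideal.absNorm_span_natCast (S := 𝓞 L) r
    rw [h2, Ideal.absNorm_top, eq_comm] at h3
    exact hr.one_lt.ne' (Nat.pow_eq_one.mp h3 |>.resolve_right (by
      rw [RingOfIntegers.rank]; exact Module.finrank_pos.ne'))
  obtain ⟨M, hM, hle⟩ := Ideal.exists_le_maximal _ h2
  have hm : (r : 𝓞 L) ∈ M := hle (Ideal.mem_span_singleton_self _)
  have hM0 : M ≠ ⊥ := by rintro rfl; exact hr.ne_zero (by simpa using hm)
  have hE := cyclotomic_comp_X_add_one_isEisensteinAt (p := r)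
  set f := ((cyclotomic r ℤ).comp (X + 1)).map (Int.castRingHom (𝓞 L)) with hf
  have hf' : f = (cyclotomic r (𝓞 L)).comp (X + C 1) := by
    rw [hf, map_comp, map_cyclotomic_int]; simp
  have hmon : f.Monic := by
    rw [hf']; exact (cyclotomic.monic r _).comp (monic_X_add_C 1) (by rw [natDegree_X_add_C]; exact one_ne_zero)
  have hmonZ : ((cyclotomic r ℤ).comp (X + C 1)).Monic := (cyclotomic.monic r _).comp (monic_X_add_C 1) (by rw [natDegree_X_add_C]; exact one_ne_zero)
  have hdeg : f.natDegree = ((cyclotomic r ℤ).comp (X + 1)).natDegree := by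
    rw [hf]; exact Monic.natDegree_map (by simpa using hmonZ) _
  have hirr : Irreducible f := by
    refine IsEisensteinAt.irreducible (𝓟 := M) ⟨?_, ?_, ?_⟩ hM.isPrime hmon.isPrimitive ?_
    · rw [hmon.leadingCoeff]; exact fun h => hM.ne_top ((Ideal.eq_top_iff_one _).mpr h)
    · intro n hn
      rw [hdeg] at hn
      obtain ⟨c, hc⟩ := Ideal.mem_span_singleton.mp (hE.mem hn)
      rw [hf, coeff_map, hc]
      simpa using Ideal.mul_mem_right _ _ hm
    · rw [hf, coeff_map, coeff_zero_eq_eval_zero, eval_comp]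
      simpa [eval_one_cyclotomic_prime] using h ⟨M, hM.isPrime, hM0⟩ hm
    · rw [hdeg, natDegree_comp, natDegree_cyclotomic, show (X + 1 : ℤ[X]) = X + C 1 by simp, natDegree_X_add_C,
        mul_one]
      exact Nat.totient_pos.mpr hr.pos
  rw [hmon.irreducible_iff_irreducible_map_fraction_map (K := L), hf', map_comp, map_cyclotomic] at hirr
  rw [Polynomial.map_add, map_X, map_C, RingHom.map_one] at hirr
  refine (MulEquiv.irreducible_iff (algEquivAevalXAddC (1 : L))).mp ?_
  rw [algEquivAevalXAddC_apply, ← comp_eq_aeval]; exact hirr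
end
section
open Polynomial
variable {K : Type} [Field K] [NumberField K]
lemma rs_rs {L L1 M : Type} [Field L] [Field L1] [Field M] [NumberField L] [NumberField L1] [NumberField M] [Algebra K L] [Algebra K L1] [Algebra K M]
    [Algebra L L1] [Algebra L M] [Algebra L1 M] [IsScalarTower K L L1] [IsScalarTower K L M] [IsScalarTower K L1 M]
    [IsScalarTower L L1 M] [IsGalois K L] [IsGalois K L1] [IsGalois K M] (σ : Gal(M/K)) :
    rs (L := L) σ = rs (rs (L := L1) σ) := by
  ext x
  apply (algebraMap L1 M).injective.comp (algebraMap L L1).injective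
  have h1 : algebraMap L L1 (rs (L := L) (rs (L := L1) σ) x) = rs (L := L1) σ (algebraMap L L1 x) :=
    AlgEquiv.restrictNormal_commutes _ L x
  have h2 : ∀ y, algebraMap L1 M (rs (L := L1) σ y) = σ (algebraMap L1 M y) := AlgEquiv.restrictNormal_commutes σ L1
  have h3 : algebraMap L M (rs (L := L) σ x) = σ (algebraMap L M x) := AlgEquiv.restrictNormal_commutes σ L x
  simp only [Function.comp, h1, h2, ← IsScalarTower.algebraMap_apply, h3]

lemma kap1 {G : Type} [CommGroup G] [Finite G] (u : G) {n : ℕ} (h : n ∣ orderOf u) {z : ℂˣ} (hz : z ^ n = 1) :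
    ∃ κ : G →* ℂˣ, κ u = z := by
  haveI : NeZero (Monoid.exponent G) := ⟨Monoid.exponent_ne_zero_of_finite⟩
  have hg : ∀ x : Subgroup.zpowers u, x ∈ Subgroup.zpowers (⟨u, Subgroup.mem_zpowers u⟩ : Subgroup.zpowers u) := by
    rintro ⟨x, k, rfl⟩; exact ⟨k, rfl⟩
  have ho : orderOf z ∣ orderOf (⟨u, Subgroup.mem_zpowers u⟩ : Subgroup.zpowers u) := by
    rw [Subgroup.orderOf_mk]; exact (orderOf_dvd_of_pow_eq_one hz).trans h
  obtain ⟨κ, hκ⟩ := MonoidHom.domRestrict_surjective (M := ℂ) (Subgroup.zpowers u) (monoidHomOfForallMemZpowers hg ho)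
  refine ⟨κ, ?_⟩
  have := DFunLike.congr_fun hκ ⟨u, Subgroup.mem_zpowers u⟩
  rw [monoidHomOfForallMemZpowers_apply_gen] at this
  exact this

lemma kap2 {G : Type} [CommGroup G] [Finite G] [IsCyclic G] {n : ℕ} (hn : 0 < n) (h : n ∣ Nat.card G) :
    ∃ κ : G →* ℂˣ, (∀ u, κ u ^ n = 1) ∧ ∀ z : ℂˣ, z ^ n = 1 → ∃ u, κ u = z := by
  obtain ⟨g, hg⟩ := IsCyclic.exists_generator (α := G)
  obtain ⟨w, hw⟩ : ∃ w : ℂˣ, IsPrimitiveRoot w n :=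
    ⟨(Complex.isPrimitiveRoot_exp n hn.ne').isUnit hn.ne' |>.unit, IsPrimitiveRoot.coe_units_iff.mp (Complex.isPrimitiveRoot_exp n hn.ne')⟩
  have ho : orderOf w ∣ orderOf g := by
    rw [← hw.eq_orderOf, orderOf_eq_card_of_forall_mem_zpowers hg]; exact h
  refine ⟨monoidHomOfForallMemZpowers hg ho, fun u => ?_, fun z hz => ?_⟩
  · obtain ⟨k, rfl⟩ := hg u
    simp only [map_zpow, monoidHomOfForallMemZpowers_apply_gen]
    rw [← zpow_natCast, zpow_comm, zpow_natCast, hw.pow_eq_one, one_zpow]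
  · haveI : NeZero n := ⟨hn.ne'⟩
    obtain ⟨i, -, hi⟩ := (IsPrimitiveRoot.coe_units_iff.mpr hw).eq_pow_of_pow_eq_one (ξ := (z : ℂ)) (by rw [← Units.val_pow_eq_pow_val, hz, Units.val_one])
    exact ⟨g ^ i, by rw [map_pow, monoidHomOfForallMemZpowers_apply_gen]; exact_mod_cast hi⟩

lemma cyc_step (L : Type) [Field L] [NumberField L] [Algebra K L] [IsGalois K L] {r : ℕ} (hr : r.Prime)
    (h : Irreducible (cyclotomic r L)) :
    ∃ (M : Type) (_ : Field M) (_ : NumberField M) (_ : Algebra K M) (_ : Algebra L M) (_ : IsScalarTower K L M)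
      (_ : IsGalois K M) (π : Gal(M/K) →* (ZMod r)ˣ),
      (∀ (κ : (ZMod r)ˣ →* ℂˣ) (v : Pl K), (Nm v).Coprime r → Unr (κ.comp π) v ∧ fr (κ.comp π) v = κ (uN r v)) ∧
      ∀ (σ₀ : Gal(L/K)) (u : (ZMod r)ˣ), ∃ σ : Gal(M/K), rs σ = σ₀ ∧ π σ = u := by
  haveI : NeZero r := ⟨hr.ne_zero⟩
  obtain ⟨f, hf, hfs⟩ := IsGalois.is_separable_splitting_field K L
  haveI : IsSplittingField L (CyclotomicField r L) ((cyclotomic r K).map (algebraMap K L)) := by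
    rw [map_cyclotomic]; exact IsCyclotomicExtension.splitting_field_cyclotomic r L _
  haveI := IsSplittingField.mul (F := K) (K := L) (L := CyclotomicField r L) f (cyclotomic r K) hf.ne_zero (cyclotomic_ne_zero _ _)
  haveI : IsGalois K (CyclotomicField r L) :=
    { to_normal := Normal.of_isSplittingField (f * cyclotomic r K) }
  haveI : IsGalois L (CyclotomicField r L) := IsGalois.tower_top_of_isGalois K L _
  have hζ := IsCyclotomicExtension.zeta_spec r L (CyclotomicField r L)
  refine ⟨CyclotomicField r L, inferInstance, inferInstance, inferInstance, inferInstance, inferInstance, inferInstance,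
    hζ.autToPow K, fun κ v hv => Cyc.base hζ κ v hv, fun σ₀ u => ?_⟩
  obtain ⟨σ, rfl⟩ := rs_surj (Ω := CyclotomicField r L) σ₀
  obtain ⟨τ, hτ⟩ := (IsCyclotomicExtension.autEquivPow (CyclotomicField r L) h).surjective ((hζ.autToPow K σ)⁻¹ * u)
  refine ⟨σ * resH K τ, by rw [map_mul, rs_resH, mul_one], ?_⟩
  have : hζ.autToPow K (resH K τ) = (hζ.autToPow K σ)⁻¹ * u := by
    rw [← hτ, IsCyclotomicExtension.autEquivPow_apply]
    apply Units.ext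
    have h1 := hζ.autToPow_spec K (resH K τ)
    rw [resH_apply, ← hζ.autToPow_spec L τ] at h1
    simpa using prim_eq hζ h1
  rw [map_mul, this]; group

lemma aux_ext (L : Type) [Field L] [NumberField L] [Algebra K L] [IsGalois K L] (p : Pl K) {n : ℕ} (hn : 0 < n) {z : ℂˣ}
    (hz : z ^ n = 1) :
    ∃ (M : Type) (_ : Field M) (_ : NumberField M) (_ : Algebra K M) (_ : Algebra L M) (_ : IsScalarTower K L M)
      (_ : IsGalois K M) (N : ℕ) (ψ : Gal(M/K) →* ℂˣ), Cyc N ψ ∧ (Nm p).Coprime N ∧ fr ψ p = z ∧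
      ∀ (σ₀ : Gal(L/K)) (w : ℂˣ), w ^ n = 1 → ∃ σ : Gal(M/K), rs σ = σ₀ ∧ ψ σ = w := by
  obtain ⟨B1, hB1⟩ := exists_unram L
  obtain ⟨r1, hr1, hb1, hc1, ho1⟩ := exists_r (Nm_gt_one p) hn B1
  obtain ⟨L1, _, _, _, _, _, _, π1, h1, h1'⟩ := cyc_step (K := K) L hr1 (cyclo_irr hr1 (hB1 r1 hr1 hb1))
  obtain ⟨B2, hB2⟩ := exists_unram L1
  obtain ⟨r2, hr2, hb2, hc2⟩ := Nat.exists_prime_gt_modEq_one (k := n) (B2 + Nm p) hn.ne'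
  obtain ⟨M, _, _, _, _, _, _, π2, h2, h2'⟩ := cyc_step (K := K) L1 hr2 (cyclo_irr hr2 (hB2 r2 hr2 (by omega)))
  haveI := Fact.mk hr1
  haveI := Fact.mk hr2
  have hp2 : (Nm p).Coprime r2 := by
    rw [Nat.coprime_comm, Nat.Prime.coprime_iff_not_dvd hr2]
    exact fun h => absurd (Nat.le_of_dvd (by have := Nm_gt_one p; omega) h) (by omega)
  obtain ⟨κ2, hκ, hκ'⟩ := kap2 (G := (ZMod r2)ˣ) hn (by
    rw [Nat.card_eq_fintype_card, ZMod.card_units]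
    exact (Nat.modEq_iff_dvd' hr2.one_lt.le).mp hc2.symm)
  obtain ⟨κ1, hκ1⟩ := kap1 (uN r1 p) (n := n) (by rwa [← orderOf_units, uN_coe hc1]) (z := z * (κ2 (uN r2 p))⁻¹) (by
    rw [mul_pow, hz, inv_pow, hκ, inv_one, mul_one])
  letI : Algebra L M := ((algebraMap L1 M).comp (algebraMap L L1)).toAlgebra
  haveI : IsScalarTower L L1 M := IsScalarTower.of_algebraMap_eq fun _ => rfl
  haveI : IsScalarTower K L M := IsScalarTower.of_algebraMap_eq fun x => by
    rw [IsScalarTower.algebraMap_apply K L1 M, IsScalarTower.algebraMap_apply K L L1]; rfl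
  have c1 : Cyc r1 (κ1.comp π1) := ⟨hr1.ne_zero, κ1, fun v hv => h1 κ1 v hv⟩
  have c2 : Cyc r2 (κ2.comp π2) := ⟨hr2.ne_zero, κ2, fun v hv => h2 κ2 v hv⟩
  haveI : IsGalois L1 M := IsGalois.tower_top_of_isGalois K L1 M
  refine ⟨M, inferInstance, inferInstance, inferInstance, inferInstance, inferInstance, inferInstance, r1 * r2,
    (κ1.comp π1).comp (rs (L := L1)) * κ2.comp π2, c1.rs.mul c2, hc1.mul_right hp2, ?_, fun σ₀ w hw => ?_⟩
  · rw [fr_mul, ← fr_descend (h1 κ1 p hc1).1.ascend, (h1 κ1 p hc1).2, (h2 κ2 p hp2).2, hκ1]; simp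
  · obtain ⟨u, hu⟩ := hκ' w hw
    obtain ⟨σ1, ha, hb⟩ := h1' σ₀ 1
    obtain ⟨σ, hc, hd⟩ := h2' σ1 u
    refine ⟨σ, ?_, ?_⟩
    · rw [← ha, ← hc]
      exact rs_rs σ
    · simp [hc, hb, hd, hu]
end

/-! ### Artin reciprocity -/
section
variable {K : Type} [Field K] [NumberField K]
variable {Ω : Type} [Field Ω] [NumberField Ω] [Algebra K Ω] [IsGalois K Ω]

lemma fr_mem (χ : Gal(Ω/K) →* ℂˣ) (v : Pl K) : ∃ g, fr χ v = χ g := ⟨_, rfl⟩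

lemma art_mem (χ : Gal(Ω/K) →* ℂˣ) (D : Dv K) : (art χ D).toMul ∈ χ.range := by
  induction D using Finsupp.induction_linear with
  | zero => simp
  | add f g hf hg => rw [map_add, toMul_add]; exact mul_mem hf hg
  | single v m =>
    rw [art_single, toMul_zsmul, toMul_ofMul]
    obtain ⟨g, hg⟩ := fr_mem χ v
    rw [hg]; exact zpow_mem (MonoidHom.mem_range.mpr ⟨g, rfl⟩) _

lemma card_art (χ : Gal(Ω/K) →* ℂˣ) (T : Finset (Pl K)) :
    (DivS T).map (art χ) = χ.range.toAddSubgroup := by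
  set H := (DivS T).map (art χ) with hH
  have hle : H ≤ χ.range.toAddSubgroup := by
    rintro _ ⟨D, -, rfl⟩; exact art_mem χ D
  haveI : Finite χ.range := Set.finite_range χ
  haveI : Finite χ.range.toAddSubgroup := ‹Finite χ.range›
  haveI : Finite H := Finite.of_injective _ (AddSubgroup.inclusion_injective hle)
  have h1 : χ ^ Nat.card H = 1 := by
    refine weak_cheb _ T fun v hv => ?_
    have hm : art χ (Finsupp.single v 1) ∈ H := ⟨_, fun w hw => by
      classical
      rw [Finsupp.single_apply, if_neg]; rintro rfl; exact hv hw, rfl⟩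
    have := card_nsmul_eq_zero' (x := (⟨_, hm⟩ : H))
    rw [Subtype.ext_iff, AddSubgroup.coe_nsmul] at this
    rw [fr_pow]
    simpa [art_single] using congrArg Additive.toMul this
  haveI : NeZero (Nat.card H) := ⟨Nat.card_pos.ne'⟩
  have h2 : χ.range ≤ rootsOfUnity (Nat.card H) ℂ := by
    rintro _ ⟨g, rfl⟩
    rw [mem_rootsOfUnity, ← MonoidHom.pow_apply, h1, MonoidHom.one_apply]
  have h3 : Nat.card χ.range.toAddSubgroup ≤ Nat.card H := by
    refine (Nat.card_le_card_of_injective _ (Subgroup.inclusion_injective h2)).trans ?_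
    exact card_rootsOfUnity _ _
  exact AddSubgroup.eq_of_le_of_card_ge hle h3

lemma relIndex_art (χ : Gal(Ω/K) →* ℂˣ) (T : Finset (Pl K)) :
    ((art χ).ker ⊓ DivS T).relIndex (DivS T) = Nat.card χ.range := by
  rw [AddSubgroup.inf_relIndex_right, AddSubgroup.relIndex_ker, card_art]; rfl

lemma A_ne (χ : Gal(Ω/K) →* ℂˣ) (S : Finset (Pl K)) (k : ℕ) : (PR S k ⊔ (Nchi χ ⊓ DivS S)).relIndex (DivS S) ≠ 0 :=
  fun h => finiteIndex_PR S k (by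
    have := AddSubgroup.relIndex_dvd_of_le_left (DivS S) (le_sup_left : PR S k ≤ PR S k ⊔ (Nchi χ ⊓ DivS S))
    rw [h] at this; exact Nat.eq_zero_of_zero_dvd this)

lemma A_le (χ : Gal(Ω/K) →* ℂˣ) (S : Finset (Pl K)) (k : ℕ) : PR S k ⊔ (Nchi χ ⊓ DivS S) ≤ DivS S :=
  sup_le (PR_le_DivS S k) inf_le_right

/-- if the reciprocity law holds, the kernel is the norm group -/
lemma ker_le {χ : Gal(Ω/K) →* ℂˣ} {S : Finset (Pl K)} (hS : ∀ v ∉ S, Unr χ v) {k : ℕ}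
    (h : ∀ D ∈ PR S k, art χ D = 0) : (art χ).ker ⊓ DivS S ≤ PR S k ⊔ (Nchi χ ⊓ DivS S) := by
  have hle : PR S k ⊔ (Nchi χ ⊓ DivS S) ≤ (art χ).ker ⊓ DivS S :=
    le_inf (sup_le h fun D hD => art_Nchi χ hD.1) (A_le χ S k)
  have h1 := AddSubgroup.relIndex_mul_relIndex _ _ _ hle inf_le_right
  have h2 := second_ineq χ S hS k
  have h3 := A_ne χ S k
  rw [relIndex_art] at h1
  rw [← h1] at h2 h3
  rw [← AddSubgroup.relIndex_eq_one]
  have h4 := Nat.pos_of_ne_zero (left_ne_zero_of_mul h3)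
  have h5 := Nat.pos_of_ne_zero (right_ne_zero_of_mul h3)
  nlinarith

lemma AR_of {χ : Gal(Ω/K) →* ℂˣ} {S : Finset (Pl K)} {k : ℕ}
    (hk : Nat.card χ.range ≤ (PR S k ⊔ (Nchi χ ⊓ DivS S)).relIndex (DivS S))
    (h : (art χ).ker ⊓ DivS S ≤ PR S k ⊔ (Nchi χ ⊓ DivS S)) : ∀ D ∈ PR S k, art χ D = 0 := by
  have h1 := AddSubgroup.relIndex_mul_relIndex _ _ _ h (A_le χ S k)
  have h3 := A_ne χ S k
  rw [relIndex_art] at h1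
  have h2 : (art χ).ker ⊓ DivS S = PR S k ⊔ (Nchi χ ⊓ DivS S) := by
    refine le_antisymm h ?_
    rw [← AddSubgroup.relIndex_eq_one]
    haveI : Finite χ.range := Set.finite_range χ
    have h0 : 0 < Nat.card χ.range := Nat.card_pos
    have h4 := Nat.pos_of_ne_zero h3
    rw [← h1] at hk h0
    have := Nat.pos_of_mul_pos_right h0
    nlinarith
  intro D hD
  have : D ∈ (art χ).ker ⊓ DivS S := by rw [h2]; exact AddSubgroup.mem_sup_left hD
  exact this.1

variable {F E : Type} [Field F] [NumberField F] [Algebra K F] [Field E] [NumberField E] [Algebra K E] [Algebra E F] [IsScalarTower K E F]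
lemma nD_nD (B : Dv F) : nD K (nD E B) = nD K B := by
  induction B using Finsupp.induction_linear with
  | zero => simp
  | add f g hf hg => simp only [map_add, hf, hg]
  | single v m =>
    rw [nD_single, nD_single, nD_single, dn_dn, fd_mul (K := K) (F := E) v]; push_cast; ring_nf

variable [Algebra E Ω] [Algebra F Ω] [IsScalarTower K E Ω] [IsScalarTower K F Ω] [IsScalarTower E F Ω]
  [IsGalois E Ω] [IsGalois F Ω]
/-- Key step: a prime is congruent to a multiple of a norm from `F`, working over `E`. -/
lemma core {χ ψ : Gal(Ω/K) →* ℂˣ} {S T : Finset (Pl K)} (hST : S ⊆ T) (hS : ∀ v ∉ S, Unr χ v) (k : ℕ) {N : ℕ} (hψ : Cyc N ψ)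
    (hT : ∀ v, ¬ (Nm v).Coprime N → v ∈ T) (hE : ∀ τ : Gal(Ω/E), χ (resH K τ) = ψ (resH K τ))
    (hE' : ∀ g : Gal(Ω/K), χ g = ψ g → ∃ τ : Gal(Ω/E), resH K τ = g) {p : Pl K} (hp : p ∉ T)
    (hpf : fr ψ p = fr χ p) {B : Dv F} (hB : B ∈ DivS (up F T)) {d : ℤ}
    (hd : d • art (χ.comp (resH K : Gal(Ω/F) →* Gal(Ω/K))) B = Additive.ofMul (fr χ p)) :
    Finsupp.single p 1 - d • nD K B ∈ PR S k ⊔ (Nchi χ ⊓ DivS S) := by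
  have hpN : (Nm p).Coprime N := by by_contra h; exact hp (hT p h)
  have hpS : p ∉ S := fun h => hp (hST h)
  have hψ' := hψ
  obtain ⟨-, κ, hκ⟩ := hψ
  have he : χ.comp (resH K : Gal(Ω/E) →* Gal(Ω/K)) = ψ.comp (resH K) := MonoidHom.ext hE
  set χE := χ.comp (resH K : Gal(Ω/E) →* Gal(Ω/K)) with hχE
  have hc : Cyc N χE := by rw [he]; exact hψ'.res
  have hUT : ∀ w ∉ up E T, Unr χE w := fun w hw => (hS _ fun h => hw (mem_up.mpr (hST h))).tower
  obtain ⟨k', hk'⟩ := exists_PR_norm (F := E) T k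
  obtain ⟨k'', hk''⟩ := cyc_AR hc (up E T) (fun w hw => mem_up.mpr (hT _ fun h => hw (by
    rw [Nm_pow (K := K) w]; exact h.pow_left _)))
  have hker := ker_le (k := max k' k'') hUT (fun D hD => hk'' D (PR_anti (le_max_right _ _) hD))
  obtain ⟨P, hP⟩ := dn_surj (Ω := Ω) p
  obtain ⟨φ, hφ⟩ := exists_isFr (K := K) P
  obtain ⟨τ, hτ⟩ := hE' φ (by rw [fr_eq χ (hS p hpS) hP hφ, fr_eq ψ (hκ p hpN).1 hP hφ, hpf])
  set w := dn E P with hw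
  have hwp : dn K w = p := by rw [hw, dn_dn, hP]
  have hf1 : fd K w = 1 := by
    rw [← Nat.dvd_one]
    refine fd_dvd w 1 fun x => ?_
    rw [hwp, pow_one, mem_dn]
    have := hφ (algebraMap (𝓞 E) (𝓞 Ω) x)
    rw [hP, ← hτ] at this
    rw [map_sub, map_pow]
    convert this using 2
    apply RingOfIntegers.coe_injective
    exact (τ.commutes (x : E)).symm
  have hwT : w ∉ up E T := by rw [mem_up, hwp]; exact hp
  have hBE : nD E B ∈ DivS (up E T) := nD_DivS (T := up F T) (fun x hx => by
    rw [mem_up] at hx ⊢; rwa [dn_dn] at hx) hB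
  have hX : Finsupp.single w 1 - d • nD E B ∈ (art χE).ker ⊓ DivS (up E T) := by
    refine ⟨?_, (DivS (up E T)).sub_mem (fun v hv => ?_) ((DivS (up E T)).zsmul_mem hBE d)⟩
    · change art χE _ = 0
      rw [map_sub, map_zsmul, art_single, one_smul, fr_tower (by rw [hwp]; exact hS p hpS), hwp, hf1, pow_one,
        art_nD (T := up F T) hUT (fun x hx => by rw [mem_up] at hx ⊢; rwa [dn_dn] at hx) hB, ← hd, sub_eq_zero]
      rfl
    · classical
      rw [Finsupp.single_apply, if_neg]; rintro rfl; exact hwT hv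
  obtain ⟨Y, hY, Z, hZ, hYZ⟩ := AddSubgroup.mem_sup.mp (hker hX)
  have hn := congrArg (nD K) hYZ
  rw [map_sub, map_zsmul, nD_nD, nD_single, hwp, hf1, map_add] at hn
  have hup : ∀ x : Pl E, dn K x ∈ S → x ∈ up E T := fun x hx => mem_up.mpr (hST hx)
  rw [show (1 : ℤ) * (1 : ℕ) = 1 by simp] at hn
  rw [← hn]
  refine add_mem (AddSubgroup.mem_sup_left (PR_mono hST k (hk' _ (PR_anti (le_max_left _ _) hY))))
    (AddSubgroup.mem_sup_right ⟨nD_Nchi hS hup hZ.2 hZ.1, nD_DivS hup hZ.2⟩)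
end

section
variable {K : Type} [Field K] [NumberField K]

lemma F4 {L : Type} [Field L] [NumberField L] [Algebra K L] [IsGalois K L] (χ : Gal(L/K) →* ℂˣ) (g : Gal(L/K)) (l : Finset (Pl K)) :
    ∃ (M : Type) (_ : Field M) (_ : NumberField M) (_ : Algebra K M) (_ : Algebra L M) (_ : IsScalarTower K L M)
      (_ : IsGalois K M) (σ : Gal(M/K)), χ (rs σ) = χ g ∧ ∀ p ∈ l, ∃ (N : ℕ) (ψ : Gal(M/K) →* ℂˣ), Cyc N ψ ∧
        (Nm p).Coprime N ∧ fr ψ p = fr χ p ∧ ψ σ = χ g := by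
  classical
  have hpow : ∀ h, χ h ^ Nat.card Gal(L/K) = 1 := fun h => by rw [← map_pow, pow_card_eq_one', map_one]
  induction l using Finset.induction_on with
  | empty =>
    obtain ⟨σ, hσ⟩ := rs_surj (K := K) (L := L) (Ω := L) g
    exact ⟨L, inferInstance, inferInstance, inferInstance, inferInstance, inferInstance, inferInstance, σ, by rw [hσ], by simp⟩
  | insert p l hp ih =>
    obtain ⟨L1, _, _, _, _, _, _, σ1, h1, h2⟩ := ih
    obtain ⟨g0, hg0⟩ := fr_mem χ p
    obtain ⟨M, _, _, _, _, _, _, N, ψ, hψ, hN, hfr, hσ⟩ := aux_ext (K := K) L1 p (n := Nat.card Gal(L/K)) Nat.card_pos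
      (z := fr χ p) (by rw [hg0, hpow])
    obtain ⟨σ, hs, hs'⟩ := hσ σ1 (χ g) (hpow _)
    letI : Algebra L M := ((algebraMap L1 M).comp (algebraMap L L1)).toAlgebra
    haveI : IsScalarTower L L1 M := IsScalarTower.of_algebraMap_eq fun _ => rfl
    haveI : IsScalarTower K L M := IsScalarTower.of_algebraMap_eq fun x => by
      rw [IsScalarTower.algebraMap_apply K L1 M, IsScalarTower.algebraMap_apply K L L1]; rfl
    haveI : IsGalois L1 M := IsGalois.tower_top_of_isGalois K L1 M
    refine ⟨M, inferInstance, inferInstance, inferInstance, inferInstance, inferInstance, inferInstance, σ,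
      by rw [rs_rs (L1 := L1), hs, h1], fun q hq => ?_⟩
    rcases Finset.mem_insert.mp hq with rfl | hq
    · exact ⟨N, ψ, hψ, hN, hfr, hs'⟩
    · obtain ⟨N', ψ', c, hN', hf', hv'⟩ := h2 q hq
      obtain ⟨-, κ, hκ⟩ := id c
      refine ⟨N', ψ'.comp rs, c.rs, hN', ?_, ?_⟩
      · rw [← fr_descend (hκ q hN').1.ascend, hf']
      · rw [MonoidHom.comp_apply, hs, hv']

variable {Ω : Type} [Field Ω] [NumberField Ω] [Algebra K Ω] [IsGalois K Ω]

lemma F5 {χ : Gal(Ω/K) →* ℂˣ} {S : Finset (Pl K)} (hS : ∀ v ∉ S, Unr χ v) (k : ℕ) (σ : Gal(Ω/K)) (hσ : ∀ τ, ∃ d : ℤ, χ τ = χ σ ^ d)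
    {D : Dv K} (hD : D ∈ DivS S) (hD0 : art χ D = 0)
    (h : ∀ p ∈ D.support, ∃ (N : ℕ) (ψ : Gal(Ω/K) →* ℂˣ), Cyc N ψ ∧ (Nm p).Coprime N ∧ fr ψ p = fr χ p ∧ ψ σ = χ σ) :
    D ∈ PR S k ⊔ (Nchi χ ⊓ DivS S) := by
  classical
  have h' : ∀ p : Pl K, ∃ (N : ℕ) (ψ : Gal(Ω/K) →* ℂˣ), p ∈ D.support → Cyc N ψ ∧ (Nm p).Coprime N ∧ fr ψ p = fr χ p ∧ ψ σ = χ σ := by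
    intro p
    by_cases hp : p ∈ D.support
    · obtain ⟨N, ψ, h⟩ := h p hp; exact ⟨N, ψ, fun _ => h⟩
    · exact ⟨0, 1, fun h => absurd h hp⟩
  choose N ψ hN using h'
  have hbad : ∃ T0 : Finset (Pl K), ∀ p ∈ D.support, ∀ v, ¬ (Nm v).Coprime (N p) → v ∈ T0 := by
    refine ⟨D.support.attach.biUnion fun p => (bad_finite (K := K) (hN p.1 p.2).1.1).toFinset, fun p hp v hv => ?_⟩
    rw [Finset.mem_biUnion]
    exact ⟨⟨p, hp⟩, Finset.mem_attach _ _, by simpa using hv⟩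
  obtain ⟨T0, hT0⟩ := hbad
  let F := IntermediateField.fixedField (Subgroup.zpowers σ)
  have hFσ : F.fixingSubgroup = Subgroup.zpowers σ := IntermediateField.fixingSubgroup_fixedField _
  have hσF : ∃ s : Gal(Ω/F), resH K s = σ := by
    have : σ ∈ F.fixingSubgroup := by rw [hFσ]; exact Subgroup.mem_zpowers σ
    exact ⟨IntermediateField.fixingSubgroupEquiv F ⟨σ, this⟩, by ext; rfl⟩
  obtain ⟨s, hs⟩ := hσF
  have hB : ∃ B ∈ DivS (up F (S ∪ T0)), art (χ.comp (resH K : Gal(Ω/F) →* Gal(Ω/K))) B = Additive.ofMul (χ σ) := by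
    have : Additive.ofMul (χ σ) ∈ (DivS (up F (S ∪ T0))).map (art (χ.comp (resH K : Gal(Ω/F) →* Gal(Ω/K)))) := by
      rw [card_art]; exact MonoidHom.mem_range.mpr ⟨s, by rw [MonoidHom.comp_apply, hs]; rfl⟩
    obtain ⟨B, h1, h2⟩ := this
    exact ⟨B, h1, h2⟩
  obtain ⟨B, hB, hBσ⟩ := hB
  have key : ∀ p : Pl K, ∃ d : ℤ, fr χ p = χ σ ^ d ∧
      (p ∈ D.support → Finsupp.single p 1 - d • nD K B ∈ PR S k ⊔ (Nchi χ ⊓ DivS S)) := by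
    intro p
    obtain ⟨g, hg⟩ := fr_mem χ p
    obtain ⟨d, hd⟩ := hσ g
    refine ⟨d, hg.trans hd, fun hp => ?_⟩
    obtain ⟨hc, hco, hf, hv⟩ := hN p hp
    set T := S ∪ (bad_finite (K := K) hc.1).toFinset with hT
    have hTT : T ⊆ S ∪ T0 := Finset.union_subset_union_right fun v hv => hT0 p hp v (by simpa using hv)
    let E := IntermediateField.fixedField (χ * (ψ p)⁻¹).ker
    have hEf : E.fixingSubgroup = (χ * (ψ p)⁻¹).ker := IntermediateField.fixingSubgroup_fixedField _
    have hmem : ∀ g : Gal(Ω/K), g ∈ E.fixingSubgroup ↔ χ g = ψ p g := fun g => by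
      rw [hEf, MonoidHom.mem_ker, MonoidHom.mul_apply, MonoidHom.inv_apply, mul_inv_eq_one]
    have hEF : E ≤ F := by
      rw [IntermediateField.le_iff_le, hEf, Subgroup.zpowers_le, ← hEf, hmem, hv]
    letI : Algebra E F := (IntermediateField.inclusion hEF).toRingHom.toAlgebra
    haveI : IsScalarTower K E F := IsScalarTower.of_algebraMap_eq fun x => rfl
    haveI : IsScalarTower E F Ω := IsScalarTower.of_algebraMap_eq fun x => rfl
    refine core (E := E) (F := F) (T := T) Finset.subset_union_left hS k hc (fun v hv => by simp [hT, hv]) (fun τ => ?_) (fun g hg => ?_) ?_ hf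
      (fun v hv => hB v (by rw [mem_up] at hv ⊢; exact hTT hv)) ?_
    · exact (hmem _).mp fun x => τ.commutes x
    · exact ⟨IntermediateField.fixingSubgroupEquiv E ⟨g, (hmem g).mpr hg⟩, by ext; rfl⟩
    · have : p ∉ S := fun h => by simp [hD p h] at hp
      simp [hT, this, hco]
    · rw [hBσ, hg, hd]; rfl
  choose d hd hd' using key
  have hDs : D = ∑ p ∈ D.support, D p • Finsupp.single p (1 : ℤ) := by
    conv_lhs => rw [← Finsupp.sum_single D]
    exact Finset.sum_congr rfl fun p _ => by simp
  have hm : χ σ ^ (∑ p ∈ D.support, D p * d p) = 1 := by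
    have h1 := congrArg (art χ) hDs
    rw [hD0, map_sum] at h1
    apply Additive.ofMul.injective
    rw [ofMul_one, h1]
    change (zmultiplesHom (Additive ℂˣ) (Additive.ofMul (χ σ))) _ = _
    rw [map_sum]
    refine Finset.sum_congr rfl fun p _ => ?_
    rw [map_zsmul, art_single, one_smul, hd, ofMul_zpow, zmultiplesHom_apply, mul_zsmul]
  have hb : (∑ p ∈ D.support, D p * d p) • nD K B ∈ Nchi χ ⊓ DivS S := by
    refine ⟨fun v => ?_, (DivS S).zsmul_mem (nD_DivS (T := up F (S ∪ T0)) (fun w hw => mem_up.mpr (Finset.mem_union_left _ hw)) hB) _⟩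
    rw [Finsupp.smul_apply]
    refine Dvd.dvd.mul_right (orderOf_dvd_iff_zpow_eq_one.mpr ?_) _
    rw [hd, zpow_comm, hm, one_zpow]
  have he : D = ∑ p ∈ D.support, D p • (Finsupp.single p 1 - d p • nD K B) + (∑ p ∈ D.support, D p * d p) • nD K B := by
    simp only [smul_sub, Finset.sum_sub_distrib, smul_smul, ← Finset.sum_smul, sub_add_cancel]
    exact hDs
  rw [he]
  exact add_mem (sum_mem fun p hp => zsmul_mem (hd' p hp) _) (AddSubgroup.mem_sup_right hb)

theorem AR (χ : Gal(Ω/K) →* ℂˣ) (S : Finset (Pl K)) (hS : ∀ v ∉ S, Unr χ v) : ∃ k, ∀ D ∈ PR S k, art χ D = 0 := by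
  obtain ⟨k, hk⟩ := first_ineq' χ S hS
  refine ⟨k, AR_of hk fun D hD => ?_⟩
  obtain ⟨g, hg⟩ : ∃ g, ∀ τ, ∃ d : ℤ, χ τ = χ g ^ d := by
    haveI : Finite χ.range := Set.finite_range χ
    obtain ⟨⟨_, g, rfl⟩, hg⟩ := IsCyclic.exists_generator (α := χ.range)
    refine ⟨g, fun τ => ?_⟩
    obtain ⟨d, hd⟩ := hg ⟨χ τ, τ, rfl⟩
    exact ⟨d, (congrArg Subtype.val hd).symm⟩
  obtain ⟨M, _, _, _, _, _, _, σ, hσ, h⟩ := F4 χ g D.support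
  haveI : IsGalois Ω M := IsGalois.tower_top_of_isGalois K Ω M
  have hS' : ∀ v ∉ S, Unr (χ.comp (rs : Gal(M/K) →* Gal(Ω/K))) v := fun v hv => (hS v hv).ascend
  have hfr : ∀ v ∉ S, fr χ v = fr (χ.comp (rs : Gal(M/K) →* Gal(Ω/K))) v := fun v hv => fr_descend (hS' v hv)
  have hsupp : ∀ p ∈ D.support, p ∉ S := fun p hp h => by simp [hD.2 p h] at hp
  have hN : Nchi (χ.comp (rs : Gal(M/K) →* Gal(Ω/K))) ⊓ DivS S ≤ Nchi χ ⊓ DivS S := fun X hX => ⟨fun v => by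
    by_cases hv : v ∈ S
    · rw [hX.2 v hv]; exact dvd_zero _
    · rw [hfr v hv]; exact hX.1 v, hX.2⟩
  refine sup_le_sup_left hN _ (F5 hS' k σ (fun τ => ?_) hD.2 ?_ fun p hp => ?_)
  · obtain ⟨d, hd⟩ := hg (rs τ); exact ⟨d, by simp only [MonoidHom.comp_apply, hd, hσ]⟩
  · rw [← hD.1]
    refine Finset.sum_congr rfl fun v hv => ?_
    simp only [hfr v (hsupp v hv)]
  · obtain ⟨N, ψ, h1, h2, h3, h4⟩ := h p hp
    exact ⟨N, ψ, h1, h2, by rw [h3, hfr p (hsupp p hp)], by rw [MonoidHom.comp_apply, hσ, h4]⟩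
end

/-! ### The sets `U_n` are subalgebras -/
section
variable {K : Type} [Field K] [NumberField K]

lemma card_prime_pow (p : PrimeIdeal K) : ∃ (l n : ℕ), l.Prime ∧ residueCard p.1 = l ^ n ∧
    (l : 𝓞 K) ∈ p.1 ∧ n ≠ 0 := by
  let v : Pl K := ⟨p.1, p.2.1, p.2.2⟩
  haveI : p.1.IsMaximal := p.2.1.isMaximal p.2.2
  letI : Field (𝓞 K ⧸ p.1) := Ideal.Quotient.field _
  haveI : Finite (𝓞 K ⧸ p.1) := pl_finite v
  letI := Fintype.ofFinite (𝓞 K ⧸ p.1)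
  obtain ⟨l, hl⟩ := CharP.exists (𝓞 K ⧸ p.1)
  obtain ⟨n, hlp, hn⟩ := FiniteField.card (𝓞 K ⧸ p.1) l
  refine ⟨l, n, hlp, ?_, ?_, n.2.ne'⟩
  · rw [residueCard, Nat.card_eq_fintype_card, hn]
  · rw [← Ideal.Quotient.eq_zero_iff_mem, map_natCast]; exact CharP.cast_eq_zero _ _

lemma pow_sub_mem (p : PrimeIdeal K) (r : 𝓞 K) : r - r ^ residueCard p.1 ∈ p.1 := by
  let v : Pl K := ⟨p.1, p.2.1, p.2.2⟩
  haveI : p.1.IsMaximal := p.2.1.isMaximal p.2.2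
  letI : Field (𝓞 K ⧸ p.1) := Ideal.Quotient.field _
  haveI : Finite (𝓞 K ⧸ p.1) := pl_finite v
  letI := Fintype.ofFinite (𝓞 K ⧸ p.1)
  rw [← Ideal.Quotient.eq_zero_iff_mem, map_sub, map_pow, residueCard, Nat.card_eq_fintype_card,
    FiniteField.pow_card, sub_self]

variable (K) (A : Type) [CommRing A] [Algebra (𝓞 K) A]

lemma un_alg (n : ℕ) : ∃ B : Subalgebra (𝓞 K) (IK K → A), (B : Set (IK K → A)) = UnSet K A n := by
  induction n with
  | zero => exact ⟨⊤, by simp [UnSet]⟩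
  | succ n ih =>
    obtain ⟨B, hB⟩ := ih
    have hspan : Submodule.span (𝓞 K) (UnSet K A n) = Subalgebra.toSubmodule B := by
      rw [← hB]; exact Submodule.span_eq (Subalgebra.toSubmodule B)
    have hm : ∀ η, η ∈ UnSet K A n ↔ η ∈ B := fun η => by rw [← hB]; rfl
    have hU : ∀ η, η ∈ UnSet K A (n + 1) ↔ η ∈ B ∧ ∀ p : PrimeIdeal K,
        shift p.toIK η - η ^ residueCard p.1 ∈ p.1 • Subalgebra.toSubmodule B := by
      intro η
      rw [UnSet, Set.mem_setOf_eq, hm]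
      simp only [idealMulSet, hspan, SetLike.mem_coe]
    have hle : ∀ p : Ideal (𝓞 K), p • Subalgebra.toSubmodule B ≤ Subalgebra.toSubmodule B :=
      fun p => Submodule.smul_le_right
    have hmulr : ∀ (p : Ideal (𝓞 K)) (z w), z ∈ p • Subalgebra.toSubmodule B → w ∈ B →
        z * w ∈ p • Subalgebra.toSubmodule B := by
      intro p z w hz hw
      induction hz using Submodule.smul_induction_on' with
      | smul r hr m hm =>
        rw [smul_mul_assoc]
        exact Submodule.smul_mem_smul hr (B.mul_mem hm hw)
      | add x _ y _ hx hy => rw [add_mul]; exact Submodule.add_mem _ hx hy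
    refine ⟨{ carrier := UnSet K A (n + 1), mul_mem' := ?_, add_mem' := ?_, algebraMap_mem' := ?_ }, rfl⟩
    · intro x y hx hy
      rw [hU] at hx hy ⊢
      refine ⟨B.mul_mem hx.1 hy.1, fun p => ?_⟩
      have e : shift p.toIK (x * y) - (x * y) ^ residueCard p.1 =
          (shift p.toIK x - x ^ residueCard p.1) * shift p.toIK y +
          (shift p.toIK y - y ^ residueCard p.1) * x ^ residueCard p.1 := by
        have : shift p.toIK (x * y) = shift p.toIK x * shift p.toIK y := rfl
        rw [this]; ring
      rw [e]
      refine Submodule.add_mem _ (hmulr _ _ _ (hx.2 p) ?_) (hmulr _ _ _ (hy.2 p) (B.pow_mem hx.1 _))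
      have := B.add_mem (hle _ (hy.2 p)) (B.pow_mem hy.1 (residueCard p.1))
      simpa using this
    · intro x y hx hy
      rw [hU] at hx hy ⊢
      refine ⟨B.add_mem hx.1 hy.1, fun p => ?_⟩
      obtain ⟨l, m, hl, hlm, hlp, -⟩ := card_prime_pow p
      obtain ⟨r, hr⟩ := exists_add_pow_prime_pow_eq hl (⟨x, hx.1⟩ : B) ⟨y, hy.1⟩ m
      have hr' := congrArg Subtype.val hr
      have e : shift p.toIK (x + y) - (x + y) ^ residueCard p.1 =
          (shift p.toIK x - x ^ residueCard p.1) + (shift p.toIK y - y ^ residueCard p.1)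
          - (l : 𝓞 K) • ((⟨x, hx.1⟩ * ⟨y, hy.1⟩ * r : B) : IK K → A) := by
        have : shift p.toIK (x + y) = shift p.toIK x + shift p.toIK y := rfl
        rw [this, hlm]
        simp only [Subalgebra.coe_pow, Subalgebra.coe_add, Subalgebra.coe_mul, SubringClass.coe_natCast] at hr'
        simp only [Nat.cast_smul_eq_nsmul, nsmul_eq_mul, Subalgebra.coe_mul]
        rw [hr']; ring
      rw [e]
      exact Submodule.sub_mem _ (Submodule.add_mem _ (hx.2 p) (hy.2 p))
        (Submodule.smul_mem_smul hlp (Subtype.prop _))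
    · intro r
      rw [hU]
      refine ⟨B.algebraMap_mem r, fun p => ?_⟩
      have e : shift p.toIK (algebraMap (𝓞 K) (IK K → A) r) - (algebraMap (𝓞 K) (IK K → A) r) ^ residueCard p.1
        = (r - r ^ residueCard p.1) • (1 : IK K → A) := by
        rw [← map_pow, ← Algebra.algebraMap_eq_smul_one, map_sub]; rfl
      rw [e]
      exact Submodule.smul_mem_smul (pow_sub_mem p r) B.one_mem

end

/-! ### Frobenius congruences for Witt vectors -/
section
variable {K : Type} [Field K] [NumberField K]

lemma exists_sp (p : Pl K) : ∃ π ∈ p.asIdeal, π ≠ 0 ∧ ∃ s ∉ p.asIdeal, ∀ r ∈ p.asIdeal,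
    ∃ r', s * r = π * r' := by
  have hlt : p.asIdeal ^ 2 < p.asIdeal := by
    have := Ideal.pow_right_strictAnti p.asIdeal p.ne_bot p.isPrime.ne_top (show 1 < 2 by norm_num)
    simpa using this
  obtain ⟨π, hπ, hπ2⟩ := SetLike.exists_of_lt hlt
  have h0 : π ≠ 0 := by rintro rfl; exact hπ2 (zero_mem _)
  obtain ⟨J, hJ⟩ : p.asIdeal ∣ Ideal.span {π} := Ideal.dvd_iff_le.mpr (by
    rwa [Ideal.span_singleton_le_iff_mem])
  have hJp : ¬ J ≤ p.asIdeal := by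
    intro h
    apply hπ2
    rw [← Ideal.span_singleton_le_iff_mem, hJ, sq]
    exact Ideal.mul_mono_right h
  obtain ⟨s, hs, hsp⟩ := SetLike.not_le_iff_exists.mp hJp
  refine ⟨π, hπ, h0, s, hsp, fun r hr => ?_⟩
  have : s * r ∈ Ideal.span {π} := by
    rw [hJ, mul_comm s r]; exact Ideal.mul_mem_mul hr hs
  obtain ⟨r', h⟩ := Ideal.mem_span_singleton.mp this
  exact ⟨r', h⟩

/-- A prime as an element of `I_K`. -/
def plIK (p : Pl K) : IK K := PrimeIdeal.toIK ⟨p.asIdeal, p.isPrime, p.ne_bot⟩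

variable {A : Type} [CommRing A] [Algebra (𝓞 K) A]

lemma un_step (p : Pl K) : ∃ π ∈ p.asIdeal, π ≠ 0 ∧ ∃ s ∉ p.asIdeal, ∀ n, ∀ η ∈ UnSet K A (n + 1),
    ∃ η' ∈ UnSet K A n, ∀ b, s • (η (plIK p * b) - η b ^ Nm p) = π • η' b := by
  obtain ⟨π, hπ, h0, s, hs, H⟩ := exists_sp p
  refine ⟨π, hπ, h0, s, hs, fun n η hη => ?_⟩
  obtain ⟨B, hB⟩ := un_alg K A n
  have h1 := hη.2 ⟨p.asIdeal, p.isPrime, p.ne_bot⟩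
  rw [idealMulSet, ← hB] at h1
  have h2 : Submodule.span (𝓞 K) (B : Set (IK K → A)) = Subalgebra.toSubmodule B :=
    Submodule.span_eq (Subalgebra.toSubmodule B)
  rw [h2] at h1
  have key : ∀ z ∈ p.asIdeal • Subalgebra.toSubmodule B, ∃ w ∈ B, s • z = π • w := by
    intro z hz
    induction hz using Submodule.smul_induction_on' with
    | smul r hr m hm =>
      obtain ⟨r', hr'⟩ := H r hr
      exact ⟨r' • m, B.smul_mem hm r', by rw [← mul_smul, hr', mul_smul]⟩
    | add x _ y _ hx hy =>
      obtain ⟨w, hw, hw'⟩ := hx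
      obtain ⟨w2, hw2, hw2'⟩ := hy
      exact ⟨w + w2, B.add_mem hw hw2, by rw [smul_add, smul_add, hw', hw2']⟩
  obtain ⟨w, hw, hw'⟩ := key _ h1
  refine ⟨w, by rw [← hB]; exact hw, fun b => ?_⟩
  exact congrFun hw' b

variable {Ω : Type} [Field Ω] [NumberField Ω] [Algebra K Ω]

lemma pow_congr (P : Pl Ω) {M : ℕ} (hM : 1 ≤ M) {u v : 𝓞 Ω} (h : u - v ∈ P.asIdeal ^ M) :
    u ^ Nm (dn K P) - v ^ Nm (dn K P) ∈ P.asIdeal ^ (M + 1) := by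
  have hq : ((Nm (dn K P) : ℕ) : 𝓞 Ω) ∈ P.asIdeal := by
    have h1 : ((Nm (dn K P) : ℕ) : 𝓞 K) ∈ (dn K P).asIdeal := by
      rw [Nm_eq]; exact Ideal.absNorm_mem _
    have h2 : algebraMap (𝓞 K) (𝓞 Ω) ((Nm (dn K P) : ℕ) : 𝓞 K) ∈ P.asIdeal := h1
    simpa using h2
  have h1 : u - v ∈ P.asIdeal := Ideal.pow_le_self (by omega) h
  rw [← Commute.geom_sum₂_mul (Commute.all u v), mul_comm, pow_succ]
  refine Ideal.mul_mem_mul h ?_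
  rw [← Ideal.Quotient.eq_zero_iff_mem] at hq h1 ⊢
  rw [map_sub, sub_eq_zero] at h1
  simp only [map_sum, map_mul, map_pow, h1]
  rw [Finset.sum_congr rfl (g := fun i => (Ideal.Quotient.mk P.asIdeal v) ^ (Nm (dn K P) - 1))]
  · rw [Finset.sum_const, Finset.card_range, nsmul_eq_mul, ← map_natCast (Ideal.Quotient.mk P.asIdeal), hq, zero_mul]
  · intro i hi
    rw [← pow_add]; congr 1
    have := Finset.mem_range.mp hi; omega

lemma cancel_s (P : Pl Ω) {s : 𝓞 K} (hs : s ∉ (dn K P).asIdeal) {M : ℕ} {x : 𝓞 Ω}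
    (h : s • x ∈ P.asIdeal ^ M) : x ∈ P.asIdeal ^ M := by
  have hs' : algebraMap (𝓞 K) (𝓞 Ω) s ∉ P.asIdeal := hs
  rw [Algebra.smul_def] at h
  haveI := P.isPrime
  exact (P.isPrime.mul_mem_pow P.asIdeal h).resolve_left hs'

theorem frob_congr (ι : 𝓞 Ω →ₐ[𝓞 K] A) (hι : Function.Injective ι)
    (hsat : ∀ (r : 𝓞 K) (z : A) (w : 𝓞 Ω), r ≠ 0 → r • z = ι w → ∃ w', z = ι w')
    (P : Pl Ω) (φ : Gal(Ω/K)) (hφ : IsFr K P φ) (M : ℕ) :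
    ∀ x : IK K → 𝓞 Ω, (fun b => ι (x b)) ∈ UnSet K A (M + 1) → ∀ b e, M ≤ e →
      x (plIK (dn K P) ^ (e + 1) * b) - φ • x (plIK (dn K P) ^ e * b) ∈ P.asIdeal ^ (M + 1) := by
  obtain ⟨π, hπ, h0, s, hs, H⟩ := un_step (A := A) (dn K P)
  have hπ' : algebraMap (𝓞 K) (𝓞 Ω) π ∈ P.asIdeal := hπ
  have desc : ∀ n (x : IK K → 𝓞 Ω), (fun b => ι (x b)) ∈ UnSet K A (n + 1) → ∃ x' : IK K → 𝓞 Ω,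
      (fun b => ι (x' b)) ∈ UnSet K A n ∧
      ∀ b, s • (x (plIK (dn K P) * b) - x b ^ Nm (dn K P)) = π • x' b := by
    intro n x hx
    obtain ⟨η, hη, hη'⟩ := H n _ hx
    have : ∀ b, ∃ w, η b = ι w := fun b =>
      hsat π _ (s • (x (plIK (dn K P) * b) - x b ^ Nm (dn K P))) h0 (by
        rw [← hη' b, map_smul, map_sub, map_pow])
    choose x' hx' using this
    refine ⟨x', by rwa [← funext hx'], fun b => hι ?_⟩
    rw [map_smul, map_smul, ← hx', ← hη', map_sub, map_pow]
  induction M with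
  | zero =>
    intro x hx b e _
    obtain ⟨x', -, hx'⟩ := desc 0 x hx
    have h1 := hx' (plIK (dn K P) ^ e * b)
    rw [← mul_assoc, ← pow_succ'] at h1
    have h2 : x (plIK (dn K P) ^ (e + 1) * b) - x (plIK (dn K P) ^ e * b) ^ Nm (dn K P) ∈ P.asIdeal ^ 1 := by
      apply cancel_s P hs
      rw [h1, Algebra.smul_def, pow_one]
      exact Ideal.mul_mem_right _ _ hπ'
    have h3 := hφ (x (plIK (dn K P) ^ e * b))
    rw [pow_one] at h2
    rw [zero_add, pow_one]
    have := sub_mem h2 h3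
    rwa [sub_sub_sub_cancel_right] at this
  | succ M ih =>
    intro x hx b e he
    obtain ⟨e, rfl⟩ : ∃ e', e = e' + 1 := ⟨e - 1, by omega⟩
    obtain ⟨x', hx1, hx'⟩ := desc _ x hx
    have h1 := hx' (plIK (dn K P) ^ (e + 1) * b)
    have h2 := hx' (plIK (dn K P) ^ e * b)
    rw [← mul_assoc, ← pow_succ'] at h1 h2
    have h3 := congrArg (φ • ·) h2
    simp only [smul_comm φ, smul_sub, smul_pow'] at h3
    rw [smul_sub] at h1
    apply cancel_s P hs
    have i1 := ih x hx.1 b e (by omega)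
    have i2 := ih x' hx1 b e (by omega)
    have i3 := pow_congr (K := K) P (by omega) i1
    have i4 : algebraMap (𝓞 K) (𝓞 Ω) π * (x' (plIK (dn K P) ^ (e + 1) * b) - φ • x' (plIK (dn K P) ^ e * b)) ∈
        P.asIdeal ^ (M + 1 + 1) := by
      rw [pow_succ' _ (M+1)]; exact Ideal.mul_mem_mul hπ' i2
    have i5 := add_mem (Ideal.mul_mem_left _ (algebraMap (𝓞 K) (𝓞 Ω) s) i3) i4
    convert i5 using 1
    simp only [Algebra.smul_def] at h1 h3 ⊢
    linear_combination h1 - h3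

end

/-! ### Frobenii generate; orbits of Frobenii are governed by ray classes -/
section

lemma sep_char {G : Type} [Group G] [Finite G] (N : Subgroup G)
    (hN : ∀ g h : G, g * h * g⁻¹ * h⁻¹ ∈ N) {u : G} (hu : u ∉ N) :
    ∃ χ : G →* ℂˣ, (∀ n ∈ N, χ n = 1) ∧ χ u ≠ 1 := by
  haveI : N.Normal := ⟨fun n hn g => by
    have := N.mul_mem (hN g n) hn
    simpa using this⟩
  letI : CommGroup (G ⧸ N) := { (inferInstance : Group (G ⧸ N)) with
    mul_comm := by
      intro a b
      induction a using QuotientGroup.induction_on with | H a => ?_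
      induction b using QuotientGroup.induction_on with | H b => ?_
      rw [← QuotientGroup.mk_mul, ← QuotientGroup.mk_mul, QuotientGroup.eq]
      have := hN b⁻¹ a⁻¹
      simpa [mul_assoc] using this }
  have h1 : ((u : G) : G ⧸ N) ≠ 1 := fun h => hu ((QuotientGroup.eq_one_iff u).mp h)
  have h2 : orderOf ((u : G) : G ⧸ N) ≠ 0 := (orderOf_pos _).ne'
  have h3 : orderOf ((u : G) : G ⧸ N) ≠ 1 := fun h => h1 (orderOf_eq_one_iff.mp h)
  haveI : NeZero (orderOf ((u : G) : G ⧸ N)) := ⟨h2⟩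
  have hz := Complex.isPrimitiveRoot_exp _ h2
  have hzu := (hz.isUnit_unit h2)
  obtain ⟨κ, hκ⟩ := kap1 ((u : G) : G ⧸ N) dvd_rfl hzu.pow_eq_one
  refine ⟨κ.comp (QuotientGroup.mk' N), fun n hn => ?_, ?_⟩
  · have : ((n : G) : G ⧸ N) = 1 := (QuotientGroup.eq_one_iff n).mpr hn
    exact (congrArg κ this).trans (map_one κ)
  · intro h
    have : κ (u : G ⧸ N) = 1 := h
    rw [hκ] at this
    have h5 := hzu.dvd_of_pow_eq_one 1 (by rw [pow_one]; exact this)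
    exact h3 (Nat.dvd_one.mp h5)

variable {K : Type} [Field K] [NumberField K]
variable {Ω : Type} [Field Ω] [NumberField Ω] [Algebra K Ω] [IsGalois K Ω]

lemma frob_gen (T : Finset (Pl K)) (H : Subgroup Gal(Ω/K))
    (h : ∀ (P : Pl Ω) (σ : Gal(Ω/K)), dn K P ∉ T → IsFr K P σ → σ ∈ H) (g : Gal(Ω/K)) : g ∈ H := by
  classical
  obtain ⟨T', hT'⟩ := finite_ram K Ω
  let F := IntermediateField.fixedField (Subgroup.zpowers g)
  have hF : F.fixingSubgroup = Subgroup.zpowers g := IntermediateField.fixingSubgroup_fixedField _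
  have hmem : ∀ τ : Gal(Ω/F), resH K τ ∈ Subgroup.zpowers g := by
    intro τ
    rw [← hF, IntermediateField.mem_fixingSubgroup_iff]
    exact fun x hx => τ.commutes ⟨x, hx⟩
  have hinj : Function.Injective (resH K : Gal(Ω/F) →* Gal(Ω/K)) := by
    intro a b hab
    ext x
    exact congrArg (fun s : Gal(Ω/K) => s x) hab
  obtain ⟨g', hg'⟩ : ∃ g' : Gal(Ω/F), resH K g' = g := by
    have : g ∈ F.fixingSubgroup := by rw [hF]; exact Subgroup.mem_zpowers g
    exact ⟨IntermediateField.fixingSubgroupEquiv F ⟨g, this⟩, rfl⟩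
  by_contra hg
  obtain ⟨χ, hχ, hχg⟩ := sep_char (H.comap (resH K : Gal(Ω/F) →* Gal(Ω/K))) (fun a b => by
    have : a * b * a⁻¹ * b⁻¹ = 1 := by
      apply hinj
      obtain ⟨i, hi⟩ := Subgroup.mem_zpowers_iff.mp (hmem a)
      obtain ⟨j, hj⟩ := Subgroup.mem_zpowers_iff.mp (hmem b)
      simp only [map_mul, map_inv, map_one, ← hi, ← hj]
      group
    rw [this]; exact one_mem _) (u := g') (by rw [Subgroup.mem_comap, hg']; exact hg)
  apply hχg
  have hfin : {w : Pl F | dn K w ∈ T ∪ T'}.Finite := finite_fiber _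
  rw [weak_cheb χ hfin.toFinset ?_]; rfl
  intro w hw
  have hw' : dn K w ∉ T ∧ dn K w ∉ T' := by simpa using hw
  obtain ⟨P, rfl⟩ := dn_surj (Ω := Ω) w
  rw [dn_dn] at hw'
  obtain ⟨τ, hτ⟩ := exists_isFr (K := F) P
  obtain ⟨σ, hσ⟩ := exists_isFr (K := K) P
  rw [← fr_eq χ (v := dn F P) ?_ rfl hτ]
  · apply hχ
    have h1 := hT' P hw'.2 _ (hσ.tower hτ)
    rw [mul_inv_eq_one] at h1
    rw [Subgroup.mem_comap, h1]
    exact pow_mem (h P σ hw'.1 hσ) _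
  · intro Q hQ τ' hτ'
    have h1 := hT' Q (by rw [← dn_dn (F := F), hQ, dn_dn]; exact hw'.2) (resH K τ') hτ'
    have : τ' = 1 := hinj (by rw [h1, map_one])
    rw [this, map_one]

/-- The integral divisor of a natural-number-valued one. -/
def toDv (c : Pl K →₀ ℕ) : Dv K := c.mapRange (fun n : ℕ => (n : ℤ)) rfl

lemma toDv_add (c d : Pl K →₀ ℕ) : toDv (c + d) = toDv c + toDv d := by
  ext v; simp [toDv]

lemma toDv_single (v : Pl K) (n : ℕ) : toDv (Finsupp.single v n) = Finsupp.single v (n : ℤ) := by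
  simp [toDv]

theorem orbit_ray (y : (Pl K →₀ ℕ) → 𝓞 Ω) (F : Finset (Pl K))
    (h : ∀ (P : Pl Ω) (φ : Gal(Ω/K)), dn K P ∉ F → IsFr K P φ → ∀ c : Pl K →₀ ℕ,
      (∀ v ∈ F, c v = 0) → y (c + Finsupp.single (dn K P) 1) = φ • y c) :
    ∃ k, ∀ c c' : Pl K →₀ ℕ, (∀ v ∈ F, c v = 0) → (∀ v ∈ F, c' v = 0) →
      toDv c - toDv c' ∈ PR F k → y c = y c' := by
  classical
  let C : AddSubmonoid (Pl K →₀ ℕ) :=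
    { carrier := {c | ∀ v ∈ F, c v = 0}
      zero_mem' := fun _ _ => rfl
      add_mem' := fun {a b} ha hb v hv => by rw [Finsupp.add_apply, ha v hv, hb v hv] }
  have hC1 : ∀ v ∉ F, Finsupp.single v 1 ∈ C := fun v hv w hw => by
    rw [Finsupp.single_apply, if_neg]; rintro rfl; exact hv hw
  let Mo : Submonoid Gal(Ω/K) :=
    { carrier := {g | ∃ c0 ∈ C, ∀ c ∈ C, g • y c = y (c + c0)}
      one_mem' := ⟨0, zero_mem _, fun c _ => by simp⟩
      mul_mem' := by
        rintro a b ⟨c1, hc1, h1⟩ ⟨c2, hc2, h2⟩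
        refine ⟨c2 + c1, add_mem hc2 hc1, fun c hc => ?_⟩
        rw [mul_smul, h2 c hc, h1 _ (add_mem hc hc2), add_assoc] }
  let H : Subgroup Gal(Ω/K) :=
    { Mo with
      inv_mem' := by
        intro a ha
        have : a⁻¹ = a ^ (orderOf a - 1) := by
          rw [inv_eq_iff_mul_eq_one, ← pow_succ', Nat.sub_add_cancel (orderOf_pos a), pow_orderOf_eq_one]
        rw [this]
        exact Mo.pow_mem ha _ }
  have hall : ∀ g : Gal(Ω/K), ∃ c0 ∈ C, ∀ c ∈ C, g • y c = y (c + c0) := by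
    intro g
    have : g ∈ H := frob_gen F H (fun P σ hP hσ =>
      ⟨_, hC1 _ hP, fun c hc => (h P σ hP hσ c hc).symm⟩) g
    exact this
  let N : Subgroup Gal(Ω/K) :=
    { carrier := {g | ∀ c ∈ C, g • y c = y c}
      one_mem' := fun c _ => one_smul _ _
      mul_mem' := fun {a b} ha hb c hc => by rw [mul_smul, hb c hc, ha c hc]
      inv_mem' := fun {a} ha c hc => by rw [inv_smul_eq_iff, ha c hc] }
  have hcomm : ∀ a b : Gal(Ω/K), a * b * a⁻¹ * b⁻¹ ∈ N := by
    intro a b c hc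
    obtain ⟨c1, hc1, h1⟩ := hall a
    obtain ⟨c2, hc2, h2⟩ := hall b
    obtain ⟨c3, hc3, h3⟩ := hall (a⁻¹ * b⁻¹)
    have e1 : a * b * a⁻¹ * b⁻¹ = (a * b) * (a⁻¹ * b⁻¹) := by group
    have e2 : (b * a) * (a⁻¹ * b⁻¹) = 1 := by group
    have e3 : y c = (b * a) • y (c + c3) := by rw [← h3 c hc, ← mul_smul, e2, one_smul]
    rw [e1, mul_smul, h3 c hc, e3, mul_smul, mul_smul, h2 _ (add_mem hc hc3), h1 _ (add_mem hc hc3),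
      h1 _ (add_mem (add_mem hc hc3) hc2), h2 _ (add_mem (add_mem hc hc3) hc1), add_right_comm _ c2]
  have hunr : ∀ χ : Gal(Ω/K) →* ℂˣ, (∀ n ∈ N, χ n = 1) → ∀ v ∉ F, Unr χ v := by
    intro χ hχ v hv P hP τ hτ
    apply hχ
    intro c hc
    obtain ⟨φ, hφ⟩ := exists_isFr (K := K) P
    have hφτ : IsFr K P (φ * τ) := by
      intro x
      have h1 := hφ (τ • x)
      have h2 := Ideal.mem_of_dvd _ (sub_dvd_pow_sub_pow _ _ (Nm (dn K P))) (hτ x)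
      have := add_mem h1 h2
      rw [mul_smul]; simpa using this
    have h1 := h P φ (by rwa [hP]) hφ c hc
    have h2 := h P _ (by rwa [hP]) hφτ c hc
    rw [h1, mul_smul] at h2
    exact (smul_left_cancel φ h2).symm
  have hg : ∀ c ∈ C, ∃ g : Gal(Ω/K), (∀ c' ∈ C, g • y c' = y (c' + c)) ∧
      ∀ χ : Gal(Ω/K) →* ℂˣ, (∀ n ∈ N, χ n = 1) → art χ (toDv c) = Additive.ofMul (χ g) := by
    intro c
    induction c using Finsupp.induction_linear with
    | zero => exact fun _ => ⟨1, by simp, fun χ _ => by simp [toDv]⟩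
    | add f g hf hg =>
      intro hc
      have hf' : f ∈ C := fun v hv => by have := hc v hv; simp at this; exact this.1
      have hg' : g ∈ C := fun v hv => by have := hc v hv; simp at this; exact this.2
      obtain ⟨a, ha, ha'⟩ := hf hf'
      obtain ⟨b, hb, hb'⟩ := hg hg'
      refine ⟨b * a, fun c' hc' => ?_, fun χ hχ => ?_⟩
      · rw [mul_smul, ha c' hc', hb _ (add_mem hc' hf'), add_assoc]
      · rw [toDv_add, map_add, ha' χ hχ, hb' χ hχ, map_mul, ofMul_mul, add_comm]
    | single v m =>
      intro hc
      by_cases hv : v ∈ F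
      · have : m = 0 := by have := hc v hv; simpa using this
        subst this
        exact ⟨1, by simp, fun χ _ => by simp [toDv]⟩
      · obtain ⟨P, hP⟩ := dn_surj (Ω := Ω) v
        obtain ⟨φ, hφ⟩ := exists_isFr (K := K) P
        have hs : ∀ c' ∈ C, φ • y c' = y (c' + Finsupp.single v 1) := fun c' hc' => by
          have := h P φ (by rwa [hP]) hφ c' hc'
          rw [hP] at this; exact this.symm
        refine ⟨φ ^ m, ?_, fun χ hχ => ?_⟩
        · clear hc
          induction m with
          | zero => simp
          | succ m ih =>
            intro c' hc'
            rw [pow_succ, mul_smul, hs c' hc', ih _ (add_mem hc' (hC1 v hv)), add_assoc,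
              ← Finsupp.single_add, add_comm 1]
        · rw [toDv_single, art_single, ← fr_eq χ (hunr χ hχ v hv) hP hφ, map_pow, ofMul_pow]
          simp
  have hk : ∀ u : Gal(Ω/K), ∃ k, u ∉ N → ∃ χ : Gal(Ω/K) →* ℂˣ, (∀ n ∈ N, χ n = 1) ∧ χ u ≠ 1 ∧
      ∀ D ∈ PR F k, art χ D = 0 := by
    intro u
    by_cases hu : u ∈ N
    · exact ⟨0, fun h => absurd hu h⟩
    · obtain ⟨χ, h1, h2⟩ := sep_char N hcomm hu
      obtain ⟨k, hk⟩ := AR χ F (hunr χ h1)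
      exact ⟨k, fun _ => ⟨χ, h1, h2, hk⟩⟩
  choose k hk using hk
  refine ⟨Finset.univ.sup k, fun c c' hc hc' hD => ?_⟩
  obtain ⟨a, ha, ha'⟩ := hg c hc
  obtain ⟨b, hb, hb'⟩ := hg c' hc'
  have hN : b⁻¹ * a ∈ N := by
    by_contra hu
    obtain ⟨χ, h1, h2, h3⟩ := hk _ hu
    have h4 := h3 _ (PR_anti (Finset.le_sup (Finset.mem_univ _)) hD)
    rw [map_sub, ha' χ h1, hb' χ h1, sub_eq_zero] at h4
    have h5 : χ a = χ b := h4
    apply h2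
    rw [map_mul, map_inv, h5, inv_mul_cancel]
  have e := hN 0 (zero_mem _)
  rw [mul_smul, inv_smul_eq_iff, ha 0 (zero_mem _), hb 0 (zero_mem _), zero_add, zero_add] at e
  exact e

end

/-! ### Periodicity -/
section
variable {K : Type} [Field K] [NumberField K]
variable {Ω : Type} [Field Ω] [NumberField Ω] [Algebra K Ω] [IsGalois K Ω]

/-- The ideal of an effective divisor. -/
def mkI (c : Pl K →₀ ℕ) : IK K := c.prod (fun v n => plIK v ^ n)

lemma mkI_add (c d : Pl K →₀ ℕ) : mkI (c + d) = mkI c * mkI d :=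
  Finsupp.prod_add_index' (fun _ => pow_zero _) (fun _ _ _ => pow_add _ _ _)

lemma mkI_single (v : Pl K) (n : ℕ) : mkI (Finsupp.single v n) = plIK v ^ n :=
  Finsupp.prod_single_index (pow_zero _)

lemma coeIK_ne (a : IK K) : ((a : Ideal (𝓞 K)) : FI K) ≠ 0 := by
  rw [Ne, FractionalIdeal.coeIdeal_eq_zero]; exact a.2

lemma dvI_mkI (c : Pl K →₀ ℕ) : dvI (((mkI c : IK K) : Ideal (𝓞 K)) : FI K) = toDv c := by
  have hm : ∀ a b : IK K, dvI (((a * b : IK K) : Ideal (𝓞 K)) : FI K) =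
      dvI ((a : Ideal (𝓞 K)) : FI K) + dvI ((b : Ideal (𝓞 K)) : FI K) := fun a b => by
    rw [← dvI_mul (coeIK_ne a) (coeIK_ne b), Submonoid.coe_mul, FractionalIdeal.coeIdeal_mul]
  have h1 : dvI (((1 : IK K) : Ideal (𝓞 K)) : FI K) = 0 := by
    rw [Submonoid.coe_one, Ideal.one_eq_top, FractionalIdeal.coeIdeal_top, dvI_one]
  induction c using Finsupp.induction_linear with
  | zero => simp [mkI, toDv, dvI_one]
  | add f g hf hg => rw [mkI_add, hm, hf, hg, toDv_add]
  | single v n =>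
    induction n with
    | zero => simp [mkI, toDv, dvI_one]
    | succ n ih =>
      rw [Finsupp.single_add, mkI_add, hm, ih, toDv_add, mkI_single, pow_one, toDv_single v 1]
      congr 1
      exact dvI_pl v

lemma mkI_surj (a : IK K) : ∃ c, mkI c = a := by
  have h0 : 0 ≤ dvI ((a : Ideal (𝓞 K)) : FI K) := (dvI_nonneg_iff (coeIK_ne a)).mpr ⟨a, a.2, rfl⟩
  refine ⟨(dvI ((a : Ideal (𝓞 K)) : FI K)).mapRange Int.toNat rfl, ?_⟩
  apply Subtype.ext
  apply FractionalIdeal.coeIdeal_injective (K := K)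
  refine dvI_inj (coeIK_ne _) (coeIK_ne _) ?_
  rw [dvI_mkI]
  ext v
  simp only [toDv, Finsupp.mapRange_apply]
  exact Int.toNat_of_nonneg (h0 v)

theorem periodic_of_frob (x : IK K → 𝓞 Ω) (S : Finset (Pl K)) (E : ℕ)
    (hfr : ∀ (P : Pl Ω) (φ : Gal(Ω/K)), IsFr K P φ → ∀ b e, (dn K P ∉ S ∨ E ≤ e) →
      x (plIK (dn K P) ^ (e + 1) * b) = φ • x (plIK (dn K P) ^ e * b)) :
    ∃ f : IK K, ∀ a b : IK K, DRcongruent K f a b → x a = x b := by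
  classical
  have hy : ∀ (P : Pl Ω) (φ : Gal(Ω/K)), IsFr K P φ → ∀ D : Pl K →₀ ℕ,
      (dn K P ∉ S ∨ E ≤ D (dn K P)) → x (mkI (D + Finsupp.single (dn K P) 1)) = φ • x (mkI D) := by
    intro P φ hφ D hD
    have h := hfr P φ hφ (mkI (D.erase (dn K P))) (D (dn K P)) hD
    rw [← mkI_single, ← mkI_single, ← mkI_add, ← mkI_add, Finsupp.single_add_erase,
      Finsupp.single_add, add_right_comm, Finsupp.single_add_erase] at h
    exact h
  have hk : ∀ d : Pl K →₀ ℕ, ∃ k, ∀ c c' : Pl K →₀ ℕ, (∀ v ∈ S.filter (fun v => d v < E), c v = 0) →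
      (∀ v ∈ S.filter (fun v => d v < E), c' v = 0) →
      toDv c - toDv c' ∈ PR (S.filter (fun v => d v < E)) k → x (mkI (d + c)) = x (mkI (d + c')) := by
    intro d
    refine orbit_ray (fun c => x (mkI (d + c))) (S.filter (fun v => d v < E)) ?_
    intro P φ hP hφ c hc
    have := hy P φ hφ (d + c) (by
      by_cases h : dn K P ∈ S
      · right
        have : E ≤ d (dn K P) := by
          by_contra h2
          exact hP (Finset.mem_filter.mpr ⟨h, by omega⟩)
        rw [Finsupp.add_apply]; omega
      · exact Or.inl h)
    rw [add_assoc] at this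
    exact this
  choose k hk using hk
  set k0 := (S.finsupp (fun _ => Finset.range (E + 1))).sup k with hk0
  let f0 : Pl K →₀ ℕ := Finsupp.onFinset S (fun v => if v ∈ S then E + k0 + 1 else 0) (by
    intro v hv; by_contra h; simp [h] at hv)
  have hf0 : ∀ v ∈ S, f0 v = E + k0 + 1 := fun v hv => by simp [f0, hv]
  refine ⟨mkI f0, fun a b hab => ?_⟩
  obtain ⟨t, htp, hspan, ht1⟩ := hab
  obtain ⟨a, rfl⟩ := mkI_surj a
  obtain ⟨b, rfl⟩ := mkI_surj b
  have ht0 : t ≠ 0 := by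
    rintro rfl
    rw [FractionalIdeal.spanSingleton_zero] at hspan
    exact mul_ne_zero (coeIK_ne _) (inv_ne_zero (coeIK_ne _)) hspan
  have hdv : dv t = toDv a - toDv b := by
    rw [dv, ← hspan, dvI_mul (coeIK_ne _) (inv_ne_zero (coeIK_ne _)), dvI_inv, dvI_mkI, dvI_mkI, sub_eq_add_neg]
  have hdvv : ∀ v, dv t v = (a v : ℤ) - b v := fun v => by rw [hdv]; rfl
  have hval : ∀ v ∈ S, v.valuation K (t - 1) ≤ WithZero.exp (-(((E + k0 + 1 : ℕ) : ℤ) - b v)) := by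
    intro v hv
    have := mem_coeIdeal_pow_iff (t - 1) v _ ht1
    rw [dvI_mul (coeIK_ne _) (inv_ne_zero (coeIK_ne _)), dvI_inv, dvI_mkI, dvI_mkI, ← sub_eq_add_neg] at this
    have e : (toDv f0 - toDv b) v = ((E + k0 + 1 : ℕ) : ℤ) - b v := by
      rw [← hf0 v hv]; rfl
    rwa [e] at this
  have hcase : ∀ v ∈ S, a v = b v ∨ (E ≤ a v ∧ E ≤ b v) := by
    intro v hv
    rcases lt_or_ge (b v) (E + k0 + 1) with hb | hb
    · left
      have h1 : v.valuation K t = 1 := val_one_of_near v ((hval v hv).trans_lt (by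
        rw [exp_lt_one']; omega))
      have h2 := (dv_apply_eq_zero_iff v ht0).mpr h1
      rw [hdvv] at h2; omega
    · right
      have h1 : v.valuation K t ≤ WithZero.exp (-(((E + k0 + 1 : ℕ) : ℤ) - b v)) := by
        have e : t = (t - 1) + 1 := by ring
        rw [e]
        refine Valuation.map_add_le _ (hval v hv) ?_
        rw [map_one, ← WithZero.exp_zero, WithZero.exp_le_exp]; omega
      rw [valuation_eq v ht0, WithZero.exp_le_exp, hdvv] at h1
      omega
  let d : Pl K →₀ ℕ := Finsupp.onFinset S (fun v => if v ∈ S then min (a v) E else 0) (by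
    intro v hv; by_contra h; simp [h] at hv)
  have hd : ∀ v ∈ S, d v = min (a v) E := fun v hv => by simp [d, hv]
  have hd0 : ∀ v ∉ S, d v = 0 := fun v hv => by simp [d, hv]
  have hda : d ≤ a := fun v => by
    by_cases hv : v ∈ S
    · rw [hd v hv]; exact min_le_left _ _
    · rw [hd0 v hv]; exact Nat.zero_le _
  have hdb : d ≤ b := fun v => by
    by_cases hv : v ∈ S
    · rw [hd v hv]; have := hcase v hv; omega
    · rw [hd0 v hv]; exact Nat.zero_le _
  have hdm : d ∈ S.finsupp (fun _ => Finset.range (E + 1)) := by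
    rw [Finset.mem_finsupp_iff]
    refine ⟨fun v hv => ?_, fun v hv => ?_⟩
    · by_contra h; exact (Finsupp.mem_support_iff.mp hv) (hd0 v h)
    · rw [hd v hv, Finset.mem_range]; omega
  have ea : d + (a - d) = a := add_tsub_cancel_of_le hda
  have eb : d + (b - d) = b := add_tsub_cancel_of_le hdb
  have := hk d (a - d) (b - d) ?_ ?_ ?_
  · rwa [ea, eb] at this
  · intro v hv
    obtain ⟨hv, h2⟩ := Finset.mem_filter.mp hv
    rw [hd v hv] at h2
    rw [Finsupp.tsub_apply, hd v hv]; omega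
  · intro v hv
    obtain ⟨hv, h2⟩ := Finset.mem_filter.mp hv
    rw [hd v hv] at h2
    have := hcase v hv
    rw [Finsupp.tsub_apply, hd v hv]; omega
  · have e : toDv (a - d) - toDv (b - d) = dv t := by
      rw [hdv]
      nth_rw 2 [← ea]
      nth_rw 2 [← eb]
      rw [toDv_add, toDv_add, add_sub_add_left_eq_sub]
    rw [e]
    apply PR_anti (show k d ≤ k0 from Finset.le_sup hdm)
    refine mem_PR.mpr ⟨Units.mk0 t ht0, ⟨fun v hv => ?_, htp⟩, rfl⟩
    obtain ⟨hv, h2⟩ := Finset.mem_filter.mp hv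
    rw [hd v hv] at h2
    refine (hval v hv).trans ?_
    rw [WithZero.exp_le_exp]
    have := hcase v hv
    omega

theorem frob_of_witt {A : Type} [CommRing A] [Algebra (𝓞 K) A] (ι : 𝓞 Ω →ₐ[𝓞 K] A)
    (hι : Function.Injective ι)
    (hsat : ∀ (r : 𝓞 K) (z : A) (w : 𝓞 Ω), r ≠ 0 → r • z = ι w → ∃ w', z = ι w')
    (x : IK K → 𝓞 Ω) (hx : ∀ n, (fun b => ι (x b)) ∈ UnSet K A n)
    (W : Set (𝓞 Ω)) (hW : W.Finite) (hxW : ∀ b, x b ∈ W) (hWG : ∀ (σ : Gal(Ω/K)), ∀ w ∈ W, σ • w ∈ W) :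
    ∃ f : IK K, ∀ a b : IK K, DRcongruent K f a b → x a = x b := by
  classical
  let D : Finset (𝓞 Ω) := ((hW.toFinset ×ˢ hW.toFinset).image (fun z => z.1 - z.2)).erase 0
  have hD0 : ∀ z ∈ D, z ≠ 0 := fun z hz => Finset.ne_of_mem_erase hz
  have hD : ∀ u ∈ W, ∀ v ∈ W, u - v ≠ 0 → u - v ∈ D := fun u hu v hv h =>
    Finset.mem_erase.mpr ⟨h, Finset.mem_image.mpr ⟨(u, v), by simp [hu, hv], rfl⟩⟩
  set N : 𝓞 Ω := ∏ z ∈ D, z with hN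
  have hN0 : N ≠ 0 := Finset.prod_ne_zero_iff.mpr hD0
  have hI : Ideal.span {N} ≠ ⊥ := by rwa [Ne, Ideal.span_singleton_eq_bot]
  have hdvd : ∀ z ∈ D, ∀ I : Ideal (𝓞 Ω), z ∈ I → N ∈ I := fun z hz I h =>
    Ideal.mem_of_dvd _ (Finset.dvd_prod_of_mem _ hz) h
  have hfin : {P : Pl Ω | P.asIdeal ∣ Ideal.span {N}}.Finite := Ideal.finite_factors hI
  refine periodic_of_frob x (hfin.toFinset.image (dn K)) (Ideal.absNorm (Ideal.span {N})) ?_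
  intro P φ hφ b e he
  by_contra hne
  have hmem := hD _ (hxW (plIK (dn K P) ^ (e + 1) * b)) _ (hWG φ _ (hxW (plIK (dn K P) ^ e * b)))
    (sub_ne_zero.mpr hne)
  rcases he with h | h
  · have h1 := frob_congr ι hι hsat P φ hφ 0 x (hx 1) b e (Nat.zero_le _)
    rw [zero_add, pow_one] at h1
    apply h
    refine Finset.mem_image.mpr ⟨P, ?_, rfl⟩
    rw [Set.Finite.mem_toFinset]
    exact Ideal.dvd_iff_le.mpr ((Ideal.span_singleton_le_iff_mem _).mpr (hdvd _ hmem _ h1))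
  · have h1 := frob_congr ι hι hsat P φ hφ _ x (hx _) b e h
    have h2 : P.asIdeal ^ (Ideal.absNorm (Ideal.span {N}) + 1) ∣ Ideal.span {N} :=
      Ideal.dvd_iff_le.mpr ((Ideal.span_singleton_le_iff_mem _).mpr (hdvd _ hmem _ h1))
    have h3 := map_dvd Ideal.absNorm h2
    have h4 : Ideal.absNorm (Ideal.span {N}) ≠ 0 := by rwa [Ne, Ideal.absNorm_eq_zero_iff]
    have h5 := Nat.le_of_dvd (Nat.pos_of_ne_zero h4) h3
    rw [map_pow, ← Nm_eq] at h5
    have h6 := Nat.lt_pow_self (n := Ideal.absNorm (Ideal.span {N}) + 1) (Nm_gt_one P)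
    omega

end

/-! ### The main direction -/
section
open Polynomial

theorem periodic_of_integral (K : Type) [Field K] [NumberField K]
    (ξ : IK K → ↥(integralClosure (𝓞 K) (AlgebraicClosure K)))
    (hξ : ξ ∈ WittSet K ↥(integralClosure (𝓞 K) (AlgebraicClosure K)))
    (hint : IsIntegral (𝓞 K) ξ) :
    ∃ f : IK K, ∀ a b : IK K, DRcongruent K f a b → ξ a = ξ b := by
  classical
  obtain ⟨p, hp, hpξ⟩ := hint
  have hroot : ∀ a, aeval (ξ a) p = 0 := by
    intro a
    have h1 : aeval ξ p = 0 := hpξ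
    have h2 := congrArg (Pi.evalAlgHom (𝓞 K) (fun _ : IK K => ↥(integralClosure (𝓞 K) (AlgebraicClosure K))) a) h1
    rw [← aeval_algHom_apply, map_zero] at h2
    exact h2
  let q : K[X] := p.map (algebraMap (𝓞 K) K)
  have hq : q.Monic := hp.map _
  let L : IntermediateField K (AlgebraicClosure K) :=
    IntermediateField.adjoin K (q.rootSet (AlgebraicClosure K))
  haveI hL : q.IsSplittingField K L :=
    IntermediateField.adjoin_rootSet_isSplittingField (IsAlgClosed.splits _)
  haveI : FiniteDimensional K L := IsSplittingField.finiteDimensional L q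
  haveI : Normal K L := Normal.of_isSplittingField q
  haveI : IsGalois K L := ⟨⟩
  haveI : NumberField L := NumberField.of_module_finite K L
  have hrootL : ∀ a, ((ξ a : ↥(integralClosure (𝓞 K) (AlgebraicClosure K))) : AlgebraicClosure K) ∈ L := by
    intro a
    apply IntermediateField.subset_adjoin
    rw [mem_rootSet_of_ne hq.ne_zero]
    have h1 := congrArg (integralClosure (𝓞 K) (AlgebraicClosure K)).val (hroot a)
    rw [← aeval_algHom_apply, map_zero] at h1
    rw [aeval_map_algebraMap]
    exact h1
  let ι0 : 𝓞 L →ₐ[𝓞 K] AlgebraicClosure K :=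
    (L.val.restrictScalars (𝓞 K)).comp (IsScalarTower.toAlgHom (𝓞 K) (𝓞 L) L)
  have hι0 : ∀ x : 𝓞 L, ι0 x = ((x : L) : AlgebraicClosure K) := fun _ => rfl
  let ι : 𝓞 L →ₐ[𝓞 K] ↥(integralClosure (𝓞 K) (AlgebraicClosure K)) :=
    ι0.codRestrict _ (fun x => (Algebra.IsIntegral.isIntegral (R := 𝓞 K) x).map ι0)
  have hι : ∀ x : 𝓞 L, ((ι x : ↥(integralClosure (𝓞 K) (AlgebraicClosure K))) : AlgebraicClosure K)
    = ((x : L) : AlgebraicClosure K) := fun _ => rfl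
  have hinj : Function.Injective ι := by
    intro x y h
    have h1 := congrArg Subtype.val h
    rw [hι, hι] at h1
    exact RingOfIntegers.coe_injective (Subtype.ext h1)
  have hlift : ∀ z : ↥(integralClosure (𝓞 K) (AlgebraicClosure K)), (z : AlgebraicClosure K) ∈ L →
      ∃ w, z = ι w := by
    intro z hz
    have h1 : IsIntegral (𝓞 K) (z : AlgebraicClosure K) := z.2
    have h2 : IsIntegral (𝓞 K) (⟨z, hz⟩ : L) := by
      rw [← isIntegral_algHom_iff (L.val.restrictScalars (𝓞 K)) L.val.injective]
      exact h1
    haveI : IsScalarTower ℤ (𝓞 K) L := IsScalarTower.of_algebraMap_eq' (Subsingleton.elim _ _)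
    have h3 : IsIntegral ℤ (⟨z, hz⟩ : L) := isIntegral_trans _ h2
    exact ⟨⟨⟨z, hz⟩, h3⟩, rfl⟩
  choose x hx using fun a => hlift (ξ a) (hrootL a)
  have hxξ : (fun b => ι (x b)) = ξ := by funext b; exact (hx b).symm
  have hxroot : ∀ a, aeval (x a) p = 0 := by
    intro a
    apply hinj
    rw [map_zero, ← aeval_algHom_apply, ← hx, hroot]
  have c1 : ∀ (r : 𝓞 K) (z : ↥(integralClosure (𝓞 K) (AlgebraicClosure K))) (w : 𝓞 L), r ≠ 0 →
      r • z = ι w → ∃ w', z = ι w' := by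
    intro r z w hr h
    apply hlift
    have h1 := congrArg Subtype.val h
    rw [hι] at h1
    have h2 : (algebraMap K (AlgebraicClosure K) (r : K)) * (z : AlgebraicClosure K) = ((w : L) : AlgebraicClosure K) := by
      rw [← h1, ← IsScalarTower.algebraMap_apply, ← Algebra.smul_def]; rfl
    have h3 : algebraMap K (AlgebraicClosure K) (r : K) ≠ 0 := by
      rw [Ne, map_eq_zero]; exact RingOfIntegers.coe_ne_zero_iff.mpr hr
    have h4 : (z : AlgebraicClosure K) = (algebraMap K (AlgebraicClosure K) (r : K))⁻¹ * ((w : L) : AlgebraicClosure K) := by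
      rw [← h2, inv_mul_cancel_left₀ h3]
    rw [h4]
    exact L.mul_mem (L.inv_mem (L.algebraMap_mem _)) (w : L).2
  have c2 : {z : 𝓞 L | aeval z p = 0}.Finite := by
    have : {z : 𝓞 L | aeval z p = 0} = p.rootSet (𝓞 L) := by
      ext z
      rw [mem_rootSet', Set.mem_ofPred_eq]
      exact ⟨fun h => ⟨(hp.map _).ne_zero, h⟩, fun h => h.2⟩
    rw [this]; exact p.rootSet_finite _
  have c3 : ∀ σ : Gal(L/K), ∀ w ∈ {z : 𝓞 L | aeval z p = 0}, σ • w ∈ {z : 𝓞 L | aeval z p = 0} := by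
    intro σ w hw
    have h1 : aeval (σ • w) p = σ • aeval w p :=
      aeval_algHom_apply (MulSemiringAction.toAlgHom (𝓞 K) (𝓞 L) σ) w p
    rw [Set.mem_ofPred_eq] at hw ⊢
    rw [h1, hw, smul_zero]
  obtain ⟨f, hf⟩ := frob_of_witt (K := K) (Ω := L) ι hinj c1 x
    (fun n => by rw [hxξ]; exact Set.mem_iInter.mp hξ n) {z : 𝓞 L | aeval z p = 0} c2 hxroot c3
  refine ⟨f, fun a b hab => ?_⟩
  rw [hx a, hx b, hf a b hab]

end

end

/-- `ξ ∈ W_{O_K}(O_K̄)` is integral over `O_K` iff its coefficients are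
periodic with respect to some modulus `f` of `K`, i.e. `ξ_a = ξ_b` whenever `a ∼_f b`
in the sense of Deligne–Ribet. -/
theorem integral_iff_periodic (K : Type) [Field K] [NumberField K]
    (ξ : IK K → ↥(integralClosure (𝓞 K) (AlgebraicClosure K)))
    (hξ : ξ ∈ WittSet K ↥(integralClosure (𝓞 K) (AlgebraicClosure K))) :
    IsIntegral (𝓞 K) ξ ↔
      ∃ f : IK K, ∀ a b : IK K, DRcongruent K f a b → ξ a = ξ b := by
  exact ⟨periodic_of_integral K ξ hξ, fun h => integral_of_periodic K ξ h⟩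

end
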